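/- The averaged two-point Chowla conjecture holds for the Möbius function: for every sequence (H_M)_{M≥1} of positive integers with H_M → ∞ and H_M/M → 0 as M → ∞, lim_{M→∞} (1/(H_M · M)) Σ_{h=1}^{H_M} |Σ_{m=1}^{M} μ(m)μ(m+h)| = 0. -/

import Mathlib

open Filter Topology
section
open scoped Real ComplexConjugate
open Real (norm_eq_abs rpow_one rpow_pos_of_pos rpow_natCast rpow_mul log hasDerivAt_log pi_gt_three rpow_add rpow_le_rpow_of_exponent_le one_le_rpow sqrt_eq_rpow rpow_neg exp exp_le_exp log_pos one_le_exp exp_log log_mul rpow_def_of_pos log_exp norm_of_nonneg rpow_neg_one log_le_log log_two_gt_d9 log_div exp_add add_one_le_exp exp_le_one_iff log_inv rpow_le_rpow_of_nonpos log_nonneg log_pow log_two_lt_d9 tendsto_log_atTop log_le_log_iff log_rpow sinc sinc_of_ne_zero exp_sub log_le_sub_one_of_pos exp_pos lt_log_iff_exp_lt log_le_iff_le_exp exp_neg exp_nat_mul sqrt sq_sqrt exp_one_lt_d9 log_le_self)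
open Complex (I norm_exp_ofReal_mul_I mul_conj' norm_real exp_conj exp_zero norm_exp sub_re abs_re_le_norm re ofReal_re ofReal_sub ofReal_sum ofRealCLM add_re norm_def normSq_apply ofReal_zero ofReal_one real_smul ofReal_pow continuous_conj conj_mul')
open Finset (Ico Ico_eq_empty_of_le range mem_Ico sum_comm sum_congr mem_range sum_le_sum_of_subset_of_nonneg mem_filter sum_mul_sum sum_nonneg sum_le_sum sum_nbij' sum_const card_range card_le_card Ioc mem_Ioc mem_union sum_union disjoint_left sum_mul sum_Ico_eq_sum_range sum_range_succ mul_sum sum_add_distrib sum_filter Icc mem_Icc sum_Ioc_succ_top sum_sub_distrib sum_ite_eq' sum_le_card_nsmul sum_ite_eq)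
namespace MR

lemma exp_sub_one_lower {g : ℝ} (h0 : 0 ≤ g) (h1 : g ≤ π) :
    2 * g / π ≤ ‖Complex.exp (g * I) - 1‖ := by
  rw [mul_comm (g:ℂ), Complex.norm_exp_I_mul_ofReal_sub_one, norm_eq_abs, abs_mul, abs_two]
  have := Real.mul_le_sin (x := g/2) (by linarith) (by linarith)
  have h2 : 2 * g / π = 2 * (2 / π * (g/2)) := by ring
  rw [h2]
  exact mul_le_mul_of_nonneg_left (this.trans (le_abs_self _)) (by norm_num)

lemma exp_sub_exp_le (x y : ℝ) :
    ‖Complex.exp (x * I) - Complex.exp (y * I)‖ ≤ |x - y| := by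
  have : Complex.exp (x * I) - Complex.exp (y * I)
      = Complex.exp (y * I) * (Complex.exp (I * ((x - y : ℝ))) - 1) := by
    rw [mul_sub, ← Complex.exp_add, mul_one]; congr 2; push_cast; ring
  rw [this, norm_mul, norm_exp_ofReal_mul_I, one_mul]
  exact Real.norm_exp_I_mul_ofReal_sub_one_le

lemma kusmin (φ : ℕ → ℝ) (a : ℕ) (lo : ℝ) (hlo : 0 < lo) (b : ℕ)
    (h1 : ∀ n, a ≤ n → n < b → lo ≤ φ (n+1) - φ n)
    (h2 : ∀ n, a ≤ n → n < b → φ (n+1) - φ n ≤ π)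
    (h3 : ∀ n, a ≤ n → n + 1 < b → φ (n+2) - φ (n+1) ≤ φ (n+1) - φ n) :
    ‖∑ n ∈ Ico a b, Complex.exp (φ n * I)‖ ≤ 10 / lo := by
  set g : ℕ → ℝ := fun n => φ (n+1) - φ n with hg
  set c : ℕ → ℂ := fun n => (Complex.exp (g n * I) - 1)⁻¹ with hc
  set E : ℕ → ℂ := fun n => Complex.exp (φ n * I) with hE
  have hpi := Real.pi_pos
  have hpi2 := Real.pi_lt_d2
  have low : ∀ n, a ≤ n → n < b → 2 * g n / π ≤ ‖Complex.exp (g n * I) - 1‖ :=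
    fun n h h' => exp_sub_one_lower (hlo.le.trans (h1 n h h')) (h2 n h h')
  have pos : ∀ n, a ≤ n → n < b → 0 < g n := fun n h h' => hlo.trans_le (h1 n h h')
  have ne : ∀ n, a ≤ n → n < b → Complex.exp (g n * I) - 1 ≠ 0 := fun n h h' h0 => by
    have := low n h h'
    rw [h0, norm_zero] at this
    have := div_pos (mul_pos two_pos (pos n h h')) hpi
    linarith
  have cb : ∀ n, a ≤ n → n < b → ‖c n‖ ≤ 2 / g n := fun n h h' => by
    rw [hc]; simp only [norm_inv]
    have hp := pos n h h'
    calc ‖Complex.exp (g n * I) - 1‖⁻¹ ≤ (2 * g n / π)⁻¹ :=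
          inv_anti₀ (by positivity) (low n h h')
      _ = π / (2 * g n) := by rw [inv_div]
      _ ≤ 2 / g n := by rw [div_le_div_iff₀ (by positivity) hp]; nlinarith
  have En : ∀ n, ‖E n‖ = 1 := fun n => norm_exp_ofReal_mul_I _
  have key : ∀ m, a ≤ m → m < b →
      ‖∑ n ∈ Ico a (m+1), E n - E (m+1) * c m‖ ≤ 2 / g a + 4 * (1 / g m - 1 / g a) := by
    intro m hm
    induction m, hm using Nat.le_induction with
    | base =>
      intro hb
      have : E (a+1) = E a * Complex.exp (g a * I) := by
        rw [hE, hg]; simp only [← Complex.exp_add]; congr 1; push_cast; ring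
      have h : ∑ n ∈ Ico a (a+1), E n - E (a+1) * c a = - (E a * c a) := by
        have := ne a le_rfl hb
        simp only [Nat.Ico_succ_singleton, Finset.sum_singleton]
        rw [‹E (a+1) = _›, hc]; field_simp; ring
      rw [h, norm_neg, norm_mul, En, one_mul, sub_self, mul_zero, add_zero]
      exact cb a le_rfl hb
    | succ m hm ih =>
      intro hb
      have ih := ih (by omega)
      have e2 : E (m+1+1) = E (m+1) * Complex.exp (g (m+1) * I) := by
        rw [hE, hg]; simp only [← Complex.exp_add]; congr 1; push_cast; ring
      have hn1 := ne m hm (by omega)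
      have hn2 := ne (m+1) (by omega) hb
      have h : ∑ n ∈ Ico a (m+1+1), E n - E (m+1+1) * c (m+1)
          = (∑ n ∈ Ico a (m+1), E n - E (m+1) * c m) + E (m+1) * (c m - c (m+1)) := by
        rw [Finset.sum_Ico_succ_top (by omega), e2, hc]; field_simp; ring
      rw [h]
      have hg1 := pos m hm (by omega)
      have hg2 := pos (m+1) (by omega) hb
      have hl1 := low m hm (by omega)
      have hl2 := low (m+1) (by omega) hb
      have hmono : g (m+1) ≤ g m := h3 m hm hb
      have hd : ‖c m - c (m+1)‖ ≤ 4 * (1 / g (m+1) - 1 / g m) := by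
        have : c m - c (m+1) = (Complex.exp (g (m+1) * I) - Complex.exp (g m * I)) /
            ((Complex.exp (g m * I) - 1) * (Complex.exp (g (m+1) * I) - 1)) := by
          rw [hc]; simp only []
          rw [inv_sub_inv hn1 hn2]; congr 1; ring
        rw [this, norm_div, norm_mul]
        have h5 : ‖Complex.exp (g (m+1) * I) - Complex.exp (g m * I)‖ ≤ g m - g (m+1) :=
          (exp_sub_exp_le _ _).trans (by rw [abs_of_nonpos (by linarith)]; linarith)
        calc _ ≤ (g m - g (m+1)) / ((2 * g m / π) * (2 * g (m+1) / π)) := by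
              gcongr
          _ = (π^2/4) * (1 / g (m+1) - 1 / g m) := by field_simp; norm_num
          _ ≤ 4 * (1 / g (m+1) - 1 / g m) := by
              gcongr
              · rw [sub_nonneg]; exact one_div_le_one_div_of_le hg2 hmono
              · nlinarith
      calc _ ≤ (2 / g a + 4 * (1 / g m - 1 / g a)) + 4 * (1 / g (m+1) - 1 / g m) := by
            refine (norm_add_le _ _).trans (add_le_add ih ?_)
            rw [norm_mul, En, one_mul]; exact hd
        _ = _ := by ring
  rcases Nat.lt_or_ge a b with hab | hab
  · obtain ⟨m, rfl⟩ : ∃ m, b = m + 1 := ⟨b-1, by omega⟩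
    have k := key m (by omega) (by omega)
    have c1 := cb m (by omega) (by omega)
    have p1 := pos m (by omega) (by omega)
    have p2 := pos a (by omega) (by omega)
    have l1 := h1 m (by omega) (by omega)
    have : (∑ n ∈ Ico a (m+1), E n) = (∑ n ∈ Ico a (m+1), E n - E (m+1) * c m) + E (m+1) * c m := by ring
    rw [this]
    have h6 : 1 / g m ≤ 1 / lo := one_div_le_one_div_of_le hlo l1
    have h7 : 0 < 1 / g a := by positivity
    calc _ ≤ (2 / g a + 4 * (1 / g m - 1 / g a)) + 2 / g m := by
          refine (norm_add_le _ _).trans (add_le_add k ?_)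
          rw [norm_mul, En, one_mul]; exact c1
      _ = 6 * (1 / g m) - 2 * (1 / g a) := by ring
      _ ≤ 10 * (1 / lo) := by nlinarith [one_div_pos.mpr hlo]
      _ = 10 / lo := by ring
  · rw [Ico_eq_empty_of_le hab]; simp; positivity

lemma vdc_ineq (z : ℤ → ℂ) (a b : ℤ) (hab : a ≤ b) (hz : ∀ n, n < a ∨ b ≤ n → z n = 0) (K : ℕ) (hK : 1 ≤ K)
    (A : ℕ → ℝ) (hA : ∀ d < K, ‖∑ n ∈ Ico a b, z n * conj (z (n + d))‖ ≤ A d) :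
    (K : ℝ) * ‖∑ n ∈ Ico a b, z n‖ ^ 2 ≤ ((b - a : ℤ) + K : ℝ) * (2 * ∑ d ∈ range K, A d) := by
  classical
  have shift : ∀ (w : ℤ → ℂ), (∀ n, n < a ∨ b ≤ n → w n = 0) → ∀ r : ℕ, r < K →
      ∑ m ∈ Ico (a - K) b, w (m + r) = ∑ n ∈ Ico a b, w n := by
    intro w hw r hr
    rw [Finset.sum_Ico_add' w (a - K) b (r : ℤ)]
    symm
    apply Finset.sum_subset
    · intro x hx; simp only [mem_Ico] at hx ⊢; omega
    · intro x hx hx'; simp only [mem_Ico] at hx hx'; apply hw; omega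
  have h1 : (K : ℂ) * ∑ n ∈ Ico a b, z n = ∑ m ∈ Ico (a - K) b, ∑ r ∈ range K, z (m + r) := by
    rw [sum_comm, sum_congr rfl (fun r hr => shift z hz r (mem_range.mp hr))]
    simp
  have hA0 : ∀ d < K, 0 ≤ A d := fun d hd => (norm_nonneg _).trans (hA d hd)
  have pair : ∀ r < K, ∀ r' < K, r ≤ r' →
      ‖∑ m ∈ Ico (a - K) b, z (m + r) * conj (z (m + r'))‖ ≤ A (r' - r) := by
    intro r hr r' hr' hrr
    have := shift (fun n => z n * conj (z (n + (r' - r : ℕ)))) (fun n hn => by rw [hz n hn, zero_mul]) r hr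
    have e : ∀ m : ℤ, m + (r:ℤ) + ((r' - r : ℕ) : ℤ) = m + r' := fun m => by omega
    simp only [e] at this
    rw [this]
    exact hA _ (by omega)
  have pair2 : ∀ r < K, ∀ r' < K,
      ‖∑ m ∈ Ico (a - K) b, z (m + r) * conj (z (m + r'))‖
        ≤ if r ≤ r' then A (r' - r) else A (r - r') := by
    intro r hr r' hr'
    split_ifs with h
    · exact pair r hr r' hr' h
    · have := pair r' hr' r hr (by omega)
      have e : ∑ m ∈ Ico (a - K) b, z (m + r) * conj (z (m + r'))
          = conj (∑ m ∈ Ico (a - K) b, z (m + r') * conj (z (m + r))) := by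
        rw [map_sum]; refine sum_congr rfl fun m _ => ?_
        rw [map_mul, Complex.conj_conj, mul_comm]
      rw [e, RCLike.norm_conj]
      exact this
  have sumA : ∀ r < K, ∑ r' ∈ range K, (if r ≤ r' then A (r' - r) else A (r - r'))
      ≤ 2 * ∑ d ∈ range K, A d := by
    intro r hr
    rw [Finset.sum_ite, two_mul]
    refine add_le_add ?_ ?_
    · rw [← Finset.sum_image (g := fun r' => r' - r) (f := A) (fun x hx y hy h => by
        simp at hx hy h; omega)]
      refine sum_le_sum_of_subset_of_nonneg (fun x hx => ?_) (fun d hd _ => hA0 d (mem_range.mp hd))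
      simp only [Finset.mem_image, mem_filter, mem_range] at hx ⊢; omega
    · rw [← Finset.sum_image (g := fun r' => r - r') (f := A) (fun x hx y hy h => by
        simp at hx hy h; omega)]
      refine sum_le_sum_of_subset_of_nonneg (fun x hx => ?_) (fun d hd _ => hA0 d (mem_range.mp hd))
      simp only [Finset.mem_image, mem_filter, mem_range] at hx ⊢; omega
  have h2 : (∑ m ∈ Ico (a - K) b, ‖∑ r ∈ range K, z (m + r)‖ ^ 2)
      ≤ K * (2 * ∑ d ∈ range K, A d) := by
    have e : ((∑ m ∈ Ico (a - K) b, ‖∑ r ∈ range K, z (m + r)‖ ^ 2 : ℝ) : ℂ)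
        = ∑ r ∈ range K, ∑ r' ∈ range K, ∑ m ∈ Ico (a - K) b,
            z (m + r) * conj (z (m + r')) := by
      push_cast
      rw [sum_congr rfl (fun r _ => sum_comm), sum_comm]
      refine sum_congr rfl fun m _ => ?_
      rw [← mul_conj', map_sum, sum_mul_sum]
    have h0 : (0:ℝ) ≤ ∑ m ∈ Ico (a - K) b, ‖∑ r ∈ range K, z (m + r)‖ ^ 2 :=
      sum_nonneg fun _ _ => by positivity
    rw [← abs_of_nonneg h0, ← norm_eq_abs, ← norm_real, e]
    refine (norm_sum_le _ _).trans ?_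
    calc _ ≤ ∑ r ∈ range K, (2 * ∑ d ∈ range K, A d) := by
          refine sum_le_sum fun r hr => ?_
          have hr := mem_range.mp hr
          refine (norm_sum_le _ _).trans (le_trans (sum_le_sum fun r' hr' => ?_) (sumA r hr))
          exact pair2 r hr r' (mem_range.mp hr')
      _ = _ := by simp
  have h3 : ((K : ℝ) * ‖∑ n ∈ Ico a b, z n‖) ^ 2 ≤
      ((b - a : ℤ) + K : ℝ) * (K * (2 * ∑ d ∈ range K, A d)) := by
    have : (K : ℝ) * ‖∑ n ∈ Ico a b, z n‖ = ‖(K : ℂ) * ∑ n ∈ Ico a b, z n‖ := by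
      rw [norm_mul, Complex.norm_natCast]
    rw [this, h1]
    have hc : ((Ico (a - K) b).card : ℝ) = (b - a : ℤ) + K := by
      rw [Int.card_Ico]
      have : (((b - (a - K)).toNat : ℤ)) = (b - a) + K := by omega
      exact_mod_cast this
    calc _ ≤ (∑ m ∈ Ico (a - K) b, ‖∑ r ∈ range K, z (m + r)‖) ^ 2 := by
          gcongr; exact norm_sum_le _ _
      _ ≤ (Ico (a - K) b).card * ∑ m ∈ Ico (a - K) b, ‖∑ r ∈ range K, z (m + r)‖ ^ 2 :=
          sq_sum_le_card_mul_sum_sq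
      _ ≤ _ := by
          rw [hc]; gcongr
  have hK0 : (0:ℝ) < K := by exact_mod_cast hK
  have : (K:ℝ) * ((K : ℝ) * ‖∑ n ∈ Ico a b, z n‖^2) ≤ K * (((b - a : ℤ) + K : ℝ) * (2 * ∑ d ∈ range K, A d)) := by
    nlinarith
  exact le_of_mul_le_mul_left this hK0
end MR
namespace MR

lemma sum_Ico_int (a b : ℕ) (f : ℤ → ℂ) :
    ∑ n ∈ Ico (a:ℤ) b, f n = ∑ n ∈ Ico a b, f (n:ℤ) := by
  refine sum_nbij' (fun n => n.toNat) (fun n => (n:ℤ)) ?_ ?_ ?_ ?_ ?_ <;>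
    simp only [mem_Ico] <;> intro x hx <;> first | omega | (congr 1; omega)

lemma norm_exp_sum_le (φ : ℕ → ℝ) (a b : ℕ) (N : ℝ) (h : (b:ℝ) - a ≤ N) (hN : 0 ≤ N) :
    ‖∑ n ∈ Ico a b, Complex.exp (φ n * I)‖ ≤ N := by
  refine (norm_sum_le _ _).trans ?_
  simp only [norm_exp_ofReal_mul_I, sum_const, Nat.card_Ico, nsmul_eq_mul, mul_one]
  rcases le_total a b with h' | h'
  · rw [Nat.cast_sub h']; exact h
  · rw [Nat.sub_eq_zero_of_le h']; simpa using hN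

lemma vdc_deriv (k : ℕ) : ∃ C : ℝ, 1 ≤ C ∧ ∀ (G : ℕ → ℝ → ℝ) (a b : ℕ) (N lo hi R R1 δ : ℝ),
    a ≤ b → (b:ℝ) - a ≤ N → 1 ≤ N →
    (∀ j, ∀ x ∈ Set.Icc (a:ℝ) b, HasDerivAt (G j) (G (j+1) x) x) →
    (∀ x ∈ Set.Icc (a:ℝ) b, lo ≤ G (k+1) x ∧ G (k+1) x ≤ hi ∧ G (k+2) x ≤ 0) →
    0 < lo → hi * R ^ k ≤ π → 1 ≤ R1 → 1 ≤ R → R ≤ N → R1 / R ≤ δ → 1 / (N * lo * R1 ^ k) ≤ δ →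
    δ ≤ 1 →
    ‖∑ n ∈ Ico a b, Complex.exp (G 0 n * I)‖ ≤ C * N * δ ^ ((1/2:ℝ)^k) := by
  induction k with
  | zero =>
    refine ⟨10, by norm_num, fun G a b N lo hi R R1 δ hab hN hN1 hG hb hlo hhi hR1 hR hRN hδ hδ2 _ => ?_⟩
    have mv : ∀ (G0 G1 : ℝ → ℝ), (∀ x ∈ Set.Icc (a:ℝ) b, HasDerivAt G0 (G1 x) x) → ∀ n : ℕ, a ≤ n → n < b →
        ∃ c ∈ Set.Icc (a:ℝ) b, G0 (n+1:ℕ) - G0 n = G1 c := by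
      intro G0 G1 h n h1 h2
      have h1' : (a:ℝ) ≤ n := by exact_mod_cast h1
      have h2' : (n:ℝ) + 1 ≤ b := by exact_mod_cast h2
      obtain ⟨c, hc, he⟩ := exists_hasDerivAt_eq_slope G0 G1 (a := n) (b := n+1) (by linarith)
        (fun x hx => (h x ⟨by linarith [hx.1], by linarith [hx.2]⟩).continuousAt.continuousWithinAt)
        (fun x hx => h x ⟨by linarith [hx.1], by linarith [hx.2]⟩)
      refine ⟨c, ⟨by linarith [hc.1], by linarith [hc.2]⟩, ?_⟩
      rw [he]; push_cast; ring
    have K := kusmin (fun n => G 0 n) a lo hlo b ?_ ?_ ?_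
    · refine K.trans ?_
      have : 1 / lo ≤ N * δ := by
        have h : 1 / (N * lo) ≤ δ := by simpa using hδ2
        calc 1 / lo = N * (1 / (N * lo)) := by field_simp
          _ ≤ N * δ := by gcongr
      calc 10 / lo = 10 * (1 / lo) := by ring
        _ ≤ 10 * (N * δ) := by linarith
        _ = _ := by simp; ring
    · intro n h1 h2
      obtain ⟨c, hc, he⟩ := mv (G 0) (G 1) (hG 0) n h1 h2
      rw [he]; exact (hb c hc).1
    · intro n h1 h2
      obtain ⟨c, hc, he⟩ := mv (G 0) (G 1) (hG 0) n h1 h2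
      rw [he]; exact ((hb c hc).2.1).trans (by simpa using hhi)
    · intro n h1 h2
      have h1' : (a:ℝ) ≤ n := by exact_mod_cast h1
      have h2' : (n:ℝ) + 2 ≤ b := by exact_mod_cast h2
      obtain ⟨c, hc, he⟩ := exists_hasDerivAt_eq_slope (fun x => G 0 (x+1) - G 0 x) (fun x => G 1 (x+1) - G 1 x)
        (a := n) (b := n+1) (by linarith)
        (fun x hx => (((hG 0 (x+1) ⟨by linarith [hx.1], by linarith [hx.2]⟩).comp_add_const x 1).sub
          (hG 0 x ⟨by linarith [hx.1], by linarith [hx.2]⟩)).continuousAt.continuousWithinAt)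
        (fun x hx => ((hG 0 (x+1) ⟨by linarith [hx.1], by linarith [hx.2]⟩).comp_add_const x 1).sub
          (hG 0 x ⟨by linarith [hx.1], by linarith [hx.2]⟩))
      obtain ⟨d, hd, he2⟩ := exists_hasDerivAt_eq_slope (G 1) (G 2) (a := c) (b := c+1) (by linarith)
        (fun x hx => (hG 1 x ⟨by linarith [hx.1, hc.1], by linarith [hx.2, hc.2]⟩).continuousAt.continuousWithinAt)
        (fun x hx => hG 1 x ⟨by linarith [hx.1, hc.1], by linarith [hx.2, hc.2]⟩)
      have h3 := (hb d ⟨by linarith [hd.1, hc.1], by linarith [hd.2, hc.2]⟩).2.2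
      norm_num at he he2 h3
      have e : (n:ℝ) + 2 = n + 1 + 1 := by ring
      push_cast
      rw [e]; linarith
  | succ k ih =>
    obtain ⟨C, hC1, hC⟩ := ih
    refine ⟨6 * (2 + C), by linarith, fun G a b N lo hi R R1 δ hab hN hN1 hG hb hlo hhi hR1 hR hRN hδ hδ2 hδ1 => ?_⟩
    have hδ0 : 0 < δ := lt_of_lt_of_le (by positivity) hδ
    set δ' := δ ^ ((1/2:ℝ)^k) with hδ'
    have hδδ' : δ ≤ δ' := by
      conv_lhs => rw [← rpow_one δ]
      exact Real.rpow_le_rpow_of_exponent_ge hδ0 hδ1 (pow_le_one₀ (by norm_num) (by norm_num))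
    have hδ'0 : 0 < δ' := rpow_pos_of_pos hδ0 _
    have hhi0 : 0 < hi := by
      have := hb a ⟨le_rfl, by exact_mod_cast hab⟩
      linarith
    set K := ⌈R⌉₊ with hKd
    have hK1 : R ≤ K := Nat.le_ceil R
    have hK2 : (K:ℝ) < R + 1 := Nat.ceil_lt_add_one (by linarith)
    set z : ℤ → ℂ := fun n => if (a:ℤ) ≤ n ∧ n < b then Complex.exp (G 0 n * I) else 0 with hz
    have key := vdc_ineq z a b (by exact_mod_cast hab) (fun n hn => by rw [hz]; simp only []; rw [if_neg]; omega)
      K (by exact_mod_cast (hR.trans hK1)) (fun d => if (d:ℝ) < R1 then N else C * N * δ') ?_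
    · have hS : ∑ n ∈ Ico (a:ℤ) b, z n = ∑ n ∈ Ico a b, Complex.exp (G 0 n * I) := by
        rw [sum_Ico_int]; refine sum_congr rfl fun n hn => ?_
        rw [mem_Ico] at hn
        rw [hz]; simp only []; rw [if_pos (by omega)]; simp
      rw [hS] at key
      set S := ‖∑ n ∈ Ico a b, Complex.exp (G 0 n * I)‖ with hSd
      have hsum : ∑ d ∈ range K, (if (d:ℝ) < R1 then N else C * N * δ') ≤ 2 * R1 * N + K * (C * N * δ') := by
        rw [Finset.sum_ite, sum_const, sum_const, nsmul_eq_mul, nsmul_eq_mul]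
        refine add_le_add (mul_le_mul_of_nonneg_right ?_ (by linarith)) (mul_le_mul_of_nonneg_right ?_ (by positivity))
        · have : (Finset.filter (fun d : ℕ => (d:ℝ) < R1) (range K)).card ≤ ⌈R1⌉₊ := by
            rw [← card_range ⌈R1⌉₊]
            refine card_le_card fun d hd => ?_
            rw [mem_filter] at hd
            exact mem_range.mpr (Nat.lt_ceil.mpr hd.2)
          have h2 := Nat.ceil_lt_add_one (show 0 ≤ R1 by linarith)
          have : ((Finset.filter (fun d : ℕ => (d:ℝ) < R1) (range K)).card:ℝ) ≤ ⌈R1⌉₊ := by exact_mod_cast this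
          linarith
        · have := Finset.card_filter_le (range K) (fun d : ℕ => ¬ (d:ℝ) < R1)
          rw [card_range] at this; exact_mod_cast this
      have hK0 : (0:ℝ) < K := by linarith
      have hR1K : R1 ≤ δ * K := by
        rw [div_le_iff₀ (by linarith)] at hδ; nlinarith
      have h1 : (K:ℝ) * S ^ 2 ≤ K * ((6 * (2 + C) * N) ^ 2 * δ') := by
        have e : (((b:ℤ) - a : ℤ) : ℝ) ≤ N := by push_cast; exact hN
        calc (K:ℝ) * S^2 ≤ _ := key
          _ ≤ (N + K) * (2 * (2 * R1 * N + K * (C * N * δ'))) := by gcongr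
          _ ≤ (3 * N) * (2 * (2 * (δ' * K) * N + K * (C * N * δ'))) := by
              have : R1 ≤ δ' * K := hR1K.trans (by gcongr)
              gcongr; linarith
          _ = K * ((6 * (2 + C)) * N ^ 2 * δ') := by ring
          _ ≤ K * ((6 * (2 + C)) ^ 2 * N ^ 2 * δ') := by
              gcongr; exact le_self_pow₀ (by linarith) (by norm_num)
          _ = _ := by ring
      have h2 := le_of_mul_le_mul_left h1 hK0
      have h3 : (δ ^ ((1/2:ℝ)^(k+1))) ^ 2 = δ' := by
        rw [hδ', ← rpow_natCast, ← rpow_mul hδ0.le]; congr 1; push_cast; ring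
      rw [← h3, ← mul_pow] at h2
      exact (pow_le_pow_iff_left₀ (norm_nonneg _) (by positivity) (by norm_num)).mp h2
    · intro d hd
      have hdR : (d:ℝ) ≤ R := by
        have := Nat.lt_ceil.mp hd; exact this.le
      have hform : ∑ n ∈ Ico (a:ℤ) b, z n * conj (z (n + d)) =
          conj (∑ n ∈ Ico a (b - d), Complex.exp ((G 0 (n + d) - G 0 n : ℝ) * I)) := by
        rw [sum_Ico_int, map_sum]
        symm
        apply Finset.sum_subset_zero_on_sdiff (Finset.Ico_subset_Ico_right (by omega))
        · intro n hn
          simp only [Finset.mem_sdiff, mem_Ico] at hn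
          rw [hz]; simp only []; rw [if_neg (c := (a:ℤ) ≤ n + d ∧ _) (by omega)]; simp
        · intro n hn
          rw [mem_Ico] at hn
          rw [hz]; simp only []; rw [if_pos (by omega), if_pos (by omega)]
          simp only [← exp_conj, ← Complex.exp_add]
          congr 1; simp; ring
      rw [hform, RCLike.norm_conj]
      split_ifs with hdR1
      · refine norm_exp_sum_le (fun n => G 0 (n + d) - G 0 n) a (b - d) N ?_ (by linarith)
        have : ((b - d : ℕ):ℝ) ≤ b := by exact_mod_cast Nat.sub_le _ _
        linarith
      · push Not at hdR1
        rcases Nat.lt_or_ge (b - d) a with hbd | hbd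
        · rw [Ico_eq_empty_of_le hbd.le]; simp; positivity
        have hd0 : (0:ℝ) < d := by linarith
        have hd0' : 0 < d := by exact_mod_cast hd0
        rcases Nat.lt_or_ge b d with hbd2 | hbd2
        · have : b - d = 0 := by omega
          rw [this, Ico_eq_empty_of_le (by omega)]; simp; positivity
        have cb : ((b - d : ℕ):ℝ) = b - d := by rw [Nat.cast_sub hbd2]
        refine hC (fun j x => G j (x + d) - G j x) a (b - d) N (d * lo) (d * hi) R R1 δ hbd ?_ hN1 ?_ ?_
          (by positivity) ?_ hR1 hR hRN hδ ?_ hδ1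
        · rw [cb]; linarith
        · intro j x hx
          rw [cb] at hx
          exact ((hG j (x+d) ⟨by linarith [hx.1], by linarith [hx.2]⟩).comp_add_const x d).sub
            (hG j x ⟨by linarith [hx.1], by linarith [hx.2]⟩)
        · intro x hx
          rw [cb] at hx
          have mv : ∀ j, ∃ c ∈ Set.Icc (a:ℝ) b, G j (x + d) - G j x = d * G (j+1) c := by
            intro j
            obtain ⟨c, hc, he⟩ := exists_hasDerivAt_eq_slope (G j) (G (j+1)) (a := x) (b := x+d) (by linarith)
              (fun y hy => (hG j y ⟨by linarith [hy.1, hx.1], by linarith [hy.2, hx.2]⟩).continuousAt.continuousWithinAt)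
              (fun y hy => hG j y ⟨by linarith [hy.1, hx.1], by linarith [hy.2, hx.2]⟩)
            refine ⟨c, ⟨by linarith [hc.1, hx.1], by linarith [hc.2, hx.2]⟩, ?_⟩
            rw [he, add_sub_cancel_left, mul_div_cancel₀ _ hd0.ne']
          obtain ⟨c, hc, he⟩ := mv (k+1)
          obtain ⟨c', hc', he'⟩ := mv (k+2)
          simp only [he, he']
          have h1 := hb c hc
          have h2 := hb c' hc'
          refine ⟨by gcongr; exact h1.1, by gcongr; exact h1.2.1, ?_⟩
          have := h2.2.2
          nlinarith
        · calc d * hi * R^k ≤ R * hi * R^k := by gcongr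
            _ = hi * R^(k+1) := by ring
            _ ≤ _ := hhi
        · refine le_trans (one_div_le_one_div_of_le (by positivity) ?_) hδ2
          calc N * lo * R1^(k+1) = N * (R1 * lo) * R1^k := by ring
            _ ≤ _ := by gcongr
end MR
namespace MR

lemma exp_sum_neg (φ : ℕ → ℝ) (s : Finset ℕ) :
    ‖∑ n ∈ s, Complex.exp ((-φ n : ℝ) * I)‖ = ‖∑ n ∈ s, Complex.exp (φ n * I)‖ := by
  rw [← RCLike.norm_conj, map_sum]
  congr 1
  refine sum_congr rfl fun n _ => ?_
  rw [← exp_conj]; congr 1; simp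

noncomputable def logFam (c β : ℝ) : ℕ → ℝ → ℝ
  | 0, x => c * log (x + β)
  | (j+1), x => c * ((-1) ^ j * j.factorial * ((x + β) ^ (j+1))⁻¹)

lemma logFam_deriv (c β : ℝ) (j : ℕ) (x : ℝ) (hx : 0 < x + β) :
    HasDerivAt (logFam c β j) (logFam c β (j+1) x) x := by
  cases j with
  | zero =>
    have h := ((hasDerivAt_log hx.ne').comp_add_const x β).const_mul c
    have e : logFam c β (0+1) x = c * (x+β)⁻¹ := by simp [logFam]
    rw [e]; exact h
  | succ j =>
    have h := ((hasDerivAt_zpow (-(j+1:ℕ):ℤ) (x+β) (Or.inl hx.ne')).comp_add_const x β).const_mul (c * ((-1) ^ j * j.factorial))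
    have e : logFam c β (j+1) = fun x => c * ((-1) ^ j * j.factorial) * (x+β) ^ (-(j+1:ℕ):ℤ) := by
      funext y; simp only [logFam]; rw [zpow_neg, zpow_natCast]; ring
    rw [e]
    refine h.congr_deriv ?_
    show _ = c * ((-1) ^ (j+1) * (j+1).factorial * ((x + β) ^ (j+1+1))⁻¹)
    have : (-(j+1:ℕ):ℤ) - 1 = (-(j+1+1:ℕ):ℤ) := by push_cast; ring
    rw [this, zpow_neg, zpow_natCast, Nat.factorial_succ]; push_cast; ring

lemma log_vdc (k : ℕ) : ∃ C : ℝ, 1 ≤ C ∧ ∀ (a b : ℕ) (N τ β R R1 δ : ℝ), 1 ≤ N → N ≤ a → b ≤ 2 * N →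
    0 < τ → 0 ≤ β → β ≤ 1 → τ * k.factorial / N ^ (k+1) * R ^ k ≤ π → 1 ≤ R1 → 1 ≤ R → R ≤ N →
    R1 / R ≤ δ → 1 / (N * (τ * k.factorial / (3 * N) ^ (k+1)) * R1 ^ k) ≤ δ → δ ≤ 1 →
    ‖∑ n ∈ Ico a b, Complex.exp ((τ * log (n + β) : ℝ) * I)‖ ≤ C * N * δ ^ ((1/2:ℝ)^k) := by
  obtain ⟨C, hC1, hC⟩ := vdc_deriv k
  refine ⟨C, hC1, fun a b N τ β R R1 δ hN ha hb hτ hβ hβ1 hhi hR1 hR hRN hδ hδ2 hδ1 => ?_⟩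
  have hδ0 : 0 < δ := lt_of_lt_of_le (by positivity) hδ
  rcases Nat.lt_or_ge b a with hab | hab
  · rw [Ico_eq_empty_of_le hab.le]; simp; positivity
  have key := hC (logFam ((-1)^k * τ) β) a b N (τ * k.factorial / (3 * N) ^ (k+1)) (τ * k.factorial / N ^ (k+1)) R R1 δ
    hab (by linarith) hN (fun j x hx => logFam_deriv _ _ j x (by linarith [hx.1])) ?_ (by positivity) hhi hR1 hR hRN hδ hδ2 hδ1
  · refine le_trans (le_of_eq ?_) key
    simp only [logFam]
    rcases neg_one_pow_eq_or ℝ k with h | h <;> rw [h]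
    · simp
    · simp only [neg_mul, one_mul]
      exact (exp_sum_neg _ _).symm
  · intro x hx
    have h1 : N ≤ x + β := by linarith [hx.1]
    have h2 : x + β ≤ 3 * N := by linarith [hx.2]
    have h0 : 0 < x + β := by linarith
    have e : ((-1:ℝ)^k) * (-1)^k = 1 := by rw [← mul_pow]; simp
    have e1 : logFam ((-1)^k * τ) β (k+1) x = τ * k.factorial / (x+β)^(k+1) := by
      simp only [logFam]; rw [div_eq_mul_inv]; linear_combination (τ * k.factorial * ((x+β)^(k+1))⁻¹) * e
    have e2 : logFam ((-1)^k * τ) β (k+2) x = - (τ * (k+1).factorial * ((x+β)^(k+1+1))⁻¹) := by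
      simp only [logFam]; linear_combination (- τ * (k+1).factorial * ((x+β)^(k+1+1))⁻¹) * e
    rw [e1, e2]
    refine ⟨by gcongr, by gcongr, ?_⟩
    rw [neg_nonpos]; positivity

lemma esum_small : ∃ C : ℝ, 1 ≤ C ∧ ∀ (a b : ℕ) (N τ β : ℝ), 1 ≤ N → N ≤ a → b ≤ 2 * N →
    1 ≤ |τ| → |τ| ≤ N → 0 ≤ β → β ≤ 1 →
    ‖∑ n ∈ Ico a b, Complex.exp ((τ * log (n + β) : ℝ) * I)‖ ≤ C * N / |τ| := by
  refine ⟨30, by norm_num, ?_⟩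
  suffices H : ∀ (a b : ℕ) (N τ β : ℝ), 1 ≤ N → N ≤ a → b ≤ 2 * N →
    1 ≤ τ → τ ≤ N → 0 ≤ β → β ≤ 1 →
    ‖∑ n ∈ Ico a b, Complex.exp ((τ * log (n + β) : ℝ) * I)‖ ≤ 30 * N / τ by
    intro a b N τ β h1 h2 h3 h4 h5 h6 h7
    rcases le_total 0 τ with h | h
    · rw [abs_of_nonneg h] at *; exact H a b N τ β h1 h2 h3 h4 h5 h6 h7
    · rw [abs_of_nonpos h] at *
      have := H a b N (-τ) β h1 h2 h3 h4 h5 h6 h7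
      simp only [neg_mul] at this
      rwa [exp_sum_neg] at this
  intro a b N τ β hN ha hb hτ hτN hβ hβ1
  rcases Nat.lt_or_ge b a with hab | hab
  · rw [Ico_eq_empty_of_le hab.le]; simp; positivity
  have mv : ∀ x : ℝ, N ≤ x → x + 1 ≤ 2 * N → ∃ c ∈ Set.Ioo x (x+1), log (x+1+β) - log (x+β) = (c+β)⁻¹ := by
    intro x h1 h2
    obtain ⟨c, hc, he⟩ := exists_hasDerivAt_eq_slope (fun x => log (x+β)) (fun x => (x+β)⁻¹) (a := x) (b := x+1) (by linarith)
      (fun y hy => ((hasDerivAt_log (by linarith [hy.1] : y+β ≠ 0)).comp_add_const y β).continuousAt.continuousWithinAt)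
      (fun y hy => (hasDerivAt_log (by linarith [hy.1] : y+β ≠ 0)).comp_add_const y β)
    exact ⟨c, hc, by rw [he]; simp⟩
  have K := kusmin (fun n => τ * log (n + β)) a (τ / (3 * N)) (by positivity) b ?_ ?_ ?_
  · refine K.trans (le_of_eq ?_); field_simp; norm_num
  · intro n h1 h2
    have h1' : (a:ℝ) ≤ n := by exact_mod_cast h1
    have h2' : (n:ℝ) + 1 ≤ b := by exact_mod_cast h2
    obtain ⟨c, hc, he⟩ := mv n (by linarith) (by linarith)
    push_cast; rw [← mul_sub, he, div_eq_mul_inv]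
    gcongr
    · linarith [hc.1]
    · linarith [hc.2]
  · intro n h1 h2
    have h1' : (a:ℝ) ≤ n := by exact_mod_cast h1
    have h2' : (n:ℝ) + 1 ≤ b := by exact_mod_cast h2
    obtain ⟨c, hc, he⟩ := mv n (by linarith) (by linarith)
    push_cast; rw [← mul_sub, he, ← div_eq_mul_inv]
    have : τ / (c+β) ≤ 1 := by rw [div_le_one (by linarith [hc.1])]; linarith [hc.1]
    linarith [pi_gt_three]
  · intro n h1 h2
    have h1' : (a:ℝ) ≤ n := by exact_mod_cast h1
    have h2' : (n:ℝ) + 2 ≤ b := by exact_mod_cast h2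
    obtain ⟨c, hc, he⟩ := mv n (by linarith) (by linarith)
    obtain ⟨d, hd, he2⟩ := mv (n+1) (by linarith) (by linarith)
    have e : (n:ℝ) + 2 = n + 1 + 1 := by ring
    push_cast; rw [e, ← mul_sub, ← mul_sub, he, he2]
    gcongr
    · linarith [hc.1]
    · linarith [hc.2, hd.1]

lemma esum_step (k : ℕ) (hk : 2 ≤ k) : ∃ C c : ℝ, 1 ≤ C ∧ 0 < c ∧ c ≤ 1 ∧ ∀ (a b : ℕ) (N τ β : ℝ), 1 ≤ N → N ≤ a → b ≤ 2 * N →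
    N ^ (k-1) ≤ τ → τ ≤ N ^ k → 0 ≤ β → β ≤ 1 →
    ‖∑ n ∈ Ico a b, Complex.exp ((τ * log (n + β) : ℝ) * I)‖ ≤ C * N ^ (1 - c) := by
  obtain ⟨C, hC1, hC⟩ := log_vdc k
  have hk0 : (0:ℝ) < k := by exact_mod_cast (by omega : 0 < k)
  have hk2 : (2:ℝ) ≤ k := by exact_mod_cast hk
  set c : ℝ := 1 / (4 * k) * (1/2)^k with hc
  have hc0 : 0 < c := by positivity
  have hc1 : c ≤ 1 := by
    have h1 : (1/2:ℝ)^k ≤ 1 := pow_le_one₀ (by norm_num) (by norm_num)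
    have h2 : 1 / (4 * k : ℝ) ≤ 1 := by rw [div_le_one (by positivity)]; linarith
    calc c ≤ 1 * 1 := by rw [hc]; gcongr
      _ = 1 := by norm_num
  set N0 : ℝ := max ((3:ℝ)^((k+1) * (4*k))) ((k.factorial:ℝ)^2) with hN0
  have hN01 : 1 ≤ N0 := le_max_of_le_left (one_le_pow₀ (by norm_num))
  refine ⟨max (C * (3:ℝ)^(k+1)) N0, c, le_max_of_le_right hN01, hc0, hc1, ?_⟩
  intro a b N τ β hN ha hb hτ1 hτ2 hβ hβ1
  have hNpos : 0 < N := by linarith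
  have hNp : 0 < N ^ (1 - c) := rpow_pos_of_pos hNpos _
  rcases lt_or_ge N N0 with hlt | hge
  · refine (norm_exp_sum_le (fun n => τ * log (n+β)) a b N (by linarith) (by linarith)).trans ?_
    have : N = N ^ c * N ^ (1 - c) := by
      rw [← rpow_add hNpos]; simp
    calc N = N ^ c * N ^ (1 - c) := this
      _ ≤ max (C * (3:ℝ)^(k+1)) N0 * N ^ (1 - c) := by
        gcongr
        calc N ^ c ≤ N ^ (1:ℝ) := rpow_le_rpow_of_exponent_le hN hc1
          _ = N := rpow_one N
          _ ≤ N0 := hlt.le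
          _ ≤ _ := le_max_right _ _
  · have hτ0 : 0 < τ := lt_of_lt_of_le (by positivity) hτ1
    set R : ℝ := (N ^ ((k:ℝ) + 1/2) / τ) ^ (1 / (k:ℝ)) with hR
    set R1 : ℝ := (N ^ ((k:ℝ) + 1/4) / τ) ^ (1 / (k:ℝ)) with hR1
    have hb1 : 0 < N ^ ((k:ℝ) + 1/2) / τ := div_pos (rpow_pos_of_pos hNpos _) hτ0
    have hb2 : 0 < N ^ ((k:ℝ) + 1/4) / τ := div_pos (rpow_pos_of_pos hNpos _) hτ0
    have hRk : R ^ k = N ^ ((k:ℝ) + 1/2) / τ := by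
      rw [hR, one_div (k:ℝ), Real.rpow_inv_natCast_pow hb1.le (by omega)]
    have hR1k : R1 ^ k = N ^ ((k:ℝ) + 1/4) / τ := by
      rw [hR1, one_div (k:ℝ), Real.rpow_inv_natCast_pow hb2.le (by omega)]
    have hone : ∀ e : ℝ, 0 ≤ e → 1 ≤ N ^ ((k:ℝ) + e) / τ := fun e he => by
      rw [one_le_div hτ0]
      refine hτ2.trans ?_
      rw [← rpow_natCast]
      exact rpow_le_rpow_of_exponent_le hN (by linarith)
    have hR_1 : 1 ≤ R := one_le_rpow (hone _ (by norm_num)) (by positivity)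
    have hR1_1 : 1 ≤ R1 := one_le_rpow (hone _ (by norm_num)) (by positivity)
    have hRN : R ≤ N := by
      refine le_of_pow_le_pow_left₀ (n := k) (by omega) hNpos.le ?_
      rw [hRk, div_le_iff₀ hτ0]
      have h1 : N ^ ((k:ℝ) - 1) ≤ τ := by
        refine le_trans (le_of_eq ?_) hτ1
        rw [← rpow_natCast, Nat.cast_sub (by omega)]; simp
      calc N ^ ((k:ℝ) + 1/2) ≤ N ^ ((k:ℝ) + ((k:ℝ) - 1)) := rpow_le_rpow_of_exponent_le hN (by linarith)
        _ = N ^ k * N ^ ((k:ℝ) - 1) := by rw [rpow_add hNpos, rpow_natCast]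
        _ ≤ N ^ k * τ := by gcongr
    set δ : ℝ := (3:ℝ)^(k+1) * N ^ (-(1 / (4 * k:ℝ))) with hδ
    have h3 : (1:ℝ) ≤ (3:ℝ)^(k+1) := one_le_pow₀ (by norm_num)
    have key := hC a b N τ β R R1 δ hN ha hb hτ0 hβ hβ1 ?_ hR1_1 hR_1 hRN ?_ ?_ ?_
    · refine key.trans ?_
      calc C * N * δ ^ ((1/2:ℝ)^k) = C * N * (((3:ℝ)^(k+1)) ^ ((1/2:ℝ)^k) * N ^ (-c)) := by
            rw [hδ, Real.mul_rpow (by positivity) (by positivity), ← rpow_mul hNpos.le, hc]; ring_nf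
        _ ≤ C * N * ((3:ℝ)^(k+1) * N ^ (-c)) := by
            gcongr
            conv_rhs => rw [← rpow_one ((3:ℝ)^(k+1))]
            exact rpow_le_rpow_of_exponent_le h3 (pow_le_one₀ (by norm_num) (by norm_num))
        _ = C * (3:ℝ)^(k+1) * N ^ (1 - c) := by
            rw [sub_eq_add_neg, rpow_add hNpos, rpow_one]; ring
        _ ≤ _ := by gcongr; exact le_max_left _ _
    · rw [hRk]
      have : τ * k.factorial / N ^ (k+1) * (N ^ ((k:ℝ) + 1/2) / τ) = k.factorial * N ^ (-(1/2:ℝ)) := by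
        have e1 : N ^ ((k:ℝ) + 1/2) = N ^ (k+1) * N ^ (-(1/2:ℝ)) := by
          rw [← rpow_natCast, ← rpow_add hNpos]; congr 1; push_cast; ring
        rw [e1]; field_simp
      rw [this]
      have h1 : (k.factorial:ℝ) ≤ N ^ (1/2:ℝ) := by
        rw [← sqrt_eq_rpow]
        exact Real.le_sqrt_of_sq_le ((le_max_right _ _).trans hge)
      calc (k.factorial:ℝ) * N ^ (-(1/2:ℝ)) ≤ N ^ (1/2:ℝ) * N ^ (-(1/2:ℝ)) := by gcongr
        _ = 1 := by rw [← rpow_add hNpos]; simp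
        _ ≤ _ := by linarith [pi_gt_three]
    · have : R1 / R = N ^ (-(1 / (4 * k:ℝ))) := by
        rw [hR, hR1, ← Real.div_rpow hb2.le hb1.le]
        have : N ^ ((k:ℝ) + 1/4) / τ / (N ^ ((k:ℝ) + 1/2) / τ) = N ^ (-(1/4:ℝ)) := by
          have e1 : N ^ ((k:ℝ) + 1/4) = N ^ ((k:ℝ) + 1/2) * N ^ (-(1/4:ℝ)) := by
            rw [← rpow_add hNpos]; congr 1; ring
          have : N ^ ((k:ℝ) + 1/2) ≠ 0 := (rpow_pos_of_pos hNpos _).ne'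
          rw [e1]; field_simp
        rw [this, ← rpow_mul hNpos.le]; congr 1; field_simp
      rw [this, hδ]
      exact le_mul_of_one_le_left (by positivity) h3
    · rw [hR1k]
      have e1 : N * (τ * k.factorial / (3 * N) ^ (k+1)) * (N ^ ((k:ℝ) + 1/4) / τ)
          = k.factorial * N ^ (1/4:ℝ) / 3^(k+1) := by
        have e1 : N ^ ((k:ℝ) + 1/4) = N ^ k * N ^ (1/4:ℝ) := by
          rw [← rpow_natCast, ← rpow_add hNpos]
        rw [e1, mul_pow, pow_succ N k]; field_simp
      rw [e1, hδ, one_div_div, rpow_neg hNpos.le, ← div_eq_mul_inv]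
      refine div_le_div_of_nonneg_left (by positivity) (by positivity) ?_
      calc N ^ (1 / (4 * k:ℝ)) ≤ N ^ (1/4:ℝ) := by
            apply rpow_le_rpow_of_exponent_le hN
            apply one_div_le_one_div_of_le (by norm_num); linarith
        _ ≤ k.factorial * N ^ (1/4:ℝ) := by
            refine le_mul_of_one_le_left (by positivity) ?_
            exact_mod_cast Nat.one_le_iff_ne_zero.mpr (Nat.factorial_ne_zero k)
    · rw [hδ, rpow_neg hNpos.le, ← div_eq_mul_inv, div_le_one (by positivity)]
      have h1 : (3:ℝ)^((k+1) * (4*k)) ≤ N := (le_max_left _ _).trans hge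
      rw [pow_mul] at h1
      rw [one_div]
      rw [Real.le_rpow_inv_iff_of_pos (by positivity) hNpos.le (by positivity)]
      have : ((4 * k:ℕ):ℝ) = 4 * k := by push_cast; ring
      rw [← this, rpow_natCast]; exact h1

lemma esum_large (A : ℕ) : ∃ C c : ℝ, 1 ≤ C ∧ 0 < c ∧ c ≤ 1 ∧ ∀ (a b : ℕ) (N τ β : ℝ), 1 ≤ N → N ≤ a → b ≤ 2 * N →
    N ≤ |τ| → |τ| ≤ N ^ A → 0 ≤ β → β ≤ 1 →
    ‖∑ n ∈ Ico a b, Complex.exp ((τ * log (n + β) : ℝ) * I)‖ ≤ C * N ^ (1 - c) := by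
  have H : ∀ A : ℕ, ∃ C c : ℝ, 1 ≤ C ∧ 0 < c ∧ c ≤ 1 ∧ ∀ (a b : ℕ) (N τ β : ℝ), 1 ≤ N → N ≤ a → b ≤ 2 * N →
    N ≤ τ → τ ≤ N ^ (A + 1) → 0 ≤ β → β ≤ 1 →
    ‖∑ n ∈ Ico a b, Complex.exp ((τ * log (n + β) : ℝ) * I)‖ ≤ C * N ^ (1 - c) := by
    intro A
    induction A with
    | zero =>
      obtain ⟨C, c, h1, h2, h3, h4⟩ := esum_step 2 le_rfl
      refine ⟨C, c, h1, h2, h3, fun a b N τ β hN ha hb hτ1 hτ2 => h4 a b N τ β hN ha hb (by simpa using hτ1) ?_⟩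
      refine hτ2.trans (pow_le_pow_right₀ hN (by norm_num))
    | succ A ih =>
      obtain ⟨C, c, h1, h2, h3, h4⟩ := esum_step (A+2) (by omega)
      obtain ⟨C', c', h1', h2', h3', h4'⟩ := ih
      refine ⟨max C C', min c c', le_max_of_le_left h1, lt_min h2 h2', (min_le_left _ _).trans h3, ?_⟩
      intro a b N τ β hN ha hb hτ1 hτ2 hβ hβ1
      rcases le_total τ (N ^ (A+1)) with h | h
      · refine (h4' a b N τ β hN ha hb hτ1 h hβ hβ1).trans ?_
        gcongr
        · exact le_max_right _ _
        · exact min_le_right _ _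
      · refine (h4 a b N τ β hN ha hb (by simpa using h) hτ2 hβ hβ1).trans ?_
        gcongr
        · exact le_max_left _ _
        · exact min_le_left _ _
  obtain ⟨C, c, h1, h2, h3, h4⟩ := H A
  refine ⟨C, c, h1, h2, h3, fun a b N τ β hN ha hb hτ1 hτ2 hβ hβ1 => ?_⟩
  have hA : |τ| ≤ N ^ (A+1) := hτ2.trans (pow_le_pow_right₀ hN (by norm_num))
  rcases le_total 0 τ with h | h
  · rw [abs_of_nonneg h] at *; exact h4 a b N τ β hN ha hb hτ1 hA hβ hβ1
  · rw [abs_of_nonpos h] at *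
    have := h4 a b N (-τ) β hN ha hb hτ1 hA hβ hβ1
    simp only [neg_mul] at this
    rwa [exp_sum_neg] at this
end MR
namespace MR
open Metric

lemma bc_nonvanishing (F : ℂ → ℂ) (R M : ℝ) (w : ℂ) (hR : 0 < R) (hM : 0 < M) (hF : DifferentiableOn ℂ F (ball 0 R))
    (h0 : ∀ z ∈ ball (0:ℂ) R, F z ≠ 0) (hb : ∀ z ∈ ball (0:ℂ) R, ‖F z‖ ≤ exp M * ‖F 0‖)
    (hw : ‖w‖ ≤ R / 2) : ‖F w‖ ≤ ‖F 0‖ * exp (4 * M * ‖w‖ / R) := by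
  have hd : DifferentiableOn ℂ (fun z => deriv F z / F z) (ball 0 R) :=
    (hF.deriv isOpen_ball).div hF h0
  obtain ⟨g, hg0, hg⟩ := (hd.isExactOn_ball).with_val_at 0 0
  have hc0 : (0:ℂ) ∈ ball (0:ℂ) R := by simpa using hR
  have key : ∀ z ∈ ball (0:ℂ) R, F z = F 0 * Complex.exp (g z) := by
    intro z hz
    have hder : ∀ x ∈ ball (0:ℂ) R, HasDerivAt (fun z => F z * Complex.exp (-g z)) 0 x := by
      intro x hx
      have h1 := (hF.differentiableAt (isOpen_ball.mem_nhds hx)).hasDerivAt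
      have h2 := h1.mul (hg x hx).neg.cexp
      refine h2.congr_deriv ?_
      have := h0 x hx
      field_simp
      ring
    have := isOpen_ball.is_const_of_deriv_eq_zero (convex_ball (0:ℂ) R).isPreconnected
      (f := fun z => F z * Complex.exp (-g z))
      (fun x hx => (hder x hx).differentiableAt.differentiableWithinAt)
      (fun x hx => (hder x hx).deriv) hz hc0
    simp only [hg0, neg_zero, exp_zero, mul_one] at this
    rw [← this, mul_assoc, ← Complex.exp_add]; simp
  have hF0 : 0 < ‖F 0‖ := norm_pos_iff.2 (h0 0 hc0)
  have hwb : w ∈ ball (0:ℂ) R := by simp; linarith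
  have hre : Set.MapsTo g (ball 0 R) {z | z.re ≤ M} := by
    intro z hz
    have h1 := hb z hz
    rw [key z hz, norm_mul, norm_exp, mul_comm] at h1
    exact exp_le_exp.1 (le_of_mul_le_mul_right h1 hF0)
  have hbc := Complex.borelCaratheodory_zero hM
    (fun z hz => (hg z hz).differentiableAt.differentiableWithinAt) hre hR hwb hg0
  rw [key w hwb, norm_mul, norm_exp]
  refine mul_le_mul_of_nonneg_left (exp_le_exp.2 ?_) hF0.le
  refine ((Complex.re_le_norm _).trans hbc).trans ?_
  rw [div_le_div_iff₀ (by linarith) hR]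
  nlinarith [mul_nonneg hM.le (norm_nonneg w)]

lemma landau_lemma (n : ℕ) : ∀ (F : ℂ → ℂ) (R R' : ℝ) (w : ℂ), 0 < R → R < R' → DifferentiableOn ℂ F (ball 0 R') →
    F 0 ≠ 0 → (∀ z ∈ closedBall (0:ℂ) R, ‖F z‖ ≤ 2 ^ n * ‖F 0‖) →
    (∀ ρ ∈ ball (0:ℂ) (R / 3), F ρ = 0 → ‖w - ρ‖ ≤ ‖ρ‖) → ‖w‖ ≤ R / 6 →
    ‖F w‖ ≤ ‖F 0‖ * exp (12 * (n + 1) * log 2 * ‖w‖ / R) := by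
  have hl2 : 0 < log 2 := log_pos (by norm_num)
  induction n with
  | zero =>
    intro F R R' w hR hRR hF h0 hb hz hw
    refine (hb w (by simp; linarith)).trans ?_
    simp only [pow_zero, one_mul]
    refine le_mul_of_one_le_right (norm_nonneg _) (one_le_exp (by positivity))
  | succ n ih =>
    intro F R R' w hR hRR hF h0 hb hz hw
    by_cases hex : ∃ ρ ∈ ball (0:ℂ) (R / 3), F ρ = 0
    · obtain ⟨ρ, hρ, hFρ⟩ := hex
      have hρ0 : ρ ≠ 0 := by rintro rfl; exact h0 hFρ
      have hρn : 0 < ‖ρ‖ := norm_pos_iff.2 hρ0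
      have hρR : ‖ρ‖ < R / 3 := by simpa using hρ
      have hρR' : ρ ∈ ball (0:ℂ) R' := by simp; linarith
      set G : ℂ → ℂ := fun z => dslope F ρ z * (-ρ) with hG
      have hGd : DifferentiableOn ℂ G (ball 0 R') :=
        ((Complex.differentiableOn_dslope (isOpen_ball.mem_nhds hρR')).2 hF).mul_const _
      have hGz : ∀ z, z ≠ ρ → G z = F z * (-ρ) / (z - ρ) := by
        intro z hz
        simp only [hG]
        rw [dslope_of_ne _ hz, slope_def_field, hFρ]; ring
      have hGF : ∀ z, F z * (-ρ) = G z * (z - ρ) := by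
        intro z
        by_cases h : z = ρ
        · subst h; simp [hFρ]
        · rw [hGz z h]; have : z - ρ ≠ 0 := sub_ne_zero.2 h
          field_simp
      have hG0 : G 0 = F 0 := by
        have := hGF 0
        rw [zero_sub] at this
        exact (mul_right_cancel₀ (neg_ne_zero.2 hρ0) this).symm
      have hsub : closedBall (0:ℂ) R ⊆ ball 0 R' := closedBall_subset_ball hRR
      have hGb : ∀ z ∈ closedBall (0:ℂ) R, ‖G z‖ ≤ 2 ^ n * ‖G 0‖ := by
        intro z hz'
        have hdc : DiffContOnCl ℂ G (ball 0 R) := by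
          apply DifferentiableOn.diffContOnCl
          rw [closure_ball _ hR.ne']
          exact hGd.mono hsub
        refine Complex.norm_le_of_forall_mem_frontier_norm_le isBounded_ball hdc ?_ (by rwa [closure_ball _ hR.ne'])
        intro y hy
        rw [frontier_ball _ hR.ne', mem_sphere_zero_iff_norm] at hy
        have h1 := congrArg norm (hGF y)
        rw [norm_mul, norm_mul, norm_neg] at h1
        have h2 : 2 * ‖ρ‖ ≤ ‖y - ρ‖ := by
          have := norm_sub_norm_le y ρ
          linarith
        have h3 := hb y (by simp [hy])
        rw [hG0]
        have h4 : ‖G y‖ * (2 * ‖ρ‖) ≤ (2 ^ n * ‖F 0‖) * (2 * ‖ρ‖) := by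
          calc _ ≤ ‖G y‖ * ‖y - ρ‖ := by gcongr
            _ = ‖F y‖ * ‖ρ‖ := h1.symm
            _ ≤ 2 ^ (n+1) * ‖F 0‖ * ‖ρ‖ := by gcongr
            _ = _ := by ring
        exact le_of_mul_le_mul_right h4 (by positivity)
      have := ih G R R' w hR hRR hGd (by rwa [hG0]) hGb (fun r hr hr0 => hz r hr (by
        have := hGF r
        rw [hr0, zero_mul] at this
        exact (mul_eq_zero.1 this).resolve_right (neg_ne_zero.2 hρ0))) hw
      have h1 := congrArg norm (hGF w)
      rw [norm_mul, norm_mul, norm_neg] at h1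
      have h2 : ‖F w‖ ≤ ‖G w‖ := by
        have : ‖F w‖ * ‖ρ‖ ≤ ‖G w‖ * ‖ρ‖ := by
          rw [h1]; gcongr; exact hz ρ hρ hFρ
        exact le_of_mul_le_mul_right this hρn
      refine (h2.trans this).trans ?_
      rw [hG0]
      gcongr
      push_cast; linarith
    · push Not at hex
      have hsub : ball (0:ℂ) (R/3) ⊆ closedBall 0 R :=
        (ball_subset_ball (by linarith)).trans ball_subset_closedBall
      have := bc_nonvanishing F (R/3) ((n+1:ℝ) * log 2) w (by positivity) (by positivity)
        (hF.mono (hsub.trans (closedBall_subset_ball hRR))) hex (fun z hz => by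
          have := hb z (hsub hz)
          rw [mul_comm (n+1:ℝ), Real.exp_mul, exp_log (by norm_num)]
          exact_mod_cast this) (by linarith)
      refine this.trans ?_
      gcongr ?_ * exp ?_
      rw [div_le_div_iff₀ (by positivity) hR]
      push_cast
      nlinarith [mul_nonneg (mul_nonneg hl2.le (norm_nonneg w)) hR.le]
end MR
namespace MR

noncomputable def tw (t : ℝ) (n : ℕ) : ℂ := Complex.exp (((-(t * log n) : ℝ) : ℂ) * I)

lemma norm_tw (t : ℝ) (n : ℕ) : ‖tw t n‖ = 1 := norm_exp_ofReal_mul_I _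

lemma tw_mul (t : ℝ) {m n : ℕ} (hm : m ≠ 0) (hn : n ≠ 0) : tw t (m * n) = tw t m * tw t n := by
  unfold tw
  rw [← Complex.exp_add, Nat.cast_mul, log_mul (by exact_mod_cast hm) (by exact_mod_cast hn)]
  congr 1; push_cast; ring

lemma tw_one (t : ℝ) : tw t 1 = 1 := by simp [tw]

lemma cpow_tw (σ t : ℝ) {n : ℕ} (hn : n ≠ 0) :
    (n : ℂ) ^ (-((σ : ℂ) + t * I)) = (((n : ℝ) ^ (-σ) : ℝ) : ℂ) * tw t n := by
  have hn' : (n : ℂ) ≠ 0 := by exact_mod_cast hn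
  have h0 : (0:ℝ) < n := by exact_mod_cast Nat.pos_of_ne_zero hn
  rw [Complex.cpow_def_of_ne_zero hn', rpow_def_of_pos h0, Complex.ofReal_exp, tw, ← Complex.exp_add,
    ← Complex.natCast_log]
  congr 1; push_cast; ring

noncomputable def prs (P Q : ℝ) : Finset ℕ := (Ioc ⌊P⌋₊ ⌊Q⌋₊).filter Nat.Prime

lemma mem_prs {P Q : ℝ} (hP : 0 ≤ P) {p : ℕ} : p ∈ prs P Q ↔ P < p ∧ (p : ℝ) ≤ Q ∧ p.Prime := by
  unfold prs
  rw [mem_filter, mem_Ioc, Nat.floor_lt hP, and_assoc]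
  refine and_congr_right fun _ => and_congr_left fun hp => ?_
  exact Nat.le_floor_iff' hp.ne_zero

noncomputable def PZ (κ : ℝ) : ℝ := ∑' p : Nat.Primes, ((p : ℕ) : ℝ) ^ (-(1 + κ))

lemma summable_PZ {κ : ℝ} (hκ : 0 < κ) : Summable (fun p : Nat.Primes => ((p : ℕ) : ℝ) ^ (-(1 + κ))) :=
  Nat.Primes.summable_rpow.2 (by linarith)

open scoped LSeries.notation in
lemma log_L (N : ℕ) [NeZero N] (χ : DirichletCharacter ℂ N) (κ t : ℝ) (hκ : 0 < κ) :
    |log ‖DirichletCharacter.LFunction χ (1 + κ + t * I)‖ -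
      (∑' p : Nat.Primes, χ (p : ℕ) * tw t p * (((p : ℕ) : ℝ) ^ (-(1 + κ)) : ℝ)).re| ≤ PZ 1 := by
  set s : ℂ := 1 + κ + t * I with hs
  have hsre : s.re = 1 + κ := by simp [hs]
  have hs1 : 1 < s.re := by rw [hsre]; linarith
  have hterm : ∀ p : Nat.Primes, χ (p : ℕ) * ((p : ℕ) : ℂ) ^ (-s) = χ (p : ℕ) * tw t p * (((p : ℕ) : ℝ) ^ (-(1 + κ)) : ℝ) := by
    intro p
    have := cpow_tw (1 + κ) t p.2.ne_zero
    push_cast at this ⊢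
    rw [hs, this]; ring
  rw [DirichletCharacter.LFunction_eq_LSeries χ hs1, ← DirichletCharacter.LSeries_eulerProduct_exp_log χ hs1,
    norm_exp, log_exp]
  have hsum1 := DirichletCharacter.summable_neg_log_one_sub_mul_prime_cpow χ hs1
  have hnorm : ∀ p : Nat.Primes, ‖χ (p : ℕ) * tw t p * (((p : ℕ) : ℝ) ^ (-(1 + κ)) : ℝ)‖ ≤ ((p : ℕ) : ℝ) ^ (-(1 + κ)) := by
    intro p
    rw [norm_mul, norm_mul, norm_tw, mul_one, norm_real, norm_of_nonneg (by positivity)]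
    exact mul_le_of_le_one_left (by positivity) (χ.norm_le_one _)
  have hsum2 : Summable (fun p : Nat.Primes => χ (p : ℕ) * tw t p * (((p : ℕ) : ℝ) ^ (-(1 + κ)) : ℝ)) :=
    (summable_PZ hκ).of_norm_bounded hnorm
  rw [← sub_re, ← hsum1.tsum_sub hsum2]
  refine (abs_re_le_norm _).trans ?_
  refine tsum_of_norm_bounded (summable_PZ one_pos).hasSum fun p => ?_
  rw [hterm p]
  set z := χ (p : ℕ) * tw t p * (((p : ℕ) : ℝ) ^ (-(1 + κ)) : ℝ) with hz
  have hp2 : (2:ℝ) ≤ (p : ℕ) := by exact_mod_cast p.2.two_le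
  have hz1 : ‖z‖ ≤ ((p : ℕ) : ℝ) ^ (-1 : ℝ) := (hnorm p).trans
    (rpow_le_rpow_of_exponent_le (by linarith) (by linarith))
  have hz2 : ‖z‖ ≤ 1 / 2 := by
    refine hz1.trans ?_
    rw [rpow_neg_one, one_div]; gcongr
  have h := Complex.norm_log_one_add_sub_self_le (z := -z) (by rw [norm_neg]; linarith)
  rw [norm_neg] at h
  have h2 : ‖-Complex.log (1 - z) - z‖ = ‖Complex.log (1 + -z) - -z‖ := by
    rw [← norm_neg, sub_eq_add_neg 1 z]; congr 1; ring
  rw [h2]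
  refine h.trans ?_
  have : (1 - ‖z‖)⁻¹ ≤ 2 := by
    rw [inv_le_comm₀ (by linarith) (by norm_num)]; linarith
  calc ‖z‖ ^ 2 * (1 - ‖z‖)⁻¹ / 2 ≤ ‖z‖ ^ 2 * 2 / 2 := by gcongr
    _ = ‖z‖ ^ 2 := by ring
    _ ≤ (((p : ℕ) : ℝ) ^ (-1 : ℝ)) ^ 2 := by gcongr
    _ = _ := by
      rw [← rpow_natCast, ← rpow_mul (by linarith)]; norm_num

lemma compact_bd (f : ℝ × ℝ → ℝ) (hf : Continuous f) (hpos : ∀ x : ℝ × ℝ, 0 ≤ x.1 → 0 < f x) :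
    ∃ c C : ℝ, 0 < c ∧ 0 < C ∧ ∀ κ t : ℝ, 0 < κ → κ ≤ 2 → |t| ≤ 2 → c ≤ f (κ, t) ∧ f (κ, t) ≤ C := by
  have hK : IsCompact (Set.Icc (0:ℝ) 2 ×ˢ Set.Icc (-2:ℝ) 2) := isCompact_Icc.prod isCompact_Icc
  have hKn : (Set.Icc (0:ℝ) 2 ×ˢ Set.Icc (-2:ℝ) 2).Nonempty := ⟨(0, 0), by simp⟩
  obtain ⟨x0, hx0, hmin⟩ := hK.exists_isMinOn hKn hf.continuousOn
  obtain ⟨x1, hx1, hmax⟩ := hK.exists_isMaxOn hKn hf.continuousOn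
  refine ⟨f x0, f x1, hpos _ hx0.1.1, hpos _ hx1.1.1, fun κ t hκ hκ2 ht => ?_⟩
  have hmem : (κ, t) ∈ (Set.Icc (0:ℝ) 2 ×ˢ Set.Icc (-2:ℝ) 2) := ⟨⟨hκ.le, hκ2⟩, abs_le.1 ht⟩
  exact ⟨hmin hmem, hmax hmem⟩

lemma L_compact_triv (N : ℕ) [NeZero N] : ∃ c C : ℝ, 0 < c ∧ 0 < C ∧ ∀ κ t : ℝ, 0 < κ → κ ≤ 2 → |t| ≤ 2 →
    c ≤ ‖(κ : ℂ) + t * I‖ * ‖DirichletCharacter.LFunction (1 : DirichletCharacter ℂ N) (1 + κ + t * I)‖ ∧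
    ‖(κ : ℂ) + t * I‖ * ‖DirichletCharacter.LFunction (1 : DirichletCharacter ℂ N) (1 + κ + t * I)‖ ≤ C := by
  set f : ℝ × ℝ → ℝ := fun x => ‖DirichletCharacter.LFunctionTrivChar₁ N (1 + x.1 + x.2 * I)‖
  have hf : Continuous f := by
    refine continuous_norm.comp ((DirichletCharacter.differentiable_LFunctionTrivChar₁ N).continuous.comp ?_)
    fun_prop
  have hpos : ∀ x : ℝ × ℝ, 0 ≤ x.1 → 0 < f x := by
    intro x hx
    refine norm_pos_iff.2 ?_
    by_cases h : (1 + (x.1:ℂ) + x.2 * I) = 1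
    · rw [h]; exact DirichletCharacter.LFunctionTrivChar₁_apply_one_ne_zero N
    · rw [DirichletCharacter.LFunctionTrivChar₁, Function.update_of_ne h]
      refine mul_ne_zero (sub_ne_zero.2 h) ?_
      refine DirichletCharacter.LFunction_ne_zero_of_one_le_re _ (Or.inr h) ?_
      have := hx
      simpa using this
  obtain ⟨c, C, hc, hC, h⟩ := compact_bd f hf hpos
  refine ⟨c, C, hc, hC, fun κ t hκ hκ2 ht => ?_⟩
  have h1 : (1 + (κ:ℂ) + t * I) ≠ 1 := by
    intro h
    have := congrArg re h
    simp at this; linarith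
  have heq : f (κ, t) = ‖(κ : ℂ) + t * I‖ * ‖DirichletCharacter.LFunction (1 : DirichletCharacter ℂ N) (1 + κ + t * I)‖ := by
    simp only [f]
    rw [DirichletCharacter.LFunctionTrivChar₁, Function.update_of_ne h1, norm_mul]
    congr 2; ring
  rw [← heq]
  exact h κ t hκ hκ2 ht

lemma L_compact_nontriv (N : ℕ) [NeZero N] (χ : DirichletCharacter ℂ N) (hχ : χ ≠ 1) :
    ∃ c C : ℝ, 0 < c ∧ 0 < C ∧ ∀ κ t : ℝ, 0 < κ → κ ≤ 2 → |t| ≤ 2 →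
    c ≤ ‖DirichletCharacter.LFunction χ (1 + κ + t * I)‖ ∧
    ‖DirichletCharacter.LFunction χ (1 + κ + t * I)‖ ≤ C := by
  set f : ℝ × ℝ → ℝ := fun x => ‖DirichletCharacter.LFunction χ (1 + x.1 + x.2 * I)‖
  have hf : Continuous f := by
    refine continuous_norm.comp ((DirichletCharacter.differentiable_LFunction hχ).continuous.comp ?_)
    fun_prop
  have hpos : ∀ x : ℝ × ℝ, 0 ≤ x.1 → 0 < f x := by
    intro x hx
    refine norm_pos_iff.2 ?_
    refine DirichletCharacter.LFunction_ne_zero_of_one_le_re _ (Or.inl hχ) ?_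
    have := hx
    simpa using this
  exact compact_bd f hf hpos

lemma PZ_asymp : ∃ C : ℝ, 0 < C ∧ ∀ κ : ℝ, 0 < κ → κ ≤ 2 → |PZ κ + log κ| ≤ C := by
  obtain ⟨c, C, hc, hC, h⟩ := L_compact_triv 1
  refine ⟨PZ 1 + |log c| + |log C| + 1, ?_, fun κ hκ hκ2 => ?_⟩
  · have : 0 ≤ PZ 1 := tsum_nonneg fun p => by positivity
    positivity
  have h1 := log_L 1 1 κ 0 hκ
  obtain ⟨h2, h3⟩ := h κ 0 hκ hκ2 (by simp)
  have hre : (∑' p : Nat.Primes, (1 : DirichletCharacter ℂ 1) (p : ℕ) * tw 0 p * (((p : ℕ) : ℝ) ^ (-(1 + κ)) : ℝ)).re = PZ κ := by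
    rw [PZ, ← ofReal_re (∑' p : Nat.Primes, ((p : ℕ) : ℝ) ^ (-(1 + κ))), Complex.ofReal_tsum]
    congr 2
    ext p
    have : (1 : DirichletCharacter ℂ 1) ((p : ℕ) : ZMod 1) = 1 := MulChar.one_apply (isUnit_of_subsingleton _)
    rw [this]
    simp [tw]
  rw [hre] at h1
  have hnk : ‖(κ : ℂ) + (0:ℝ) * I‖ = κ := by simp [abs_of_pos hκ]
  rw [hnk] at h2 h3
  set A := ‖DirichletCharacter.LFunction (1 : DirichletCharacter ℂ 1) (1 + κ + (0:ℝ) * I)‖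
  have hA : 0 < A := by
    by_contra hA
    have : κ * A ≤ 0 := mul_nonpos_of_nonneg_of_nonpos hκ.le (not_lt.1 hA)
    linarith
  have h4 := log_le_log hc h2
  have h5 := log_le_log (by positivity) h3
  rw [log_mul hκ.ne' hA.ne'] at h4 h5
  have := abs_le.1 h1
  have := neg_abs_le (log c)
  have := le_abs_self (log C)
  have := abs_nonneg (log c)
  have := abs_nonneg (log C)
  rw [abs_le]; constructor <;> linarith

lemma tsum_prs (y : ℝ) (g : ℕ → ℂ) :
    HasSum (fun p : Nat.Primes => if ((p : ℕ) : ℝ) ≤ y then g p else 0) (∑ p ∈ prs 1 y, g p) := by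
  have h1 : HasSum (fun n : ℕ => if n ∈ prs 1 y then g n else 0) (∑ p ∈ prs 1 y, g p) := by
    have := hasSum_sum_of_ne_finset_zero (L := SummationFilter.unconditional _) (f := fun n : ℕ => if n ∈ prs 1 y then g n else 0) (s := prs 1 y)
      (fun b hb => by simp [hb])
    rwa [sum_congr rfl (fun x hx => if_pos hx)] at this
  have h2 := (hasSum_subtype_iff_of_support_subset (s := {p : ℕ | p.Prime}) (f := fun n : ℕ => if n ∈ prs 1 y then g n else 0) (by
    intro n hn
    simp only [Function.mem_support, ne_eq, ite_eq_right_iff, Classical.not_imp] at hn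
    exact ((mem_prs zero_le_one).1 hn.1).2.2)).2 h1
  refine h2.congr_fun ?_
  intro p
  have hp : Nat.Prime (p : ℕ) := p.2
  have : ((p : ℕ) : ℝ) ≤ y ↔ (p : ℕ) ∈ prs 1 y := by
    rw [mem_prs zero_le_one]
    exact ⟨fun h => ⟨by exact_mod_cast hp.one_lt, h, hp⟩, fun h => h.2.1⟩
  simp only [Function.comp, this]

lemma prime_sum_approx : ∃ C : ℝ, 0 < C ∧ ∀ (y : ℝ) (a : ℕ → ℂ), 2 ≤ y → (∀ n, ‖a n‖ ≤ 1) →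
    ‖∑ p ∈ prs 1 y, a p * ((p : ℝ)⁻¹ : ℝ) - ∑' p : Nat.Primes, a p * (((p : ℕ) : ℝ) ^ (-(1 + 1 / log y)) : ℝ)‖ ≤ C := by
  obtain ⟨C, hC, h⟩ := PZ_asymp
  have hlog2 : (1/2 : ℝ) < log 2 := by linarith [log_two_gt_d9]
  refine ⟨2 * exp 1 * (log 2 + 2 * C), by positivity, fun y a hy ha => ?_⟩
  have hly : log 2 ≤ log y := log_le_log (by norm_num) hy
  set κ := 1 / log y with hκd
  have hly0 : 0 < log y := by linarith
  have hκ : 0 < κ := by positivity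
  have hκ2 : κ ≤ 2 := by rw [hκd, div_le_iff₀ (by linarith)]; linarith
  have hs : Summable (fun p : Nat.Primes => a p * (((p : ℕ) : ℝ) ^ (-(1 + κ)) : ℝ)) :=
    (summable_PZ hκ).of_norm_bounded fun p => by
      rw [norm_mul, norm_real, norm_of_nonneg (by positivity)]
      exact mul_le_of_le_one_left (by positivity) (ha _)
  have h1 := tsum_prs y (fun p => a p * ((p : ℝ)⁻¹ : ℝ))
  rw [← h1.tsum_eq, ← h1.summable.tsum_sub hs]
  have hmaj : HasSum (fun p : Nat.Primes => 2 * exp 1 * (((p : ℕ) : ℝ) ^ (-(1 + κ / 2)) - ((p : ℕ) : ℝ) ^ (-(1 + κ))))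
      (2 * exp 1 * (PZ (κ / 2) - PZ κ)) :=
    ((summable_PZ (half_pos hκ)).hasSum.sub (summable_PZ hκ).hasSum).mul_left _
  have hfin : 2 * exp 1 * (PZ (κ / 2) - PZ κ) ≤ 2 * exp 1 * (log 2 + 2 * C) := by
    gcongr
    have e1 := abs_le.1 (h (κ / 2) (by positivity) (by linarith))
    have e2 := abs_le.1 (h κ hκ hκ2)
    rw [log_div hκ.ne' (by norm_num)] at e1
    linarith
  refine (tsum_of_norm_bounded hmaj fun p => ?_).trans hfin
  have hp2 : (2:ℝ) ≤ (p : ℕ) := by exact_mod_cast p.2.two_le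
  have hp0 : (0:ℝ) < (p : ℕ) := by linarith
  set P : ℝ := ((p : ℕ) : ℝ) with hP
  have hlp : 0 < log P := log_pos (by linarith)
  have hpow : ∀ r : ℝ, P ^ (-(1 + r)) = P⁻¹ * exp (-(r * log P)) := by
    intro r
    rw [neg_add, rpow_add hp0, rpow_neg_one, rpow_def_of_pos hp0]; congr 2; ring
  set u := κ * log P with hu
  have hu0 : 0 < u := by positivity
  have hexp : P ^ (-(1 + κ / 2)) - P ^ (-(1 + κ)) = P⁻¹ * exp (-u) * (exp (u / 2) - 1) := by
    rw [hpow, hpow]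
    have : exp (-(κ / 2 * log P)) = exp (-u) * exp (u / 2) := by
      rw [← exp_add]; congr 1; rw [hu]; ring
    rw [this]; ring
  have hmain : exp 1 * (P⁻¹ * exp (-u) * u) ≤ 2 * exp 1 * (P ^ (-(1 + κ / 2)) - P ^ (-(1 + κ))) := by
    rw [hexp]
    have := add_one_le_exp (u / 2)
    have h3 : 0 ≤ exp 1 * (P⁻¹ * exp (-u)) := by positivity
    nlinarith
  refine le_trans ?_ hmain
  have hdiff : ∀ x : ℝ, ‖a p * (x : ℂ)‖ ≤ |x| := fun x => by
    rw [norm_mul, norm_real, norm_eq_abs]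
    exact mul_le_of_le_one_left (abs_nonneg _) (ha _)
  split_ifs with hpy
  · rw [← mul_sub, ← ofReal_sub]
    refine (hdiff _).trans ?_
    have hu1 : u ≤ 1 := by
      rw [hu, hκd, one_div, inv_mul_le_iff₀ (by linarith), mul_one]
      exact log_le_log hp0 hpy
    rw [hpow, ← hu]
    have e1 : exp (-u) ≤ 1 := exp_le_one_iff.2 (by linarith)
    have e2 := add_one_le_exp (-u)
    rw [abs_of_nonneg (by rw [sub_nonneg]; exact mul_le_of_le_one_right (by positivity) e1)]
    have e3 : 1 ≤ exp 1 * exp (-u) := by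
      rw [← exp_add]; exact one_le_exp (by linarith)
    calc P⁻¹ - P⁻¹ * exp (-u) = P⁻¹ * (1 - exp (-u)) := by ring
      _ ≤ P⁻¹ * u := by gcongr; linarith
      _ ≤ P⁻¹ * (exp 1 * exp (-u) * u) := by
        gcongr; exact le_mul_of_one_le_left hu0.le e3
      _ = _ := by ring
  · rw [zero_sub, norm_neg]
    refine (hdiff _).trans ?_
    rw [abs_of_nonneg (by positivity), hpow, ← hu]
    have hu1 : 1 ≤ u := by
      rw [hu, hκd, one_div, le_inv_mul_iff₀ (by linarith), mul_one]
      exact log_le_log (by linarith) (not_le.1 hpy).le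
    have e3 : 1 ≤ exp 1 := one_le_exp (by norm_num)
    calc P⁻¹ * exp (-u) ≤ P⁻¹ * exp (-u) * (exp 1 * u) :=
          le_mul_of_one_le_right (by positivity) (by nlinarith)
      _ = _ := by ring

lemma prs_split {x y : ℝ} (hx : 1 ≤ x) (hxy : x ≤ y) (g : ℕ → ℂ) :
    ∑ p ∈ prs x y, g p = ∑ p ∈ prs 1 y, g p - ∑ p ∈ prs 1 x, g p := by
  have : prs 1 y = prs x y ∪ prs 1 x := by
    ext p
    rw [mem_union, mem_prs zero_le_one, mem_prs zero_le_one, mem_prs (by linarith)]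
    constructor
    · rintro ⟨h1, h2, h3⟩
      by_cases h : x < p
      · exact Or.inl ⟨h, h2, h3⟩
      · exact Or.inr ⟨h1, not_lt.1 h, h3⟩
    · rintro (⟨h1, h2, h3⟩ | ⟨h1, h2, h3⟩)
      · exact ⟨by linarith, h2, h3⟩
      · exact ⟨h1, by linarith, h3⟩
  rw [this, sum_union, add_sub_cancel_right]
  rw [disjoint_left]
  intro p h1 h2
  rw [mem_prs zero_le_one] at h2
  rw [mem_prs (by linarith)] at h1
  linarith [h1.1, h2.2.1]

lemma mertens : ∃ C : ℝ, 0 < C ∧ ∀ x y : ℝ, 2 ≤ x → x ≤ y →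
    |∑ p ∈ prs x y, (p : ℝ)⁻¹ - log (log y / log x)| ≤ C := by
  obtain ⟨C1, hC1, h1⟩ := PZ_asymp
  obtain ⟨C2, hC2, h2⟩ := prime_sum_approx
  have hlog2 : (1/2 : ℝ) < log 2 := by linarith [log_two_gt_d9]
  have key : ∀ y : ℝ, 2 ≤ y → |∑ p ∈ prs 1 y, (p : ℝ)⁻¹ - log (log y)| ≤ C1 + C2 := by
    intro y hy
    have hly : log 2 ≤ log y := log_le_log (by norm_num) hy
    have e1 := h2 y (fun _ => 1) hy (by simp)
    have hly0 : 0 < log y := by linarith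
    have e2 := h1 (1 / log y) (by positivity) (by rw [div_le_iff₀ (by linarith)]; linarith)
    simp only [one_mul] at e1
    rw [← Complex.ofReal_tsum, ← ofReal_sum, ← ofReal_sub, norm_real, norm_eq_abs] at e1
    rw [one_div, log_inv] at e2
    rw [one_div] at e1
    rw [PZ] at e2
    have := abs_le.1 e1
    have := abs_le.1 e2
    rw [abs_le]; constructor <;> linarith
  refine ⟨2 * (C1 + C2), by positivity, fun x y hx hxy => ?_⟩
  have hlx : log 2 ≤ log x := log_le_log (by norm_num) hx
  have hly : log x ≤ log y := log_le_log (by linarith) hxy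
  have e := prs_split (by linarith) hxy (fun p => (((p : ℝ)⁻¹ : ℝ) : ℂ))
  rw [← ofReal_sum, ← ofReal_sum, ← ofReal_sum] at e
  have e' : ∑ p ∈ prs x y, (p : ℝ)⁻¹ = ∑ p ∈ prs 1 y, (p : ℝ)⁻¹ - ∑ p ∈ prs 1 x, (p : ℝ)⁻¹ := by exact_mod_cast e
  rw [e', log_div (by linarith) (by linarith)]
  have := abs_le.1 (key x hx)
  have := abs_le.1 (key y (by linarith))
  rw [abs_le]; constructor <;> linarith

lemma prime_sum_L : ∃ C : ℝ, 0 < C ∧ ∀ (N : ℕ) (_ : NeZero N) (χ : DirichletCharacter ℂ N) (x y t : ℝ), 2 ≤ x → x ≤ y →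
    |(∑ p ∈ prs x y, χ p * tw t p * ((p : ℝ)⁻¹ : ℝ)).re -
      (log ‖DirichletCharacter.LFunction χ (1 + (1 / log y : ℝ) + t * I)‖ -
       log ‖DirichletCharacter.LFunction χ (1 + (1 / log x : ℝ) + t * I)‖)| ≤ C := by
  obtain ⟨C2, hC2, h2⟩ := prime_sum_approx
  have hPZ : 0 ≤ PZ 1 := tsum_nonneg fun p => by positivity
  refine ⟨2 * (C2 + PZ 1), by positivity, fun N _ χ x y t hx hxy => ?_⟩
  have key : ∀ y : ℝ, 2 ≤ y → |(∑ p ∈ prs 1 y, χ p * tw t p * ((p : ℝ)⁻¹ : ℝ)).re -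
      log ‖DirichletCharacter.LFunction χ (1 + (1 / log y : ℝ) + t * I)‖| ≤ C2 + PZ 1 := by
    intro y hy
    have hly : 0 < log y := log_pos (by linarith)
    have e1 := h2 y (fun p => χ p * tw t p) hy (fun n => by
      rw [norm_mul, norm_tw, mul_one]; exact χ.norm_le_one _)
    have e2 := log_L N χ (1 / log y) t (by positivity)
    have e3 := (abs_re_le_norm _).trans e1
    rw [sub_re] at e3
    have := abs_le.1 e3
    have := abs_le.1 e2
    rw [abs_le]; constructor <;> linarith
  rw [prs_split (by linarith) hxy, sub_re]
  have := abs_le.1 (key x hx)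
  have := abs_le.1 (key y (by linarith))
  rw [abs_le]; constructor <;> linarith
end MR
namespace MR

lemma abel_antitone (w : ℕ → ℝ) (e : ℕ → ℂ) (B : ℝ) (n : ℕ) (hw : Antitone w) (hw0 : ∀ i, 0 ≤ w i)
    (hB : ∀ k ≤ n, ‖∑ i ∈ range k, e i‖ ≤ B) :
    ‖∑ i ∈ range n, (w i : ℂ) * e i‖ ≤ w 0 * B := by
  have hB0 : 0 ≤ B := (norm_nonneg _).trans (hB 0 (Nat.zero_le _))
  rcases n with _ | n
  · simpa using mul_nonneg (hw0 0) hB0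
  have h := Finset.sum_range_by_parts (fun i => (w i : ℂ)) e (n + 1)
  simp only [smul_eq_mul, Nat.add_sub_cancel] at h
  rw [h]
  have h1 : ‖(w n : ℂ) * ∑ i ∈ range (n + 1), e i‖ ≤ w n * B := by
    rw [norm_mul, norm_real, norm_of_nonneg (hw0 n)]
    exact mul_le_mul_of_nonneg_left (hB _ le_rfl) (hw0 n)
  have h2 : ‖∑ i ∈ range n, ((w (i + 1) : ℂ) - w i) * ∑ i ∈ range (i + 1), e i‖ ≤
      ∑ i ∈ range n, (w i - w (i + 1)) * B := by
    refine norm_sum_le_of_le _ fun i hi => ?_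
    rw [norm_mul, ← ofReal_sub, norm_real, norm_eq_abs, abs_sub_comm,
      abs_of_nonneg (sub_nonneg.2 (hw (Nat.le_succ i)))]
    refine mul_le_mul_of_nonneg_left (hB _ ?_) (sub_nonneg.2 (hw (Nat.le_succ i)))
    have := mem_range.1 hi
    omega
  rw [← sum_mul, Finset.sum_range_sub'] at h2
  refine (norm_sub_le _ _).trans ((add_le_add h1 h2).trans (le_of_eq (by ring)))

lemma norm_real_cpow {x : ℝ} (hx : 0 < x) (s : ℂ) : ‖(x : ℂ) ^ s‖ = x ^ s.re :=
  Complex.norm_cpow_eq_rpow_re_of_pos hx s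

lemma dn_bound (x0 : ℝ) (s : ℂ) (hx : 0 < x0) (hs : s ≠ 1) (hs0 : 0 < s.re) :
    ‖(x0 : ℂ) ^ (-s) - ((x0 : ℂ) ^ (1 - s) - ((x0 + 1 : ℝ) : ℂ) ^ (1 - s)) / (s - 1)‖ ≤ ‖s‖ * x0 ^ (-s.re - 1) := by
  have hsne : s ≠ 0 := by rintro rfl; simp at hs0
  have hs1 : s - 1 ≠ 0 := sub_ne_zero.2 hs
  have hs1' : 1 - s ≠ 0 := sub_ne_zero.2 hs.symm
  have hmono : ∀ x ∈ Set.Icc x0 (x0 + 1), x ^ (-s.re - 1) ≤ x0 ^ (-s.re - 1) := fun x h =>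
    rpow_le_rpow_of_nonpos hx h.1 (by linarith)
  have hd1 : ∀ x ∈ Set.Icc x0 (x0 + 1), ‖(x0 : ℂ) ^ (-s) - (x : ℂ) ^ (-s)‖ ≤ ‖s‖ * x0 ^ (-s.re - 1) := by
    intro x hxm
    have := Convex.norm_image_sub_le_of_norm_hasDerivWithin_le (𝕜 := ℝ) (f := fun y : ℝ => (y : ℂ) ^ (-s))
      (f' := fun y : ℝ => -s * (y : ℂ) ^ (-s - 1)) (s := Set.Icc x0 (x0 + 1)) (C := ‖s‖ * x0 ^ (-s.re - 1))
      (fun y hy => (hasDerivAt_ofReal_cpow_const (by linarith [hy.1]) (neg_ne_zero.2 hsne)).hasDerivWithinAt)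
      (fun y hy => by
        rw [norm_mul, norm_neg, norm_real_cpow (by linarith [hy.1])]
        refine mul_le_mul_of_nonneg_left ?_ (norm_nonneg _)
        simpa using hmono y hy)
      (convex_Icc _ _) (Set.left_mem_Icc.2 (by linarith)) hxm
    rw [← norm_neg, neg_sub]
    refine this.trans (mul_le_of_le_one_right (by positivity) ?_)
    rw [norm_eq_abs, abs_le]; constructor <;> linarith [hxm.1, hxm.2]
  have := Convex.norm_image_sub_le_of_norm_hasDerivWithin_le (𝕜 := ℝ)
      (f := fun y : ℝ => (y : ℂ) * (x0 : ℂ) ^ (-s) + (y : ℂ) ^ (1 - s) / (s - 1))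
      (f' := fun y : ℝ => (x0 : ℂ) ^ (-s) - (y : ℂ) ^ (-s)) (s := Set.Icc x0 (x0 + 1)) (C := ‖s‖ * x0 ^ (-s.re - 1))
      (fun y hy => by
        have h1 : HasDerivAt (fun y : ℝ => (y : ℂ) ^ (1 - s)) ((1 - s) * (y : ℂ) ^ (1 - s - 1)) y :=
          hasDerivAt_ofReal_cpow_const (by linarith [hy.1]) hs1'
        have h2 : HasDerivAt (fun y : ℝ => (y : ℂ)) 1 y := ofRealCLM.hasDerivAt
        refine (((h2.mul_const _).add (h1.div_const (s - 1))).congr_deriv ?_).hasDerivWithinAt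
        rw [show 1 - s - 1 = -s by ring]
        field_simp; ring)
      hd1 (convex_Icc _ _) (Set.left_mem_Icc.2 (by linarith)) (Set.right_mem_Icc.2 (by linarith))
  simp only [add_sub_cancel_left, norm_one, mul_one] at this
  refine le_trans (le_of_eq ?_) this
  congr 1
  push_cast
  field_simp; ring

lemma block_bound (A : ℕ) (hA : 1 ≤ A) : ∃ r C : ℝ, 0 < r ∧ r ≤ 1 / 4 ∧ 1 ≤ C ∧ ∀ (N : ℕ) (s : ℂ) (β : ℝ), 1 ≤ N → 0 ≤ β → β ≤ 1 →
    1 ≤ |s.im| → 1 - r ≤ s.re → (N : ℝ) ^ r ≤ 6 * |s.im| →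
    ‖∑ n ∈ Ico N (2 * N), (((n : ℝ) + β : ℝ) : ℂ) ^ (-s)‖ ≤ C * |s.im| ^ (r / A) := by
  obtain ⟨C1, hC1, h1⟩ := esum_small
  obtain ⟨C2, c, hC2, hc, hc1, h2⟩ := esum_large A
  refine ⟨min c (1/4), 6 * (C1 + C2), by positivity, min_le_right _ _, by linarith, fun N s β hN hβ hβ1 hτ hσ hNr => ?_⟩
  set r := min c (1/4) with hr
  have hrc : r ≤ c := min_le_left _ _
  have hr4 : r ≤ 1/4 := min_le_right _ _
  have hr0 : 0 < r := by positivity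
  have hA' : (1:ℝ) ≤ A := by exact_mod_cast hA
  have hN' : (1:ℝ) ≤ N := by exact_mod_cast hN
  set τ := |s.im| with hτd
  have hpow1 : 1 ≤ τ ^ (r / A) := one_le_rpow hτ (by positivity)
  have hB : ∃ B : ℝ, (N : ℝ) ^ (-s.re) * B ≤ 6 * (C1 + C2) * τ ^ (r / A) ∧ ∀ k ≤ N,
      ‖∑ i ∈ range k, Complex.exp (((-s.im) * log ((N + i : ℕ) + β) : ℝ) * I)‖ ≤ B := by
    have hconv : ∀ k, ∑ i ∈ range k, Complex.exp (((-s.im) * log ((N + i : ℕ) + β) : ℝ) * I)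
        = ∑ n ∈ Ico N (N + k), Complex.exp (((-s.im) * log (n + β) : ℝ) * I) := by
      intro k; rw [sum_Ico_eq_sum_range]; simp
    have habs : |-s.im| = τ := abs_neg _
    have hNs : (N : ℝ) ^ (-s.re) ≤ (N : ℝ) ^ (r - 1) := rpow_le_rpow_of_exponent_le hN' (by linarith)
    have hb : ∀ k ≤ N, ((N + k : ℕ) : ℝ) ≤ 2 * N := by
      intro k hk
      have : (k:ℝ) ≤ N := by exact_mod_cast hk
      push_cast; linarith
    have hN0 : (0:ℝ) < N := by linarith
    rcases le_total τ N with h | h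
    · refine ⟨C1 * N / τ, ?_, fun k hk => ?_⟩
      · calc (N : ℝ) ^ (-s.re) * (C1 * N / τ) ≤ (N : ℝ) ^ (r - 1) * (C1 * N / τ) := by gcongr
          _ = C1 * ((N : ℝ) ^ r / τ) := by
            rw [Real.rpow_sub_one hN0.ne']; field_simp
          _ ≤ C1 * 6 := by
            gcongr; rw [div_le_iff₀ (by linarith)]; exact hNr
          _ ≤ 6 * (C1 + C2) := by linarith
          _ ≤ _ := le_mul_of_one_le_right (by linarith) hpow1
      · rw [hconv]
        have := h1 N (N + k) N (-s.im) β hN' le_rfl (hb k hk) (by rw [habs]; exact hτ) (by rw [habs]; exact h) hβ hβ1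
        rwa [habs] at this
    · rcases le_total τ ((N : ℝ) ^ A) with h' | h'
      · refine ⟨C2 * N ^ (1 - c), ?_, fun k hk => ?_⟩
        · calc (N : ℝ) ^ (-s.re) * (C2 * N ^ (1 - c)) ≤ (N : ℝ) ^ (r - 1) * (C2 * N ^ (1 - c)) := by gcongr
            _ = C2 * (N : ℝ) ^ (r - c) := by
              rw [mul_left_comm, ← rpow_add hN0]; congr 2; ring
            _ ≤ C2 * 1 := by
              gcongr; exact Real.rpow_le_one_of_one_le_of_nonpos hN' (by linarith)
            _ ≤ 6 * (C1 + C2) := by linarith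
            _ ≤ _ := le_mul_of_one_le_right (by linarith) hpow1
        · rw [hconv]
          exact h2 N (N + k) N (-s.im) β hN' le_rfl (hb k hk) (by rw [habs]; exact h) (by rw [habs]; exact h') hβ hβ1
      · refine ⟨N, ?_, fun k hk => ?_⟩
        · calc (N : ℝ) ^ (-s.re) * N ≤ (N : ℝ) ^ (r - 1) * N := by gcongr
            _ = (N : ℝ) ^ r := by rw [Real.rpow_sub_one hN0.ne']; field_simp
            _ = ((N : ℝ) ^ A) ^ (r / A) := by
              rw [← rpow_natCast, ← rpow_mul hN0.le]; congr 1; field_simp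
            _ ≤ τ ^ (r / A) := by gcongr
            _ ≤ _ := le_mul_of_one_le_left (by positivity) (by linarith)
        · refine (norm_sum_le_of_le _ (fun i _ => (norm_exp_ofReal_mul_I _).le)).trans ?_
          simpa using hk
  obtain ⟨B, hB1, hB2⟩ := hB
  have hB0 : 0 ≤ B := (norm_nonneg _).trans (hB2 0 (Nat.zero_le _))
  have hσ0 : 0 < s.re := by linarith
  set w : ℕ → ℝ := fun i => ((N + i : ℕ) + β : ℝ) ^ (-s.re) with hw
  have hwa : Antitone w := by
    intro i j hij
    simp only [hw]
    refine rpow_le_rpow_of_nonpos (by push_cast; positivity) ?_ (by linarith)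
    have : (i:ℝ) ≤ j := by exact_mod_cast hij
    push_cast; linarith
  have := abel_antitone w _ B N hwa (fun i => by simp only [hw]; positivity) hB2
  have e : ∑ n ∈ Ico N (2 * N), (((n : ℝ) + β : ℝ) : ℂ) ^ (-s) =
      ∑ i ∈ range N, (w i : ℂ) * Complex.exp (((-s.im) * log ((N + i : ℕ) + β) : ℝ) * I) := by
    rw [sum_Ico_eq_sum_range, show 2 * N - N = N by omega]
    refine sum_congr rfl fun i _ => ?_
    have hx : (0:ℝ) < (N + i : ℕ) + β := by push_cast; positivity
    simp only [hw]
    rw [Complex.cpow_def_of_ne_zero (by exact_mod_cast hx.ne'), ← Complex.ofReal_log hx.le, rpow_def_of_pos hx, Complex.ofReal_exp,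
      ← Complex.exp_add]
    congr 1
    apply Complex.ext <;> simp <;> ring
  rw [e]
  refine this.trans (le_trans ?_ hB1)
  refine mul_le_mul_of_nonneg_right ?_ hB0
  simp only [hw]
  exact rpow_le_rpow_of_nonpos (by linarith) (by push_cast; linarith) (by linarith)

end MR
namespace MR

def strip (t : ℝ) : Set ℂ := {s | 3 / 4 < s.re ∧ s.re < 4 ∧ |s.im - t| < 1}

lemma isOpen_strip (t : ℝ) : IsOpen (strip t) :=
  (isOpen_lt continuous_const Complex.continuous_re).inter
    ((isOpen_lt Complex.continuous_re continuous_const).inter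
      (isOpen_lt (by fun_prop : Continuous fun s : ℂ => |s.im - t|) continuous_const))

lemma sum_dyadic (f : ℕ → ℂ) (K : ℕ) :
    ∑ n ∈ Ico 1 (2 ^ K), f n = ∑ k ∈ range K, ∑ n ∈ Ico (2 ^ k) (2 * 2 ^ k), f n := by
  induction K with
  | zero => simp
  | succ K ih =>
    rw [sum_range_succ, ← ih, pow_succ', Finset.sum_Ico_consecutive _ Nat.one_le_two_pow (by omega)]

lemma hurwitz_G (A : ℕ) (hA : 1 ≤ A) : ∃ r C : ℝ, 0 < r ∧ r ≤ 1 / 4 ∧ 1 ≤ C ∧ ∀ (β t : ℝ), 0 ≤ β → β ≤ 1 → 2 ≤ |t| →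
    ∃ G : ℂ → ℂ, DifferentiableOn ℂ G (strip t) ∧
    (∀ s ∈ strip t, 1 < s.re → HasSum (fun n : ℕ => 1 / (((n + 1 : ℕ) : ℂ) + β) ^ s) (G s)) ∧
    (∀ s ∈ strip t, 1 - r ≤ s.re → ‖G s‖ ≤ C * |t| ^ (r / A) * (1 + log |t|)) := by
  obtain ⟨r, C, hr, hr4, hC, hblock⟩ := block_bound A hA
  set Z : ℝ := ∑' n : ℕ, ((n + 1 : ℕ) : ℝ) ^ (-(5/4) : ℝ) with hZ
  have hsumZ : Summable (fun n : ℕ => ((n + 1 : ℕ) : ℝ) ^ (-(5/4) : ℝ)) :=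
    (summable_nat_add_iff 1).2 (Real.summable_nat_rpow.2 (by norm_num))
  have hZ0 : 0 ≤ Z := tsum_nonneg fun n => by positivity
  refine ⟨r, 40 * C + 30 + 10 * Z, hr, hr4, by linarith, fun β t hβ hβ1 ht => ?_⟩
  have hA' : (1:ℝ) ≤ A := by exact_mod_cast hA
  obtain ⟨K, hK1, hK2⟩ : ∃ K : ℕ, (2 * |t|) ^ 4 ≤ (2:ℝ) ^ K ∧ (2:ℝ) ^ K ≤ 2 * (2 * |t|) ^ 4 := by
    obtain ⟨n, hn1, hn2⟩ := exists_nat_pow_near (x := (2 * |t|) ^ 4) (one_le_pow₀ (by linarith)) (y := (2:ℝ)) (by norm_num)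
    exact ⟨n + 1, hn2.le, by rw [pow_succ']; linarith⟩
  set M : ℕ := 2 ^ K with hM
  have hM' : (M : ℝ) = 2 ^ K := by push_cast [hM]; rfl
  have hM1 : (1:ℝ) ≤ M := by exact_mod_cast Nat.one_le_two_pow
  set X : ℕ → ℝ := fun k => ((M + k : ℕ) : ℝ) + β with hX
  have hX1 : ∀ k, ((M + k : ℕ) : ℝ) ≤ X k := fun k => by simp only [hX]; linarith
  have hX0 : ∀ k, 0 < X k := fun k => by have := hX1 k; push_cast at this; linarith [(Nat.cast_nonneg k : (0:ℝ) ≤ k)]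
  have hXs : ∀ k, X (k + 1) = X k + 1 := fun k => by simp only [hX]; push_cast; ring
  set d : ℕ → ℂ → ℂ := fun k s => (X k : ℂ) ^ (-s) - ((X k : ℂ) ^ (1 - s) - ((X (k + 1) : ℝ) : ℂ) ^ (1 - s)) / (s - 1) with hd
  have him : ∀ s ∈ strip t, 1 ≤ |s.im| ∧ |t| ≤ 2 * |s.im| ∧ |s.im| ≤ 2 * |t| := by
    intro s hs
    have h1 := hs.2.2
    have h2 := abs_sub_abs_le_abs_sub t s.im
    have h3 := abs_sub_abs_le_abs_sub s.im t
    rw [abs_sub_comm] at h2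
    refine ⟨by linarith, by linarith, by linarith⟩
  have hne1 : ∀ s ∈ strip t, s ≠ 1 := by
    rintro s hs rfl
    have := (him _ hs).1
    simp at this; linarith
  have hnorm : ∀ s ∈ strip t, ‖s‖ ≤ 4 * |t| := by
    intro s hs
    have h1 := Complex.norm_le_abs_re_add_abs_im s
    rw [abs_of_pos (by linarith [hs.1] : 0 < s.re)] at h1
    have h3 := abs_sub_abs_le_abs_sub s.im t
    linarith [hs.2.1, hs.2.2]
  have hMt : 1 ≤ (M:ℝ) ^ (1/4 : ℝ) / (2 * |t|) := by
    rw [le_div_iff₀ (by linarith), one_mul, hM']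
    calc 2 * |t| = ((2 * |t|) ^ 4) ^ (1/4 : ℝ) := by
          rw [← rpow_natCast, ← rpow_mul (by positivity)]; norm_num
      _ ≤ _ := by gcongr
  have hdb : ∀ k, ∀ s ∈ strip t, ‖d k s‖ ≤ 2 * ((k + 1 : ℕ) : ℝ) ^ (-(5/4) : ℝ) := by
    intro k s hs
    simp only [hd]
    rw [hXs k]
    refine (dn_bound (X k) s (hX0 k) (hne1 s hs) (by linarith [hs.1])).trans ?_
    have hx1 : 1 ≤ X k := by have := hX1 k; push_cast at this; linarith [(Nat.cast_nonneg k : (0:ℝ) ≤ k)]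
    calc ‖s‖ * X k ^ (-s.re - 1) ≤ 4 * |t| * X k ^ (-(1/4) + -(5/4) : ℝ) := by
          gcongr
          · exact hnorm s hs
          · linarith [hs.1]
      _ = 4 * |t| * X k ^ (-(1/4) : ℝ) * X k ^ (-(5/4) : ℝ) := by rw [rpow_add (hX0 k)]; ring
      _ ≤ 4 * |t| * (M:ℝ) ^ (-(1/4) : ℝ) * ((k + 1 : ℕ) : ℝ) ^ (-(5/4) : ℝ) := by
          gcongr 4 * |t| * ?_ * ?_
          · refine rpow_le_rpow_of_nonpos (by linarith) ?_ (by norm_num)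
            have := hX1 k; push_cast at this; linarith [(Nat.cast_nonneg k : (0:ℝ) ≤ k)]
          · refine rpow_le_rpow_of_nonpos (by positivity) ?_ (by norm_num)
            have := hX1 k; push_cast at this ⊢; linarith
      _ ≤ 2 * ((k + 1 : ℕ) : ℝ) ^ (-(5/4) : ℝ) := by
          gcongr
          rw [rpow_neg (by linarith)]
          rw [le_div_iff₀ (by linarith), one_mul] at hMt
          rw [← div_eq_mul_inv, div_le_iff₀ (by linarith)]
          linarith
  have hsumd : Summable (fun k : ℕ => 2 * ((k + 1 : ℕ) : ℝ) ^ (-(5/4) : ℝ)) := hsumZ.mul_left 2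
  refine ⟨fun s => ∑ n ∈ Ico 1 M, (((n : ℝ) + β : ℝ) : ℂ) ^ (-s) + (X 0 : ℂ) ^ (1 - s) / (s - 1) + ∑' k, d k s, ?_, ?_, ?_⟩
  · have hcp : ∀ (x : ℝ), 0 < x → ∀ g : ℂ → ℂ, Differentiable ℂ g → DifferentiableOn ℂ (fun s => (x : ℂ) ^ (g s)) (strip t) := by
      intro x hx g hg s _
      exact ((hg s).const_cpow (Or.inl (by exact_mod_cast hx.ne'))).differentiableWithinAt
    have hs1 : DifferentiableOn ℂ (fun s : ℂ => s - 1) (strip t) := by fun_prop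
    have hs2 : ∀ s ∈ strip t, s - 1 ≠ 0 := fun s hs => sub_ne_zero.2 (hne1 s hs)
    refine DifferentiableOn.add (DifferentiableOn.add ?_ ?_) ?_
    · refine DifferentiableOn.fun_sum fun n hn => ?_
      refine hcp _ ?_ _ (by fun_prop)
      have := (mem_Ico.1 hn).1
      positivity
    · exact (hcp _ (hX0 0) _ (by fun_prop)).div hs1 hs2
    · refine Complex.differentiableOn_tsum_of_summable_norm hsumd (fun k => ?_) (isOpen_strip t) hdb
      exact (hcp _ (hX0 k) _ (by fun_prop)).sub
        (((hcp _ (hX0 k) _ (by fun_prop)).sub (hcp _ (hX0 (k+1)) _ (by fun_prop))).div hs1 hs2)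
  · intro s hs hs1
    have hmain := HurwitzZeta.hasSum_hurwitzZeta_of_one_lt_re (a := β) ⟨hβ, hβ1⟩ hs1
    have hform : ∀ n : ℕ, 1 / ((n : ℂ) + β) ^ s = (((n : ℝ) + β : ℝ) : ℂ) ^ (-s) := by
      intro n; rw [Complex.cpow_neg, one_div]; push_cast; rfl
    have hsm := hmain.summable
    have hsM : Summable (fun k : ℕ => (X k : ℂ) ^ (-s)) := by
      have := (summable_nat_add_iff M).2 hsm
      refine this.congr fun k => ?_
      rw [hform, add_comm k M]
    have hsd : Summable (fun k => d k s) := hsumd.of_norm_bounded (fun k => hdb k s hs)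
    have htel : ∑' k, ((X k : ℂ) ^ (-s) - d k s) = (X 0 : ℂ) ^ (1 - s) / (s - 1) := by
      have h1 := (hsM.sub hsd).hasSum.tendsto_sum_nat
      refine tendsto_nhds_unique h1 ?_
      have h2 : ∀ n, ∑ k ∈ range n, ((X k : ℂ) ^ (-s) - d k s) =
          (X 0 : ℂ) ^ (1 - s) / (s - 1) - (X n : ℂ) ^ (1 - s) / (s - 1) := by
        intro n
        rw [← Finset.sum_range_sub' (fun k => (X k : ℂ) ^ (1 - s) / (s - 1))]
        refine sum_congr rfl fun k _ => ?_
        simp only [hd]; ring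
      simp only [h2]
      have h3 : Tendsto (fun n => (X n : ℂ) ^ (1 - s)) atTop (𝓝 0) := by
        rw [tendsto_zero_iff_norm_tendsto_zero]
        have : ∀ n, ‖(X n : ℂ) ^ (1 - s)‖ = X n ^ (-(s.re - 1)) := fun n => by
          rw [norm_real_cpow (hX0 n)]; simp
        simp only [this]
        refine (tendsto_rpow_neg_atTop (by linarith)).comp ?_
        refine tendsto_atTop_mono (fun n => ?_) tendsto_natCast_atTop_atTop
        have := hX1 n; push_cast at this; linarith
      simpa using (h3.div_const (s - 1)).const_sub ((X 0 : ℂ) ^ (1 - s) / (s - 1))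
    rw [hsM.tsum_sub hsd] at htel
    have hs1m := (summable_nat_add_iff 1).2 hsm
    have htot := (hs1m.sum_add_tsum_nat_add (M - 1))
    have hsucc := hs1m.hasSum
    rw [← htot] at hsucc
    beta_reduce
    rw [sum_Ico_eq_sum_range]
    have e1 : ∑ k ∈ range (M - 1), ((((1 + k : ℕ) : ℝ) + β : ℝ) : ℂ) ^ (-s) = ∑ i ∈ range (M - 1), 1 / (((i + 1 : ℕ) : ℂ) + β) ^ s :=
      sum_congr rfl fun i _ => by rw [hform, add_comm 1 i]
    have e2 : ∑' i : ℕ, 1 / (((i + (M - 1) + 1 : ℕ) : ℂ) + β) ^ s = ∑' k : ℕ, (X k : ℂ) ^ (-s) :=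
      tsum_congr fun i => by
        rw [hform, show i + (M - 1) + 1 = M + i by have : 1 ≤ M := Nat.one_le_two_pow; omega]
    rw [e2] at hsucc
    rw [e1, add_assoc, ← htel, sub_add_cancel]
    exact hsucc
  · intro s hs hsr
    obtain ⟨ht1, ht2, ht3⟩ := him s hs
    have hlogt : 0 ≤ log |t| := log_nonneg (by linarith)
    have hpow1 : 1 ≤ |t| ^ (r / A) := one_le_rpow (by linarith) (by positivity)
    have hK : (K : ℝ) ≤ 10 * (1 + log |t|) := by
      have := log_le_log (by positivity) hK2
      rw [log_pow, log_mul (by norm_num) (by positivity), log_pow, log_mul (by norm_num) (by linarith)] at this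
      push_cast at this
      have l1 := log_two_gt_d9
      have l2 := log_two_lt_d9
      nlinarith
    have hMr : (2 * M : ℝ) ^ r ≤ 6 * |t| := by
      calc (2 * M : ℝ) ^ r ≤ (2 * M : ℝ) ^ (1/4 : ℝ) := rpow_le_rpow_of_exponent_le (by linarith) hr4
        _ ≤ ((6 * |t|) ^ 4) ^ (1/4 : ℝ) := by
          gcongr
          rw [hM']
          calc 2 * (2:ℝ) ^ K ≤ 2 * (2 * (2 * |t|) ^ 4) := by gcongr
            _ ≤ _ := by ring_nf; nlinarith [pow_nonneg (abs_nonneg t) 4]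
        _ = 6 * |t| := by rw [← rpow_natCast, ← rpow_mul (by positivity)]; norm_num
    have hb1 : ‖∑ n ∈ Ico 1 M, (((n : ℝ) + β : ℝ) : ℂ) ^ (-s)‖ ≤ K * (C * (4 * |t| ^ (r / A))) := by
      rw [hM, sum_dyadic]
      refine (norm_sum_le_of_le (f := fun k => ∑ n ∈ Ico ((2:ℕ) ^ k) (2 * 2 ^ k), (((n : ℝ) + β : ℝ) : ℂ) ^ (-s))
        (n := fun _ => C * (4 * |t| ^ (r / A))) _ fun k hk => ?_).trans (by simp)
      have hkK : ((2 ^ k : ℕ) : ℝ) ≤ M / 2 := by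
        have : k + 1 ≤ K := mem_range.1 hk
        have h2 : (2:ℝ) ^ (k + 1) ≤ 2 ^ K := pow_le_pow_right₀ (by norm_num) this
        rw [hM']; push_cast; rw [pow_succ] at h2; linarith
      refine (hblock (2 ^ k) s β Nat.one_le_two_pow hβ hβ1 ht1 hsr ?_).trans ?_
      · have h16 : (M / 2 : ℝ) ^ r ≤ 3 * |t| := by
          calc (M / 2 : ℝ) ^ r ≤ ((2 * |t|) ^ 4) ^ r := by
                refine Real.rpow_le_rpow (by positivity) ?_ hr.le
                rw [hM']; linarith
            _ ≤ ((2 * |t|) ^ 4) ^ (1/4 : ℝ) := rpow_le_rpow_of_exponent_le (one_le_pow₀ (by linarith)) hr4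
            _ = 2 * |t| := by rw [← rpow_natCast, ← rpow_mul (by positivity)]; norm_num
            _ ≤ 3 * |t| := by linarith
        refine (Real.rpow_le_rpow (by positivity) hkK hr.le).trans ?_
        linarith
      · gcongr C * ?_
        calc |s.im| ^ (r / A) ≤ (2 * |t|) ^ (r / A) := by gcongr
          _ = 2 ^ (r / A) * |t| ^ (r / A) := Real.mul_rpow (by norm_num) (abs_nonneg _)
          _ ≤ 4 * |t| ^ (r / A) := by
            gcongr
            calc (2:ℝ) ^ (r / A) ≤ 2 ^ (1:ℝ) := rpow_le_rpow_of_exponent_le (by norm_num) (by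
                  rw [div_le_one (by linarith)]; linarith)
              _ ≤ 4 := by norm_num
    have hb2 : ‖(X 0 : ℂ) ^ (1 - s) / (s - 1)‖ ≤ 12 := by
      rw [norm_div, norm_real_cpow (hX0 0)]
      have h1 : |s.im| ≤ ‖s - 1‖ := by simpa using Complex.abs_im_le_norm (s - 1)
      have hX0' : X 0 ≤ 2 * M := by simp only [hX]; push_cast; linarith
      have hX0'' : 1 ≤ X 0 := by simp only [hX]; push_cast; linarith
      rw [div_le_iff₀ (by linarith)]
      calc X 0 ^ (1 - s).re ≤ X 0 ^ r := rpow_le_rpow_of_exponent_le hX0'' (by simp; linarith)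
        _ ≤ (2 * M) ^ r := by gcongr
        _ ≤ 6 * |t| := hMr
        _ ≤ 12 * ‖s - 1‖ := by linarith
    have hb3 : ‖∑' k, d k s‖ ≤ 2 * Z := by
      have := tsum_of_norm_bounded hsumd.hasSum (fun k => hdb k s hs)
      rwa [tsum_mul_left] at this
    have hfac : 1 ≤ |t| ^ (r / A) * (1 + log |t|) := one_le_mul_of_one_le_of_one_le hpow1 (by linarith)
    calc _ ≤ K * (C * (4 * |t| ^ (r / A))) + 12 + 2 * Z := (norm_add₃_le).trans (by gcongr)
      _ ≤ 10 * (1 + log |t|) * (C * (4 * |t| ^ (r / A))) + (12 + 2 * Z) * (|t| ^ (r / A) * (1 + log |t|)) := by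
        rw [add_assoc]
        gcongr
        exact le_mul_of_one_le_right (by positivity) hfac
      _ ≤ _ := by
        have : 0 ≤ |t| ^ (r / A) * (1 + log |t|) := by linarith
        nlinarith

lemma L_bound (q : ℕ) [NeZero q] (ψ : DirichletCharacter ℂ q) (η : ℝ) (hη : 0 < η) : ∃ r C : ℝ, 0 < r ∧ r ≤ 1 / 4 ∧ 1 ≤ C ∧
    ∀ t : ℝ, 2 ≤ |t| → ∃ F : ℂ → ℂ, DifferentiableOn ℂ F (strip t) ∧
    (∀ s ∈ strip t, 1 < s.re → F s = DirichletCharacter.LFunction ψ s) ∧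
    (∀ s ∈ strip t, 1 - r ≤ s.re → ‖F s‖ ≤ C * |t| ^ (η * r)) := by
  obtain ⟨A, hA⟩ := exists_nat_gt (2 / η)
  have hA0 : (0:ℝ) < A := lt_trans (by positivity) hA
  have hA1 : 1 ≤ A := Nat.one_le_iff_ne_zero.2 (by rintro rfl; simp at hA0)
  obtain ⟨r, C, hr, hr4, hC, hG⟩ := hurwitz_G A hA1
  have hq1 : (1:ℝ) ≤ q := by exact_mod_cast NeZero.one_le
  have hδ : 0 < η * r / 2 := by positivity
  refine ⟨r, q * (q ^ 4 + C) * (1 + 1 / (η * r / 2)), hr, hr4, ?_, fun t ht => ?_⟩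
  · have : (1:ℝ) ≤ q ^ 4 := one_le_pow₀ hq1
    have h2 : 0 ≤ 1 / (η * r / 2) := by positivity
    nlinarith [mul_le_mul hq1 (by linarith : (1:ℝ) ≤ q ^ 4 + C) (by norm_num) (by linarith)]
  have hβ : ∀ j : ZMod q, 0 ≤ (j.val : ℝ) / q ∧ (j.val : ℝ) / q ≤ 1 := fun j => by
    refine ⟨by positivity, (div_le_one (by linarith)).2 ?_⟩
    exact_mod_cast (ZMod.val_lt j).le
  choose G hG1 hG2 hG3 using fun j : ZMod q => hG ((j.val : ℝ) / q) t (hβ j).1 (hβ j).2 ht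
  have hs0 : ∀ s ∈ strip t, s ≠ 0 := by
    rintro s hs rfl
    have := hs.1
    norm_num at this
  refine ⟨fun s => (q : ℂ) ^ (-s) * ∑ j : ZMod q, ψ j * (1 / (((j.val : ℝ) / q : ℝ) : ℂ) ^ s + G j s), ?_, ?_, ?_⟩
  · refine DifferentiableOn.mul ?_ (DifferentiableOn.fun_sum fun j _ => DifferentiableOn.const_mul (DifferentiableOn.add ?_ (hG1 j)) _)
    · intro s hs
      exact (differentiableAt_id.neg.const_cpow (Or.inl (by exact_mod_cast NeZero.ne q))).differentiableWithinAt
    · have : ∀ s : ℂ, 1 / (((j.val : ℝ) / q : ℝ) : ℂ) ^ s = (((j.val : ℝ) / q : ℝ) : ℂ) ^ (-s) := fun s => by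
        rw [Complex.cpow_neg, one_div]
      simp only [this]
      intro s hs
      exact (differentiableAt_id.neg.const_cpow (Or.inr (neg_ne_zero.2 (hs0 s hs)))).differentiableWithinAt
  · intro s hs hs1
    rw [DirichletCharacter.LFunction, ZMod.LFunction]
    beta_reduce
    congr 1
    refine sum_congr rfl fun j _ => ?_
    congr 1
    rw [ZMod.toAddCircle_apply]
    have h1 := HurwitzZeta.hasSum_hurwitzZeta_of_one_lt_re (a := (j.val : ℝ) / q) (hβ j) hs1
    rw [← h1.tsum_eq, h1.summable.tsum_eq_zero_add, (hG2 j s hs hs1).tsum_eq]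
    simp
  · intro s hs hsr
    have hlogt : 0 ≤ log |t| := log_nonneg (by linarith)
    set E := |t| ^ (r / A) * (1 + log |t|) with hE
    have hpow1 : 1 ≤ |t| ^ (r / A) := one_le_rpow (by linarith) (by positivity)
    have hE1 : 1 ≤ E := one_le_mul_of_one_le_of_one_le hpow1 (by linarith)
    have hE2 : E ≤ (1 + 1 / (η * r / 2)) * |t| ^ (η * r) := by
      have h1 : |t| ^ (r / A) ≤ |t| ^ (η * r / 2) := by
        refine rpow_le_rpow_of_exponent_le (by linarith) ?_
        rw [div_le_iff₀ hA0]
        rw [div_lt_iff₀ hη] at hA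
        nlinarith
      have h2 : 1 ≤ |t| ^ (η * r / 2) := one_le_rpow (by linarith) (by positivity)
      have h3 := Real.log_le_rpow_div (abs_nonneg t) hδ
      calc E ≤ |t| ^ (η * r / 2) * (|t| ^ (η * r / 2) + |t| ^ (η * r / 2) / (η * r / 2)) := by
            rw [hE]; gcongr
        _ = (1 + 1 / (η * r / 2)) * (|t| ^ (η * r / 2) * |t| ^ (η * r / 2)) := by ring
        _ = _ := by rw [← rpow_add (by linarith)]; ring_nf
    have hqs : ‖(q : ℂ) ^ (-s)‖ ≤ 1 := by
      have := norm_real_cpow (x := q) (by linarith) (-s)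
      rw [Complex.ofReal_natCast] at this
      rw [this]
      exact Real.rpow_le_one_of_one_le_of_nonpos hq1 (by simp; linarith [hs.1])
    have hsum : ‖∑ j : ZMod q, ψ j * (1 / (((j.val : ℝ) / q : ℝ) : ℂ) ^ s + G j s)‖ ≤ q * ((q ^ 4 + C) * E) := by
      refine (norm_sum_le_of_le (n := fun _ => (q ^ 4 + C) * E) _ fun j _ => ?_).trans (by simp [ZMod.card])
      rw [norm_mul]
      refine (mul_le_of_le_one_left (norm_nonneg _) (ψ.norm_le_one j)).trans ((norm_add_le _ _).trans ?_)
      rw [add_mul]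
      refine add_le_add ?_ ((hG3 j s hs hsr).trans (le_of_eq (by rw [hE]; ring)))
      refine le_trans ?_ (le_mul_of_one_le_right (by positivity) hE1)
      rcases Nat.eq_zero_or_pos j.val with h0 | h0
      · rw [h0]; simp [Complex.zero_cpow (hs0 s hs)]
      · have hx : 0 < (j.val : ℝ) / q := by positivity
        have hx' : (j.val : ℝ) / q ≤ 1 := (hβ j).2
        have hxq : (q : ℝ)⁻¹ ≤ (j.val : ℝ) / q := by
          rw [inv_eq_one_div]; gcongr; exact_mod_cast h0
        rw [norm_div, norm_one, norm_real_cpow hx, one_div, ← rpow_neg hx.le]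
        calc ((j.val : ℝ) / q) ^ (-s.re) ≤ ((q : ℝ)⁻¹) ^ (-s.re) :=
              rpow_le_rpow_of_nonpos (by positivity) hxq (by linarith [hs.1])
          _ = (q : ℝ) ^ s.re := by rw [Real.inv_rpow (by positivity), rpow_neg (by positivity), inv_inv]
          _ ≤ (q : ℝ) ^ (4 : ℝ) := rpow_le_rpow_of_exponent_le hq1 hs.2.1.le
          _ = _ := by norm_cast
    rw [norm_mul]
    calc _ ≤ 1 * (q * ((q ^ 4 + C) * E)) := by gcongr
      _ ≤ 1 * (q * ((q ^ 4 + C) * ((1 + 1 / (η * r / 2)) * |t| ^ (η * r)))) := by gcongr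
      _ = _ := by ring
end MR
namespace MR

lemma L_ratio_high (q : ℕ) [NeZero q] (ψ : DirichletCharacter ℂ q) (δ' : ℝ) (hδ' : 0 < δ') :
    ∃ X0 : ℝ, 1 ≤ X0 ∧ ∀ X : ℝ, X0 ≤ X → ∀ t κ1 : ℝ, 2 ≤ |t| → |t| ≤ 6 * X ^ 2 → 0 < κ1 → κ1 ≤ 1 / (δ' * log X) →
    log ‖DirichletCharacter.LFunction ψ (1 + κ1 + t * I)‖ -
       log ‖DirichletCharacter.LFunction ψ (1 + (1 / (δ' * log X) : ℝ) + t * I)‖ ≤ 50 := by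
  obtain ⟨r, C, hr, hr4, hC, hF⟩ := L_bound q ψ δ' hδ'
  obtain ⟨C1, hC1, hPZ⟩ := PZ_asymp
  set D : ℝ := log C + C1 + PZ 1 + 2 * log 2 + δ' * r * log 6 with hD
  have hlim : Tendsto (fun X : ℝ => 1 / (δ' * log X)) atTop (𝓝[>] 0) := by
    rw [tendsto_nhdsWithin_iff]
    have h1 : Tendsto (fun X : ℝ => δ' * log X) atTop atTop := tendsto_log_atTop.const_mul_atTop hδ'
    refine ⟨by simp only [one_div]; exact h1.inv_tendsto_atTop, ?_⟩
    filter_upwards [h1.eventually_gt_atTop 0] with X hX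
    exact Set.mem_Ioi.2 (one_div_pos.2 hX)
  have hlim2 : Tendsto (fun κ : ℝ => 24 / r * (κ * (D + log (1 / κ)))) (𝓝[>] 0) (𝓝 0) := by
    have h1 : Tendsto (fun κ : ℝ => κ) (𝓝[>] 0) (𝓝 0) := nhdsWithin_le_nhds
    have h2 : Tendsto (fun κ : ℝ => log κ * κ) (𝓝[>] 0) (𝓝 0) := by
      simpa using tendsto_log_mul_rpow_nhdsGT_zero one_pos
    have h3 := ((h1.mul_const D).sub h2).const_mul (24 / r)
    simp only [zero_mul, sub_zero, mul_zero] at h3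
    refine h3.congr fun κ => ?_
    rw [one_div, log_inv]; ring
  have hev : ∀ᶠ κ : ℝ in 𝓝[>] 0, 24 / r * (κ * (D + log (1 / κ))) ≤ 1 ∧ κ ≤ r / 12 := by
    refine (hlim2.eventually (ge_mem_nhds one_pos)).and ?_
    have : ∀ᶠ κ : ℝ in 𝓝 0, κ ≤ r / 12 := ge_mem_nhds (by positivity)
    exact this.filter_mono nhdsWithin_le_nhds
  obtain ⟨X0, hX0⟩ := eventually_atTop.1 (hlim.eventually hev)
  refine ⟨max X0 2, by simp, fun X hX t κ1 ht htX hκ1 hκ10 => ?_⟩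
  have hX2 : 2 ≤ X := (le_max_right _ _).trans hX
  have hlX : 0 < log X := log_pos (by linarith)
  obtain ⟨hsm, hκr⟩ := hX0 X ((le_max_left _ _).trans hX)
  set κ0 := 1 / (δ' * log X) with hκ0d
  have hκ0 : 0 < κ0 := by positivity
  obtain ⟨F, hF1, hF2, hF3⟩ := hF t ht
  set s0 : ℂ := 1 + κ0 + t * I with hs0
  have hs0re : s0.re = 1 + κ0 := by simp [hs0]
  have hs0im : s0.im = t := by simp [hs0]
  have hball : ∀ z : ℂ, ‖z‖ < r → s0 + z ∈ strip t ∧ 1 - r ≤ (s0 + z).re := by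
    intro z hz
    have h1 := abs_le.1 (abs_re_le_norm z)
    have h2 := Complex.abs_im_le_norm z
    refine ⟨⟨?_, ?_, ?_⟩, ?_⟩
    · rw [add_re, hs0re]; linarith
    · rw [add_re, hs0re]; linarith
    · rw [Complex.add_im, hs0im, add_sub_cancel_left]; linarith
    · rw [add_re, hs0re]; linarith
  have hLs0 : ∀ κ : ℝ, 0 < κ → (1 + (κ : ℂ) + t * I) ≠ 1 ∧ DirichletCharacter.LFunction ψ (1 + κ + t * I) ≠ 0 := by
    intro κ hκ
    have h1 : (1 + (κ : ℂ) + t * I) ≠ 1 := by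
      intro h
      have := congrArg re h
      simp at this; linarith
    refine ⟨h1, DirichletCharacter.LFunction_ne_zero_of_one_le_re _ (Or.inr h1) ?_⟩
    simp; linarith
  have hF0 : F s0 = DirichletCharacter.LFunction ψ s0 := by
    have := (hball 0 (by simpa using hr)).1
    rw [add_zero] at this
    exact hF2 s0 this (by rw [hs0re]; linarith)
  have hL0 : DirichletCharacter.LFunction ψ s0 ≠ 0 := (hLs0 κ0 hκ0).2
  have hlow : log κ0 - C1 - PZ 1 ≤ log ‖F s0‖ := by
    have h1 := abs_le.1 (log_L q ψ κ0 t hκ0)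
    have h2 := abs_le.1 (hPZ κ0 hκ0 (by linarith))
    have h3 : |(∑' p : Nat.Primes, ψ (p : ℕ) * tw t p * (((p : ℕ) : ℝ) ^ (-(1 + κ0)) : ℝ)).re| ≤ PZ κ0 := by
      refine (abs_re_le_norm _).trans (tsum_of_norm_bounded (summable_PZ hκ0).hasSum fun p => ?_)
      rw [norm_mul, norm_mul, norm_tw, mul_one, norm_real, norm_of_nonneg (by positivity)]
      exact mul_le_of_le_one_left (by positivity) (ψ.norm_le_one _)
    have h4 := abs_le.1 h3
    rw [hF0]; linarith
  have hl2 : 0 < log 2 := log_pos (by norm_num)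
  have hnF : 0 < ‖F s0‖ := norm_pos_iff.2 (by rw [hF0]; exact hL0)
  set Y : ℝ := log (C * |t| ^ (δ' * r)) - log ‖F s0‖ with hY
  set n : ℕ := ⌈Y / log 2⌉₊ with hn
  have hnY : Y ≤ n * log 2 := by
    have := Nat.le_ceil (Y / log 2)
    rwa [div_le_iff₀ hl2] at this
  have hCt : 0 < C * |t| ^ (δ' * r) := by
    have : 0 < |t| := by linarith
    positivity
  have hbd : C * |t| ^ (δ' * r) ≤ 2 ^ n * ‖F s0‖ := by
    rw [← log_le_log_iff hCt (by positivity), log_mul (by positivity) hnF.ne', log_pow]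
    linarith
  have hYup : Y ≤ D - 2 * log 2 + log (1 / κ0) + 2 * δ' * r * log X := by
    have h1 : log (C * |t| ^ (δ' * r)) ≤ log C + δ' * r * (log 6 + 2 * log X) := by
      rw [log_mul (by positivity) (by have : 0 < |t| := (by linarith); positivity), log_rpow (by linarith)]
      gcongr
      have := log_le_log (by linarith) htX
      rw [log_mul (by norm_num) (by positivity), log_pow] at this
      exact_mod_cast this
    rw [one_div κ0, log_inv, hY, hD]
    linarith
  have hnup : ((n:ℝ) + 1) * log 2 ≤ D + log (1 / κ0) + 2 * δ' * r * log X := by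
    have hpos : 0 ≤ D - 2 * log 2 + log (1 / κ0) + 2 * δ' * r * log X := by
      have h1 : 0 ≤ PZ 1 := tsum_nonneg fun p => by positivity
      have h2 : 0 ≤ log (1 / κ0) := log_nonneg (by rw [le_div_iff₀ hκ0]; linarith)
      have h3 : 0 ≤ log C := log_nonneg hC
      have h4 : 0 ≤ log 6 := log_nonneg (by norm_num)
      have : 0 ≤ 2 * δ' * r * log X := by positivity
      have : 0 ≤ δ' * r * log 6 := by positivity
      rw [hD]; linarith
    have h1 : (n:ℝ) ≤ (D - 2 * log 2 + log (1 / κ0) + 2 * δ' * r * log X) / log 2 + 1 := by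
      have : Y / log 2 ≤ (D - 2 * log 2 + log (1 / κ0) + 2 * δ' * r * log X) / log 2 := by gcongr
      exact (Nat.ceil_le_ceil this |> Nat.cast_le.2 |>.trans (Nat.ceil_lt_add_one (by positivity)).le)
    have h2 : ((n:ℝ) + 1) * log 2 ≤ ((D - 2 * log 2 + log (1 / κ0) + 2 * δ' * r * log X) / log 2 + 1 + 1) * log 2 := by gcongr
    refine h2.trans (le_of_eq ?_)
    field_simp; ring
  set w : ℂ := ((κ1 - κ0 : ℝ) : ℂ) with hw
  have hwn : ‖w‖ ≤ κ0 := by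
    rw [hw, norm_real, norm_eq_abs, abs_le]; constructor <;> linarith
  have hland := landau_lemma n (fun z => F (s0 + z)) (r / 2) r w (by positivity) (by linarith)
    (by
      intro z hz
      have hz' := (hball z (by simpa using hz)).1
      have h1 : DifferentiableAt ℂ F (s0 + z) := hF1.differentiableAt ((isOpen_strip t).mem_nhds hz')
      exact (h1.comp z (by fun_prop : DifferentiableAt ℂ (fun z => s0 + z) z)).differentiableWithinAt)
    (by simpa using norm_pos_iff.1 hnF)
    (by
      intro z hz
      obtain ⟨h1, h2⟩ := hball z (by have := mem_closedBall_zero_iff.1 hz; linarith)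
      refine (hF3 _ h1 h2).trans ?_
      simpa using hbd)
    (by
      intro ρ hρ hρ0
      have hρ' := mem_ball_zero_iff.1 hρ
      have h1 := (hball ρ (by linarith)).1
      have hre : (s0 + ρ).re ≤ 1 := by
        by_contra hcon
        have h2 := hF2 _ h1 (not_le.1 hcon)
        have hρ0' : F (s0 + ρ) = 0 := hρ0
        rw [hρ0'] at h2
        refine DirichletCharacter.LFunction_ne_zero_of_one_le_re ψ (Or.inr ?_) (not_le.1 hcon).le h2.symm
        intro h3
        rw [h3] at hcon; simp at hcon
      rw [add_re, hs0re] at hre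
      rw [norm_def, norm_def]
      refine Real.sqrt_le_sqrt ?_
      rw [normSq_apply, normSq_apply, hw]
      simp only [sub_re, Complex.sub_im, ofReal_re, Complex.ofReal_im]
      nlinarith)
    (by linarith)
  simp only [add_zero] at hland
  have hFw : F (s0 + w) = DirichletCharacter.LFunction ψ (1 + κ1 + t * I) := by
    rw [hF2 _ (hball w (by linarith)).1 (by rw [add_re, hs0re, hw, ofReal_re]; linarith)]
    congr 1
    rw [hs0, hw]; push_cast; ring
  rw [hFw] at hland
  have hL1 := norm_pos_iff.2 (hLs0 κ1 hκ1).2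
  have := log_le_log hL1 hland
  rw [log_mul hnF.ne' (Real.exp_ne_zero _), log_exp, hF0] at this
  have hnn0 : 0 ≤ D + log (1 / κ0) + 2 * δ' * r * log X := le_trans (by positivity) hnup
  have hlast : 12 * ((n:ℝ) + 1) * log 2 * ‖w‖ / (r / 2) ≤ 50 := by
    calc 12 * ((n:ℝ) + 1) * log 2 * ‖w‖ / (r / 2) = 24 / r * (((n:ℝ) + 1) * log 2 * ‖w‖) := by field_simp; ring
      _ ≤ 24 / r * ((D + log (1 / κ0) + 2 * δ' * r * log X) * κ0) := by gcongr
      _ = 24 / r * (κ0 * (D + log (1 / κ0))) + 48 * (δ' * log X * κ0) := by field_simp; ring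
      _ ≤ 1 + 48 * 1 := by
        refine add_le_add hsm (le_of_eq ?_)
        rw [hκ0d]; field_simp
      _ ≤ 50 := by norm_num
  linarith

lemma L_ratio_low (q : ℕ) [NeZero q] (χ : DirichletCharacter ℂ q) : ∃ C : ℝ, 0 < C ∧ ∀ κ0 κ1 t : ℝ, 0 < κ1 → κ1 ≤ κ0 → κ0 ≤ 2 → |t| ≤ 2 →
    log ‖DirichletCharacter.LFunction χ (1 + κ0 + t * I)‖ -
       log ‖DirichletCharacter.LFunction χ (1 + κ1 + t * I)‖ ≤ C := by
  by_cases hχ : χ = 1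
  · subst hχ
    obtain ⟨c, C, hc, hC, h⟩ := L_compact_triv q
    refine ⟨|log C - log c| + 1, by positivity, fun κ0 κ1 t h1 h10 h2 ht => ?_⟩
    obtain ⟨-, ha⟩ := h κ0 t (by linarith) h2 ht
    obtain ⟨hb, -⟩ := h κ1 t h1 (by linarith) ht
    set N0 := ‖(κ0 : ℂ) + t * I‖
    set N1 := ‖(κ1 : ℂ) + t * I‖
    have hN1 : 0 < N1 := norm_pos_iff.2 (by intro h; have := congrArg re h; simp at this; linarith)
    have hN : N1 ≤ N0 := by
      simp only [N0, N1]
      rw [norm_def, norm_def]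
      refine Real.sqrt_le_sqrt ?_
      rw [Complex.normSq_add_mul_I, Complex.normSq_add_mul_I]; nlinarith
    have hx : ∀ κ : ℝ, 0 < κ → 0 < ‖DirichletCharacter.LFunction (1 : DirichletCharacter ℂ q) (1 + κ + t * I)‖ := by
      intro κ hκ
      refine norm_pos_iff.2 (DirichletCharacter.LFunction_ne_zero_of_one_le_re _ (Or.inr ?_) (by simp; linarith))
      intro h
      have := congrArg re h
      simp at this; linarith
    have e1 := log_le_log (mul_pos (by linarith) (hx κ0 (by linarith))) ha
    have e2 := log_le_log hc hb
    rw [log_mul (by linarith) (hx κ0 (by linarith)).ne'] at e1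
    rw [log_mul (by linarith) (hx κ1 h1).ne'] at e2
    have e3 := log_le_log hN1 hN
    have := le_abs_self (log C - log c)
    linarith
  · obtain ⟨c, C, hc, hC, h⟩ := L_compact_nontriv q χ hχ
    refine ⟨|log C - log c| + 1, by positivity, fun κ0 κ1 t h1 h10 h2 ht => ?_⟩
    obtain ⟨hd, ha⟩ := h κ0 t (by linarith) h2 ht
    obtain ⟨hb, -⟩ := h κ1 t h1 (by linarith) ht
    have e1 := log_le_log (by linarith) ha
    have e2 := log_le_log hc hb
    have := le_abs_self (log C - log c)
    linarith

lemma three_four_one {q : ℕ} (χ : DirichletCharacter ℂ q) (t : ℝ) (p : ℕ) :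
    -(χ p * tw t p).re ≤ 3 / 4 + ((χ ^ 2) p * tw (2 * t) p).re / 4 := by
  have h2 : (χ ^ 2) p * tw (2 * t) p = (χ p * tw t p) ^ 2 := by
    rw [mul_pow, MulChar.pow_apply' _ (by norm_num), tw, tw, ← Complex.exp_nat_mul]
    congr 2; push_cast; ring
  rw [h2]
  set z := χ p * tw t p with hz
  have hnz : ‖z‖ = ‖χ p‖ := by rw [hz, norm_mul, norm_tw, mul_one]
  have hre : (z ^ 2).re = 2 * z.re ^ 2 - ‖z‖ ^ 2 := by
    rw [← Complex.normSq_eq_norm_sq, normSq_apply, sq]; simp; ring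
  rw [hre]
  have h1 : ‖z‖ ≤ 1 := by rw [hnz]; exact χ.norm_le_one _
  have h3 : ‖z‖ ^ 2 ≤ 1 := by nlinarith [norm_nonneg z]
  nlinarith [sq_nonneg (z.re + 1)]

lemma claim (q : ℕ) [NeZero q] (χ : DirichletCharacter ℂ q) : ∃ C0 : ℝ, 0 < C0 ∧ ∀ δ' δ : ℝ, 0 < δ' → δ' ≤ δ →
    ∃ X0 : ℝ, ∀ X : ℝ, X0 ≤ X → ∀ t : ℝ, |t| ≤ 3 * X ^ 2 →
    -(∑ p ∈ prs (X ^ δ') (X ^ δ), χ p * tw t p * ((p : ℝ)⁻¹ : ℝ)).re ≤ 3 / 4 * log (δ / δ') + C0 := by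
  obtain ⟨C1, hC1, h1⟩ := prime_sum_L
  obtain ⟨C2, hC2, h2⟩ := mertens
  obtain ⟨C3, hC3, h3⟩ := L_ratio_low q χ
  refine ⟨C1 + C2 + C3 + 50, by positivity, fun δ' δ hδ' hδ => ?_⟩
  obtain ⟨X0, hX0, h4⟩ := L_ratio_high q (χ ^ 2) δ' hδ'
  have hev : ∀ᶠ X : ℝ in atTop, 2 ≤ X ^ δ' := (tendsto_rpow_atTop hδ').eventually_ge_atTop 2
  obtain ⟨X1, hX1⟩ := eventually_atTop.1 hev
  refine ⟨max (max X0 X1) 2, fun X hX t ht => ?_⟩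
  have hXX0 : X0 ≤ X := ((le_max_left _ _).trans (le_max_left _ _)).trans hX
  have hx2 : 2 ≤ X ^ δ' := hX1 X (((le_max_right _ _).trans (le_max_left _ _)).trans hX)
  have hX2 : 2 ≤ X := (le_max_right _ _).trans hX
  have hxy : X ^ δ' ≤ X ^ δ := rpow_le_rpow_of_exponent_le (by linarith) hδ
  have hl : 0 < log X := log_pos (by linarith)
  have hδ0 : 0 < δ := by linarith
  have hlx : log (X ^ δ') = δ' * log X := log_rpow (by linarith) _
  have hly : log (X ^ δ) = δ * log X := log_rpow (by linarith) _
  have hlog0 : 0 ≤ log (δ / δ') := log_nonneg (by rw [le_div_iff₀ hδ']; linarith)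
  have hκ : 1 / (δ * log X) ≤ 1 / (δ' * log X) := by gcongr
  rcases le_total |t| 1 with ht1 | ht1
  · have e1 := abs_le.1 (h1 q inferInstance χ (X ^ δ') (X ^ δ) t hx2 hxy)
    rw [hlx, hly] at e1
    have e2 := h3 (1 / (δ' * log X)) (1 / (δ * log X)) t (by positivity) hκ (by
      rw [← hlx, div_le_iff₀ (by rw [hlx]; positivity)]
      have := log_le_log (by norm_num) hx2
      linarith [log_two_gt_d9]) (by linarith)
    linarith [e1.1]
  · have e1 := abs_le.1 (h1 q inferInstance (χ ^ 2) (X ^ δ') (X ^ δ) (2 * t) hx2 hxy)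
    rw [hlx, hly] at e1
    have e2 := h4 X hXX0 (2 * t) (1 / (δ * log X)) (by rw [abs_mul, abs_two]; linarith)
      (by rw [abs_mul, abs_two]; linarith) (by positivity) hκ
    have e3 := abs_le.1 (h2 (X ^ δ') (X ^ δ) hx2 hxy)
    rw [hlx, hly, mul_div_mul_right _ _ hl.ne'] at e3
    have e4 : -(∑ p ∈ prs (X ^ δ') (X ^ δ), χ p * tw t p * ((p : ℝ)⁻¹ : ℝ)).re ≤
        3 / 4 * ∑ p ∈ prs (X ^ δ') (X ^ δ), (p : ℝ)⁻¹ + (∑ p ∈ prs (X ^ δ') (X ^ δ), (χ ^ 2) p * tw (2 * t) p * ((p : ℝ)⁻¹ : ℝ)).re / 4 := by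
      rw [Complex.re_sum, Complex.re_sum, ← Finset.sum_neg_distrib, mul_sum, Finset.sum_div, ← sum_add_distrib]
      refine sum_le_sum fun p _ => ?_
      have := three_four_one χ t p
      rw [Complex.re_mul_ofReal, Complex.re_mul_ofReal]
      have hp : (0:ℝ) ≤ (p : ℝ)⁻¹ := by positivity
      nlinarith
    linarith [e1.2, e3.2]
end MR
namespace MR
open MeasureTheory FourierTransform

noncomputable def tent (u : ℝ) : ℝ := max 0 (1 - |u|)

lemma tent_nonneg (u : ℝ) : 0 ≤ tent u := le_max_left _ _
lemma tent_le_one (u : ℝ) : tent u ≤ 1 := max_le zero_le_one (by linarith [abs_nonneg u])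
lemma tent_zero {u : ℝ} (h : 1 ≤ |u|) : tent u = 0 := max_eq_left (by linarith)

lemma continuous_tent : Continuous tent := by unfold tent; fun_prop

lemma sinc_sq_le (x : ℝ) : sinc x ^ 2 ≤ 2 / (1 + x ^ 2) := by
  rw [le_div_iff₀ (by positivity)]
  by_cases hx : x = 0
  · simp [hx]
  · rw [sinc_of_ne_zero hx, div_pow, div_mul_eq_mul_div, div_le_iff₀ (by positivity)]
    have h1 := Real.sin_sq_le_one x
    have h2 := Real.sin_sq_le_sq (x := x)
    nlinarith [sq_nonneg x, sq_nonneg (Real.sin x)]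

lemma integrable_sinc_sq : Integrable (fun x : ℝ => sinc x ^ 2) := by
  refine (integrable_inv_one_add_sq.const_mul 2).mono' (by have := Real.continuous_sinc; fun_prop) ?_
  refine Eventually.of_forall fun x => ?_
  rw [norm_of_nonneg (sq_nonneg _)]
  exact (sinc_sq_le x).trans_eq (div_eq_mul_inv _ _)

lemma fourier_tent (ξ : ℝ) : 𝓕 (fun x : ℝ => (tent x : ℂ)) ξ = ((sinc (π * ξ) ^ 2 : ℝ) : ℂ) := by
  rw [Real.fourier_eq']
  set ω : ℝ := 2 * π * ξ with hω
  have h0 : ∀ x : ℝ, Complex.exp (((-2 * π * inner ℝ x ξ : ℝ) : ℂ) * I) • (tent x : ℂ) = (tent x : ℂ) * Complex.exp (-(ω * x : ℝ) * I) := by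
    intro x
    rw [smul_eq_mul, mul_comm]
    congr 2
    simp only [real_inner_eq_re_inner, RCLike.inner_apply, hω, conj_trivial, RCLike.re_to_real]; push_cast; ring
  simp_rw [h0]
  have hsub : Function.support (fun x : ℝ => (tent x : ℂ) * Complex.exp (-(ω * x : ℝ) * I)) ⊆ Set.Ioc (-1) 1 := by
    intro x hx
    by_contra h
    apply hx
    have : 1 ≤ |x| := by
      rw [Set.mem_Ioc, not_and_or, not_lt, not_le] at h
      rcases h with h | h
      · rw [abs_of_nonpos (by linarith)]; linarith
      · rw [abs_of_nonneg (by linarith)]; linarith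
    simp [tent_zero this]
  rw [← intervalIntegral.integral_eq_integral_of_support_subset hsub]
  have hc : Continuous (fun x : ℝ => (tent x : ℂ) * Complex.exp (-(ω * x : ℝ) * I)) := by
    have := continuous_tent; fun_prop
  rw [← intervalIntegral.integral_add_adjacent_intervals (b := 0) (hc.intervalIntegrable _ _) (hc.intervalIntegrable _ _)]
  have e1 : ∫ x in (-1:ℝ)..0, (tent x : ℂ) * Complex.exp (-(ω * x : ℝ) * I) = ∫ x in (-1:ℝ)..0, ((1 + x : ℝ) : ℂ) * Complex.exp (-(ω * x : ℝ) * I) := by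
    refine intervalIntegral.integral_congr fun x hx => ?_
    rw [Set.uIcc_of_le (by norm_num)] at hx
    rw [tent, abs_of_nonpos hx.2, max_eq_right (by linarith [hx.1])]; congr 2; ring
  have e2 : ∫ x in (0:ℝ)..1, (tent x : ℂ) * Complex.exp (-(ω * x : ℝ) * I) = ∫ x in (0:ℝ)..1, ((1 - x : ℝ) : ℂ) * Complex.exp (-(ω * x : ℝ) * I) := by
    refine intervalIntegral.integral_congr fun x hx => ?_
    rw [Set.uIcc_of_le (by norm_num)] at hx
    rw [tent, abs_of_nonneg hx.1, max_eq_right (by linarith [hx.2])]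
  rw [e1, e2]
  by_cases hω0 : ω = 0
  · have hξ : ξ = 0 := by simpa [hω, Real.pi_ne_zero] using hω0
    rw [hω0, hξ]
    simp only [zero_mul, ofReal_zero, neg_zero, exp_zero, mul_one, mul_zero, Real.sinc_zero]
    rw [intervalIntegral.integral_ofReal, intervalIntegral.integral_ofReal]
    rw [intervalIntegral.integral_add (by simp) (by simp), intervalIntegral.integral_sub (by simp) (by simp)]
    norm_num
  · have hω0c : (ω : ℂ) ≠ 0 := by exact_mod_cast hω0
    have hE : ∀ x : ℝ, HasDerivAt (fun x : ℝ => Complex.exp (-(ω * x : ℝ) * I)) (Complex.exp (-(ω * x : ℝ) * I) * (-ω * I)) x := by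
      intro x
      refine HasDerivAt.cexp ?_
      have h1 : HasDerivAt (fun x : ℝ => (x : ℂ)) 1 x := ofRealCLM.hasDerivAt
      have h2 : (fun x : ℝ => -((ω * x : ℝ) : ℂ) * I) = fun x : ℝ => (-ω * I) * (x : ℂ) := by
        funext y; push_cast; ring
      rw [h2]; simpa using h1.const_mul (-ω * I : ℂ)
    have g1 : (ω:ℂ) * (I / ω) = I := by field_simp
    have g2 : (ω:ℂ) * (1 / ω ^ 2) * I = I / ω := by field_simp
    have hx1 : ∀ x : ℝ, HasDerivAt (fun x : ℝ => (x : ℂ)) 1 x := fun x => ofRealCLM.hasDerivAt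
    rw [intervalIntegral.integral_eq_sub_of_hasDerivAt (f := fun x : ℝ => Complex.exp (-(ω * x : ℝ) * I) * ((1 + x) * (I / ω) + 1 / ω ^ 2)) ?_ (Continuous.intervalIntegrable (by fun_prop) _ _),
      intervalIntegral.integral_eq_sub_of_hasDerivAt (f := fun x : ℝ => Complex.exp (-(ω * x : ℝ) * I) * ((1 - x) * (I / ω) - 1 / ω ^ 2)) ?_ (Continuous.intervalIntegrable (by fun_prop) _ _)]
    · have hs : sinc (π * ξ) ^ 2 = (2 - 2 * Real.cos ω) / ω ^ 2 := by
        have h2 : ω = 2 * (π * ξ) := by rw [hω]; ring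
        have h3 : π * ξ ≠ 0 := by intro h; rw [h] at h2; simp at h2; exact hω0 h2
        rw [sinc_of_ne_zero h3, h2, Real.cos_two_mul, Real.cos_sq']
        field_simp; ring
      rw [hs]
      have e3 : Complex.exp (-((ω * (-1:ℝ) : ℝ):ℂ) * I) + Complex.exp (-((ω * (1:ℝ) : ℝ):ℂ) * I) = 2 * Complex.cos ω := by
        rw [Complex.two_cos]; congr 2 <;> push_cast <;> ring
      push_cast at e3 ⊢
      simp only [mul_zero, neg_zero, zero_mul, exp_zero]
      linear_combination (-(1 / (ω:ℂ)^2)) * e3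
    · intro x _
      refine ((hE x).fun_mul ((((hx1 x).const_sub 1).mul_const (I / ω)).sub_const (1 / (ω:ℂ) ^ 2))).congr_deriv ?_
      rw [ofReal_sub, ofReal_one]
      generalize Complex.exp _ = e
      linear_combination e * (-(1 - x) * I) * g1 + e * g2 - e * (1 - x) * Complex.I_sq
    · intro x _
      refine ((hE x).fun_mul ((((hx1 x).const_add 1).mul_const (I / ω)).add_const (1 / (ω:ℂ) ^ 2))).congr_deriv ?_
      rw [Complex.ofReal_add, ofReal_one]
      generalize Complex.exp _ = e
      linear_combination e * (-(1 + x) * I) * g1 - e * g2 - e * (1 + x) * Complex.I_sq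

lemma int_sinc (T : ℝ) (hT : 0 < T) (u : ℝ) : ∫ t : ℝ, ((sinc (t / (2 * T)) ^ 2 : ℝ) : ℂ) * Complex.exp ((t * u : ℝ) * I) = ((2 * π * T * tent (T * u) : ℝ) : ℂ) := by
  have hF : 𝓕 (fun x : ℝ => (tent x : ℂ)) = fun ξ : ℝ => ((sinc (π * ξ) ^ 2 : ℝ) : ℂ) := funext fourier_tent
  have h1 : Integrable (fun x : ℝ => (tent x : ℂ)) := by
    refine Continuous.integrable_of_hasCompactSupport (by have := continuous_tent; fun_prop) ?_
    refine HasCompactSupport.intro (isCompact_Icc (a := (-1:ℝ)) (b := 1)) fun x hx => ?_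
    have : 1 ≤ |x| := by
      by_contra h; rw [not_le, abs_lt] at h; exact hx ⟨h.1.le, h.2.le⟩
    simp [tent_zero this]
  have h2 : Integrable (𝓕 (fun x : ℝ => (tent x : ℂ))) := by
    rw [hF]
    exact ((integrable_comp_mul_left_iff _ Real.pi_ne_zero).2 integrable_sinc_sq).ofReal
  have h3 := congrFun (Continuous.fourierInv_fourier_eq (by have := continuous_tent; fun_prop) h1 h2) (T * u)
  rw [hF, Real.fourierInv_eq'] at h3
  have h4 := Measure.integral_comp_mul_left (fun t : ℝ => ((sinc (t / (2 * T)) ^ 2 : ℝ) : ℂ) * Complex.exp ((t * u : ℝ) * I)) (2 * π * T)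
  have h5 : ∀ v : ℝ, Complex.exp (((2 * π * inner ℝ v (T * u) : ℝ) : ℂ) * I) • ((sinc (π * v) ^ 2 : ℝ) : ℂ) = ((sinc (2 * π * T * v / (2 * T)) ^ 2 : ℝ) : ℂ) * Complex.exp ((2 * π * T * v * u : ℝ) * I) := by
    intro v
    have h6 : 2 * π * T * v / (2 * T) = π * v := by field_simp
    rw [smul_eq_mul, mul_comm, h6]
    congr 3
    · simp only [real_inner_eq_re_inner, RCLike.inner_apply, conj_trivial, RCLike.re_to_real]; ring
  simp_rw [h5] at h3
  rw [h4, abs_of_pos (by positivity), real_smul] at h3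
  have hpos : (2 * π * T : ℂ) ≠ 0 := by
    have : (0:ℝ) < 2 * π * T := by positivity
    exact_mod_cast this.ne'
  push_cast at h3 ⊢
  rw [← h3, mul_inv_cancel_left₀ hpos]

end MR
namespace MR
open MeasureTheory

noncomputable def nu (T : ℝ) : Measure ℝ := volume.withDensity (fun t => ENNReal.ofReal (sinc (t / (2 * T)) ^ 2))

noncomputable def dp (c : ℕ → ℂ) (s : Finset ℕ) (t : ℝ) : ℂ := ∑ n ∈ s, c n * tw t n

lemma continuous_tw (n : ℕ) : Continuous (fun t => tw t n) := by unfold tw; fun_prop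
lemma continuous_dp (c : ℕ → ℂ) (s : Finset ℕ) : Continuous (dp c s) := by
  unfold dp
  have := continuous_tw
  fun_prop

lemma norm_dp_le (c : ℕ → ℂ) (s : Finset ℕ) (t : ℝ) : ‖dp c s t‖ ≤ ∑ n ∈ s, ‖c n‖ :=
  (norm_sum_le _ _).trans_eq (sum_congr rfl fun n _ => by rw [norm_mul, norm_tw, mul_one])

lemma int_bdd {ρ : Measure ℝ} [IsFiniteMeasure ρ] {E : Type*} [NormedAddCommGroup E] {g : ℝ → E} [SecondCountableTopologyEither ℝ E] (hg : Continuous g) (C : ℝ) (hC : ∀ t, ‖g t‖ ≤ C) : Integrable g ρ :=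
  Integrable.of_bound hg.aestronglyMeasurable C (Eventually.of_forall hC)

lemma int_dp {ρ : Measure ℝ} [IsFiniteMeasure ρ] (c : ℕ → ℂ) (s : Finset ℕ) : Integrable (fun t => ‖dp c s t‖ ^ 2) ρ :=
  int_bdd ((continuous_dp c s).norm.pow 2) ((∑ n ∈ s, ‖c n‖) ^ 2) fun t => by
    rw [norm_of_nonneg (by positivity)]; gcongr; exact norm_dp_le c s t

lemma sinc_cont (T : ℝ) : Continuous (fun t : ℝ => sinc (t / (2 * T)) ^ 2) := by
  have := Real.continuous_sinc; fun_prop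

lemma integrable_sinc_T {T : ℝ} (hT : 0 < T) : Integrable (fun t : ℝ => sinc (t / (2 * T)) ^ 2) :=
  (integrable_comp_div_iff _ (by positivity)).2 integrable_sinc_sq

lemma fin_nu {T : ℝ} (hT : 0 < T) : IsFiniteMeasure (nu T) :=
  isFiniteMeasure_withDensity_ofReal (integrable_sinc_T hT).2

lemma integral_nu {E : Type*} [NormedAddCommGroup E] [NormedSpace ℝ E] (T : ℝ) (g : ℝ → E) : ∫ t, g t ∂(nu T) = ∫ t, sinc (t / (2 * T)) ^ 2 • g t := by
  unfold nu
  rw [integral_withDensity_eq_integral_toReal_smul (by have := sinc_cont T; fun_prop) (by simp)]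
  refine integral_congr_ae (Eventually.of_forall fun t => ?_)
  simp only
  rw [ENNReal.toReal_ofReal (sq_nonneg _)]

lemma tw_conj (t : ℝ) (m n : ℕ) : tw t m * conj (tw t n) = Complex.exp ((t * (log n - log m) : ℝ) * I) := by
  unfold tw
  rw [← exp_conj, ← Complex.exp_add]
  congr 1
  simp only [map_mul, Complex.conj_ofReal, Complex.conj_I]; push_cast; ring

lemma sq_expand {ι : Type*} (s : Finset ι) (g : ι → ℂ) : ((‖∑ n ∈ s, g n‖ ^ 2 : ℝ) : ℂ) = ∑ m ∈ s, ∑ n ∈ s, g m * conj (g n) := by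
  rw [ofReal_pow, ← mul_conj', map_sum, sum_mul_sum]

lemma dp_sq_nu {T : ℝ} (hT : 0 < T) (c : ℕ → ℂ) (s : Finset ℕ) : ((∫ t, ‖dp c s t‖ ^ 2 ∂(nu T) : ℝ) : ℂ) =
    ∑ m ∈ s, ∑ n ∈ s, c m * conj (c n) * ((2 * π * T * tent (T * (log n - log m)) : ℝ) : ℂ) := by
  haveI := fin_nu hT
  rw [← integral_complex_ofReal]
  unfold dp
  simp_rw [sq_expand]
  have hb : ∀ m n, Integrable (fun t => c m * tw t m * conj (c n * tw t n)) (nu T) := by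
    intro m n
    refine int_bdd ?_ (‖c m‖ * ‖c n‖) fun t => by simp [norm_tw]
    have h1 := continuous_tw m
    have h2 := continuous_conj.comp (continuous_const.mul (continuous_tw n) : Continuous fun t => c n * tw t n)
    exact (continuous_const.mul h1).mul h2
  rw [integral_finsetSum _ fun m _ => integrable_finsetSum _ fun n _ => hb m n]
  refine sum_congr rfl fun m _ => ?_
  rw [integral_finsetSum _ fun n _ => hb m n]
  refine sum_congr rfl fun n _ => ?_
  rw [← int_sinc T hT, integral_nu, ← integral_const_mul]
  refine integral_congr_ae (Eventually.of_forall fun t => ?_)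
  simp only
  rw [← tw_conj, real_smul, map_mul]; ring

lemma win_inter {a b d : ℝ} (hd : 0 < d) : volume.real (Set.Ico (a - d) a ∩ Set.Ico (b - d) b) = d * tent ((b - a) / d) := by
  rw [Set.Ico_inter_Ico, measureReal_def, Real.volume_Ico, ENNReal.toReal_ofReal', tent, mul_max_of_nonneg _ _ hd.le, mul_zero, mul_sub, mul_one, abs_div, abs_of_pos hd, mul_div_cancel₀ _ hd.ne', max_comm]
  congr 1
  rcases le_total a b with h | h
  · rw [inf_eq_left.2 h, sup_eq_right.2 (by linarith), abs_of_nonneg (by linarith)]; ring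
  · rw [inf_eq_right.2 h, sup_eq_left.2 (by linarith), abs_of_nonpos (by linarith)]; ring

noncomputable def win (c : ℕ → ℂ) (s : Finset ℕ) (d v : ℝ) : ℂ := ∑ n ∈ s, (Set.Ico (log n - d) (log n)).indicator (fun _ => c n) v

lemma win_eq (c : ℕ → ℂ) (s : Finset ℕ) (d v : ℝ) : win c s d v = ∑ n ∈ s.filter (fun n : ℕ => v < log n ∧ log n ≤ v + d), c n := by
  unfold win
  rw [sum_filter]
  refine sum_congr rfl fun n _ => ?_
  simp only [Set.indicator, Set.mem_Ico]
  refine if_congr ⟨fun h => ⟨h.2, by linarith [h.1]⟩, fun h => ⟨by linarith [h.2], h.1⟩⟩ rfl rfl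

lemma win_prod (c : ℕ → ℂ) (d : ℝ) (m n : ℕ) (v : ℝ) : (Set.Ico (log m - d) (log m)).indicator (fun _ => c m) v * conj ((Set.Ico (log n - d) (log n)).indicator (fun _ => c n) v) =
    (Set.Ico (log m - d) (log m) ∩ Set.Ico (log n - d) (log n)).indicator (fun _ => c m * conj (c n)) v := by
  simp only [Set.indicator, Set.mem_inter_iff]
  by_cases h1 : v ∈ Set.Ico (log m - d) (log m) <;> by_cases h2 : v ∈ Set.Ico (log n - d) (log n) <;> simp [h1, h2]

lemma win_prod_int (c : ℕ → ℂ) (d : ℝ) (m n : ℕ) : Integrable (fun v => (Set.Ico (log m - d) (log m)).indicator (fun _ => c m) v * conj ((Set.Ico (log n - d) (log n)).indicator (fun _ => c n) v)) := by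
  simp_rw [win_prod]
  refine (integrable_indicator_iff (measurableSet_Ico.inter measurableSet_Ico)).2 (integrableOn_const ?_)
  refine ne_top_of_le_ne_top ?_ (measure_mono Set.inter_subset_left)
  simp

lemma win_int (c : ℕ → ℂ) (s : Finset ℕ) (d : ℝ) : Integrable (fun v => ‖win c s d v‖ ^ 2) := by
  have : Integrable (fun v => ((‖win c s d v‖ ^ 2 : ℝ) : ℂ)) := by
    unfold win
    simp_rw [sq_expand]
    exact integrable_finsetSum _ fun m _ => integrable_finsetSum _ fun n _ => win_prod_int c d m n
  exact this.re

lemma parseval {T : ℝ} (hT : 0 < T) (c : ℕ → ℂ) (s : Finset ℕ) :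
    ∫ t, ‖dp c s t‖ ^ 2 ∂(nu T) = 2 * π * T ^ 2 * ∫ v, ‖win c s (1 / T) v‖ ^ 2 := by
  have : ((∫ t, ‖dp c s t‖ ^ 2 ∂(nu T) : ℝ) : ℂ) = ((2 * π * T ^ 2 * ∫ v, ‖win c s (1 / T) v‖ ^ 2 : ℝ) : ℂ) := by
    rw [dp_sq_nu hT, Complex.ofReal_mul, ← integral_complex_ofReal]
    unfold win
    simp_rw [sq_expand]
    rw [integral_finsetSum _ fun m _ => integrable_finsetSum _ fun n _ => win_prod_int c _ m n, mul_sum]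
    refine sum_congr rfl fun m _ => ?_
    rw [integral_finsetSum _ fun n _ => win_prod_int c _ m n, mul_sum]
    refine sum_congr rfl fun n _ => ?_
    simp_rw [win_prod]
    rw [integral_indicator_const _ (measurableSet_Ico.inter measurableSet_Ico), win_inter (by positivity), real_smul]
    have e1 : (log n - log m) / (1 / T) = T * (log n - log m) := by field_simp
    rw [e1]; push_cast; field_simp
  exact_mod_cast this

lemma log_close {T : ℝ} (hT : 1 ≤ T) {m n : ℕ} (hm : 1 ≤ m) (hn : 1 ≤ n) (h : |T * (log n - log m)| < 1) : |(n : ℝ) - m| ≤ 2 * m / T := by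
  have hm' : (0:ℝ) < m := by exact_mod_cast hm
  have hn' : (0:ℝ) < n := by exact_mod_cast hn
  have hT0 : 0 < T := by linarith
  rw [abs_lt] at h
  set x := log n - log m with hx
  have hnm : (n:ℝ) = m * exp x := by rw [hx, exp_sub, exp_log hm', exp_log hn']; field_simp
  have h1 : x ≤ 1 / T := by rw [le_div_iff₀ hT0]; linarith
  have h2 : -(1 / T) ≤ x := by rw [neg_le, le_div_iff₀ hT0]; linarith
  have hT1 : 1 / T ≤ 1 := by rw [div_le_one hT0]; exact hT
  have h3 := add_one_le_exp x
  have h4 : exp x ≤ 1 + 2 / T := by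
    have h5 : |exp x - 1| ≤ 2 * |x| := Real.abs_exp_sub_one_le (abs_le.2 ⟨by linarith, by linarith⟩)
    have h6 : |x| ≤ 1 / T := abs_le.2 ⟨h2, h1⟩
    have h7 : 2 * (1 / T) = 2 / T := by ring
    linarith [le_abs_self (exp x - 1)]
  rw [hnm, abs_le]
  have e : 2 * (m:ℝ) / T = m * (2 / T) := by ring
  have e2 : (2:ℝ) / T = 2 * (1 / T) := by ring
  have e3 : 0 < 1 / T := by positivity
  rw [e]
  constructor <;> nlinarith

lemma count_close (s : Finset ℕ) (a r : ℝ) (hr : 0 ≤ r) : ((s.filter fun n : ℕ => |(n:ℝ) - a| ≤ r).card : ℝ) ≤ 2 * r + 1 := by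
  have h1 : (s.filter fun n : ℕ => |(n:ℝ) - a| ≤ r) ⊆ Icc ⌈a - r⌉₊ ⌊a + r⌋₊ := by
    intro n hn
    have h := abs_le.1 (mem_filter.1 hn).2
    exact mem_Icc.2 ⟨Nat.ceil_le.2 (by linarith), Nat.le_floor (by linarith)⟩
  have h2 := card_le_card h1
  rw [Nat.card_Icc] at h2
  by_cases h3 : ⌈a - r⌉₊ ≤ ⌊a + r⌋₊ + 1
  · have h4 : ((⌊a + r⌋₊ + 1 - ⌈a - r⌉₊ : ℕ) : ℝ) = ⌊a + r⌋₊ + 1 - ⌈a - r⌉₊ := by push_cast [h3]; ring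
    have h5 : ((s.filter fun n : ℕ => |(n:ℝ) - a| ≤ r).card : ℝ) ≤ ((⌊a + r⌋₊ + 1 - ⌈a - r⌉₊ : ℕ) : ℝ) := by exact_mod_cast h2
    have h6 := Nat.le_ceil (a - r)
    by_cases h7 : 0 ≤ a + r
    · have := Nat.floor_le h7; linarith
    · have : ⌊a + r⌋₊ = 0 := Nat.floor_of_nonpos (by linarith)
      rw [this] at h4 h5
      have h8 : (s.filter fun n : ℕ => |(n:ℝ) - a| ≤ r) = ∅ := by
        refine Finset.filter_eq_empty_iff.2 fun n _ h => ?_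
        have := abs_le.1 h
        have : (0:ℝ) ≤ n := by positivity
        linarith
      rw [h8]; simp; linarith
  · have : (s.filter fun n : ℕ => |(n:ℝ) - a| ≤ r).card = 0 := by omega
    rw [this]; simp; linarith

lemma mvt {T : ℝ} (hT : 1 ≤ T) (c : ℕ → ℂ) (s : Finset ℕ) (hs : ∀ n ∈ s, 1 ≤ n) :
    ∫ t, ‖dp c s t‖ ^ 2 ∂(nu T) ≤ 32 * ∑ n ∈ s, (T + n) * ‖c n‖ ^ 2 := by
  have hT0 : 0 < T := by linarith
  have h1 := dp_sq_nu hT0 c s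
  set I := ∫ t, ‖dp c s t‖ ^ 2 ∂(nu T)
  have hI : |I| ≤ ∑ m ∈ s, ∑ n ∈ s, (2 * π * T * tent (T * (log n - log m))) * ((‖c m‖ ^ 2 + ‖c n‖ ^ 2) / 2) := by
    rw [← norm_eq_abs, ← norm_real, h1]
    refine (norm_sum_le _ _).trans (sum_le_sum fun m _ => (norm_sum_le _ _).trans (sum_le_sum fun n _ => ?_))
    have h0 : 0 ≤ 2 * π * T * tent (T * (log n - log m)) := by have := tent_nonneg (T * (log n - log m)); positivity
    rw [norm_mul, norm_mul, norm_real, RCLike.norm_conj, norm_of_nonneg h0, mul_comm]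
    refine mul_le_mul_of_nonneg_left ?_ h0
    nlinarith [sq_nonneg (‖c m‖ - ‖c n‖)]
  have hsym : ∑ m ∈ s, ∑ n ∈ s, (2 * π * T * tent (T * (log n - log m))) * ((‖c m‖ ^ 2 + ‖c n‖ ^ 2) / 2) =
      ∑ m ∈ s, ∑ n ∈ s, (2 * π * T * tent (T * (log n - log m))) * ‖c m‖ ^ 2 := by
    have e1 : ∑ m ∈ s, ∑ n ∈ s, (2 * π * T * tent (T * (log n - log m))) * ‖c n‖ ^ 2 =
      ∑ m ∈ s, ∑ n ∈ s, (2 * π * T * tent (T * (log n - log m))) * ‖c m‖ ^ 2 := by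
      rw [sum_comm]
      refine sum_congr rfl fun m _ => sum_congr rfl fun n _ => ?_
      have : T * (log m - log n) = -(T * (log n - log m)) := by ring
      rw [this, tent, tent, abs_neg]
    have e2 : ∀ m n : ℕ, (2 * π * T * tent (T * (log n - log m))) * ((‖c m‖ ^ 2 + ‖c n‖ ^ 2) / 2) = ((2 * π * T * tent (T * (log n - log m))) * ‖c m‖ ^ 2 + (2 * π * T * tent (T * (log n - log m))) * ‖c n‖ ^ 2) / 2 := fun m n => by ring
    simp_rw [e2, ← Finset.sum_div, sum_add_distrib]
    rw [e1]; ring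
  refine (le_abs_self I).trans (hI.trans (hsym.le.trans ?_))
  rw [mul_sum]
  refine sum_le_sum fun m hm => ?_
  have hcount : ∑ n ∈ s, tent (T * (log n - log m)) ≤ 2 * (2 * m / T) + 1 := by
    refine le_trans ?_ (count_close s m (2 * m / T) (by positivity))
    rw [Finset.card_filter, Nat.cast_sum]
    refine sum_le_sum fun n hn => ?_
    by_cases h : |T * (log n - log m)| < 1
    · rw [if_pos (log_close hT (hs m hm) (hs n hn) h)]; simpa using tent_le_one _
    · rw [tent_zero (not_lt.1 h)]; positivity
  rw [← sum_mul, ← mul_sum, ← mul_assoc]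
  refine mul_le_mul_of_nonneg_right ?_ (sq_nonneg _)
  have hpi := Real.pi_lt_four
  have hpi0 := Real.pi_pos
  calc 2 * π * T * ∑ n ∈ s, tent (T * (log n - log m)) ≤ 2 * 4 * T * (2 * (2 * m / T) + 1) := by
        have : 0 ≤ ∑ n ∈ s, tent (T * (log n - log m)) := sum_nonneg fun _ _ => tent_nonneg _
        gcongr
    _ = 32 * m + 8 * T := by field_simp; ring
    _ ≤ 32 * (T + m) := by linarith

end MR
namespace MR
open MeasureTheory

noncomputable def blk (A B : ℝ) : Finset ℕ := Ioc ⌊A⌋₊ ⌊B⌋₊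

lemma mem_blk {A B : ℝ} (hA : 0 ≤ A) {n : ℕ} : n ∈ blk A B ↔ A < n ∧ (n:ℝ) ≤ B := by
  unfold blk
  rw [mem_Ioc, Nat.floor_lt hA]
  refine and_congr_right fun h => ?_
  have : n ≠ 0 := by rintro rfl; simp at h; linarith
  exact Nat.le_floor_iff' this

lemma blk_pos {A B : ℝ} {n : ℕ} (h : n ∈ blk A B) : 1 ≤ n := by
  unfold blk at h; have := (mem_Ioc.1 h).1; omega

lemma harm_nat (a b : ℕ) (ha : 1 ≤ a) (hab : a ≤ b) : ∑ n ∈ Ioc a b, (1:ℝ) / n ≤ log (b / a) ∧ log ((b + 1) / (a + 1)) ≤ ∑ n ∈ Ioc a b, (1:ℝ) / n := by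
  induction b, hab using Nat.le_induction with
  | base => 
    have h0 : (a:ℝ) ≠ 0 := by positivity
    have h1 : (a:ℝ) + 1 ≠ 0 := by positivity
    simp [h0, h1]
  | succ b hab ih =>
    have ha' : (0:ℝ) < a := by exact_mod_cast ha
    have hb' : (0:ℝ) < b := by have : 0 < b := by omega
                               exact_mod_cast this
    rw [sum_Ioc_succ_top (by omega)]
    push_cast
    constructor
    · have h1 := Real.one_sub_inv_le_log_of_pos (x := ((b:ℝ) + 1) / b) (by positivity)
      have h2 : 1 - (((b:ℝ) + 1) / b)⁻¹ = 1 / (b + 1) := by field_simp; ring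
      have h3 : ((b:ℝ) + 1) / a = (b / a) * ((b + 1) / b) := by field_simp
      rw [h3, log_mul (by positivity) (by positivity)]; linarith [ih.1]
    · have h1 := log_le_sub_one_of_pos (x := ((b:ℝ) + 1 + 1) / (b + 1)) (by positivity)
      have h2 : ((b:ℝ) + 1 + 1) / (b + 1) - 1 = 1 / (b + 1) := by field_simp; ring
      have h3 : ((b:ℝ) + 1 + 1) / (a + 1) = ((b + 1) / (a + 1)) * ((b + 1 + 1) / (b + 1)) := by field_simp
      rw [h3, log_mul (by positivity) (by positivity)]; linarith [ih.2]

lemma harm {A B : ℝ} (hA : 1 ≤ A) (hB : A ≤ B) : |∑ n ∈ blk A B, (1:ℝ) / n - log (B / A)| ≤ 2 / A := by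
  have ha1 : 1 ≤ ⌊A⌋₊ := Nat.one_le_floor_iff _ |>.2 hA
  obtain ⟨h1, h2⟩ := harm_nat ⌊A⌋₊ ⌊B⌋₊ ha1 (Nat.floor_mono hB)
  have ha := Nat.floor_le (by linarith : 0 ≤ A)
  have hb := Nat.floor_le (by linarith : 0 ≤ B)
  have ha' := Nat.lt_floor_add_one A
  have hb' := Nat.lt_floor_add_one B
  have ha1' : (1:ℝ) ≤ ⌊A⌋₊ := by exact_mod_cast ha1
  set a : ℝ := (⌊A⌋₊ : ℝ)
  set b : ℝ := (⌊B⌋₊ : ℝ)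
  have hb1 : 1 ≤ b := ha1'.trans (by exact Nat.cast_le.2 (Nat.floor_mono hB))
  unfold blk
  have e0 : log (B / A) = log B - log A := log_div (by linarith) (by linarith)
  rw [log_div (by linarith) (by linarith)] at h1 h2
  have e1 : log b ≤ log B := log_le_log (by linarith) hb
  have e2 : log B ≤ log (b + 1) := log_le_log (by linarith) hb'.le
  have e3 : log A - log a ≤ 2 / A := by
    rw [← log_div (by linarith) (by linarith)]
    refine (log_le_sub_one_of_pos (by positivity)).trans ?_
    rw [div_sub_one (by linarith), div_le_div_iff₀ (by linarith) (by linarith)]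
    nlinarith
  have e4 : log (a + 1) - log A ≤ 2 / A := by
    rw [← log_div (by linarith) (by linarith)]
    refine (log_le_sub_one_of_pos (by positivity)).trans ?_
    rw [div_sub_one (by linarith), div_le_div_iff₀ (by linarith) (by linarith)]
    nlinarith
  rw [abs_le, e0]
  constructor <;> linarith

lemma harm_dvd {A B : ℝ} (d : ℕ) (hd : 1 ≤ d) (hA : d ≤ A) (hB : A ≤ B) : |∑ n ∈ blk A B, (if d ∣ n then (1:ℝ) / n else 0) - log (B / A) / d| ≤ 2 / A := by
  have hd' : (0:ℝ) < d := by exact_mod_cast hd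
  have hA0 : 0 < A := by linarith
  have h1 := harm (A := A / d) (B := B / d) (by rwa [le_div_iff₀ hd', one_mul]) (by gcongr)
  have e1 : ∑ n ∈ blk A B, (if d ∣ n then (1:ℝ) / n else 0) = (1 / d) * ∑ n ∈ blk (A / d) (B / d), (1:ℝ) / n := by
    rw [← sum_filter, mul_sum]
    symm
    refine Finset.sum_bij (fun m _ => d * m) ?_ ?_ ?_ ?_
    · intro m hm
      rw [mem_blk (by positivity), div_lt_iff₀ hd', le_div_iff₀ hd'] at hm
      rw [mem_filter, mem_blk hA0.le]
      push_cast
      exact ⟨⟨by linarith [hm.1], by linarith [hm.2]⟩, dvd_mul_right _ _⟩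
    · intro a _ b _ h; exact Nat.eq_of_mul_eq_mul_left (by omega) h
    · intro n hn
      rw [mem_filter, mem_blk hA0.le] at hn
      obtain ⟨⟨h2, h3⟩, m, rfl⟩ := hn
      push_cast at h2 h3
      refine ⟨m, ?_, rfl⟩
      rw [mem_blk (by positivity), div_lt_iff₀ hd', le_div_iff₀ hd']
      exact ⟨by linarith, by linarith⟩
    · intro m hm
      push_cast
      rw [div_mul_div_comm, one_mul]
  have e2 : B / d / (A / d) = B / A := by field_simp
  rw [e2] at h1
  rw [e1]
  have e3 : 1 / (d:ℝ) * ∑ n ∈ blk (A / d) (B / d), (1:ℝ) / n - log (B / A) / d = (1 / d) * (∑ n ∈ blk (A / d) (B / d), (1:ℝ) / n - log (B / A)) := by ring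
  rw [e3, abs_mul, abs_of_pos (by positivity)]
  calc 1 / (d:ℝ) * |∑ n ∈ blk (A / d) (B / d), (1:ℝ) / n - log (B / A)| ≤ 1 / d * (2 / (A / d)) := by gcongr
    _ = 2 / A := by field_simp

noncomputable def om (e : ℕ) (S : Finset ℕ) (n : ℕ) : ℝ := ∑ p ∈ S, if p ^ e ∣ n then 1 else 0
noncomputable def Ls (e : ℕ) (S : Finset ℕ) : ℝ := ∑ p ∈ S, 1 / (p:ℝ) ^ e

lemma om_nonneg (e S n) : 0 ≤ om e S n := sum_nonneg fun _ _ => by split_ifs <;> norm_num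
lemma Ls_nonneg (e S) : 0 ≤ Ls e S := sum_nonneg fun _ _ => by positivity

lemma tk_first {A B Q : ℝ} (e : ℕ) (S : Finset ℕ) (hS : ∀ p ∈ S, p.Prime) (hQ : ∀ p ∈ S, (p:ℝ) ≤ Q) (hQA : Q ^ e ≤ A) (hB : A ≤ B) :
    |∑ n ∈ blk A B, (1:ℝ) / n * om e S n - log (B / A) * Ls e S| ≤ S.card * (2 / A) := by
  have e1 : ∑ n ∈ blk A B, (1:ℝ) / n * om e S n - log (B / A) * Ls e S = ∑ p ∈ S, (∑ n ∈ blk A B, (if p ^ e ∣ n then (1:ℝ) / n else 0) - log (B / A) / (p ^ e : ℕ)) := by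
    unfold om Ls
    rw [sum_sub_distrib, mul_sum, sum_comm (s := S)]
    congr 1
    · refine sum_congr rfl fun n _ => ?_
      rw [mul_sum]
      refine sum_congr rfl fun p _ => ?_
      split_ifs <;> simp
    · refine sum_congr rfl fun p _ => ?_
      push_cast; ring
  rw [e1, ← nsmul_eq_mul, ← sum_const]
  refine (Finset.abs_sum_le_sum_abs _ _).trans (sum_le_sum fun p hp => harm_dvd _ (Nat.pow_pos (hS p hp).pos) ?_ hB)
  push_cast
  exact le_trans (by gcongr; exact hQ p hp) hQA

lemma tk_second {A B Q : ℝ} (e : ℕ) (S : Finset ℕ) (hS : ∀ p ∈ S, p.Prime) (hQ : ∀ p ∈ S, (p:ℝ) ≤ Q) (hQ1 : 1 ≤ Q) (hQA : Q ^ (2 * e) ≤ A) (hB : A ≤ B) :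
    ∑ n ∈ blk A B, (1:ℝ) / n * om e S n ^ 2 ≤ log (B / A) * (Ls e S ^ 2 + Ls e S) + S.card ^ 2 * (2 / A) := by
  have hA : 1 ≤ A := (one_le_pow₀ hQ1).trans hQA
  have hlog : 0 ≤ log (B / A) := log_nonneg (by rwa [le_div_iff₀ (by linarith), one_mul])
  have e1 : ∑ n ∈ blk A B, (1:ℝ) / n * om e S n ^ 2 = ∑ p ∈ S, ∑ r ∈ S, ∑ n ∈ blk A B, if p ^ e ∣ n ∧ r ^ e ∣ n then (1:ℝ) / n else 0 := by
    have : ∀ n ∈ blk A B, (1:ℝ) / n * om e S n ^ 2 = ∑ p ∈ S, ∑ r ∈ S, if p ^ e ∣ n ∧ r ^ e ∣ n then (1:ℝ) / n else 0 := by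
      intro n _
      unfold om
      rw [sq, sum_mul_sum, mul_sum]
      refine sum_congr rfl fun p _ => ?_
      rw [mul_sum]
      refine sum_congr rfl fun r _ => ?_
      by_cases h1 : p ^ e ∣ n <;> by_cases h2 : r ^ e ∣ n <;> simp [h1, h2]
    rw [sum_congr rfl this, sum_comm]
    exact sum_congr rfl fun p _ => sum_comm
  rw [e1]
  have h2 : ∀ p ∈ S, ∀ r ∈ S, ∑ n ∈ blk A B, (if p ^ e ∣ n ∧ r ^ e ∣ n then (1:ℝ) / n else 0) ≤ log (B / A) * ((1 / (p:ℝ) ^ e) * (1 / (r:ℝ) ^ e)) + (if r = p then log (B / A) * (1 / (p:ℝ) ^ e) else 0) + 2 / A := by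
    intro p hp r hr
    have hp0 : (0:ℝ) < p := by exact_mod_cast (hS p hp).pos
    have hr0 : (0:ℝ) < r := by exact_mod_cast (hS r hr).pos
    by_cases h : r = p
    · subst h
      rw [if_pos rfl]
      simp only [and_self]
      have := (abs_le.1 (harm_dvd (A := A) (B := B) (r ^ e) (Nat.pow_pos (hS r hr).pos) (by
        push_cast
        calc (r:ℝ) ^ e ≤ Q ^ e := by gcongr; exact hQ r hr
          _ ≤ Q ^ (2 * e) := pow_le_pow_right₀ hQ1 (by omega)
          _ ≤ A := hQA) hB)).2
      push_cast at this
      have h3 : 0 ≤ log (B / A) * ((1 / (r:ℝ) ^ e) * (1 / (r:ℝ) ^ e)) := by positivity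
      have h4 : log (B / A) * (1 / (r:ℝ) ^ e) = log (B / A) / (r:ℝ) ^ e := by ring
      linarith
    · rw [if_neg h]
      have hcop : Nat.Coprime (p ^ e) (r ^ e) := Nat.Coprime.pow _ _ ((Nat.coprime_primes (hS p hp) (hS r hr)).2 (Ne.symm h))
      have h3 : ∀ n : ℕ, (p ^ e ∣ n ∧ r ^ e ∣ n) ↔ p ^ e * r ^ e ∣ n := fun n => ⟨fun h => hcop.mul_dvd_of_dvd_of_dvd h.1 h.2, fun h => ⟨(dvd_mul_right _ _).trans h, (dvd_mul_left _ _).trans h⟩⟩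
      simp_rw [h3]
      have := (abs_le.1 (harm_dvd (A := A) (B := B) (p ^ e * r ^ e) (Nat.mul_pos (Nat.pow_pos (hS p hp).pos) (Nat.pow_pos (hS r hr).pos)) (by
        push_cast
        calc (p:ℝ) ^ e * (r:ℝ) ^ e ≤ Q ^ e * Q ^ e := by gcongr <;> [exact hQ p hp; exact hQ r hr]
          _ = Q ^ (2 * e) := by ring
          _ ≤ A := hQA) hB)).2
      push_cast at this
      have h4 : log (B / A) * ((1 / (p:ℝ) ^ e) * (1 / (r:ℝ) ^ e)) = log (B / A) / ((p:ℝ) ^ e * (r:ℝ) ^ e) := by field_simp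
      linarith
  refine (sum_le_sum fun p hp => sum_le_sum fun r hr => h2 p hp r hr).trans (le_of_eq ?_)
  simp_rw [sum_add_distrib, sum_ite_eq']
  rw [Finset.sum_ite_mem, Finset.inter_self]
  unfold Ls
  simp only [sum_const, nsmul_eq_mul, ← mul_sum]
  rw [← sum_mul]
  ring

lemma tk_var {A B Q : ℝ} (e : ℕ) (S : Finset ℕ) (hS : ∀ p ∈ S, p.Prime) (hQ : ∀ p ∈ S, (p:ℝ) ≤ Q) (hQ1 : 1 ≤ Q) (hQA : Q ^ (2 * e) ≤ A) (hB : A ≤ B) :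
    ∑ n ∈ blk A B, (1:ℝ) / n * (om e S n - Ls e S) ^ 2 ≤ log (B / A) * Ls e S + 8 * S.card ^ 2 / A := by
  have hA : 1 ≤ A := (one_le_pow₀ hQ1).trans hQA
  have h1 := (abs_le.1 (tk_first e S hS hQ ((pow_le_pow_right₀ hQ1 (by omega)).trans hQA) hB)).1
  have h2 := tk_second e S hS hQ hQ1 hQA hB
  have h3 := (abs_le.1 (harm hA hB)).2
  have hL : Ls e S ≤ S.card := by
    unfold Ls
    rw [← nsmul_one, ← sum_const]
    refine sum_le_sum fun p hp => ?_
    have : (1:ℝ) ≤ (p:ℝ) ^ e := one_le_pow₀ (by exact_mod_cast (hS p hp).one_le)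
    rw [div_le_one (by linarith)]; exact this
  have hL0 := Ls_nonneg e S
  have e1 : ∑ n ∈ blk A B, (1:ℝ) / n * (om e S n - Ls e S) ^ 2 = ∑ n ∈ blk A B, (1:ℝ) / n * om e S n ^ 2 - 2 * Ls e S * ∑ n ∈ blk A B, (1:ℝ) / n * om e S n + Ls e S ^ 2 * ∑ n ∈ blk A B, (1:ℝ) / n := by
    rw [mul_sum, mul_sum, ← sum_sub_distrib, ← sum_add_distrib]
    refine sum_congr rfl fun n _ => by ring
  rw [e1]
  set L := Ls e S
  set N : ℝ := (S.card : ℝ)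
  have h4 : 2 * L * ∑ n ∈ blk A B, (1:ℝ) / n * om e S n ≥ 2 * L * (log (B / A) * L - N * (2 / A)) := by
    refine mul_le_mul_of_nonneg_left ?_ (by positivity); linarith
  have h5 : L ^ 2 * ∑ n ∈ blk A B, (1:ℝ) / n ≤ L ^ 2 * (log (B / A) + 2 / A) := by
    refine mul_le_mul_of_nonneg_left ?_ (by positivity); linarith
  have h6 : 8 * N ^ 2 / A = (2 / A) * (4 * N ^ 2) := by ring
  have h7 : N ^ 2 * (2 / A) + 2 * L * (N * (2 / A)) + L ^ 2 * (2 / A) ≤ (2 / A) * (4 * N ^ 2) := by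
    have : N ^ 2 * (2 / A) + 2 * L * (N * (2 / A)) + L ^ 2 * (2 / A) = (2 / A) * (N ^ 2 + 2 * L * N + L ^ 2) := by ring
    rw [this]
    refine mul_le_mul_of_nonneg_left ?_ (by positivity)
    nlinarith
  rw [h6]; nlinarith

end MR
namespace MR
open MeasureTheory

structure Mf (f : ℕ → ℂ) : Prop where
  le : ∀ n, ‖f n‖ ≤ 1
  mul : ∀ p m : ℕ, p.Prime → ¬ p ∣ m → f (p * m) = f p * f m

noncomputable def BB (f : ℕ → ℂ) (A B : ℝ) (t : ℝ) : ℂ := dp (fun n => f n / n) (blk A B) t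

open Classical in
noncomputable def tkc (f : ℕ → ℂ) (S : Finset ℕ) (X Y : ℝ) (I : ℕ → Finset ℕ) (n : ℕ) : ℂ :=
  ((Ls 1 S : ℂ) * (if n ∈ blk X Y then f n else 0) - ∑ p ∈ S, if p ∣ n ∧ n / p ∈ I p then f p * f (n / p) else 0) / n

lemma tk_id (f : ℕ → ℂ) (S : Finset ℕ) (hS : ∀ p ∈ S, p.Prime) (X Y Y2 : ℝ) (hY : Y ≤ Y2) (I : ℕ → Finset ℕ)
    (hI : ∀ p ∈ S, ∀ m ∈ I p, p * m ∈ blk X Y2) (t : ℝ) :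
    dp (tkc f S X Y I) (blk X Y2) t = Ls 1 S * BB f X Y t - ∑ p ∈ S, f p / p * tw t p * dp (fun n => f n / n) (I p) t := by
  classical
  have hsub : blk X Y ⊆ blk X Y2 := Finset.Ioc_subset_Ioc_right (Nat.floor_mono hY)
  unfold dp tkc BB dp
  have e1 : ∀ n : ℕ, ((Ls 1 S : ℂ) * (if n ∈ blk X Y then f n else 0) - ∑ p ∈ S, if p ∣ n ∧ n / p ∈ I p then f p * f (n / p) else 0) / n * tw t n = (if n ∈ blk X Y then (Ls 1 S : ℂ) * (f n / n * tw t n) else 0) - ∑ p ∈ S, if p ∣ n ∧ n / p ∈ I p then f p * f (n / p) / n * tw t n else 0 := by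
    intro n
    rw [sub_div, sub_mul, Finset.sum_div, sum_mul]
    congr 1
    · split_ifs
      · ring
      · simp
    · refine sum_congr rfl fun p _ => ?_
      split_ifs <;> simp
  rw [sum_congr rfl fun n _ => e1 n, sum_sub_distrib]
  congr 1
  · rw [Finset.sum_ite_mem, Finset.inter_eq_right.2 hsub, mul_sum]
  · rw [sum_comm]
    refine sum_congr rfl fun p hp => ?_
    rw [← sum_filter, mul_sum]
    symm
    have hp0 := (hS p hp).pos
    refine Finset.sum_bij (fun m _ => p * m) ?_ ?_ ?_ ?_
    · intro m hm
      exact mem_filter.2 ⟨hI p hp m hm, dvd_mul_right _ _, by rwa [Nat.mul_div_cancel_left _ hp0]⟩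
    · intro a _ b _ h; exact Nat.eq_of_mul_eq_mul_left hp0 h
    · intro n hn
      obtain ⟨-, h1, h2⟩ := mem_filter.1 hn
      exact ⟨n / p, h2, Nat.mul_div_cancel' h1⟩
    · intro m hm
      have h1 := blk_pos (hI p hp m hm)
      have hm0 : m ≠ 0 := by rintro rfl; simp at h1
      rw [Nat.mul_div_cancel_left _ hp0, tw_mul t hp0.ne' hm0]
      push_cast
      have : (p:ℂ) ≠ 0 := by exact_mod_cast hp0.ne'
      have : (m:ℂ) ≠ 0 := by exact_mod_cast hm0
      field_simp

lemma Ls_two_le (S : Finset ℕ) (hS : ∀ p ∈ S, p.Prime) : Ls 2 S ≤ 2 := by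
  unfold Ls
  have h := sum_Ioo_inv_sq_le (α := ℝ) 0 (S.sup id + 1)
  simp only [Nat.cast_zero, zero_add, div_one] at h
  refine le_trans ?_ h
  simp_rw [one_div]
  refine sum_le_sum_of_subset_of_nonneg (fun p hp => ?_) fun _ _ _ => by positivity
  exact Finset.mem_Ioo.2 ⟨(hS p hp).pos, Nat.lt_succ_of_le (Finset.le_sup (f := id) hp)⟩

lemma tkc_core {f : ℕ → ℂ} (hf : Mf f) (S : Finset ℕ) (hS : ∀ p ∈ S, p.Prime) (X Y : ℝ) (I : ℕ → Finset ℕ) (n : ℕ) (hn0 : n ≠ 0)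
    (hn : n ∈ blk X Y) (hI : ∀ p ∈ S, p ∣ n → n / p ∈ I p) : n * ‖tkc f S X Y I n‖ ≤ |om 1 S n - Ls 1 S| + 2 * om 2 S n := by
  classical
  have hn0' : (n:ℂ) ≠ 0 := by exact_mod_cast hn0
  have e0 : (n:ℝ) = ‖(n:ℂ)‖ := by simp
  rw [e0, ← norm_mul]
  have e1 : (n:ℂ) * tkc f S X Y I n = f n * ((Ls 1 S - om 1 S n : ℝ) : ℂ) + ∑ p ∈ S, if p ∣ n then f n - f p * f (n / p) else 0 := by
    unfold tkc
    rw [mul_div_cancel₀ _ hn0', if_pos hn]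
    have : ∑ p ∈ S, (if p ∣ n ∧ n / p ∈ I p then f p * f (n / p) else 0) = ∑ p ∈ S, (if p ∣ n then f p * f (n / p) else 0) :=
      sum_congr rfl fun p hp => if_congr ⟨fun h => h.1, fun h => ⟨h, hI p hp h⟩⟩ rfl rfl
    rw [this]
    unfold om
    push_cast
    rw [mul_sub, mul_sum, sub_add, mul_comm, ← sum_sub_distrib]
    congr 1
    refine sum_congr rfl fun p _ => ?_
    rw [pow_one]
    split_ifs <;> simp
  rw [e1]
  refine (norm_add_le _ _).trans (add_le_add ?_ ?_)
  · rw [norm_mul, norm_real, norm_eq_abs, abs_sub_comm]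
    exact mul_le_of_le_one_left (abs_nonneg _) (hf.le n)
  · unfold om
    rw [mul_sum]
    refine (norm_sum_le _ _).trans (sum_le_sum fun p hp => ?_)
    by_cases h1 : p ∣ n
    · obtain ⟨m, rfl⟩ := h1
      have hp0 := (hS p hp).pos
      rw [if_pos (dvd_mul_right _ _), Nat.mul_div_cancel_left _ hp0]
      by_cases h2 : p ∣ m
      · rw [if_pos (by rw [sq]; exact Nat.mul_dvd_mul_left p h2)]
        calc ‖f (p * m) - f p * f m‖ ≤ ‖f (p * m)‖ + ‖f p‖ * ‖f m‖ := by rw [← norm_mul]; exact norm_sub_le _ _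
          _ ≤ 1 + 1 * 1 := by gcongr <;> exact hf.le _
          _ = 2 * 1 := by norm_num
      · rw [hf.mul p m (hS p hp) h2]; simp; split_ifs <;> norm_num
    · rw [if_neg h1]; simp; split_ifs <;> norm_num

lemma tkc_edge {f : ℕ → ℂ} (hf : Mf f) (S : Finset ℕ) (X Y : ℝ) (I : ℕ → Finset ℕ) (n : ℕ) : n * ‖tkc f S X Y I n‖ ≤ Ls 1 S + om 1 S n := by
  classical
  rcases Nat.eq_zero_or_pos n with rfl | hn0
  · simp only [Nat.cast_zero, zero_mul]; exact add_nonneg (Ls_nonneg _ _) (om_nonneg _ _ _)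
  have hn0' : (n:ℂ) ≠ 0 := by exact_mod_cast hn0.ne'
  have e0 : (n:ℝ) = ‖(n:ℂ)‖ := by simp
  rw [e0, ← norm_mul]
  unfold tkc
  rw [mul_div_cancel₀ _ hn0']
  refine (norm_sub_le _ _).trans (add_le_add ?_ ?_)
  · rw [norm_mul, norm_real, norm_of_nonneg (Ls_nonneg _ _)]
    refine mul_le_of_le_one_right (Ls_nonneg _ _) ?_
    split_ifs
    · exact hf.le n
    · simp
  · unfold om
    refine (norm_sum_le _ _).trans (sum_le_sum fun p _ => ?_)
    by_cases h : p ∣ n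
    · rw [pow_one, if_pos h]
      split_ifs
      · rw [norm_mul]; exact mul_le_one₀ (hf.le _) (norm_nonneg _) (hf.le _)
      · simp
    · simp [h]

lemma blk_split {A B C : ℝ} (h1 : A ≤ B) (h2 : B ≤ C) (g : ℕ → ℝ) : ∑ n ∈ blk A C, g n = ∑ n ∈ blk A B, g n + ∑ n ∈ blk B C, g n :=
  (Finset.sum_Ioc_consecutive g (Nat.floor_mono h1) (Nat.floor_mono h2)).symm

lemma card_le_of_primes {Q : ℝ} (S : Finset ℕ) (hS : ∀ p ∈ S, p.Prime) (hQ1 : 1 ≤ Q) (hQ : ∀ p ∈ S, (p:ℝ) ≤ Q) : (S.card : ℝ) ≤ Q := by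
  have : S ⊆ Ioc 0 ⌊Q⌋₊ := fun p hp => mem_Ioc.2 ⟨(hS p hp).pos, Nat.le_floor (hQ p hp)⟩
  have h := card_le_card this
  rw [Nat.card_Ioc, Nat.sub_zero] at h
  exact (Nat.cast_le.2 h).trans (Nat.floor_le (by linarith))

lemma tk_coef {f : ℕ → ℂ} (hf : Mf f) (S : Finset ℕ) (hS : ∀ p ∈ S, p.Prime) {Q X X1 Y1 Y Y2 : ℝ} (hQ1 : 1 ≤ Q) (hQ : ∀ p ∈ S, (p:ℝ) ≤ Q)
    (hQX : Q ^ 4 ≤ X) (h1 : X ≤ X1) (h2 : X1 ≤ Y1) (h3 : Y1 ≤ Y) (h4 : Y ≤ Y2) (hlog : 1 ≤ log (Y2 / X)) (I : ℕ → Finset ℕ)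
    (hI : ∀ p ∈ S, ∀ m : ℕ, X1 < (p * m : ℕ) → ((p * m : ℕ):ℝ) ≤ Y1 → m ∈ I p) :
    ∑ n ∈ blk X Y2, n * ‖tkc f S X Y I n‖ ^ 2 ≤ 100 * (log (Y2 / X) * (Ls 1 S + 1) + (log (X1 / X) + log (Y2 / Y1)) * Ls 1 S ^ 2) := by
  have hX : 1 ≤ X := (one_le_pow₀ hQ1).trans hQX
  have hcard := card_le_of_primes S hS hQ1 hQ
  have hL0 := Ls_nonneg 1 S
  have hL : Ls 1 S ≤ S.card := by
    unfold Ls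
    rw [← nsmul_one, ← sum_const]
    refine sum_le_sum fun p hp => ?_
    have : (1:ℝ) ≤ (p:ℝ) ^ 1 := one_le_pow₀ (by exact_mod_cast (hS p hp).one_le)
    rw [div_le_one (by linarith)]; exact this
  have hsm : ∀ A : ℝ, X ≤ A → (S.card:ℝ) ^ 2 / A ≤ 1 := by
    intro A hA
    rw [div_le_one (by linarith)]
    calc (S.card:ℝ) ^ 2 ≤ Q ^ 2 := by gcongr
      _ ≤ Q ^ 4 := pow_le_pow_right₀ hQ1 (by norm_num)
      _ ≤ A := hQX.trans hA
  have hpw : ∀ n : ℕ, n ≠ 0 → (n:ℝ) * ‖tkc f S X Y I n‖ ^ 2 = 1 / n * (n * ‖tkc f S X Y I n‖) ^ 2 := by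
    intro n hn
    have : (n:ℝ) ≠ 0 := by exact_mod_cast hn
    field_simp
  have hedge : ∀ A B : ℝ, X ≤ A → A ≤ B → ∑ n ∈ blk A B, n * ‖tkc f S X Y I n‖ ^ 2 ≤ 4 * Ls 1 S ^ 2 * log (B / A) + 2 * Ls 1 S * log (B / A) + 8 := by
    intro A B hA hB
    have g1 : ∑ n ∈ blk A B, n * ‖tkc f S X Y I n‖ ^ 2 ≤ ∑ n ∈ blk A B, (2 * Ls 1 S ^ 2 * ((1:ℝ) / n) + 2 * ((1:ℝ) / n * om 1 S n ^ 2)) := by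
      refine sum_le_sum fun n hn => ?_
      rw [hpw n (by have := blk_pos hn; omega)]
      have g2 := tkc_edge hf S X Y I n
      have g3 := om_nonneg 1 S n
      have : (n * ‖tkc f S X Y I n‖) ^ 2 ≤ 2 * Ls 1 S ^ 2 + 2 * om 1 S n ^ 2 := by
        have : (n * ‖tkc f S X Y I n‖) ^ 2 ≤ (Ls 1 S + om 1 S n) ^ 2 := by gcongr
        nlinarith [sq_nonneg (Ls 1 S - om 1 S n)]
      calc 1 / (n:ℝ) * (n * ‖tkc f S X Y I n‖) ^ 2 ≤ 1 / n * (2 * Ls 1 S ^ 2 + 2 * om 1 S n ^ 2) := by gcongr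
        _ = _ := by ring
    refine g1.trans ?_
    rw [sum_add_distrib, ← mul_sum, ← mul_sum]
    have g4 := (abs_le.1 (harm (hX.trans hA) hB)).2
    have g5 := tk_second 1 S hS hQ hQ1 (le_trans (pow_le_pow_right₀ hQ1 (by norm_num)) (hQX.trans hA)) hB
    have g6 := hsm A hA
    have g7 : (S.card:ℝ) ^ 2 * (2 / A) = 2 * (S.card ^ 2 / A) := by ring
    have g8 : 2 * Ls 1 S ^ 2 * ∑ n ∈ blk A B, (1:ℝ) / n ≤ 2 * Ls 1 S ^ 2 * (log (B / A) + 2 / A) := by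
      refine mul_le_mul_of_nonneg_left ?_ (by positivity); linarith
    have g9 : Ls 1 S ^ 2 / A ≤ S.card ^ 2 / A := by have : 0 < A := by linarith
                                                    gcongr
    have g10 : 2 * Ls 1 S ^ 2 * (2 / A) = 4 * (Ls 1 S ^ 2 / A) := by ring
    rw [g7] at g5
    linarith
  have hcore : ∑ n ∈ blk X1 Y1, n * ‖tkc f S X Y I n‖ ^ 2 ≤ 2 * (log (Y1 / X1) * Ls 1 S) + 48 * log (Y1 / X1) + 32 := by
    have g1 : ∑ n ∈ blk X1 Y1, n * ‖tkc f S X Y I n‖ ^ 2 ≤ ∑ n ∈ blk X1 Y1, (2 * ((1:ℝ) / n * (om 1 S n - Ls 1 S) ^ 2) + 8 * ((1:ℝ) / n * om 2 S n ^ 2)) := by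
      refine sum_le_sum fun n hn => ?_
      have hn1 := blk_pos hn
      have hn' := (mem_blk (by linarith)).1 hn
      rw [hpw n (by omega)]
      have g2 := tkc_core hf S hS X Y I n (by omega) ((mem_blk (by linarith)).2 ⟨by linarith [hn'.1], by linarith [hn'.2]⟩) (by
        rintro p hp ⟨m, rfl⟩
        rw [Nat.mul_div_cancel_left _ (hS p hp).pos]
        exact hI p hp m hn'.1 hn'.2)
      have g3 := om_nonneg 2 S n
      have : (n * ‖tkc f S X Y I n‖) ^ 2 ≤ 2 * (om 1 S n - Ls 1 S) ^ 2 + 8 * om 2 S n ^ 2 := by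
        have : (n * ‖tkc f S X Y I n‖) ^ 2 ≤ (|om 1 S n - Ls 1 S| + 2 * om 2 S n) ^ 2 := by gcongr
        have h5 := sq_abs (om 1 S n - Ls 1 S)
        nlinarith [sq_nonneg (|om 1 S n - Ls 1 S| - 2 * om 2 S n)]
      calc 1 / (n:ℝ) * (n * ‖tkc f S X Y I n‖) ^ 2 ≤ 1 / n * (2 * (om 1 S n - Ls 1 S) ^ 2 + 8 * om 2 S n ^ 2) := by gcongr
        _ = _ := by ring
    refine g1.trans ?_
    rw [sum_add_distrib, ← mul_sum, ← mul_sum]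
    have g4 := tk_var 1 S hS hQ hQ1 (le_trans (pow_le_pow_right₀ hQ1 (by norm_num)) (hQX.trans h1)) h2
    have g5 := tk_second 2 S hS hQ hQ1 (hQX.trans h1) h2
    have g6 := hsm X1 h1
    have g7 : (S.card:ℝ) ^ 2 * (2 / X1) = 2 * (S.card ^ 2 / X1) := by ring
    have g8 : 8 * (S.card:ℝ) ^ 2 / X1 = 8 * (S.card ^ 2 / X1) := by ring
    have g9 := Ls_two_le S hS
    have g10 := Ls_nonneg 2 S
    have g11 : log (Y1 / X1) * (Ls 2 S ^ 2 + Ls 2 S) ≤ log (Y1 / X1) * 6 := by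
      refine mul_le_mul_of_nonneg_left (by nlinarith) (log_nonneg (by rw [le_div_iff₀ (by linarith)]; linarith))
    rw [g7] at g5; rw [g8] at g4
    linarith
  rw [blk_split h1 (h2.trans (h3.trans h4)), blk_split h2 (h3.trans h4)]
  have k1 := hedge X X1 le_rfl h1
  have k2 := hedge Y1 Y2 (h1.trans h2) (h3.trans h4)
  have hl : ∀ A B : ℝ, X ≤ A → A ≤ B → 0 ≤ log (B / A) := fun A B hA hB => log_nonneg (by rw [le_div_iff₀ (by linarith)]; linarith)
  have l1 := hl X X1 le_rfl h1
  have l2 := hl Y1 Y2 (h1.trans h2) (h3.trans h4)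
  have l3 := hl X1 Y1 h1 h2
  have e : log (Y2 / X) = log (X1 / X) + log (Y1 / X1) + log (Y2 / Y1) := by
    rw [log_div (by linarith) (by linarith), log_div (by linarith) (by linarith), log_div (by linarith) (by linarith), log_div (by linarith) (by linarith)]; ring
  rw [e] at hlog ⊢
  generalize log (X1 / X) = a at *
  generalize log (Y1 / X1) = b at *
  generalize log (Y2 / Y1) = c at *
  generalize Ls 1 S = L at *
  have m1 := mul_nonneg l1 hL0
  have m2 := mul_nonneg l2 hL0
  have m3 := mul_nonneg l3 hL0
  have m4 := mul_nonneg l1 (sq_nonneg L)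
  have m5 := mul_nonneg l2 (sq_nonneg L)
  linarith

end MR
namespace MR
open MeasureTheory

def LS (ρ : Measure ℝ) (C X : ℝ) : Prop := ∀ (c : ℕ → ℂ) (s : Finset ℕ), (∀ n ∈ s, X < n ∧ (n:ℝ) ≤ exp 2 * X) →
  ∫ t, ‖dp c s t‖ ^ 2 ∂ρ ≤ C * ∑ n ∈ s, n * ‖c n‖ ^ 2

lemma LS_nu {T X : ℝ} (hT : 1 ≤ T) (hX : T ≤ X) : LS (nu T) 64 X := by
  intro c s hs
  refine (mvt hT c s fun n hn => by exact_mod_cast (hT.trans hX).trans (hs n hn).1.le).trans ?_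
  rw [show (64:ℝ) = 32 * 2 by norm_num, mul_assoc, mul_sum (a := (2:ℝ))]
  refine mul_le_mul_of_nonneg_left (sum_le_sum fun n hn => ?_) (by norm_num)
  rw [← mul_assoc]; gcongr; linarith [(hs n hn).1]

lemma LS_restrict {ρ : Measure ℝ} [IsFiniteMeasure ρ] {C X : ℝ} (h : LS ρ C X) (U : Set ℝ) : LS (ρ.restrict U) C X := fun c s hs =>
  (integral_mono_measure Measure.restrict_le_self (Eventually.of_forall fun t => by positivity) (int_dp c s)).trans (h c s hs)

noncomputable def Bx (f : ℕ → ℂ) (X t : ℝ) : ℂ := BB f X (exp 1 * X) t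
noncomputable def pw (y0 : ℝ) (k v : ℕ) : Finset ℕ := prs (exp (y0 + v / k)) (exp (y0 + (v + 1) / k))
noncomputable def Qx (f : ℕ → ℂ) (y0 : ℝ) (k v : ℕ) (t : ℝ) : ℂ := dp (fun p => f p / p) (pw y0 k v) t

lemma pw_mem {y0 : ℝ} {k v p : ℕ} : p ∈ pw y0 k v ↔ p.Prime ∧ y0 + v / k < log p ∧ log p ≤ y0 + (v + 1) / k := by
  unfold pw
  rw [mem_prs (exp_pos _).le]
  constructor
  · rintro ⟨a, b, c⟩
    have : (0:ℝ) < p := by exact_mod_cast c.pos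
    exact ⟨c, (lt_log_iff_exp_lt this).2 a, (log_le_iff_le_exp this).2 b⟩
  · rintro ⟨c, a, b⟩
    have : (0:ℝ) < p := by exact_mod_cast c.pos
    exact ⟨(lt_log_iff_exp_lt this).1 a, (log_le_iff_le_exp this).1 b, c⟩

lemma pw_idx {y0 : ℝ} {k v p : ℕ} (hk : 1 ≤ k) (h : p ∈ pw y0 k v) : ⌈(log p - y0) * k⌉₊ - 1 = v := by
  have hk' : (0:ℝ) < k := by exact_mod_cast hk
  obtain ⟨_, h1, h2⟩ := pw_mem.1 h
  have : ⌈(log p - y0) * k⌉₊ = v + 1 := by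
    rw [Nat.ceil_eq_iff (by omega)]
    constructor
    · have : (v:ℝ) / k < log p - y0 := by linarith
      rw [div_lt_iff₀ hk'] at this; simpa using this
    · have : log p - y0 ≤ (v + 1 : ℝ) / k := by linarith
      rw [le_div_iff₀ hk'] at this; push_cast; exact this
  omega

lemma pw_sum {E : Type*} [AddCommMonoid E] (y0 : ℝ) {k : ℕ} (hk : 1 ≤ k) (V : ℕ) (g : ℕ → E) : ∑ p ∈ prs (exp y0) (exp (y0 + V / k)), g p = ∑ v ∈ range V, ∑ p ∈ pw y0 k v, g p := by
  have hk' : (0:ℝ) < k := by exact_mod_cast hk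
  induction V with
  | zero => simp [prs]
  | succ V ih =>
    rw [sum_range_succ, ← ih]
    have : prs (exp y0) (exp (y0 + (V + 1 : ℕ) / k)) = prs (exp y0) (exp (y0 + V / k)) ∪ pw y0 k V := by
      ext p
      simp only [pw, mem_union, mem_prs (exp_pos _).le]
      push_cast
      have h1 : exp (y0 + V / k) ≤ exp (y0 + (V + 1) / k) := by gcongr; linarith
      have h2 : exp y0 ≤ exp (y0 + V / k) := by gcongr; linarith [show (0:ℝ) ≤ V / k by positivity]
      constructor
      · rintro ⟨a, b, c⟩
        rcases le_or_gt (p:ℝ) (exp (y0 + V / k)) with h | h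
        · exact Or.inl ⟨a, h, c⟩
        · exact Or.inr ⟨h, b, c⟩
      · rintro (⟨a, b, c⟩ | ⟨a, b, c⟩)
        · exact ⟨a, b.trans h1, c⟩
        · exact ⟨h2.trans_lt a, b, c⟩
    rw [this, sum_union]
    rw [disjoint_left]
    intro p hp hq
    have := ((mem_prs (exp_pos _).le).1 hp).2.1
    have := ((mem_prs (exp_pos _).le).1 hq).1
    linarith

lemma E0 {f : ℕ → ℂ} (hf : Mf f) (ρ : Measure ℝ) [IsFiniteMeasure ρ] {C X y0 : ℝ} (hC0 : 0 ≤ C) (hX0 : 0 < X) (hC : LS ρ C X) (k V : ℕ) (hk : 1 ≤ k)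
    (hy0 : 0 ≤ y0) (hX : 4 * (y0 + V / k) ≤ log X) (L : ℝ) (hL : L = Ls 1 (prs (exp y0) (exp (y0 + V / k)))) :
    L ^ 2 * ∫ t, ‖Bx f X t‖ ^ 2 ∂ρ ≤ 2 * V * ∑ v ∈ range V, ∫ t, ‖Qx f y0 k v t‖ ^ 2 * ‖Bx f (X * exp (-(y0 + v / k))) t‖ ^ 2 ∂ρ
      + 400 * C * (L + 1 + L ^ 2 / k) := by
  have hk' : (1:ℝ) ≤ k := by exact_mod_cast hk
  have hk1 : 1 / (k:ℝ) ≤ 1 := by rw [div_le_one (by linarith)]; exact hk'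
  have hk0 : 0 < 1 / (k:ℝ) := by positivity
  set S := prs (exp y0) (exp (y0 + V / k)) with hS
  set I : ℕ → Finset ℕ := fun p => blk (X * exp (-(y0 + (⌈(log p - y0) * k⌉₊ - 1 : ℕ) / k))) (exp 1 * (X * exp (-(y0 + (⌈(log p - y0) * k⌉₊ - 1 : ℕ) / k)))) with hI
  set Y2 := exp (1 + 1 / k) * X with hY2
  have hIv : ∀ v p, p ∈ pw y0 k v → I p = blk (X * exp (-(y0 + v / k))) (exp 1 * (X * exp (-(y0 + v / k)))) := by
    intro v p hp; rw [hI]; simp only [pw_idx hk hp]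
  have hSv : ∀ p ∈ S, ∃ v, p ∈ pw y0 k v := by
    intro p hp
    by_contra hcon
    push Not at hcon
    have := pw_sum y0 hk V (fun q => if q = p then (1:ℝ) else 0)
    rw [sum_ite_eq' , if_pos hp, Finset.sum_eq_zero] at this
    · norm_num at this
    · intro v _; rw [sum_ite_eq', if_neg (hcon v)]
  have hSp : ∀ p ∈ S, p.Prime := fun p hp => ((mem_prs (exp_pos _).le).1 hp).2.2
  have hY : exp 1 * X ≤ Y2 := by rw [hY2]; gcongr; linarith
  have key : ∀ t, (L : ℂ) * Bx f X t = dp (tkc f S X (exp 1 * X) I) (blk X Y2) t + ∑ v ∈ range V, Qx f y0 k v t * Bx f (X * exp (-(y0 + v / k))) t := by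
    intro t
    rw [tk_id f S hSp X _ Y2 hY I, hS, pw_sum y0 hk V, hL, Bx, sub_add, sub_eq_self.2]
    · rw [sub_eq_zero]
      refine sum_congr rfl fun v _ => ?_
      rw [Qx, dp, sum_mul]
      refine sum_congr rfl fun p hp => ?_
      rw [hIv v p hp, Bx, BB]
    · intro p hp m hm
      obtain ⟨v, hv⟩ := hSv p hp
      rw [hIv v p hv, mem_blk (by positivity)] at hm
      obtain ⟨a, b⟩ := (mem_prs (exp_pos _).le).1 hv
      rw [mem_blk hX0.le]; push_cast
      constructor
      · calc X = exp (y0 + v / k) * (X * exp (-(y0 + v / k))) := by rw [exp_neg]; field_simp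
          _ < p * m := by gcongr; exact hm.1
      · calc (p:ℝ) * m ≤ exp (y0 + (v + 1) / k) * (exp 1 * (X * exp (-(y0 + v / k)))) := by gcongr; exacts [b.1, hm.2]
          _ = Y2 := by
            rw [hY2, show exp (y0 + (v + 1) / k) * (exp 1 * (X * exp (-(y0 + v / k)))) = exp (y0 + (v + 1) / k) * exp 1 * exp (-(y0 + v / k)) * X by ring, ← exp_add, ← exp_add]
            congr 2; ring
  have hco := tk_coef hf S hSp (Q := exp (y0 + V / k)) (X := X) (X1 := exp (1 / k) * X) (Y1 := exp 1 * X) (Y := exp 1 * X) (Y2 := Y2)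
    (one_le_exp (by positivity)) (fun p hp => ((mem_prs (exp_pos _).le).1 hp).2.1) (by rw [← exp_nat_mul]; push_cast; rwa [← Real.le_log_iff_exp_le hX0])
    (le_mul_of_one_le_left hX0.le (one_le_exp hk0.le)) (by gcongr) le_rfl hY (by rw [hY2, mul_div_cancel_right₀ _ hX0.ne', log_exp]; linarith) I (by
      intro p hp m h1 h2
      obtain ⟨v, hv⟩ := hSv p hp
      obtain ⟨a, b⟩ := (mem_prs (exp_pos _).le).1 hv
      rw [hIv v p hv, mem_blk (by positivity)]
      push_cast at h1 h2
      have hp0 : (0:ℝ) < p := (exp_pos _).trans a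
      constructor
      · refine lt_of_mul_lt_mul_left ?_ hp0.le
        refine lt_of_le_of_lt ?_ h1
        calc (p:ℝ) * (X * exp (-(y0 + v / k))) ≤ exp (y0 + (v + 1) / k) * (X * exp (-(y0 + v / k))) := by gcongr; exact b.1
          _ = exp (y0 + (v + 1) / k + -(y0 + v / k)) * X := by rw [exp_add (y0 + (v + 1) / k)]; ring
          _ = _ := by congr 2; ring
      · refine le_of_mul_le_mul_left (h2.trans ?_) hp0
        calc exp 1 * X = exp (y0 + v / k) * (exp 1 * (X * exp (-(y0 + v / k)))) := by rw [exp_neg]; field_simp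
          _ ≤ _ := by gcongr)
  rw [hY2, mul_div_mul_right _ _ hX0.ne', mul_div_cancel_right₀ _ hX0.ne', mul_div_cancel_right₀ _ hX0.ne', ← exp_sub, log_exp, log_exp, log_exp, ← hL, ← hY2] at hco
  have hE := hC (tkc f S X (exp 1 * X) I) (blk X Y2) (fun n hn => by
    rw [mem_blk hX0.le] at hn
    exact ⟨hn.1, hn.2.trans (by rw [hY2]; gcongr; linarith)⟩)
  have hc : ∀ X, Continuous (Bx f X) := fun X => by unfold Bx BB; exact continuous_dp _ _
  have hq : ∀ v, Integrable (fun t => ‖Qx f y0 k v t‖ ^ 2 * ‖Bx f (X * exp (-(y0 + v / k))) t‖ ^ 2) ρ := fun v => by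
    refine int_bdd (C := (∑ p ∈ pw y0 k v, ‖f p / p‖) ^ 2 * (∑ n ∈ blk (X * exp (-(y0 + v / k))) (exp 1 * (X * exp (-(y0 + v / k)))), ‖f n / n‖) ^ 2) (((continuous_dp _ _).norm.pow 2).mul ((hc _).norm.pow 2)) fun t => ?_
    rw [norm_of_nonneg (by positivity)]
    gcongr
    · exact norm_dp_le _ _ _
    · exact norm_dp_le _ _ _
  have hpt : ∀ t, L ^ 2 * ‖Bx f X t‖ ^ 2 ≤ 2 * ‖dp (tkc f S X (exp 1 * X) I) (blk X Y2) t‖ ^ 2 + 2 * V * ∑ v ∈ range V, ‖Qx f y0 k v t‖ ^ 2 * ‖Bx f (X * exp (-(y0 + v / k))) t‖ ^ 2 := by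
    intro t
    have h1 : L ^ 2 * ‖Bx f X t‖ ^ 2 = ‖(L : ℂ) * Bx f X t‖ ^ 2 := by rw [norm_mul, mul_pow, norm_real, norm_eq_abs, sq_abs]
    rw [h1, key t]
    set a := dp (tkc f S X (exp 1 * X) I) (blk X Y2) t
    set b := ∑ v ∈ range V, Qx f y0 k v t * Bx f (X * exp (-(y0 + v / k))) t
    have h2 : ‖a + b‖ ^ 2 ≤ 2 * ‖a‖ ^ 2 + 2 * ‖b‖ ^ 2 := by
      have := norm_add_le a b
      nlinarith [sq_nonneg (‖a‖ - ‖b‖), norm_nonneg (a + b)]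
    have h3 : ‖b‖ ^ 2 ≤ V * ∑ v ∈ range V, ‖Qx f y0 k v t‖ ^ 2 * ‖Bx f (X * exp (-(y0 + v / k))) t‖ ^ 2 := by
      calc ‖b‖ ^ 2 ≤ (∑ v ∈ range V, ‖Qx f y0 k v t * Bx f (X * exp (-(y0 + v / k))) t‖) ^ 2 := by gcongr; exact norm_sum_le _ _
        _ ≤ _ := by
          refine sq_sum_le_card_mul_sum_sq.trans_eq ?_
          rw [card_range]; congr 1
          exact sum_congr rfl fun v _ => by rw [norm_mul, mul_pow]
    linarith
  have hint := integral_mono (μ := ρ) ((int_dp (ρ := ρ) _ _).const_mul _) (((int_dp _ _).const_mul 2).add ((integrable_finsetSum _ fun v _ => hq v).const_mul _)) hpt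
  simp only [Pi.add_apply] at hint
  rw [integral_const_mul, integral_add ((int_dp _ _).const_mul 2) ((integrable_finsetSum _ fun v _ => hq v).const_mul _), integral_const_mul, integral_const_mul, integral_finsetSum _ fun v _ => hq v] at hint
  have hL0 : 0 ≤ L := hL ▸ Ls_nonneg _ _
  have hfin : C * ∑ n ∈ blk X Y2, n * ‖tkc f S X (exp 1 * X) I n‖ ^ 2 ≤ C * (200 * (L + 1 + L ^ 2 / k)) := by
    gcongr
    refine hco.trans ?_
    have e1 : (1 / (k:ℝ) + (1 + 1 / k - 1)) * L ^ 2 = 2 * (L ^ 2 / k) := by ring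
    rw [e1]
    nlinarith
  change L ^ 2 * ∫ t, ‖Bx f X t‖ ^ 2 ∂ρ ≤ _ at hint
  linarith

lemma om_dvd {S : Finset ℕ} {m n : ℕ} (h : m ∣ n) : om 1 S m ≤ om 1 S n := by
  unfold om
  gcongr with p hp
  simp only [pow_one]
  split_ifs with h1 h2
  · rfl
  · exact absurd (h1.trans h) h2
  · norm_num
  · rfl

lemma moment {S : Finset ℕ} (c b : ℕ → ℂ) {P Q A B : ℝ} (hP : 0 < P) (hS : ∀ p ∈ S, P < p ∧ (p:ℝ) ≤ Q) (hc : ∀ p, ‖c p‖ ≤ 1 / p) (hb : ∀ n, ‖b n‖ ≤ 1 / n) (hA : 0 ≤ A) (l : ℕ) :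
    ∃ a : ℕ → ℂ, (∀ t, dp c S t ^ l * dp b (blk A B) t = dp a (blk (A * P ^ l) (B * Q ^ l)) t) ∧ ∀ n, ‖a n‖ ≤ om 1 S n ^ l / n := by
  induction l with
  | zero => exact ⟨b, by simp, by simpa using hb⟩
  | succ l ih =>
    obtain ⟨a, ha, hn⟩ := ih
    set s := blk (A * P ^ l) (B * Q ^ l) with hs
    refine ⟨fun n => ∑ p ∈ S, if p ∣ n ∧ n / p ∈ s then c p * a (n / p) else 0, fun t => ?_, fun n => ?_⟩
    · rw [pow_succ', mul_assoc, ha t]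
      simp only [dp, sum_mul]
      rw [sum_comm]
      refine sum_congr rfl fun p hp => ?_
      have hp0 : 0 < p := by have := (hS p hp).1; exact_mod_cast hP.trans this
      rw [mul_sum]
      refine Finset.sum_bij_ne_zero (fun m _ _ => p * m) ?_ ?_ ?_ ?_
      · intro m hm _
        rw [hs, mem_blk (by positivity)] at hm
        rw [mem_blk (by positivity)]; push_cast
        have := hS p hp
        constructor
        · calc A * P ^ (l + 1) = P * (A * P ^ l) := by ring
            _ < p * m := mul_lt_mul'' this.1 hm.1 hP.le (by positivity)
        · calc (p:ℝ) * m ≤ Q * (B * Q ^ l) := by gcongr; exacts [hP.le.trans (this.1.le.trans this.2), this.2, hm.2]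
            _ = _ := by ring
      · intro m1 _ _ m2 _ _ h
        exact Nat.eq_of_mul_eq_mul_left hp0 h
      · intro n hn hne
        by_cases h : p ∣ n ∧ n / p ∈ s
        · rw [if_pos h] at hne
          refine ⟨n / p, h.2, ?_, Nat.mul_div_cancel' h.1⟩
          contrapose! hne
          rcases mul_eq_zero.1 hne with h' | h' <;> rcases mul_eq_zero.1 h' with h' | h'
          · simp [h']
          · exact absurd h' (norm_ne_zero_iff.1 (by rw [norm_tw]; norm_num))
          · simp [h']
          · exact absurd h' (norm_ne_zero_iff.1 (by rw [norm_tw]; norm_num))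
        · rw [if_neg h] at hne; simp at hne
      · intro m hm _
        have hm0 := blk_pos hm
        rw [if_pos ⟨dvd_mul_right _ _, by rwa [Nat.mul_div_cancel_left _ hp0]⟩, Nat.mul_div_cancel_left _ hp0, tw_mul t hp0.ne' (by omega)]; ring
    · refine (norm_sum_le _ _).trans ?_
      rw [pow_succ', mul_div_assoc]
      conv_rhs => rw [om, sum_mul]
      gcongr with p hp
      rw [pow_one]
      have hp0 : 0 < p := by have := (hS p hp).1; exact_mod_cast hP.trans this
      by_cases h : p ∣ n ∧ n / p ∈ s
      · obtain ⟨m, rfl⟩ := h.1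
        rw [if_pos h, if_pos h.1, Nat.mul_div_cancel_left _ hp0, norm_mul, one_mul]
        calc ‖c p‖ * ‖a m‖ ≤ (1 / p) * (om 1 S m ^ l / m) := by gcongr; exacts [hc p, hn m]
          _ ≤ (1 / p) * (om 1 S (p * m) ^ l / m) := by gcongr; exacts [om_nonneg _ _ _, om_dvd (dvd_mul_left _ _)]
          _ = _ := by rw [om]; push_cast; field_simp
      · rw [if_neg h, norm_zero]
        have := om_nonneg 1 S n
        split_ifs <;> positivity

lemma two_om (S : Finset ℕ) (hS : ∀ p ∈ S, p.Prime) {N0 N1 : ℝ} (h0 : 0 < N0) (h1 : 0 ≤ N1) (l : ℕ) :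
    ∑ n ∈ blk N0 N1, om 1 S n ^ l / n ≤ l.factorial * 2 ^ l * (N1 / N0) * exp (Ls 1 S) := by
  have e1 : ∀ n, (2:ℝ) ^ (om 1 S n) = ∑ A ∈ S.powerset, if (∏ p ∈ A, p) ∣ n then (1:ℝ) else 0 := by
    intro n
    have h : (2:ℝ) ^ (om 1 S n) = ∏ p ∈ S, (1 + if p ∣ n then (1:ℝ) else 0) := by
      unfold om
      rw [Real.rpow_sum_of_pos (by norm_num)]
      refine Finset.prod_congr rfl fun p _ => ?_
      rw [pow_one]; split_ifs <;> norm_num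
    rw [h, Finset.prod_one_add]
    refine sum_congr rfl fun A hA => ?_
    have hA' := Finset.mem_powerset.1 hA
    have : (∏ p ∈ A, p) ∣ n ↔ ∀ p ∈ A, p ∣ n := by
      constructor
      · exact fun h p hp => (Finset.dvd_prod_of_mem _ hp).trans h
      · intro h
        exact Finset.prod_dvd_of_isRelPrime (fun p hp q hq hpq => Nat.coprime_iff_isRelPrime.1 ((Nat.coprime_primes (hS p (hA' hp)) (hS q (hA' hq))).2 hpq)) h
    by_cases h : ∀ p ∈ A, p ∣ n
    · rw [if_pos (this.2 h), Finset.prod_congr rfl fun p hp => if_pos (h p hp), Finset.prod_const_one]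
    · rw [if_neg (fun h' => h (this.1 h'))]
      push Not at h
      obtain ⟨p, hp, hpn⟩ := h
      exact Finset.prod_eq_zero hp (if_neg hpn)
  have e2 : ∀ x : ℝ, 0 ≤ x → x ^ l ≤ l.factorial * 2 ^ l * 2 ^ x := by
    intro x hx
    have h := Real.pow_div_factorial_le_exp (x / 2) (by positivity) l
    have : exp (x / 2) ≤ 2 ^ x := by
      rw [rpow_def_of_pos (by norm_num)]
      gcongr
      nlinarith [log_two_gt_d9]
    rw [div_le_iff₀ (by positivity), div_pow, div_le_iff₀ (by positivity)] at h
    calc x ^ l ≤ _ := h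
      _ ≤ 2 ^ x * l.factorial * 2 ^ l := by gcongr
      _ = _ := by ring
  have e3 : ∀ A ∈ S.powerset, ∑ n ∈ blk N0 N1, (if (∏ p ∈ A, p) ∣ n then (1:ℝ) else 0) ≤ N1 * ∏ p ∈ A, (1:ℝ) / p := by
    intro A hA
    have hpos : 0 < ∏ p ∈ A, p := Finset.prod_pos fun p hp => (hS p (Finset.mem_powerset.1 hA hp)).pos
    rw [← sum_filter, sum_const, nsmul_eq_mul, mul_one, Finset.prod_div_distrib, Finset.prod_const_one, ← Nat.cast_prod, mul_one_div]
    set d := ∏ p ∈ A, p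
    calc (((blk N0 N1).filter (d ∣ ·)).card : ℝ) ≤ ((Ioc 0 ⌊N1⌋₊).filter (d ∣ ·)).card := by
          gcongr
          exact Finset.Ioc_subset_Ioc_left (Nat.zero_le _)
      _ = ((⌊N1⌋₊ / d : ℕ) : ℝ) := by rw [Nat.Ioc_filter_dvd_card_eq_div]
      _ ≤ ⌊N1⌋₊ / d := Nat.cast_div_le
      _ ≤ N1 / d := by gcongr; exact Nat.floor_le h1
  calc ∑ n ∈ blk N0 N1, om 1 S n ^ l / n ≤ ∑ n ∈ blk N0 N1, (l.factorial * 2 ^ l * 2 ^ (om 1 S n)) / N0 := by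
        gcongr with n hn
        · exact e2 _ (om_nonneg _ _ _)
        · exact ((mem_blk h0.le).1 hn).1.le
    _ = l.factorial * 2 ^ l / N0 * ∑ A ∈ S.powerset, ∑ n ∈ blk N0 N1, (if (∏ p ∈ A, p) ∣ n then (1:ℝ) else 0) := by
        rw [sum_comm, mul_sum]
        refine sum_congr rfl fun n _ => ?_
        rw [e1]; ring
    _ ≤ l.factorial * 2 ^ l / N0 * ∑ A ∈ S.powerset, N1 * ∏ p ∈ A, (1:ℝ) / p := by gcongr with A hA; exact e3 A hA
    _ = l.factorial * 2 ^ l * (N1 / N0) * ∏ p ∈ S, (1 + (1:ℝ) / p) := by rw [← mul_sum, ← Finset.prod_one_add]; ring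
    _ ≤ _ := by
        gcongr
        unfold Ls
        rw [Real.exp_sum]
        gcongr with p hp
        rw [pow_one, add_comm]; exact add_one_le_exp _
end MR
namespace MR
open MeasureTheory

lemma tw_sub (t t' : ℝ) (n : ℕ) : tw (t - t') n = tw t n * conj (tw t' n) := by
  unfold tw
  rw [← exp_conj, ← Complex.exp_add]
  congr 1
  simp only [map_mul, Complex.conj_ofReal, Complex.conj_I]; push_cast; ring

lemma hm {ρ : Measure ℝ} [IsFiniteMeasure ρ] (w : ℕ → ℝ) (R s : Finset ℕ) (M : ℝ) (hw : ∀ n ∈ R, 0 ≤ w n) (hsR : s ⊆ R) (hws : ∀ n ∈ s, 0 < w n)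
    (h1 : ∀ᵐ t ∂ρ, ∫ t', ‖dp (fun n => (w n : ℂ)) R (t - t')‖ ∂ρ ≤ M) (h2 : ∀ᵐ t' ∂ρ, ∫ t, ‖dp (fun n => (w n : ℂ)) R (t - t')‖ ∂ρ ≤ M) (hM : 0 ≤ M) (c : ℕ → ℂ) :
    ∫ t, ‖dp c s t‖ ^ 2 ∂ρ ≤ M * ∑ n ∈ s, ‖c n‖ ^ 2 / w n := by
  set K := dp (fun n => (w n : ℂ)) R with hK
  set F := dp c s with hF
  set J := ∫ t, ‖F t‖ ^ 2 ∂ρ with hJ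
  have hJ0 : 0 ≤ J := integral_nonneg fun t => by positivity
  have cF : Continuous F := continuous_dp c s
  have cK : Continuous K := continuous_dp _ _
  have bF := norm_dp_le c s
  have bK := norm_dp_le (fun n => (w n : ℂ)) R
  rw [← hF] at bF; rw [← hK] at bK
  set CF := ∑ n ∈ s, ‖c n‖
  set CK := ∑ n ∈ R, ‖(w n : ℂ)‖
  have hCF : 0 ≤ CF := (norm_nonneg _).trans (bF 0)
  have hCK : 0 ≤ CK := (norm_nonneg _).trans (bK 0)
  set g : ℕ → ℂ := fun n => ∫ t, conj (F t) * tw t n ∂ρ with hg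
  have ig : ∀ n, Integrable (fun t => conj (F t) * tw t n) ρ := fun n =>
    int_bdd ((continuous_conj.comp cF).mul (continuous_tw n)) CF fun t => by simpa [norm_tw] using bF t
  have e1 : (J : ℂ) = ∑ n ∈ s, c n * g n := by
    rw [hJ, ← integral_complex_ofReal]
    simp only [hg, ← integral_const_mul]
    rw [← integral_finsetSum _ fun n _ => (ig n).const_mul _]
    refine integral_congr_ae (Eventually.of_forall fun t => ?_)
    simp only
    rw [ofReal_pow, ← mul_conj', hF]
    conv_lhs => rw [dp, sum_mul]
    refine sum_congr rfl fun n _ => ?_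
    rw [dp]; ring
  have b2 : ∀ p : ℝ × ℝ, Continuous K := fun _ => cK
  have iFK : ∀ q : ℝ × ℝ → ℝ, Continuous q → (∀ p, 0 ≤ q p ∧ q p ≤ CF) → Integrable (fun p : ℝ × ℝ => q p ^ 2 * ‖K (p.1 - p.2)‖) (ρ.prod ρ) := by
    intro q hq hb
    refine Integrable.of_bound (by fun_prop) (CF ^ 2 * CK) (Eventually.of_forall fun p => ?_)
    rw [norm_of_nonneg (by positivity)]
    have := hb p
    gcongr
    · exact this.1
    · exact this.2
    · exact bK _
  have i1 := iFK (fun p => ‖F p.1‖) (by fun_prop) (fun p => ⟨norm_nonneg _, bF _⟩)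
  have i2 := iFK (fun p => ‖F p.2‖) (by fun_prop) (fun p => ⟨norm_nonneg _, bF _⟩)
  have J1 : ∫ p, ‖F p.1‖ ^ 2 * ‖K (p.1 - p.2)‖ ∂(ρ.prod ρ) ≤ M * J := by
    rw [integral_prod _ i1, hJ, ← integral_const_mul]
    refine integral_mono_of_nonneg (Eventually.of_forall fun t => integral_nonneg fun _ => by positivity) ((int_dp c s).const_mul _) (h1.mono fun t ht => ?_)
    simp only
    rw [integral_const_mul, mul_comm]
    gcongr
  have J2 : ∫ p, ‖F p.2‖ ^ 2 * ‖K (p.1 - p.2)‖ ∂(ρ.prod ρ) ≤ M * J := by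
    rw [integral_prod_symm _ i2, hJ, ← integral_const_mul]
    refine integral_mono_of_nonneg (Eventually.of_forall fun t => integral_nonneg fun _ => by positivity) ((int_dp c s).const_mul _) (h2.mono fun t ht => ?_)
    simp only
    rw [integral_const_mul, mul_comm]
    gcongr
  have e2 : ((∑ n ∈ R, w n * ‖g n‖ ^ 2 : ℝ) : ℂ) = ∫ p, conj (F p.1) * F p.2 * K (p.1 - p.2) ∂(ρ.prod ρ) := by
    have hgg : ∀ n, ((‖g n‖ ^ 2 : ℝ) : ℂ) = ∫ p, (conj (F p.1) * tw p.1 n) * (F p.2 * conj (tw p.2 n)) ∂(ρ.prod ρ) := by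
      intro n
      rw [integral_prod_mul (fun t => conj (F t) * tw t n) (fun t => F t * conj (tw t n)), ofReal_pow, ← mul_conj', hg, ← integral_conj]
      simp
    push_cast
    simp only [← ofReal_pow, hgg, ← integral_const_mul]
    rw [← integral_finsetSum]
    · refine integral_congr_ae (Eventually.of_forall fun p => ?_)
      simp only [hK, dp, mul_sum, tw_sub]
      exact sum_congr rfl fun n _ => by ring
    · intro n _
      refine ((ig n).mul_prod (g := fun t => F t * conj (tw t n)) ?_).const_mul _
      refine int_bdd (cF.mul (continuous_conj.comp (continuous_tw n))) CF fun t => by simpa [norm_tw] using bF t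
  have e3 : ∑ n ∈ R, w n * ‖g n‖ ^ 2 ≤ M * J := by
    have h0 : 0 ≤ ∑ n ∈ R, w n * ‖g n‖ ^ 2 := sum_nonneg fun n hn => mul_nonneg (hw n hn) (by positivity)
    calc ∑ n ∈ R, w n * ‖g n‖ ^ 2 = ‖((∑ n ∈ R, w n * ‖g n‖ ^ 2 : ℝ) : ℂ)‖ := by rw [norm_real, norm_of_nonneg h0]
      _ ≤ ∫ p, ‖conj (F p.1) * F p.2 * K (p.1 - p.2)‖ ∂(ρ.prod ρ) := by rw [e2]; exact norm_integral_le_integral_norm _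
      _ ≤ ∫ p, 1 / 2 * (‖F p.1‖ ^ 2 * ‖K (p.1 - p.2)‖) + 1 / 2 * (‖F p.2‖ ^ 2 * ‖K (p.1 - p.2)‖) ∂(ρ.prod ρ) := by
        refine integral_mono_of_nonneg (Eventually.of_forall fun t => norm_nonneg _) ((i1.const_mul _).add (i2.const_mul _)) (Eventually.of_forall fun p => ?_)
        simp only [norm_mul, RCLike.norm_conj]
        nlinarith [mul_nonneg (sq_nonneg (‖F p.1‖ - ‖F p.2‖)) (norm_nonneg (K (p.1 - p.2)))]
      _ ≤ M * J := by
        rw [integral_add (i1.const_mul _) (i2.const_mul _), integral_const_mul, integral_const_mul]; linarith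
  have hA : 0 ≤ ∑ n ∈ s, ‖c n‖ ^ 2 / w n := sum_nonneg fun n hn => div_nonneg (by positivity) (hws n hn).le
  have e4 : J ^ 2 ≤ (∑ n ∈ s, ‖c n‖ ^ 2 / w n) * (M * J) := by
    have hJn : J ≤ ∑ n ∈ s, ‖c n‖ * ‖g n‖ := by
      have : J = ‖(J:ℂ)‖ := by rw [norm_real, norm_of_nonneg hJ0]
      rw [this, e1]
      exact (norm_sum_le _ _).trans_eq (by simp)
    calc J ^ 2 ≤ (∑ n ∈ s, ‖c n‖ * ‖g n‖) ^ 2 := by gcongr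
      _ ≤ (∑ n ∈ s, ‖c n‖ ^ 2 / w n) * ∑ n ∈ s, w n * ‖g n‖ ^ 2 := by
        refine Finset.sum_sq_le_sum_mul_sum_of_sq_le_mul _ (fun n hn => div_nonneg (by positivity) (hws n hn).le) (fun n hn => mul_nonneg (hws n hn).le (by positivity)) fun n hn => ?_
        have := (hws n hn).ne'
        refine le_of_eq ?_
        field_simp
      _ ≤ _ := by
        gcongr
        refine le_trans (sum_le_sum_of_subset_of_nonneg hsR fun n hn _ => mul_nonneg (hw n hn) (by positivity)) e3
  rcases hJ0.eq_or_lt with h | h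
  · rw [← h]; positivity
  · refine le_of_mul_le_mul_right ?_ h
    nlinarith [e4]

noncomputable def La : ℝ := 3 * log 2
lemma La_pos : 2 < La ∧ La < 3 := by unfold La; constructor <;> linarith [log_two_gt_d9, log_two_lt_d9]
noncomputable def wt (N n : ℕ) : ℝ := tent ((log n - (log N + La)) / La) / n
noncomputable def KK (N : ℕ) (τ : ℝ) : ℂ := dp (fun n => (wt N n : ℂ)) (Ico N (64 * N)) τ

open FourierTransform in
lemma int_tent (u0 τ : ℝ) : ‖∫ u : ℝ, (tent ((u - u0) / La) : ℂ) * Complex.exp ((-(τ * u) : ℝ) * I)‖ = La * sinc (La / 2 * τ) ^ 2 := by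
  have hL := La_pos
  have h1 : ∫ u : ℝ, (tent ((u - u0) / La) : ℂ) * Complex.exp ((-(τ * u) : ℝ) * I) = La * (Complex.exp ((-(τ * u0) : ℝ) * I) * 𝓕 (fun x : ℝ => (tent x : ℂ)) (La * τ / (2 * π))) := by
    set h : ℝ → ℂ := fun x => (tent x : ℂ) * Complex.exp ((-(τ * (u0 + La * x)) : ℝ) * I) with hh
    have e : (fun u : ℝ => (tent ((u - u0) / La) : ℂ) * Complex.exp ((-(τ * u) : ℝ) * I)) = fun u => (fun z => h (z / La)) (u - u0) := by
      funext u; simp only [hh]; rw [mul_div_cancel₀ _ (by linarith : La ≠ 0)]; congr 5; ring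
    rw [e, integral_sub_right_eq_self (fun z => h (z / La)), Measure.integral_comp_div, abs_of_pos (by linarith), real_smul, Real.fourier_eq', ← integral_const_mul (Complex.exp _)]
    congr 2; funext x
    simp only [hh, smul_eq_mul]
    rw [← mul_assoc, ← Complex.exp_add, mul_comm]
    congr 2
    simp only [RCLike.inner_apply, conj_trivial]
    push_cast
    field_simp; ring
  rw [h1, fourier_tent, norm_mul, norm_mul, norm_exp_ofReal_mul_I, norm_real, norm_real, norm_of_nonneg (by linarith), norm_of_nonneg (by positivity), one_mul]
  congr 3; field_simp

lemma tent_lip (x y : ℝ) : |tent x - tent y| ≤ |x - y| := by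
  unfold tent
  rw [max_comm 0, max_comm 0]
  refine (abs_max_sub_max_le_abs (1 - |x|) (1 - |y|) 0).trans ?_
  rw [show 1 - |x| - (1 - |y|) = |y| - |x| by ring, abs_sub_comm x y]
  exact abs_abs_sub_abs_le _ _

lemma KK_small (N : ℕ) (hN : 1 ≤ N) (τ : ℝ) : ‖KK N τ‖ ≤ La * sinc (La / 2 * τ) ^ 2 + 64 * (2 + |τ|) / N := by
  have hL := La_pos
  have hN' : (1:ℝ) ≤ N := by exact_mod_cast hN
  set u0 := log N + La with hu0
  set g : ℝ → ℂ := fun u => (tent ((u - u0) / La) : ℂ) * Complex.exp ((-(τ * u) : ℝ) * I) with hg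
  have cg : Continuous g := by have := continuous_tent; fun_prop
  have hlip : ∀ a b, ‖g a - g b‖ ≤ (1 + |τ|) * |a - b| := by
    intro a b
    have : g a - g b = ((tent ((a - u0) / La) - tent ((b - u0) / La) : ℝ) : ℂ) * Complex.exp ((-(τ * a) : ℝ) * I) + (tent ((b - u0) / La) : ℂ) * (Complex.exp ((-(τ * a) : ℝ) * I) - Complex.exp ((-(τ * b) : ℝ) * I)) := by
      simp only [hg]; push_cast; ring
    rw [this]
    refine (norm_add_le _ _).trans ?_
    rw [norm_mul, norm_mul, norm_exp_ofReal_mul_I, norm_real, norm_real, norm_of_nonneg (tent_nonneg _), norm_eq_abs]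
    have h1 := tent_lip ((a - u0) / La) ((b - u0) / La)
    have h2 : |(a - u0) / La - (b - u0) / La| ≤ |a - b| := by
      rw [← sub_div, sub_sub_sub_cancel_right, abs_div, abs_of_pos (by linarith : 0 < La)]
      exact div_le_self (abs_nonneg _) (by linarith)
    have h3 := exp_sub_exp_le (-(τ * a)) (-(τ * b))
    rw [show -(τ * a) - -(τ * b) = -(τ * (a - b)) by ring, abs_neg, abs_mul] at h3
    have h4 := tent_le_one ((b - u0) / La)
    have h5 := tent_nonneg ((b - u0) / La)
    nlinarith [norm_nonneg (Complex.exp ((-(τ * a) : ℝ) * I) - Complex.exp ((-(τ * b) : ℝ) * I))]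
  have hsum : ∑ n ∈ Ico N (64 * N), ∫ u in log n..Real.log (n + 1 : ℕ), g u = ∫ u, g u := by
    rw [intervalIntegral.sum_integral_adjacent_intervals_Ico (a := fun n : ℕ => log n) (by omega) (fun k _ => cg.intervalIntegrable _ _)]
    have h64 : log (64 * N : ℕ) = u0 + La := by
      push_cast
      rw [log_mul (by norm_num) (by positivity), show (64:ℝ) = 2 ^ 6 by norm_num, log_pow, hu0, La]; push_cast; ring
    rw [h64, intervalIntegral.integral_of_le (by linarith), setIntegral_eq_integral_of_forall_compl_eq_zero]
    intro u hu
    simp only [hg]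
    rw [tent_zero]; · simp
    rw [Set.mem_Ioc, not_and_or, not_lt, not_le] at hu
    rw [abs_div, abs_of_pos (by linarith : 0 < La), one_le_div (by linarith)]
    rcases hu with hu | hu
    · rw [abs_of_nonpos] <;> linarith
    · rw [abs_of_nonneg] <;> linarith
  have hterm : ∀ n ∈ Ico N (64 * N), ‖(wt N n : ℂ) * tw τ n - ∫ u in log n..Real.log (n + 1 : ℕ), g u‖ ≤ (2 + |τ|) / N ^ 2 := by
    intro n hn
    have hn1 := (mem_Ico.1 hn).1
    have hn0 : (N:ℝ) ≤ n := by exact_mod_cast hn1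
    have hn0' : (0:ℝ) < n := by linarith
    set d := log (n + 1 : ℕ) - log n with hd
    have hd1 : d ≤ 1 / n := by
      rw [hd, ← log_div (by positivity) (by positivity)]
      refine (log_le_sub_one_of_pos (by positivity)).trans_eq ?_
      push_cast; field_simp; ring
    have hd2 : 1 / n - 1 / (n:ℝ) ^ 2 ≤ d := by
      have := Real.one_sub_inv_le_log_of_pos (x := ((n + 1 : ℕ):ℝ) / n) (by positivity)
      rw [log_div (by positivity) (by positivity)] at this
      refine le_trans ?_ this
      push_cast
      rw [inv_div, one_sub_div (by positivity), div_sub_div _ _ (by positivity) (by positivity), div_le_div_iff₀ (by positivity) (by positivity)]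
      nlinarith
    have hd0 : 0 ≤ d := by
      rw [hd, sub_nonneg]; gcongr; omega
    have hw : (wt N n : ℂ) * tw τ n = g (log n) * (1 / n : ℝ) := by
      simp only [hg, wt, tw]; rw [hu0]; push_cast; ring
    have hI : (∫ u in log n..Real.log (n + 1 : ℕ), g u) = g (log n) * (d : ℝ) + ∫ u in log n..Real.log (n + 1 : ℕ), (g u - g (log n)) := by
      rw [intervalIntegral.integral_sub (cg.intervalIntegrable _ _) (by simp), intervalIntegral.integral_const, real_smul]; ring
    have hI2 : ‖∫ u in log n..Real.log (n + 1 : ℕ), (g u - g (log n))‖ ≤ ((1 + |τ|) * d) * d := by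
      refine (intervalIntegral.norm_integral_le_of_norm_le_const (C := (1 + |τ|) * d) fun u hu => ?_).trans_eq ?_
      · rw [Set.uIoc_of_le (by linarith)] at hu
        refine (hlip _ _).trans ?_
        gcongr
        rw [abs_of_pos (by linarith [hu.1])]; linarith [hu.2]
      · rw [← hd, abs_of_nonneg hd0]
    have hg1 : ‖g (log n)‖ ≤ 1 := by
      simp only [hg]; rw [norm_mul, norm_exp_ofReal_mul_I, norm_real, norm_of_nonneg (tent_nonneg _), mul_one]; exact tent_le_one _
    rw [hw, hI, show g (log n) * ((1 / n : ℝ) : ℂ) - (g (log n) * (d : ℝ) + ∫ u in log n..Real.log (n + 1 : ℕ), (g u - g (log n))) = g (log n) * ((1 / n - d : ℝ) : ℂ) - ∫ u in log n..Real.log (n + 1 : ℕ), (g u - g (log n)) by push_cast; ring]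
    refine (norm_sub_le _ _).trans ?_
    rw [norm_mul, norm_real, norm_of_nonneg (by linarith)]
    have hdd : d * d ≤ 1 / (n:ℝ) ^ 2 := by
      calc d * d ≤ 1 / n * (1 / n) := by gcongr
        _ = _ := by field_simp
    have hx : 1 / (n:ℝ) ^ 2 ≤ 1 / (N:ℝ) ^ 2 := by gcongr
    have := abs_nonneg τ
    calc _ ≤ 1 * (1 / (n:ℝ) ^ 2) + (1 + |τ|) * (1 / (n:ℝ) ^ 2) := by
          refine add_le_add (mul_le_mul hg1 (by linarith) (by linarith) (by norm_num)) (hI2.trans ?_)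
          rw [mul_assoc]; gcongr
      _ = (2 + |τ|) * (1 / (n:ℝ) ^ 2) := by ring
      _ ≤ (2 + |τ|) * (1 / (N:ℝ) ^ 2) := by gcongr
      _ = _ := by ring
  calc ‖KK N τ‖ = ‖(∫ u, g u) + ∑ n ∈ Ico N (64 * N), ((wt N n : ℂ) * tw τ n - ∫ u in log n..Real.log (n + 1 : ℕ), g u)‖ := by
        rw [sum_sub_distrib, hsum, KK, dp]; congr 1; ring
    _ ≤ La * sinc (La / 2 * τ) ^ 2 + ∑ n ∈ Ico N (64 * N), (2 + |τ|) / (N:ℝ) ^ 2 := by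
        refine (norm_add_le _ _).trans (add_le_add (int_tent u0 τ).le ((norm_sum_le _ _).trans (sum_le_sum hterm)))
    _ ≤ _ := by
        rw [sum_const, Nat.card_Ico, nsmul_eq_mul]
        gcongr
        calc ((64 * N - N : ℕ) : ℝ) * ((2 + |τ|) / (N:ℝ) ^ 2) ≤ (64 * N) * ((2 + |τ|) / (N:ℝ) ^ 2) := by
              gcongr; exact_mod_cast (Nat.sub_le _ _)
          _ = _ := by field_simp

end MR
namespace MR
open MeasureTheory

lemma KK_large : ∃ C c : ℝ, 1 ≤ C ∧ 0 < c ∧ c ≤ 1 / 2 ∧ ∀ (N : ℕ) (τ : ℝ), 1 ≤ N → sqrt N ≤ |τ| → |τ| ≤ (N:ℝ) ^ 5 → ‖KK N τ‖ ≤ C * (N:ℝ) ^ (-c) := by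
  obtain ⟨C1, hC1, h1⟩ := esum_small
  obtain ⟨C2, c, hC2, hc, hc1, h2⟩ := esum_large 5
  have hL := La_pos
  have hLp : 0 < La := by linarith
  refine ⟨24 * (C1 + C2), min c (1 / 2), by linarith, by positivity, min_le_right _ _, fun N τ hN hτ1 hτ2 => ?_⟩
  set c' := min c (1 / 2)
  have hN' : (1:ℝ) ≤ N := by exact_mod_cast hN
  have hτ0 : 1 ≤ |τ| := le_trans (Real.one_le_sqrt.2 hN') hτ1
  have key : ∀ i : ℕ, ‖∑ n ∈ Ico (N * 2 ^ i) (N * 2 ^ (i + 1)), (wt N n : ℂ) * tw τ n‖ ≤ 4 * (C1 + C2) * (N:ℝ) ^ (-c') := by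
    intro i
    set a := N * 2 ^ i with ha
    have ha1 : 1 ≤ a := Nat.one_le_iff_ne_zero.2 (by positivity)
    have haN : N ≤ a := Nat.le_mul_of_pos_right _ (by positivity)
    have ha' : (1:ℝ) ≤ a := by exact_mod_cast ha1
    have haN' : (N:ℝ) ≤ a := by exact_mod_cast haN
    have hB : ∀ k ≤ a, ‖∑ j ∈ range k, tw τ (a + j)‖ ≤ (C1 + C2) * (a * (N:ℝ) ^ (-c')) := by
      intro k hk
      have e : ∑ j ∈ range k, tw τ (a + j) = ∑ n ∈ Ico a (a + k), Complex.exp ((-τ * log (n + 0) : ℝ) * I) := by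
        rw [sum_Ico_eq_sum_range, Nat.add_sub_cancel_left]
        refine sum_congr rfl fun j _ => ?_
        rw [tw, add_zero, neg_mul]
      have hk' : ((a + k : ℕ) : ℝ) ≤ 2 * a := by have : a + k ≤ 2 * a := by omega
                                                 exact_mod_cast this
      have hx : 0 ≤ a * (N:ℝ) ^ (-c') := by positivity
      rw [e]
      rcases le_total |τ| a with h | h
      · have hs : 1 / |τ| ≤ (N:ℝ) ^ (-c') := by
          calc 1 / |τ| ≤ 1 / sqrt N := by gcongr
            _ = (N:ℝ) ^ (-(1 / 2 : ℝ)) := by rw [rpow_neg (by linarith), ← sqrt_eq_rpow, one_div]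
            _ ≤ _ := rpow_le_rpow_of_exponent_le hN' (neg_le_neg (min_le_right _ _))
        refine (h1 a (a + k) a (-τ) 0 ha' le_rfl hk' (by rwa [abs_neg]) (by rwa [abs_neg]) le_rfl zero_le_one).trans ?_
        rw [abs_neg]
        calc C1 * a / |τ| = C1 * (a * (1 / |τ|)) := by ring
          _ ≤ C1 * (a * (N:ℝ) ^ (-c')) := by gcongr
          _ ≤ _ := by nlinarith
      · refine (h2 a (a + k) a (-τ) 0 ha' le_rfl hk' (by rwa [abs_neg]) (by rw [abs_neg]; exact hτ2.trans (by gcongr)) le_rfl zero_le_one).trans ?_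
        calc C2 * (a:ℝ) ^ (1 - c) = C2 * (a * (a:ℝ) ^ (-c)) := by rw [sub_eq_add_neg, rpow_add (by linarith), rpow_one]
          _ ≤ C2 * (a * (N:ℝ) ^ (-c')) := by
            have : (a:ℝ) ^ (-c) ≤ (N:ℝ) ^ (-c') := (rpow_le_rpow_of_nonpos (by linarith) haN' (by linarith)).trans (rpow_le_rpow_of_exponent_le hN' (neg_le_neg (min_le_left _ _)))
            gcongr
          _ ≤ _ := by nlinarith
    set x : ℕ → ℝ := fun j => (log ((a + j : ℕ):ℝ) - (log N + La)) / La with hx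
    have hxm : Monotone x := fun j j' h => by
      simp only [hx]
      have : (0:ℝ) < (a + j : ℕ) := by exact_mod_cast (by omega : 0 < a + j)
      gcongr
    have hx1 : ∀ j, -1 ≤ x j := fun j => by
      simp only [hx]
      rw [le_div_iff₀ (by linarith)]
      have : log N ≤ log ((a + j : ℕ):ℝ) := by gcongr; omega
      linarith
    have tool : ∀ φ : ℕ → ℝ, Antitone φ → (∀ j, 0 ≤ φ j) → φ 0 ≤ 2 → ‖∑ j ∈ range a, ((φ j / (a + j : ℕ) : ℝ) : ℂ) * tw τ (a + j)‖ ≤ 2 / a * ((C1 + C2) * (a * (N:ℝ) ^ (-c'))) := by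
      intro φ h1 h2 h3
      refine (abel_antitone (fun j => φ j / (a + j : ℕ)) (fun j => tw τ (a + j)) _ a (fun j j' h => ?_) (fun j => div_nonneg (h2 j) (by positivity)) hB).trans ?_
      · simp only
        have : (0:ℝ) < (a + j : ℕ) := by exact_mod_cast (by omega : 0 < a + j)
        have := h1 h
        have := h2 j
        gcongr
      · simp only [add_zero]
        gcongr
    have hD := tool (fun j => max 0 (1 - x j)) (fun j j' h => max_le_max le_rfl (by linarith [hxm h])) (fun j => le_max_left _ _) (max_le (by norm_num) (by linarith [hx1 0]))
    have hE := tool (fun j => max 0 (-2 * x j)) (fun j j' h => max_le_max le_rfl (by linarith [hxm h])) (fun j => le_max_left _ _) (max_le (by norm_num) (by linarith [hx1 0]))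
    have hsplit : ∑ n ∈ Ico a (N * 2 ^ (i + 1)), (wt N n : ℂ) * tw τ n = ∑ j ∈ range a, ((max 0 (1 - x j) / (a + j : ℕ) : ℝ) : ℂ) * tw τ (a + j) - ∑ j ∈ range a, ((max 0 (-2 * x j) / (a + j : ℕ) : ℝ) : ℂ) * tw τ (a + j) := by
      rw [sum_Ico_eq_sum_range, show N * 2 ^ (i + 1) - a = a by rw [ha, pow_succ, ← mul_assoc]; omega, ← sum_sub_distrib]
      refine sum_congr rfl fun j _ => ?_
      rw [← sub_mul, ← ofReal_sub, ← sub_div, wt]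
      congr 3
      change tent (x j) = _
      have := hx1 j
      unfold tent
      rcases le_total 0 (x j) with h | h
      · rw [abs_of_nonneg h, max_eq_left (by linarith : -2 * x j ≤ 0), sub_zero]
      · rw [abs_of_nonpos h, max_eq_right (by linarith), max_eq_right (by linarith), max_eq_right (by linarith)]; ring
    rw [hsplit]
    refine (norm_sub_le _ _).trans ((add_le_add hD hE).trans_eq ?_)
    field_simp; ring
  have : KK N τ = ∑ i ∈ range 6, ∑ n ∈ Ico (N * 2 ^ i) (N * 2 ^ (i + 1)), (wt N n : ℂ) * tw τ n := by
    rw [KK, dp]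
    have : ∀ m : ℕ, ∑ n ∈ Ico N (N * 2 ^ m), (wt N n : ℂ) * tw τ n = ∑ i ∈ range m, ∑ n ∈ Ico (N * 2 ^ i) (N * 2 ^ (i + 1)), (wt N n : ℂ) * tw τ n := by
      intro m
      induction m with
      | zero => simp
      | succ m ih => rw [sum_range_succ, ← ih, Finset.sum_Ico_consecutive _ (Nat.le_mul_of_pos_right _ (by positivity)) (Nat.mul_le_mul_left _ (Nat.pow_le_pow_right (by norm_num) (by omega)))]
    rw [← this, mul_comm]; norm_num
  rw [this]
  refine (norm_sum_le _ _).trans ((sum_le_sum fun i _ => key i).trans_eq ?_)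
  simp; ring

lemma LS_U : ∃ C c X0 : ℝ, 1 ≤ C ∧ 0 < c ∧ c ≤ 1 ∧ 1 ≤ X0 ∧ ∀ X : ℝ, X0 ≤ X → ∀ U : Set ℝ, MeasurableSet U → U ⊆ Set.Icc (-X ^ 2) (X ^ 2) → volume.real U ≤ X ^ c →
    ∀ y : ℝ, sqrt X ≤ y → LS (volume.restrict U) C y := by
  obtain ⟨C1, c, hC1, hc, hc1, h1⟩ := KK_large
  have hL := La_pos
  have hLp : 0 < La := by linarith
  set I0 := ∫ τ, La * sinc (La / 2 * τ) ^ 2 with hI0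
  have iS : Integrable (fun τ => La * sinc (La / 2 * τ) ^ 2) :=
    ((integrable_comp_mul_left_iff (fun x => sinc x ^ 2) (by linarith : La / 2 ≠ 0)).2 integrable_sinc_sq).const_mul _
  have hI00 : 0 ≤ I0 := integral_nonneg fun τ => by positivity
  refine ⟨3 * (I0 + 4 * (192 + C1)), c / 2, 5000000, by linarith, by linarith, by linarith, by norm_num, fun X hX U hU hUX hvol y hy => ?_⟩
  have hX0 : (0:ℝ) < X := by linarith
  have hsX : 2200 ≤ sqrt X := Real.le_sqrt_of_sq_le (by norm_num; linarith)
  have hsq := sq_sqrt hX0.le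
  set N := ⌊y / 2⌋₊ with hN
  have hN1 : (N:ℝ) ≤ y / 2 := Nat.floor_le (by linarith)
  have hN2 : y / 2 < N + 1 := Nat.lt_floor_add_one _
  have hN3 : sqrt X / 4 ≤ N := by linarith
  have hN4 : (1:ℝ) ≤ N := by linarith
  have hN5 : 1 ≤ N := by exact_mod_cast hN4
  have hfin : volume U < ⊤ := lt_of_le_of_lt (measure_mono hUX) (by simp)
  haveI : IsFiniteMeasure (volume.restrict U) := ⟨by simpa using hfin⟩
  have hKb : ∀ τ : ℝ, |τ| ≤ 2 * X ^ 2 → ‖KK N τ‖ ≤ La * sinc (La / 2 * τ) ^ 2 + (192 + C1) * (N:ℝ) ^ (-c) := by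
    intro τ hτ
    have hp : 0 ≤ (N:ℝ) ^ (-c) := by positivity
    rcases le_total |τ| (sqrt N) with h | h
    · refine (KK_small N hN5 τ).trans ?_
      gcongr
      have hs1 : 1 ≤ sqrt N := Real.one_le_sqrt.2 hN4
      calc 64 * (2 + |τ|) / N ≤ 64 * (3 * sqrt N) / N := by gcongr; linarith
        _ = 192 * (sqrt N / N) := by ring
        _ = 192 * (N:ℝ) ^ (-(1 / 2 : ℝ)) := by
          rw [Real.sqrt_div_self', rpow_neg (by linarith), ← sqrt_eq_rpow, one_div]
        _ ≤ 192 * (N:ℝ) ^ (-c) := by gcongr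
        _ ≤ _ := by nlinarith
    · refine (h1 N τ hN5 h (hτ.trans ?_)).trans ?_
      · calc 2 * X ^ 2 ≤ (sqrt X / 4) ^ 5 := by
              rw [div_pow, le_div_iff₀ (by norm_num)]
              have : sqrt X ^ 5 = sqrt X * X ^ 2 := by rw [show sqrt X ^ 5 = sqrt X * (sqrt X ^ 2) ^ 2 by ring, hsq]
              rw [this]; nlinarith [sq_nonneg X]
          _ ≤ _ := by gcongr
      · have : 0 ≤ La * sinc (La / 2 * τ) ^ 2 := by positivity
        nlinarith
  have hNc : (N:ℝ) ^ (-c) * X ^ (c / 2) ≤ 4 := by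
    calc (N:ℝ) ^ (-c) * X ^ (c / 2) ≤ (sqrt X / 4) ^ (-c) * X ^ (c / 2) := by
          gcongr ?_ * _
          exact rpow_le_rpow_of_nonpos (by positivity) hN3 (by linarith)
      _ = 4 ^ c := by
        rw [Real.div_rpow (by positivity) (by norm_num), sqrt_eq_rpow, ← rpow_mul hX0.le, rpow_neg (by norm_num : (0:ℝ) ≤ 4), div_inv_eq_mul, mul_right_comm, ← rpow_add hX0, show 1 / 2 * -c + c / 2 = 0 by ring, Real.rpow_zero, one_mul]
      _ ≤ 4 ^ (1:ℝ) := by gcongr; norm_num; linarith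
      _ = 4 := by norm_num
  have cK : Continuous (KK N) := by unfold KK; exact continuous_dp _ _
  have bK : ∀ τ, ‖KK N τ‖ ≤ _ := norm_dp_le _ _
  have hM : ∀ φ : ℝ → ℝ, Continuous φ → (∀ t ∈ U, |φ t| ≤ 2 * X ^ 2) → Integrable (fun t => La * sinc (La / 2 * φ t) ^ 2) → (∫ t, La * sinc (La / 2 * φ t) ^ 2 = I0) →
      ∫ t in U, ‖KK N (φ t)‖ ≤ I0 + 4 * (192 + C1) := by
    intro φ hφ hb hi he
    calc ∫ t in U, ‖KK N (φ t)‖ ≤ ∫ t in U, (La * sinc (La / 2 * φ t) ^ 2 + (192 + C1) * (N:ℝ) ^ (-c)) := by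
          refine setIntegral_mono_on (int_bdd (cK.comp hφ).norm _ fun t => by rw [norm_norm]; exact bK _) (hi.integrableOn.add (integrable_const _)) hU fun t ht => hKb _ (hb t ht)
      _ = (∫ t in U, La * sinc (La / 2 * φ t) ^ 2) + volume.real U * ((192 + C1) * (N:ℝ) ^ (-c)) := by
          rw [integral_add hi.integrableOn (integrable_const _)]; simp
      _ ≤ I0 + X ^ (c / 2) * ((192 + C1) * (N:ℝ) ^ (-c)) := by
          gcongr
          rw [← he]
          exact setIntegral_le_integral hi (Eventually.of_forall fun t => by positivity)
      _ ≤ _ := by nlinarith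
  have hUb : ∀ t ∈ U, |t| ≤ X ^ 2 := fun t ht => abs_le.2 (by have := hUX ht; simpa using this)
  intro c0 s hs
  have hin : ∀ n ∈ s, (2 * N : ℝ) ≤ n ∧ (n:ℝ) ≤ 32 * N := by
    intro n hn
    obtain ⟨a, b⟩ := hs n hn
    refine ⟨by linarith, b.trans ?_⟩
    have : exp 2 ≤ 8 := by
      have := exp_one_lt_d9
      rw [show (2:ℝ) = 1 + 1 by norm_num, exp_add]; nlinarith [exp_pos 1]
    nlinarith
  have hwn : ∀ n ∈ s, 1 / (3 * n) ≤ wt N n := by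
    intro n hn
    obtain ⟨a, b⟩ := hin n hn
    have hn0 : (0:ℝ) < n := by linarith
    unfold wt
    rw [one_div, mul_inv, div_eq_mul_inv]
    gcongr
    unfold tent
    refine le_max_of_le_right ?_
    have : |(log n - (log N + La)) / La| ≤ 2 / 3 := by
      rw [abs_div, abs_of_pos (by linarith : 0 < La), div_le_iff₀ (by linarith), abs_le]
      have h1 : log 2 + log N ≤ log n := by rw [← log_mul (by norm_num) (by linarith)]; gcongr
      have h2 : log n ≤ 5 * log 2 + log N := by
        rw [show 5 * log 2 = log 32 by rw [show (32:ℝ) = 2 ^ 5 by norm_num, log_pow]; norm_num, ← log_mul (by norm_num) (by linarith)]; gcongr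
      unfold La; constructor <;> linarith
    linarith
  have hUc : ∀ t0 ∈ U, ∫ t' in U, ‖KK N (t0 - t')‖ ≤ I0 + 4 * (192 + C1) := fun t0 h0 => hM (fun t' => t0 - t') (by fun_prop)
    (fun t ht => (abs_sub _ _).trans (by linarith [hUb t ht, hUb t0 h0])) (iS.comp_sub_left t0) (integral_sub_left_eq_self (fun τ => La * sinc (La / 2 * τ) ^ 2) volume t0)
  have hUd : ∀ t0 ∈ U, ∫ t in U, ‖KK N (t - t0)‖ ≤ I0 + 4 * (192 + C1) := fun t0 h0 => hM (fun t => t - t0) (by fun_prop)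
    (fun t ht => (abs_sub _ _).trans (by linarith [hUb t ht, hUb t0 h0])) (iS.comp_sub_right t0) (integral_sub_right_eq_self (fun τ => La * sinc (La / 2 * τ) ^ 2) t0)
  have := hm (ρ := volume.restrict U) (wt N) (Ico N (64 * N)) s (I0 + 4 * (192 + C1)) (fun n _ => div_nonneg (tent_nonneg _) (by positivity)) (fun n hn => by
      obtain ⟨a, b⟩ := hin n hn
      rw [mem_Ico]
      have h1 : 2 * N ≤ n := by exact_mod_cast a
      have h2 : n ≤ 32 * N := by exact_mod_cast b
      omega) (fun n hn => lt_of_lt_of_le (by have := (hin n hn).1; have : (0:ℝ) < n := by linarith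
                                             positivity) (hwn n hn)) (ae_restrict_of_forall_mem hU hUc) (ae_restrict_of_forall_mem hU hUd) (by linarith) c0
  refine this.trans ?_
  rw [mul_comm (3:ℝ), mul_assoc, mul_sum (a := (3:ℝ))]
  refine mul_le_mul_of_nonneg_left (sum_le_sum fun n hn => ?_) (by linarith)
  have h3 := hwn n hn
  have hn0 : (0:ℝ) < n := by have := (hin n hn).1; linarith
  calc ‖c0 n‖ ^ 2 / wt N n ≤ ‖c0 n‖ ^ 2 / (1 / (3 * n)) := by gcongr
    _ = _ := by field_simp
end MR
namespace MR
open MeasureTheory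

lemma fdn {f : ℕ → ℂ} (hf : Mf f) (n : ℕ) : ‖f n / n‖ ≤ 1 / n := by
  rw [norm_div, Complex.norm_natCast]; exact div_le_div_of_nonneg_right (hf.le n) (by positivity)

lemma harm1 {X : ℝ} (hX : 1 ≤ X) : ∑ n ∈ blk X (exp 1 * X), (1:ℝ) / n ≤ 3 := by
  have h := (abs_le.1 (harm hX (show X ≤ exp 1 * X by nlinarith [add_one_le_exp 1]))).2
  rw [mul_div_cancel_right₀ _ (by linarith), log_exp] at h
  have : 2 / X ≤ 2 := by rw [div_le_iff₀ (by linarith)]; linarith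
  linarith

lemma LS_Bx {f : ℕ → ℂ} (hf : Mf f) {ρ : Measure ℝ} {C X : ℝ} (hC : 0 ≤ C) (hX : 1 ≤ X) (h : LS ρ C X) : ∫ t, ‖Bx f X t‖ ^ 2 ∂ρ ≤ C * 3 := by
  refine (h _ _ fun n hn => ?_).trans (mul_le_mul_of_nonneg_left ((sum_le_sum fun n hn => ?_).trans (harm1 hX)) hC)
  · have := (mem_blk (by linarith)).1 hn
    exact ⟨this.1, this.2.trans (by gcongr; norm_num)⟩
  · have hn : (0:ℝ) < n := by exact_mod_cast blk_pos hn
    calc (n:ℝ) * ‖f n / n‖ ^ 2 ≤ n * (1 / n) ^ 2 := by gcongr; exact fdn hf n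
      _ = 1 / (n:ℝ) := by field_simp

lemma Bx_le {f : ℕ → ℂ} (hf : Mf f) {X : ℝ} (hX : 1 ≤ X) (t : ℝ) : ‖Bx f X t‖ ≤ 3 :=
  ((norm_dp_le _ _ t).trans (sum_le_sum fun n _ => fdn hf n)).trans (harm1 hX)

lemma Qx_cont (f : ℕ → ℂ) (y : ℝ) (k v : ℕ) : Continuous (Qx f y k v) := continuous_dp (fun n => f n / n) (pw y k v)

lemma int_dd {ρ : Measure ℝ} [IsFiniteMeasure ρ] (c d : ℕ → ℂ) (s u : Finset ℕ) (k l : ℕ) : Integrable (fun t => ‖dp c s t‖ ^ k * ‖dp d u t‖ ^ l) ρ :=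
  int_bdd (((continuous_dp c s).norm.pow k).mul ((continuous_dp d u).norm.pow l)) ((∑ n ∈ s, ‖c n‖) ^ k * (∑ n ∈ u, ‖d n‖) ^ l) fun t => by
    rw [norm_of_nonneg (by positivity)]; gcongr <;> exact norm_dp_le _ _ t

lemma stg : ∃ K > 0, ∃ A : ℕ, 3 ≤ A ∧ ∀ f : ℕ → ℂ, Mf f → ∀ a ≥ A, ∀ X T : ℝ, 1 ≤ T → T ≤ X → 8 * (a:ℝ) ^ 2 ≤ log X → ∀ (U : Set ℝ) (w : ℝ), 0 ≤ w →
    (∀ v < a ^ 3, ∫ t in U, ‖Qx f a a v t‖ ^ 2 * ‖Bx f (X * exp (-(a + v / a))) t‖ ^ 2 ∂nu T ≤ w) →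
    ∫ t in U, ‖Bx f X t‖ ^ 2 ∂nu T ≤ 2 * a ^ 6 * w + K / log a := by
  obtain ⟨C, hC0, hC⟩ := mertens
  obtain ⟨A, hA⟩ := eventually_atTop.1 ((tendsto_log_atTop.comp tendsto_natCast_atTop_atTop).eventually_ge_atTop (2 * C + 2))
  refine ⟨25600 * 5, by norm_num, max A 3, le_max_right _ _, fun f hf a ha X T hT hTX hX U w hw0 hw => ?_⟩
  have ha3 : (3:ℝ) ≤ a := by exact_mod_cast (le_max_right _ _).trans ha
  have hla : 2 * C + 2 ≤ log a := hA a ((le_max_left _ _).trans ha)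
  have hk : ((a ^ 3 : ℕ) : ℝ) / a = a ^ 2 := by push_cast; field_simp
  haveI := fin_nu (show 0 < T by linarith)
  have e0 := E0 hf ((nu T).restrict U) (by norm_num) (by linarith) (LS_restrict (LS_nu hT hTX) U) a (a ^ 3) (by have := (le_max_right _ _).trans ha; omega) (y0 := a) (by positivity)
    (by rw [hk]; nlinarith) _ rfl
  rw [hk] at e0
  set L := Ls 1 (prs (exp a) (exp (a + a ^ 2))) with hL
  have hL1 : log a - C ≤ L := by
    have := (abs_le.1 (hC (exp a) (exp (a + a ^ 2)) (by linarith [add_one_le_exp (a:ℝ)]) (by gcongr; nlinarith))).1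
    rw [log_exp, log_exp] at this
    have h2 : log a ≤ log ((a + a ^ 2) / a) := log_le_log (by linarith) (by rw [le_div_iff₀ (by linarith)]; nlinarith)
    have h3 : L = ∑ p ∈ prs (exp a) (exp (a + a ^ 2)), (p:ℝ)⁻¹ := sum_congr rfl fun p _ => by simp
    linarith
  have hL2 : 1 ≤ L := by linarith
  have hL3 : log a / 2 ≤ L := by linarith
  have hs : ∑ v ∈ range (a ^ 3), ∫ t, ‖Qx f a a v t‖ ^ 2 * ‖Bx f (X * exp (-(a + v / a))) t‖ ^ 2 ∂(nu T).restrict U ≤ a ^ 3 * w := by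
    refine (sum_le_sum fun v hv => hw v (mem_range.1 hv)).trans_eq ?_
    simp
  set I := ∫ t in U, ‖Bx f X t‖ ^ 2 ∂nu T
  have hlp : 0 < log a := by linarith
  have h1 : L ^ 2 * I ≤ L ^ 2 * (2 * a ^ 6 * w + 25600 * 5 / log a) := by
    refine e0.trans ?_
    have g1 : 2 * ((a ^ 3 : ℕ):ℝ) * ∑ v ∈ range (a ^ 3), ∫ t, ‖Qx f a a v t‖ ^ 2 * ‖Bx f (X * exp (-(a + v / a))) t‖ ^ 2 ∂(nu T).restrict U ≤ L ^ 2 * (2 * a ^ 6 * w) := by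
      calc _ ≤ 2 * ((a ^ 3 : ℕ):ℝ) * (a ^ 3 * w) := by gcongr
        _ = 1 * (2 * a ^ 6 * w) := by push_cast; ring
        _ ≤ _ := by gcongr; nlinarith
    have g2 : L ≤ L ^ 2 * (2 / log a) := by
      have : 1 ≤ L * (2 / log a) := by rw [mul_div_assoc', le_div_iff₀ hlp]; linarith
      nlinarith
    have g3 : L ^ 2 / a ≤ L ^ 2 * (1 / log a) := by
      rw [div_eq_mul_one_div]; gcongr; exact log_le_self (by linarith)
    have : L ^ 2 * (25600 * 5 / log a) = 25600 * (2 * (L ^ 2 * (2 / log a)) + L ^ 2 * (1 / log a)) := by ring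
    linarith
  exact le_of_mul_le_mul_left h1 (by positivity)

lemma mom {f : ℕ → ℂ} (hf : Mf f) {a : ℕ} (ha : 1 ≤ a) (v l : ℕ) {b : ℕ → ℂ} (hb : ∀ n, ‖b n‖ ≤ 1 / n) {A B T : ℝ} (hA : 0 < A) (hB : 0 ≤ B) (hT : 1 ≤ T)
    (hTA : T ≤ A * exp (l * (a + v / a))) :
    ∫ t, ‖Qx f a a v t‖ ^ (2 * l) * ‖dp b (blk A B) t‖ ^ 2 ∂nu T ≤ 64 * (B / A) * exp (2 * l * log (2 * l) + 3 * l + 3) := by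
  have ha' : (1:ℝ) ≤ a := by exact_mod_cast ha
  set y : ℝ := a + v / a with hy
  have hy1 : 1 ≤ y := by have : (0:ℝ) ≤ v / a := by positivity
                         linarith
  have hy2 : (a:ℝ) + (v + 1) / a = y + 1 / a := by rw [hy]; ring
  have hka : 1 / (a:ℝ) ≤ 1 := by rw [div_le_one (by linarith)]; exact ha'
  have hS : ∀ p ∈ pw a a v, exp y < p ∧ (p:ℝ) ≤ exp (y + 1 / a) := fun p hp => by
    unfold pw at hp; rw [hy2] at hp
    have := (mem_prs (exp_pos _).le).1 hp
    exact ⟨this.1, this.2.1⟩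
  have hSp : ∀ p ∈ pw a a v, p.Prime := fun p hp => (pw_mem.1 hp).1
  obtain ⟨g, hg1, hg2⟩ := moment (fun p => f p / p) b (B := B) (exp_pos y) hS (fdn hf) hb hA.le l
  have e1 : ∀ t, ‖Qx f a a v t‖ ^ (2 * l) * ‖dp b (blk A B) t‖ ^ 2 = ‖dp g (blk (A * exp y ^ l) (B * exp (y + 1 / a) ^ l)) t‖ ^ 2 := fun t => by
    rw [← hg1 t, norm_mul, norm_pow, mul_pow, ← pow_mul, mul_comm l 2]; rfl
  simp_rw [e1]
  rw [exp_nat_mul] at hTA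
  have hN0 : 0 < A * exp y ^ l := by positivity
  refine (mvt hT _ _ fun n hn => blk_pos hn).trans ?_
  have hLs : Ls 1 (pw a a v) ≤ 3 := by
    have h := (abs_le.1 (harm (show 1 ≤ exp y by linarith [add_one_le_exp y]) (show exp y ≤ exp (y + 1 / a) by gcongr; linarith [show 0 ≤ 1 / (a:ℝ) by positivity]))).2
    rw [← exp_sub, log_exp] at h
    have h2 : 2 / exp y ≤ 2 := by rw [div_le_iff₀ (by positivity)]; linarith [add_one_le_exp y]
    have h3 : Ls 1 (pw a a v) ≤ ∑ n ∈ blk (exp y) (exp (y + 1 / a)), (1:ℝ) / n := by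
      unfold Ls; simp only [pow_one]
      exact sum_le_sum_of_subset_of_nonneg (fun p hp => (mem_blk (exp_pos _).le).2 (hS p hp)) fun _ _ _ => by positivity
    linarith
  have h4 : ∑ n ∈ blk (A * exp y ^ l) (B * exp (y + 1 / a) ^ l), (T + n) * ‖g n‖ ^ 2 ≤ 2 * ∑ n ∈ blk (A * exp y ^ l) (B * exp (y + 1 / a) ^ l), om 1 (pw a a v) n ^ (2 * l) / n := by
    rw [mul_sum]
    refine sum_le_sum fun n hn => ?_
    have hn1 := ((mem_blk hN0.le).1 hn).1
    have hn0 : (0:ℝ) < n := hN0.trans hn1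
    have := om_nonneg 1 (pw a a v) n
    calc (T + n) * ‖g n‖ ^ 2 ≤ (2 * n) * (om 1 (pw a a v) n ^ l / n) ^ 2 := by gcongr; · linarith
                                                                               · exact hg2 n
      _ = 2 * (om 1 (pw a a v) n ^ (2 * l) / n) := by rw [div_pow, ← pow_mul, mul_comm l 2]; field_simp
  have h5 := two_om (pw a a v) hSp hN0 (show 0 ≤ B * exp (y + 1 / a) ^ l by positivity) (2 * l)
  have h6 : B * exp (y + 1 / a) ^ l / (A * exp y ^ l) = B / A * exp (l * (1 / a)) := by
    rw [← exp_nat_mul, ← exp_nat_mul, mul_add, exp_add]; field_simp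
  rw [h6] at h5
  have h7 : (((2 * l).factorial : ℕ) : ℝ) ≤ exp (2 * l * log (2 * l)) := by
    rcases Nat.eq_zero_or_pos l with h | h
    · simp [h]
    · have : (0:ℝ) < l := by exact_mod_cast h
      rw [mul_comm (2 * (l:ℝ)), ← rpow_def_of_pos (by positivity)]
      have := Nat.factorial_le_pow (2 * l)
      calc (((2 * l).factorial : ℕ) : ℝ) ≤ (((2 * l) ^ (2 * l) : ℕ) : ℝ) := by exact_mod_cast this
        _ = _ := by rw [show (2:ℝ) * l = ((2 * l : ℕ) : ℝ) by push_cast; ring, rpow_natCast]; push_cast; ring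
  have h8 : (2:ℝ) ^ (2 * l) ≤ exp (2 * l) := by
    rw [show (2:ℝ) * l = ((2 * l : ℕ):ℝ) * 1 by push_cast; ring, exp_nat_mul]
    gcongr; linarith [add_one_le_exp 1]
  calc 32 * ∑ n ∈ blk (A * exp y ^ l) (B * exp (y + 1 / a) ^ l), (T + n) * ‖g n‖ ^ 2 ≤ 64 * ((2 * l).factorial * 2 ^ (2 * l) * (B / A * exp (l * (1 / a))) * exp (Ls 1 (pw a a v))) := by linarith
    _ ≤ 64 * (exp (2 * l * log (2 * l)) * exp (2 * l) * (B / A * exp (l * 1)) * exp 3) := by gcongr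
    _ = _ := by rw [show 2 * l * log (2 * l) + 3 * l + 3 = 2 * l * log (2 * l) + 2 * l + l * 1 + 3 by ring, exp_add, exp_add, exp_add]; ring

end MR
namespace MR
open MeasureTheory

lemma nu_tail {T R : ℝ} (hT : 0 < T) (hR : 0 < R) : (nu T).real {t | R < |t|} ≤ 16 * T ^ 2 / R := by
  have hm : MeasurableSet {t : ℝ | R < |t|} := (isOpen_lt continuous_const continuous_abs).measurableSet
  rw [← integral_indicator_one hm, integral_nu]
  have e : (fun t : ℝ => sinc (t / (2 * T)) ^ 2 • {t : ℝ | R < |t|}.indicator (1 : ℝ → ℝ) t) = fun t => (Set.Ioi R).indicator (fun t : ℝ => sinc (t / (2 * T)) ^ 2) |t| := by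
    funext t
    by_cases h : R < |t|
    · rw [Set.indicator_of_mem (show t ∈ {t : ℝ | R < |t|} from h), Set.indicator_of_mem (show |t| ∈ Set.Ioi R from h)]
      rcases abs_cases t with ⟨h1, _⟩ | ⟨h1, _⟩ <;> simp [h1, neg_div, Real.sinc_neg]
    · rw [Set.indicator_of_notMem (show t ∉ {t : ℝ | R < |t|} from h), Set.indicator_of_notMem (show |t| ∉ Set.Ioi R from h)]; simp
  rw [e, integral_comp_abs, setIntegral_indicator measurableSet_Ioi, Set.inter_eq_right.2 (Set.Ioi_subset_Ioi hR.le)]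
  have h1 : ∫ t in Set.Ioi R, sinc (t / (2 * T)) ^ 2 ≤ ∫ t in Set.Ioi R, 8 * T ^ 2 * t ^ (-2 : ℝ) := by
    refine setIntegral_mono_on (integrable_sinc_T hT).integrableOn ((integrableOn_Ioi_rpow_of_lt (by norm_num) hR).const_mul _) measurableSet_Ioi fun t ht => ?_
    have ht : 0 < t := hR.trans ht
    refine (sinc_sq_le _).trans ?_
    rw [rpow_neg ht.le, Real.rpow_two, ← div_eq_mul_inv, div_le_div_iff₀ (by positivity) (by positivity)]
    have : (t / (2 * T)) ^ 2 * (4 * T ^ 2) = t ^ 2 := by field_simp; norm_num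
    nlinarith [sq_nonneg T]
  rw [integral_const_mul, integral_Ioi_rpow_of_lt (by norm_num) hR, show (-2:ℝ) + 1 = -1 by norm_num, rpow_neg_one] at h1
  calc _ ≤ 2 * (8 * T ^ 2 * (-R⁻¹ / -1)) := by gcongr
    _ = _ := by ring

noncomputable def al (c : ℝ) (a : ℕ) : ℝ := c * (2 - 1 / log a)
def Bd (f : ℕ → ℂ) (α : ℝ) (a : ℕ) : Set ℝ := {t | ∃ v < a ^ 3, exp (-(α * (a + v / a))) < ‖Qx f a a v t‖}

lemma Bd_meas (f α a) : MeasurableSet (Bd f α a) := by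
  have : Bd f α a = ⋃ v ∈ range (a ^ 3), {t | exp (-(α * (a + v / a))) < ‖Qx f a a v t‖} := by
    ext t; simp [Bd]
  rw [this]
  exact (isOpen_biUnion fun v _ => isOpen_lt continuous_const (Qx_cont f a a v).norm).measurableSet

lemma Bd_le {f : ℕ → ℂ} {α : ℝ} {a : ℕ} {t : ℝ} (h : t ∈ Bd f α a) (l : ℕ → ℕ) :
    1 ≤ ∑ v ∈ range (a ^ 3), exp (2 * α * (l v * (a + v / a))) * ‖Qx f a a v t‖ ^ (2 * l v) := by
  obtain ⟨v, hv, h⟩ := h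
  refine le_trans ?_ (Finset.single_le_sum (f := fun v : ℕ => exp (2 * α * (l v * (a + v / a))) * ‖Qx f a a v t‖ ^ (2 * l v)) (fun _ _ => by positivity) (mem_range.2 hv))
  calc (1:ℝ) = exp (2 * α * (l v * (a + v / a))) * exp (-(α * (a + v / a))) ^ (2 * l v) := by
        rw [← exp_nat_mul, ← exp_add, eq_comm, Real.exp_eq_one_iff]; push_cast; ring
    _ ≤ _ := by gcongr

lemma big (K : ℝ) : ∃ A : ℕ, ∀ a ≥ A, (8:ℝ) ≤ a ∧ 1 ≤ log a ∧ K * log a ^ 2 ≤ a ∧ K * (a:ℝ) ^ 28 ≤ exp a := by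
  have h1 : ∀ᶠ x : ℝ in atTop, (8:ℝ) ≤ x ∧ 1 ≤ log x ∧ K * log x ^ 2 ≤ x ∧ K * x ^ 28 ≤ exp x := by
    have k1 := (Real.isLittleO_pow_log_id_atTop (n := 2)).def (show 0 < 1 / (|K| + 1) by positivity)
    have k2 := (Real.isLittleO_pow_exp_atTop (n := 28)).def (show 0 < 1 / (|K| + 1) by positivity)
    filter_upwards [k1, k2, eventually_ge_atTop 8, tendsto_log_atTop.eventually_ge_atTop 1] with x h1 h2 h3 h4
    have : ∀ u v : ℝ, 0 ≤ u → 0 ≤ v → ‖u‖ ≤ 1 / (|K| + 1) * ‖v‖ → K * u ≤ v := fun u v hu hv h => by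
      rw [norm_of_nonneg hu, norm_of_nonneg hv, one_div_mul_eq_div, le_div_iff₀ (by positivity)] at h
      nlinarith [le_abs_self K]
    exact ⟨h3, h4, this _ _ (by positivity) (by linarith) h1, this _ _ (by positivity) (by positivity) h2⟩
  exact eventually_atTop.1 (tendsto_natCast_atTop_atTop.eventually h1)

lemma yv {a v : ℕ} (ha : 1 ≤ a) (hv : v < a ^ 3) : (a:ℝ) ≤ a + v / a ∧ (a:ℝ) + v / a ≤ 2 * a ^ 2 := by
  have ha' : (1:ℝ) ≤ a := by exact_mod_cast ha
  have h1 : (0:ℝ) ≤ v / a := by positivity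
  have h2 : (v:ℝ) / a ≤ a ^ 2 := by
    rw [div_le_iff₀ (by linarith), ← pow_succ]; exact_mod_cast hv.le
  exact ⟨by linarith, by nlinarith⟩

lemma log_le_mul {x a : ℝ} (n : ℕ) (hx : 0 < x) (h : x ≤ a ^ n) : log x ≤ n * log a := by
  rw [← log_pow]; exact log_le_log hx h

set_option maxHeartbeats 1000000 in
lemma stage {α0 : ℝ} (h0 : 0 < α0) : ∃ A : ℕ, ∀ a ≥ A, ∀ f : ℕ → ℂ, Mf f → ∀ X T : ℝ, 1 ≤ T → T ≤ X → ∀ v < (a ^ 4) ^ 3,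
    ∫ t in Bd f (al α0 a) a \ Bd f (al α0 (a ^ 4)) (a ^ 4), ‖Qx f (a ^ 4 : ℕ) (a ^ 4) v t‖ ^ 2 * ‖Bx f (X * exp (-((a ^ 4 : ℕ) + v / (a ^ 4 : ℕ)))) t‖ ^ 2 ∂nu T ≤ a ^ 3 * (192 * exp (-a)) := by
  obtain ⟨A, hA⟩ := big ((45 + 8 * α0 + 3) / α0 + 2 / α0)
  refine ⟨A, fun a ha f hf X T hT hTX v hv => ?_⟩
  obtain ⟨a8, hL1, hK, -⟩ := hA a ha
  have ha1 : 1 ≤ a := by have : (1:ℝ) ≤ a := by linarith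
                         exact_mod_cast this
  set L := log a
  obtain ⟨b, hb⟩ : ∃ b, b = a ^ 4 := ⟨_, rfl⟩
  rw [← hb] at hv ⊢
  have hbR : (b:ℝ) = (a:ℝ) ^ 4 := by rw [hb]; push_cast; rfl
  obtain ⟨hy1, hy2⟩ := yv (show 1 ≤ b by rw [hb]; exact Nat.one_le_pow _ _ ha1) hv
  obtain ⟨y, hy⟩ : ∃ y : ℝ, y = b + v / b := ⟨_, rfl⟩
  rw [← hy] at hy1 hy2 ⊢
  have hLb : log b = 4 * L := by rw [hbR, log_pow]; norm_num; rfl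
  set α := al α0 a with hα
  set β := al α0 b with hβ
  have hαβ : β = α + 3 / 4 * α0 / L := by
    rw [hβ, hα, al, al, hLb, show log (a:ℝ) = L from rfl]; field_simp; ring
  have hα2 : α ≤ 2 * α0 := by
    rw [hα, al]; have : 0 ≤ 1 / L := by positivity
    nlinarith
  have hα0' : 0 ≤ α := by
    rw [hα, al]; have : 1 / L ≤ 1 := by rw [div_le_one (by linarith)]; exact hL1
    exact mul_nonneg h0.le (by linarith)
  set y' : ℕ → ℝ := fun w => a + w / a with hy'
  set l : ℕ → ℕ := fun w => ⌈y / y' w⌉₊ with hl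
  have hX : 0 < X := by linarith
  set Y := X * exp (-y) with hY
  have hY0 : 0 < Y := by positivity
  haveI := fin_nu (show 0 < T by linarith)
  have hay : (a:ℝ) ^ 4 ≤ y := by rw [← hbR]; exact hy1
  have hyn : 0 ≤ y := le_trans (by positivity) hay
  have key : ∀ w < a ^ 3, exp (-(2 * β * y)) * exp (2 * α * (l w * y' w)) * (64 * (exp 1 * Y / Y) * exp (2 * l w * log (2 * l w) + 3 * l w + 3)) ≤ 192 * exp (-a) ∧ T ≤ Y * exp (l w * y' w) := by
    intro w hw
    obtain ⟨h1, h2⟩ := yv ha1 hw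
    change (a:ℝ) ≤ y' w at h1
    change y' w ≤ _ at h2
    have hyp : 0 < y' w := by linarith
    have hl1 : y ≤ l w * y' w := by rw [← div_le_iff₀ hyp]; exact Nat.le_ceil _
    have hl2 : (l w : ℝ) ≤ y / y' w + 1 := (Nat.ceil_lt_add_one (by positivity)).le
    have hay' : (a:ℝ) ^ 3 ≤ y / a := by rw [le_div_iff₀ (by linarith), ← pow_succ]; exact hay
    have h64 : (64:ℝ) ≤ a ^ 2 := by nlinarith only [a8]
    have ha3 : (64:ℝ) * a ≤ a ^ 3 := by rw [pow_succ]; gcongr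
    have hl3 : (l w : ℝ) ≤ 2 * (y / a) := by
      have : y / y' w ≤ y / a := by gcongr
      linarith
    have hl4 : l w * y' w ≤ y + 2 * a ^ 2 := by
      have := mul_le_mul_of_nonneg_right hl2 hyp.le
      rw [add_mul, div_mul_cancel₀ _ hyp.ne'] at this; linarith
    have hl0 : 0 < (l w : ℝ) := by
      by_contra h; push Not at h
      have := mul_nonpos_of_nonpos_of_nonneg h hyp.le
      linarith [show 0 < (a:ℝ) ^ 4 by positivity]
    have hlog : log (2 * l w) ≤ 9 * L := by
      refine log_le_mul 9 (by linarith) ?_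
      have : y / a ≤ 2 * a ^ 7 := by
        rw [div_le_iff₀ (by linarith)]; rw [hbR] at hy2; linarith [hy2, show (2:ℝ) * a ^ 7 * a = 2 * (a ^ 4) ^ 2 by ring]
      have h7 : (0:ℝ) ≤ (a:ℝ) ^ 7 := by positivity
      calc 2 * (l w : ℝ) ≤ 8 * a ^ 7 := by linarith
        _ ≤ a ^ 2 * a ^ 7 := mul_le_mul_of_nonneg_right (by linarith) h7
        _ = a ^ 9 := by ring
    constructor
    · rw [mul_div_cancel_right₀ _ hY0.ne']
      have hE : -(2 * β * y) + 2 * α * (l w * y' w) + (2 * l w * log (2 * l w) + 3 * l w + 3) ≤ -a := by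
        have e1 : 2 * α * (l w * y' w) ≤ 2 * α * y + 8 * α0 * a ^ 2 := by linarith [mul_le_mul_of_nonneg_left hl4 hα0', mul_le_mul_of_nonneg_right hα2 (sq_nonneg (a:ℝ))]
        have e2 : 2 * l w * log (2 * l w) + 3 * l w ≤ 42 * (y / a) * L := by
          have : 2 * l w * log (2 * l w) ≤ 2 * l w * (9 * L) := by gcongr
          linarith [mul_le_mul_of_nonneg_right hl3 (show 0 ≤ L by linarith), le_mul_of_one_le_right hl0.le hL1]
        have e3 : 8 * α0 * a ^ 2 ≤ 8 * α0 * (y / a) := by gcongr; exact le_trans (by gcongr <;> norm_num; linarith) hay'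
        set z := y / a with hz
        have hz' : y = z * a := by rw [hz]; field_simp
        have hz0 : 0 < z := by linarith
        have e4 : ((45 + 8 * α0 + 3) / α0 + 2 / α0) * L ^ 2 = (50 + 8 * α0) * L ^ 2 / α0 := by ring
        rw [e4, div_le_iff₀ h0] at hK
        have e5 : (48 + 8 * α0) * L + 2 * L ≤ α0 / L * a := by
          rw [div_mul_eq_mul_div, le_div_iff₀ (by linarith), show ((48 + 8 * α0) * L + 2 * L) * L = (50 + 8 * α0) * L ^ 2 by ring]; linarith
        have e6 : 2 * β * y = 2 * α * y + 3 / 2 * (z * (α0 / L * a)) := by rw [hαβ, hz']; ring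
        have e7 := mul_le_mul_of_nonneg_left e5 hz0.le
        have e8 : z ≤ z * L := le_mul_of_one_le_right hz0.le hL1
        have e9 : 8 * α0 * z ≤ 8 * α0 * (z * L) := by gcongr
        have e10 : 0 ≤ z * L * α0 := by positivity
        rw [show z * ((48 + 8 * α0) * L + 2 * L) = 50 * (z * L) + 8 * (z * L * α0) by ring] at e7
        linarith
      have e1 := exp_one_lt_d9
      calc _ = 64 * exp 1 * exp (-(2 * β * y) + 2 * α * (l w * y' w) + (2 * l w * log (2 * l w) + 3 * l w + 3)) := by
            rw [exp_add (-(2 * β * y) + 2 * α * (l w * y' w)), exp_add (-(2 * β * y))]; ring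
        _ ≤ 64 * 3 * exp (-a) := by gcongr; linarith
        _ = _ := by norm_num
    · refine hTX.trans ?_
      rw [hY, mul_assoc, ← exp_add]
      exact le_mul_of_one_le_right hX.le (one_le_exp (by linarith))
  have hint : ∀ w, Integrable (fun t => ‖Qx f a a w t‖ ^ (2 * l w) * ‖Bx f Y t‖ ^ 2) (nu T) := fun w => int_dd _ _ _ _ _ _
  set F : ℝ → ℝ := fun t => ∑ w ∈ range (a ^ 3), exp (-(2 * β * y)) * exp (2 * α * (l w * y' w)) * (‖Qx f a a w t‖ ^ (2 * l w) * ‖Bx f Y t‖ ^ 2) with hF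
  have hFi : Integrable F (nu T) := integrable_finsetSum _ fun w _ => (hint w).const_mul _
  calc _ ≤ ∫ t in Bd f α a \ Bd f β b, F t ∂nu T := by
        refine setIntegral_mono_on (int_dd _ _ _ _ _ _).integrableOn hFi.integrableOn ((Bd_meas _ _ _).diff (Bd_meas _ _ _)) fun t ht => ?_
        have h1 : ‖Qx f b b v t‖ ≤ exp (-(β * y)) := by
          by_contra h; push Not at h
          exact ht.2 ⟨v, hv, by rw [← hy]; exact h⟩
        have h2 := Bd_le ht.1 l
        calc ‖Qx f b b v t‖ ^ 2 * ‖Bx f Y t‖ ^ 2 ≤ exp (-(β * y)) ^ 2 * ‖Bx f Y t‖ ^ 2 * 1 := by rw [mul_one]; gcongr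
          _ ≤ exp (-(β * y)) ^ 2 * ‖Bx f Y t‖ ^ 2 * _ := mul_le_mul_of_nonneg_left h2 (by positivity)
          _ = F t := by
            rw [hF, mul_sum]; refine sum_congr rfl fun w _ => ?_
            rw [← exp_nat_mul, show ((2:ℕ):ℝ) * -(β * y) = -(2 * β * y) by push_cast; ring]; ring
    _ ≤ ∫ t, F t ∂nu T := setIntegral_le_integral hFi (Eventually.of_forall fun t => sum_nonneg fun _ _ => by positivity)
    _ = ∑ w ∈ range (a ^ 3), exp (-(2 * β * y)) * exp (2 * α * (l w * y' w)) * ∫ t, ‖Qx f a a w t‖ ^ (2 * l w) * ‖Bx f Y t‖ ^ 2 ∂nu T := by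
        rw [hF, integral_finsetSum _ fun w _ => (hint w).const_mul _]
        simp_rw [integral_const_mul]
    _ ≤ ∑ w ∈ range (a ^ 3), 192 * exp (-a) := by
        refine sum_le_sum fun w hw => ?_
        obtain ⟨k1, k2⟩ := key w (mem_range.1 hw)
        exact (mul_le_mul_of_nonneg_left (mom hf ha1 w (l w) (fdn hf) hY0 (by positivity) hT k2) (by positivity)).trans k1
    _ = _ := by simp

end MR
namespace MR
open MeasureTheory

lemma sinc_half {x : ℝ} (h : |x| ≤ 1 / 2) : 1 / 2 ≤ sinc x ^ 2 := by
  have : 1 - x ^ 2 / 4 ≤ sinc x := by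
    wlog hx : 0 ≤ x generalizing x
    · have := this (x := -x) (by rwa [abs_neg]) (by linarith)
      rwa [Real.sinc_neg, neg_sq] at this
    rcases eq_or_lt_of_le hx with h0 | h0
    · rw [← h0]; simp
    rw [abs_of_pos h0] at h
    rw [sinc_of_ne_zero h0.ne', le_div_iff₀ h0]
    linarith [Real.sin_gt_sub_cube h0, show 0 < x ^ 3 by positivity, show (1 - x ^ 2 / 4) * x = x - x ^ 3 / 4 by ring]
  have h2 : x ^ 2 ≤ 1 / 4 := by rw [← sq_abs]; nlinarith [abs_nonneg x]
  nlinarith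

lemma Umeas {c : ℝ} (hc : 0 < c) (hc1 : c ≤ 1) : ∃ A : ℕ, ∀ a ≥ A, ∀ f : ℕ → ℂ, Mf f → ∀ X : ℝ, 1 < X → (a:ℝ) ^ 4 ≤ log X → log X ≤ (a:ℝ) ^ 16 →
    volume.real (Bd f (al (c / 64) a) a ∩ Set.Icc (-(X ^ 2)) (X ^ 2)) ≤ X ^ c := by
  obtain ⟨A, hA⟩ := big (256 * exp 3 + 560 / c)
  refine ⟨A, fun a ha f hf X hX hX1 hX2 => ?_⟩
  obtain ⟨a8, hL1, hK, hK2⟩ := hA a ha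
  have ha1 : 1 ≤ a := by have : (1:ℝ) ≤ a := by linarith
                         exact_mod_cast this
  set L := log a
  set Z := log X with hZ
  have hXZ : X = exp Z := (exp_log (by linarith)).symm
  set α := al (c / 64) a with hα
  have hα2 : α ≤ c / 32 := by
    rw [hα, al]; have : 0 ≤ 1 / L := by positivity
    nlinarith
  have hα0' : 0 ≤ α := by
    rw [hα, al]; have : 1 / L ≤ 1 := by rw [div_le_one (by linarith)]; exact hL1
    exact mul_nonneg (by positivity) (by linarith)
  have h560 : 560 * L ≤ c * a := by
    have : 560 / c * L ^ 2 ≤ a := by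
      refine le_trans ?_ hK; gcongr; linarith [exp_pos 3]
    rw [div_mul_eq_mul_div, div_le_iff₀ hc] at this
    nlinarith only [this, hL1]
  have h64 : (64:ℝ) ≤ a ^ 2 := by nlinarith only [a8]
  have haZ : (64:ℝ) * a ^ 2 ≤ Z := by
    refine le_trans ?_ hX1
    rw [show (a:ℝ) ^ 4 = a ^ 2 * a ^ 2 by ring]; gcongr
  have haZ' : 8 * (a:ℝ) ≤ Z := by nlinarith only [haZ, a8]
  set y' : ℕ → ℝ := fun w => a + w / a with hy'
  set l : ℕ → ℕ := fun w => ⌈3 * Z / y' w⌉₊ with hl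
  set b : ℕ → ℂ := fun n => if n = 1 then 1 else 0 with hb
  have hb1 : ∀ n, ‖b n‖ ≤ 1 / n := fun n => by
    by_cases h : n = 1
    · simp [hb, h]
    · simp [hb, h]
  have hb2 : ∀ t, ‖dp b (blk (1 / 2) 1) t‖ ^ 2 = 1 := fun t => by
    have : blk (1 / 2) 1 = {1} := by
      unfold blk; rw [Nat.floor_one, Nat.floor_eq_zero.2 (by norm_num)]; rfl
    rw [this]; simp [dp, hb, tw_one]
  have hX20 : 1 ≤ X ^ 2 := one_le_pow₀ hX.le
  haveI := fin_nu (show 0 < X ^ 2 by positivity)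
  have key : ∀ w < a ^ 3, exp (2 * α * (l w * y' w)) * (64 * (1 / (1 / 2)) * exp (2 * l w * log (2 * l w) + 3 * l w + 3)) ≤ 128 * exp 3 * exp (c * Z / 2) ∧ X ^ 2 ≤ 1 / 2 * exp (l w * y' w) := by
    intro w hw
    obtain ⟨h1, h2⟩ := yv ha1 hw
    change (a:ℝ) ≤ y' w at h1
    change y' w ≤ _ at h2
    have hyp : 0 < y' w := by linarith
    have hl1 : 3 * Z ≤ l w * y' w := by rw [← div_le_iff₀ hyp]; exact Nat.le_ceil _
    have hl2 : (l w : ℝ) ≤ 3 * Z / y' w + 1 := (Nat.ceil_lt_add_one (div_nonneg (by linarith) hyp.le)).le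
    set z := Z / a with hz
    have hz1 : 1 ≤ z := by rw [hz, le_div_iff₀ (by linarith)]; linarith
    have hl3 : (l w : ℝ) ≤ 4 * z := by
      have : 3 * Z / y' w ≤ 3 * Z / a := div_le_div_of_nonneg_left (by linarith) (by linarith) h1
      simp only [mul_div_assoc] at this hl2; linarith
    have hl4 : l w * y' w ≤ 3 * Z + 2 * a ^ 2 := by
      have := mul_le_mul_of_nonneg_right hl2 hyp.le
      rw [add_mul, div_mul_cancel₀ _ hyp.ne'] at this; linarith
    have hl0 : 0 < (l w : ℝ) := by
      by_contra h; push Not at h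
      have := mul_nonpos_of_nonpos_of_nonneg h hyp.le
      linarith
    have hlog : log (2 * l w) ≤ 16 * L := by
      refine log_le_mul 16 (by linarith) (le_trans (show 2 * (l w:ℝ) ≤ 8 * z by linarith) ?_)
      rw [hz, mul_div_assoc', div_le_iff₀ (by linarith)]
      nlinarith only [hX2, a8, show (0:ℝ) ≤ (a:ℝ) ^ 16 by positivity]
    constructor
    · have hE : 2 * α * (l w * y' w) + (2 * l w * log (2 * l w) + 3 * l w + 3) ≤ 3 + c * Z / 2 := by
        have e1 : 2 * α * (l w * y' w) ≤ c * Z / 4 := by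
          calc 2 * α * (l w * y' w) ≤ 2 * (c / 32) * (4 * Z) := mul_le_mul (by linarith) (by linarith) (by positivity) (by positivity)
            _ = _ := by ring
        have e2 : 2 * l w * log (2 * l w) + 3 * l w ≤ z * (140 * L) := by
          have : 2 * l w * log (2 * l w) ≤ 2 * l w * (16 * L) := by gcongr
          linarith [mul_le_mul_of_nonneg_right hl3 (show 0 ≤ L by linarith), le_mul_of_one_le_right hl0.le hL1]
        have e3 : z * (140 * L) ≤ z * (c * a / 4) := by gcongr; linarith
        have e4 : z * (c * a / 4) = c * Z / 4 := by rw [hz]; field_simp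
        linarith
      calc _ = 128 * exp (2 * α * (l w * y' w) + (2 * l w * log (2 * l w) + 3 * l w + 3)) := by
            rw [exp_add (2 * α * (l w * y' w))]; ring
        _ ≤ 128 * exp (3 + c * Z / 2) := by gcongr
        _ = _ := by rw [exp_add]; ring
    · have : 2 ≤ exp Z := by linarith [add_one_le_exp Z]
      calc X ^ 2 ≤ 1 / 2 * exp (3 * Z) := by
            rw [show 3 * Z = ((3:ℕ):ℝ) * Z by norm_num, exp_nat_mul, hXZ]; nlinarith only [this, sq_nonneg (exp Z)]
        _ ≤ _ := by gcongr
  have hint : ∀ w, Integrable (fun t => ‖Qx f a a w t‖ ^ (2 * l w) * ‖dp b (blk (1 / 2) 1) t‖ ^ 2) (nu (X ^ 2)) := fun w => int_dd _ _ _ _ _ _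
  set F : ℝ → ℝ := fun t => ∑ w ∈ range (a ^ 3), exp (2 * α * (l w * y' w)) * (‖Qx f a a w t‖ ^ (2 * l w) * ‖dp b (blk (1 / 2) 1) t‖ ^ 2) with hF
  have hFi : Integrable F (nu (X ^ 2)) := integrable_finsetSum _ fun w _ => (hint w).const_mul _
  have hF0 : ∀ t, 0 ≤ F t := fun t => sum_nonneg fun _ _ => by positivity
  set U := Bd f α a ∩ Set.Icc (-(X ^ 2)) (X ^ 2) with hU
  have hUm : MeasurableSet U := (Bd_meas _ _ _).inter measurableSet_Icc
  have s1 : volume.real U ≤ 2 * ∫ t, F t ∂nu (X ^ 2) := by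
    rw [← integral_indicator_one hUm, integral_nu, ← integral_const_mul]
    have hFs : Integrable (fun t => 2 * (sinc (t / (2 * X ^ 2)) ^ 2 • F t)) volume := by
      refine Integrable.const_mul ?_ _
      have hFc : Continuous F := continuous_finsetSum _ fun w _ => continuous_const.mul (((Qx_cont f a a w).norm.pow _).mul ((continuous_dp _ _).norm.pow _))
      have hFb : ∃ D, ∀ t, ‖F t‖ ≤ D := by
        refine ⟨∑ w ∈ range (a ^ 3), exp (2 * α * (l w * y' w)) * ((∑ n ∈ pw a a w, ‖f n / n‖) ^ (2 * l w) * 1), fun t => ?_⟩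
        rw [norm_of_nonneg (hF0 t)]
        refine sum_le_sum fun w _ => ?_
        rw [hb2]; gcongr; exact norm_dp_le _ _ t
      obtain ⟨D, hD⟩ := hFb
      exact (integrable_sinc_T (show 0 < X ^ 2 by positivity)).mul_bdd hFc.aestronglyMeasurable (Eventually.of_forall hD)
    refine integral_mono_of_nonneg (Eventually.of_forall fun t => Set.indicator_nonneg (fun _ _ => zero_le_one) t) hFs (Eventually.of_forall fun t => ?_)
    have := hF0 t
    change U.indicator 1 t ≤ 2 * (sinc (t / (2 * X ^ 2)) ^ 2 * F t)
    by_cases ht : t ∈ U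
    swap
    · rw [Set.indicator_of_notMem ht]; positivity
    rw [Set.indicator_of_mem ht]
    have h1 : 1 ≤ F t := by
      have := Bd_le ht.1 l
      simpa only [hF, hb2, mul_one] using this
    have h2 := sinc_half (x := t / (2 * X ^ 2)) (by
      rw [abs_div, abs_of_pos (show 0 < 2 * X ^ 2 by positivity), div_le_iff₀ (by positivity)]
      have := abs_le.2 ht.2; linarith)
    rw [Pi.one_apply]; nlinarith only [h1, h2]
  calc volume.real U ≤ 2 * ∑ w ∈ range (a ^ 3), exp (2 * α * (l w * y' w)) * ∫ t, ‖Qx f a a w t‖ ^ (2 * l w) * ‖dp b (blk (1 / 2) 1) t‖ ^ 2 ∂nu (X ^ 2) := by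
        rw [hF, integral_finsetSum _ fun w _ => (hint w).const_mul _] at s1
        simp_rw [integral_const_mul] at s1; exact s1
    _ ≤ 2 * ∑ w ∈ range (a ^ 3), 128 * exp 3 * exp (c * Z / 2) := by
        refine mul_le_mul_of_nonneg_left (sum_le_sum fun w hw => ?_) zero_le_two
        obtain ⟨k1, k2⟩ := key w (mem_range.1 hw)
        exact (mul_le_mul_of_nonneg_left (mom hf ha1 w (l w) hb1 (by norm_num) (by norm_num) hX20 k2) (by positivity)).trans k1
    _ = 256 * exp 3 * a ^ 3 * exp (c * Z / 2) := by simp; ring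
    _ ≤ exp (c * Z / 2) * exp (c * Z / 2) := by
        gcongr
        calc 256 * exp 3 * (a:ℝ) ^ 3 ≤ (256 * exp 3 + 560 / c) * (a:ℝ) ^ 28 := by
              gcongr
              · linarith [show 0 ≤ 560 / c by positivity]
              · linarith
              · norm_num
          _ ≤ _ := hK2
          _ ≤ _ := by
              gcongr
              nlinarith only [h560, hL1, a8, haZ, hc, mul_le_mul_of_nonneg_left haZ hc.le]
    _ = X ^ c := by rw [← exp_add, rpow_def_of_pos (by linarith)]; congr 1; ring

lemma partE {c : ℝ} (hc : 0 < c) (hc1 : c ≤ 1) {f : ℕ → ℂ} (hf : Mf f) {ε : ℝ} (hε : 0 < ε) : ∃ h ≥ (1:ℝ), ∃ X0 ≥ (1:ℝ), ∀ X ≥ X0, h ≤ X ∧ ∃ U, MeasurableSet U ∧ U ⊆ Set.Icc (-(X ^ 2)) (X ^ 2) ∧ volume.real U ≤ X ^ c ∧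
    ∫ t, ‖Bx f X t‖ ^ 2 ∂nu (X / h) ≤ ε + ∫ t in U, ‖Bx f X t‖ ^ 2 := by
  obtain ⟨K, hK, A1, hA3, h1⟩ := stg
  obtain ⟨A2, h2⟩ := stage (show 0 < c / 64 by positivity)
  obtain ⟨A3, h3⟩ := Umeas hc hc1
  obtain ⟨A4, h4⟩ := big 400
  obtain ⟨A5, h5⟩ := eventually_atTop.1 ((tendsto_log_atTop.comp tendsto_natCast_atTop_atTop).eventually_ge_atTop ((2 * K + 200) / ε))
  obtain ⟨A6, h6⟩ := eventually_atTop.1 (tendsto_natCast_atTop_atTop.eventually ((isLittleO_pow_exp_pos_mul_atTop 7 (show 0 < c / 32 by positivity)).def (show (0:ℝ) < 1 / 400 by norm_num)))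
  obtain ⟨a, ha⟩ : ∃ a, a = A1 + A2 + A3 + A4 + A5 + A6 := ⟨_, rfl⟩
  have L1 : ∀ b ≥ a, (8:ℝ) ≤ b ∧ 1 ≤ log b := fun b hb => ⟨(h4 b (by omega)).1, (h4 b (by omega)).2.1⟩
  obtain ⟨a8, hL1⟩ := L1 a le_rfl
  have ha1 : 1 ≤ a := by omega
  refine ⟨exp (2 * a ^ 2), one_le_exp (by positivity), exp (a ^ 4), one_le_exp (by positivity), fun X hX => ?_⟩
  have hX0 : 0 < X := (exp_pos _).trans_le hX
  have hlX : (a:ℝ) ^ 4 ≤ log X := (Real.le_log_iff_exp_le hX0).2 hX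
  have h82 : 8 * (a:ℝ) ^ 2 ≤ a ^ 4 := by nlinarith only [a8, sq_nonneg (a:ℝ), mul_self_nonneg ((a:ℝ) ^ 2 - 8)]
  set h := exp (2 * (a:ℝ) ^ 2) with hh
  have hhX : h ≤ X := le_trans (exp_le_exp.2 (by nlinarith only [h82, sq_nonneg (a:ℝ)])) hX
  have hh0 : 0 < h := exp_pos _
  have hh1 : 1 ≤ h := one_le_exp (by positivity)
  refine ⟨hhX, ?_⟩
  obtain ⟨T, hT⟩ : ∃ T, T = X / h := ⟨_, rfl⟩
  rw [← hT]
  have hT1 : 1 ≤ T := by rw [hT, le_div_iff₀ hh0]; linarith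
  have hTX : T ≤ X := by rw [hT]; exact div_le_self hX0.le hh1
  have hX1 : 1 ≤ X := hT1.trans hTX
  haveI := fin_nu (show 0 < T by linarith)
  set g : ℝ → ℝ := fun t => ‖Bx f X t‖ ^ 2 with hg
  have hgi : Integrable g (nu T) := int_dp _ _
  have hg0 : ∀ t, 0 ≤ g t := fun t => by positivity
  have fin : ∀ b : ℕ, a ≤ b → (b:ℝ) ^ 4 ≤ log X → log X ≤ (b:ℝ) ^ 16 → ∃ U, MeasurableSet U ∧ U ⊆ Set.Icc (-(X ^ 2)) (X ^ 2) ∧ volume.real U ≤ X ^ c ∧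
      ∫ t in Bd f (al (c / 64) b) b, g t ∂nu T ≤ (K + 2) / log b + 144 / h + ∫ t in U, g t := by
    intro b hab hb4 hb16
    obtain ⟨b8, hbL⟩ := L1 b hab
    have hlX' : (8:ℝ) ≤ log X := (b8.trans (le_self_pow₀ (by linarith) (by norm_num))).trans hb4
    set S := Bd f (al (c / 64) b) b with hS
    set I := Set.Icc (-(X ^ 2)) (X ^ 2)
    refine ⟨S ∩ I, (Bd_meas _ _ _).inter measurableSet_Icc, Set.inter_subset_right, h3 b (by omega) f hf X (by by_contra hn; linarith [Real.log_nonpos hX0.le (not_lt.1 hn)]) hb4 hb16, ?_⟩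
    rw [← integral_inter_add_sdiff (measurableSet_Icc : MeasurableSet I) hgi.integrableOn]
    have hle : nu T ≤ volume := by
      unfold nu
      conv_rhs => rw [← withDensity_one (μ := (volume : Measure ℝ))]
      refine withDensity_mono (Eventually.of_forall fun t => ?_)
      rw [Pi.one_apply, ENNReal.ofReal_le_one, sq_le_one_iff_abs_le_one]
      exact Real.abs_sinc_le_one _
    haveI : IsFiniteMeasure ((volume : Measure ℝ).restrict (S ∩ I)) := ⟨by
      rw [Measure.restrict_apply_univ]; exact (measure_mono Set.inter_subset_right).trans_lt (by simp [I])⟩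
    have k1 : ∫ t in S ∩ I, g t ∂nu T ≤ ∫ t in S ∩ I, g t := integral_mono_measure (Measure.restrict_mono_measure hle _) (Eventually.of_forall hg0) (int_dp _ _)
    have k2 : ∫ t in S \ I, g t ∂nu T ≤ 144 / h := by
      have m := nu_tail (show 0 < T by linarith) (show 0 < X ^ 2 by positivity)
      have hsub : S \ I ⊆ {t | X ^ 2 < |t|} := fun t ht => by
        by_contra hn; exact ht.2 (abs_le.1 (not_lt.1 hn))
      have k3 := norm_setIntegral_le_of_norm_le_const (μ := nu T) (s := S \ I) (f := g) (C := 9) (measure_lt_top _ _) fun t _ => by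
        rw [norm_of_nonneg (hg0 t)]; nlinarith only [Bx_le hf hX1 t, norm_nonneg (Bx f X t)]
      calc _ ≤ 9 * (nu T).real (S \ I) := (le_abs_self _).trans k3
        _ ≤ 9 * (16 * T ^ 2 / X ^ 2) := by gcongr; exact (measureReal_mono hsub).trans m
        _ = 144 / h * (1 / h) := by rw [hT]; field_simp; norm_num
        _ ≤ 144 / h * 1 := by gcongr; rw [div_le_one hh0]; exact hh1
        _ = _ := mul_one _
    have : 0 ≤ (K + 2) / log b := by positivity
    linarith
  have chain : ∀ n b : ℕ, a ≤ b → (b:ℝ) ^ 4 ≤ log X → log X ≤ b + n → ∃ U, MeasurableSet U ∧ U ⊆ Set.Icc (-(X ^ 2)) (X ^ 2) ∧ volume.real U ≤ X ^ c ∧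
      ∫ t in Bd f (al (c / 64) b) b, g t ∂nu T ≤ (K + 2) / log b + 144 / h + ∫ t in U, g t := by
    intro n
    induction n with
    | zero =>
      intro b hab hb4 hbn
      obtain ⟨b8, hbL⟩ := L1 b hab
      exact fin b hab hb4 (hbn.trans (by rw [Nat.cast_zero, add_zero]; exact le_self_pow₀ (by linarith) (by norm_num)))
    | succ n ih =>
      intro b hab hb4 hbn
      obtain ⟨b8, hbL⟩ := L1 b hab
      rcases le_or_gt (log X) ((b:ℝ) ^ 16) with hfin | hfin
      · exact fin b hab hb4 hfin
      obtain ⟨U, hU1, hU2, hU3, hU4⟩ := ih (b ^ 4) (hab.trans (Nat.le_self_pow (by norm_num) b)) (by push_cast; rw [← pow_mul]; exact hfin.le) (by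
        push_cast at hbn ⊢
        have : (b:ℝ) + 1 ≤ b ^ 4 := by nlinarith only [b8, sq_nonneg ((b:ℝ) ^ 2 - b), sq_nonneg (b:ℝ)]
        linarith)
      refine ⟨U, hU1, hU2, hU3, ?_⟩
      have hst := h1 f hf (b ^ 4) (by have := Nat.le_self_pow (show 4 ≠ 0 by norm_num) b; omega) X T hT1 hTX (by
        push_cast; refine le_trans ?_ hfin.le
        have : (8:ℝ) ≤ (b:ℝ) ^ 8 := b8.trans (le_self_pow₀ (by linarith) (by norm_num))
        nlinarith only [this]) _ _ (by positivity) (h2 b (by omega) f hf X T hT1 hTX)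
      have hsp : ∫ t in Bd f (al (c / 64) b) b, g t ∂nu T ≤ ∫ t in Bd f (al (c / 64) b) b \ Bd f (al (c / 64) (b ^ 4)) (b ^ 4), g t ∂nu T + ∫ t in Bd f (al (c / 64) (b ^ 4)) (b ^ 4), g t ∂nu T := by
        rw [← integral_inter_add_sdiff (Bd_meas f (al (c / 64) (b ^ 4)) (b ^ 4)) hgi.integrableOn, add_comm]
        exact add_le_add_right (setIntegral_mono_set hgi.integrableOn (Eventually.of_forall hg0) Set.inter_subset_right.eventuallyLE) _
      have hlb : log (b ^ 4 : ℕ) = 4 * log b := by push_cast; rw [log_pow]; norm_num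
      rw [hlb] at hst hU4
      have e1 : 2 * ((b ^ 4 : ℕ):ℝ) ^ 6 * (b ^ 3 * (192 * exp (-b))) ≤ 1 / log b := by
        have e2 := (h4 b (by omega)).2.2.2
        rw [le_div_iff₀ (by linarith), exp_neg]
        have : log b ≤ b := log_le_self (by linarith)
        calc 2 * ((b ^ 4 : ℕ):ℝ) ^ 6 * (b ^ 3 * (192 * (exp b)⁻¹)) * log b ≤ 2 * ((b ^ 4 : ℕ):ℝ) ^ 6 * (b ^ 3 * (192 * (exp b)⁻¹)) * b := by gcongr
          _ = 384 * (b:ℝ) ^ 28 / exp b := by push_cast; ring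
          _ ≤ 1 := by rw [div_le_one (exp_pos _)]; linarith [show (0:ℝ) ≤ (b:ℝ) ^ 28 by positivity]
      have e2 : K / (4 * log b) + (K + 2) / (4 * log b) + 1 / log b ≤ (K + 2) / log b := by
        rw [show K / (4 * log b) + (K + 2) / (4 * log b) + 1 / log b = (K / 2 + 3 / 2) / log b by ring]
        exact div_le_div_of_nonneg_right (by linarith) (by linarith)
      linarith
  obtain ⟨U, hU1, hU2, hU3, hU4⟩ := chain ⌈log X⌉₊ a le_rfl hlX ((Nat.le_ceil _).trans (by linarith))
  refine ⟨U, hU1, hU2, hU3, ?_⟩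
  have hfst := h1 f hf a (by omega) X T hT1 hTX (by linarith) (Bd f (al (c / 64) a) a)ᶜ (exp (-(c / 32 * a)) * 192) (by positivity) (fun v hv => by
    obtain ⟨y1, y2⟩ := yv ha1 hv
    set y : ℝ := a + v / a with hy
    have hTy : T ≤ X * exp (-y) := by
      rw [hT, div_eq_mul_inv, hh, ← exp_neg]; gcongr
    have hB := LS_Bx hf (by norm_num) (hT1.trans hTy) (LS_nu hT1 hTy)
    have hal : c / 64 ≤ al (c / 64) a := by
      have : 1 / log a ≤ 1 := by rw [div_le_one (by linarith)]; exact hL1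
      unfold al; nlinarith only [this, hc]
    calc _ ≤ ∫ t in (Bd f (al (c / 64) a) a)ᶜ, exp (-(c / 32 * a)) * ‖Bx f (X * exp (-y)) t‖ ^ 2 ∂nu T := by
          refine setIntegral_mono_on (int_dd _ _ _ _ _ _).integrableOn ((int_dp _ _).const_mul _).integrableOn (Bd_meas _ _ _).compl fun t ht => ?_
          gcongr
          have : ‖Qx f a a v t‖ ≤ exp (-(al (c / 64) a * y)) := by
            by_contra h; push Not at h
            exact ht ⟨v, hv, h⟩
          calc ‖Qx f a a v t‖ ^ 2 ≤ exp (-(al (c / 64) a * y)) ^ 2 := by gcongr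
            _ ≤ _ := by
              rw [← exp_nat_mul]; gcongr
              have := mul_le_mul hal y1 (by positivity) (le_trans (by positivity) hal)
              push_cast; linarith
      _ ≤ ∫ t, exp (-(c / 32 * a)) * ‖Bx f (X * exp (-y)) t‖ ^ 2 ∂nu T := setIntegral_le_integral ((int_dp _ _).const_mul _) (Eventually.of_forall fun t => by positivity)
      _ ≤ _ := by rw [integral_const_mul]; gcongr; linarith)
  have hlp : 0 < log a := by linarith
  have e1 : 2 * (a:ℝ) ^ 6 * (exp (-(c / 32 * a)) * 192) ≤ 1 / log a := by
    have e2 := h6 a (by omega)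
    rw [norm_of_nonneg (by positivity), norm_of_nonneg (by positivity)] at e2
    rw [le_div_iff₀ hlp, exp_neg]
    calc 2 * (a:ℝ) ^ 6 * ((exp (c / 32 * a))⁻¹ * 192) * log a ≤ 2 * (a:ℝ) ^ 6 * ((exp (c / 32 * a))⁻¹ * 192) * a := by gcongr; exact log_le_self (by linarith)
      _ = 384 * (a:ℝ) ^ 7 / exp (c / 32 * a) := by ring
      _ ≤ 1 := by rw [div_le_one (exp_pos _)]; linarith [show (0:ℝ) ≤ (a:ℝ) ^ 7 by positivity]
  have e2 : 144 / h ≤ 144 / log a := by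
    gcongr
    refine (log_le_self (by linarith)).trans (le_trans ?_ (add_one_le_exp _))
    nlinarith only [a8]
  have e3 : (2 * K + 200) / log a ≤ ε := by
    rw [div_le_iff₀ hlp]; have : (2 * K + 200) / ε ≤ log a := h5 a (by omega)
    rw [div_le_iff₀ hε] at this; linarith [mul_comm ε (log a)]
  rw [← integral_add_compl (Bd_meas f (al (c / 64) a) a) hgi]
  have e4 : (K + 2) / log a + 144 / log a + 1 / log a + K / log a ≤ (2 * K + 200) / log a := by
    rw [← add_div, ← add_div, ← add_div]; exact div_le_div_of_nonneg_right (by linarith) hlp.le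
  linarith

end MR
namespace MR
open MeasureTheory

lemma fubI (c : ℕ → ℂ) (S : Finset ℕ) (ρ : Measure ℝ) [IsFiniteMeasure ρ] :
    Integrable (fun p : ℝ × ℝ => ‖win (fun n => c n * tw p.1 n) S 1 p.2‖ ^ 2) (ρ.prod volume) := by
  have : Integrable (fun p : ℝ × ℝ => ((‖win (fun n => c n * tw p.1 n) S 1 p.2‖ ^ 2 : ℝ) : ℂ)) (ρ.prod volume) := by
    unfold win
    simp_rw [sq_expand]
    refine integrable_finsetSum _ fun m _ => integrable_finsetSum _ fun n _ => ?_
    have h1 : Integrable (fun t => tw t m * conj (tw t n)) ρ := by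
      refine int_bdd ((continuous_tw m).mul (continuous_conj.comp (continuous_tw n))) 1 fun t => by simp [norm_tw]
    refine (h1.mul_prod (win_prod_int c 1 m n)).congr (Eventually.of_forall fun p => ?_)
    simp only [Set.indicator]
    split_ifs <;> simp only [map_mul, map_zero, mul_zero, zero_mul]
    ring
  exact this.re

noncomputable def Gv (c : ℕ → ℂ) (S : Finset ℕ) (ρ : Measure ℝ) (v : ℝ) : ℝ := ∫ t, ‖win (fun n => c n * tw t n) S 1 v‖ ^ 2 ∂ρ

lemma Gv_nonneg (c S ρ v) : 0 ≤ Gv c S ρ v := integral_nonneg fun _ => by positivity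
lemma Gv_int (c S) (ρ : Measure ℝ) [IsFiniteMeasure ρ] : Integrable (Gv c S ρ) := (fubI c S ρ).integral_prod_right

lemma tw_add (t s : ℝ) (n : ℕ) : tw (t + s) n = tw t n * tw s n := by
  unfold tw; rw [← Complex.exp_add]; congr 1; push_cast; ring

lemma dp_shift (c : ℕ → ℂ) (S : Finset ℕ) (t s : ℝ) : dp c S (t + s) = dp (fun n => c n * tw t n) S s :=
  sum_congr rfl fun n _ => by rw [tw_add]; ring

lemma fub_eq (c S) (ρ : Measure ℝ) [IsFiniteMeasure ρ] : ∫ t, ∫ s, ‖dp c S (t + s)‖ ^ 2 ∂nu 1 ∂ρ = 2 * π * ∫ v, Gv c S ρ v := by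
  have : ∀ t, ∫ s, ‖dp c S (t + s)‖ ^ 2 ∂nu 1 = 2 * π * ∫ v, ‖win (fun n => c n * tw t n) S 1 v‖ ^ 2 := by
    intro t
    simp_rw [dp_shift]
    rw [parseval one_pos]; norm_num
  simp_rw [this]
  rw [integral_const_mul, integral_integral_swap (fubI c S ρ)]
  rfl

lemma fub_int (c S) (ρ : Measure ℝ) [IsFiniteMeasure ρ] : Integrable (fun t => ∫ s, ‖dp c S (t + s)‖ ^ 2 ∂nu 1) ρ := by
  have : ∀ t, ∫ s, ‖dp c S (t + s)‖ ^ 2 ∂nu 1 = 2 * π * ∫ v, ‖win (fun n => c n * tw t n) S 1 v‖ ^ 2 := by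
    intro t
    simp_rw [dp_shift]
    rw [parseval one_pos]; norm_num
  simp_rw [this]
  exact (fubI c S ρ).integral_prod_left.const_mul _

lemma win_tw (c : ℕ → ℂ) (S : Finset ℕ) (t v : ℝ) : win (fun n => c n * tw t n) S 1 v = dp c (S.filter (fun n : ℕ => v < log n ∧ log n ≤ v + 1)) t := by
  rw [win_eq]; rfl

lemma MD (c S) (ρ : Measure ℝ) {A C : ℝ} (hA : 1 ≤ A) (hLS : ∀ y, A ≤ y → LS ρ C y) (hS : ∀ n ∈ S, A < (n:ℕ)) [IsFiniteMeasure ρ] :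
    ∫ v, Gv c S ρ v ≤ C * ∑ n ∈ S, n * ‖c n‖ ^ 2 := by
  have hi : ∀ n : ℕ, Integrable ((Set.Ico (log n - 1) (log n)).indicator (fun _ => (n:ℝ) * ‖c n‖ ^ 2)) := fun n =>
    (integrable_indicator_iff measurableSet_Ico).2 (integrableOn_const (by simp))
  have h1 : ∀ v, Gv c S ρ v ≤ C * ∑ n ∈ S, (Set.Ico (log n - 1) (log n)).indicator (fun _ => (n:ℝ) * ‖c n‖ ^ 2) v := by
    intro v
    unfold Gv
    simp_rw [win_tw]
    refine (hLS (max A (exp v)) (le_max_left _ _) c _ fun n hn => ?_).trans_eq ?_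
    · obtain ⟨hn, h2, h3⟩ := mem_filter.1 hn
      have hAn := hS n hn
      have hn0 : (0:ℝ) < n := by linarith
      refine ⟨max_lt hAn ((lt_log_iff_exp_lt hn0).1 h2), ?_⟩
      have := (log_le_iff_le_exp hn0).1 h3
      have h5 : exp (v + 1) ≤ exp 2 * exp v := by rw [← exp_add]; exact exp_le_exp.2 (by linarith)
      have h6 : exp 2 * exp v ≤ exp 2 * max A (exp v) := by gcongr; exact le_max_right _ _
      linarith
    · rw [sum_filter]
      congr 1
      refine sum_congr rfl fun n _ => ?_
      simp only [Set.indicator, Set.mem_Ico]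
      refine if_congr ⟨fun h => ⟨by linarith [h.2], h.1⟩, fun h => ⟨h.2, by linarith [h.1]⟩⟩ rfl rfl
  refine (integral_mono (Gv_int c S ρ) ((integrable_finsetSum _ fun n _ => hi n).const_mul C) h1).trans_eq ?_
  rw [integral_const_mul, integral_finsetSum _ fun n _ => hi n]
  congr 1
  refine sum_congr rfl fun n _ => ?_
  rw [integral_indicator_const _ measurableSet_Ico]; simp

def Cl (f : ℕ → ℂ) : Prop := ∃ C0 : ℝ, 0 < C0 ∧ ∀ δ' δ : ℝ, 0 < δ' → δ' ≤ δ → ∃ X0 : ℝ, ∀ X : ℝ, X0 ≤ X → ∀ t : ℝ, |t| ≤ 3 * X ^ 2 →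
  (∑ p ∈ prs (X ^ δ') (X ^ δ), f p / p * tw t p).re ≤ 3 / 4 * log (δ / δ') + C0

lemma BB_le {f : ℕ → ℂ} (hf : Mf f) {A B : ℝ} (hA : 1 ≤ A) (hB : A ≤ B) (t : ℝ) : ‖BB f A B t‖ ≤ log (B / A) + 2 := by
  refine (norm_dp_le _ _ t).trans ((sum_le_sum fun n _ => fdn hf n).trans ?_)
  have h1 := (abs_le.1 (harm hA hB)).2
  have : 2 / A ≤ 2 := by rw [div_le_iff₀ (by linarith)]; linarith
  linarith

lemma Ls_prs (C1 : ℝ) (hC1 : ∀ x y, 2 ≤ x → x ≤ y → |∑ p ∈ prs x y, (p:ℝ)⁻¹ - log (log y / log x)| ≤ C1) {a b : ℝ} (ha : log 2 ≤ a) (hab : a ≤ b) :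
    |Ls 1 (prs (exp a) (exp b)) - log (b / a)| ≤ C1 := by
  have := hC1 (exp a) (exp b) ((log_le_iff_le_exp (by norm_num)).1 ha) (exp_le_exp.2 hab)
  rw [log_exp, log_exp] at this
  simpa [Ls] using this

set_option maxHeartbeats 1000000 in
lemma G1 {f : ℕ → ℂ} (hf : Mf f) (hcl : Cl f) {C : ℝ} (hC : 1 ≤ C) : ∃ C' L0 : ℝ, 0 < C' ∧ ∀ δ' δ : ℝ, 0 < δ' → δ' ≤ δ → δ ≤ 1 / 8 → L0 ≤ log (δ / δ') → 
    ∃ X0 : ℝ, ∀ X : ℝ, X0 ≤ X → ∀ U : Set ℝ, MeasurableSet U → U ⊆ Set.Icc (-X ^ 2) (X ^ 2) → volume.real U ≤ X → (∀ y, √X ≤ y → LS (volume.restrict U) C y) →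
    ∫ v, Gv (fun n => f n / n) (blk (√X) (exp 1 * X)) (volume.restrict U) v ≤ C' * (1 / log (δ / δ') + δ) * log X + 1 := by
  obtain ⟨C0, hC0, hcl⟩ := hcl
  obtain ⟨C1, hC10, hC1⟩ := mertens
  refine ⟨64 * 100 * 8 * C, 8 * (C0 + C1) + 1, by positivity, fun δ' δ hδ' hδδ hδ8 hΛ0 => ?_⟩
  obtain ⟨X0, hX0⟩ := hcl δ' δ hδ' hδδ
  set Λ := log (δ / δ') with hΛ
  have hδ : 0 < δ := by linarith
  have hev : ∀ᶠ X : ℝ in atTop, X0 ≤ X ∧ 1 ≤ log X ∧ 1 ≤ δ' * log X ∧ 8 * (2 * log X + 3) ^ 2 ≤ X := by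
    have t1 := tendsto_log_atTop
    have t2 : ∀ᶠ X : ℝ in atTop, |log X ^ 2| ≤ 1 / 200 * |X| := by
      have := (Real.isLittleO_pow_log_id_atTop (n := 2)).def (show (0:ℝ) < 1 / 200 by norm_num)
      simpa using this
    filter_upwards [eventually_ge_atTop X0, t1.eventually_ge_atTop 1, (t1.const_mul_atTop hδ').eventually_ge_atTop 1, t2, eventually_ge_atTop 1] with X h1 h2 h3 h4 h5
    refine ⟨h1, h2, h3, ?_⟩
    rw [abs_of_nonneg (by positivity), abs_of_nonneg (by linarith)] at h4
    nlinarith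
  obtain ⟨X1, hX1⟩ := eventually_atTop.1 hev
  refine ⟨max X1 1, fun X hX U hUm hUs hUv hLS => ?_⟩
  obtain ⟨hXX0, hl1, hl2, hl3⟩ := hX1 X ((le_max_left _ _).trans hX)
  have hX1' : 1 ≤ X := (le_max_right _ _).trans hX
  have hXp : 0 < X := by linarith
  set ℓ := log X with hℓ
  haveI : IsFiniteMeasure (volume.restrict U) := ⟨by rw [Measure.restrict_apply_univ]; exact (measure_mono hUs).trans_lt (by simp)⟩
  have hpow : ∀ e : ℝ, X ^ e = exp (e * ℓ) := fun e => by rw [rpow_def_of_pos hXp, mul_comm]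
  have hsq : √X = exp (ℓ / 2) := by rw [sqrt_eq_rpow, hpow]; congr 1; ring
  have hXe : X = exp ℓ := (exp_log hXp).symm
  set A := √X with hA
  set B := exp 1 * X with hB
  have hBe : B = exp (1 + ℓ) := by rw [hB, exp_add, ← hXe]
  set S := prs (X ^ δ') (X ^ δ) with hS
  have hSp : ∀ p ∈ S, p.Prime ∧ (p:ℝ) ≤ X ^ δ := fun p hp => by
    have := (mem_prs (by positivity)).1 hp; exact ⟨this.2.2, this.2.1⟩
  set Lp := Ls 1 S with hLp
  have hLb : |Lp - Λ| ≤ C1 := by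
    have := Ls_prs C1 hC1 (a := δ' * ℓ) (b := δ * ℓ) (by linarith [log_two_lt_d9]) (by gcongr)
    rwa [mul_div_mul_right _ _ (by positivity), ← hpow, ← hpow] at this
  rw [abs_le] at hLb
  have hA1 : 1 ≤ A := by rw [hsq]; exact one_le_exp (by positivity)
  have hAB : A ≤ B := by rw [hsq, hBe]; gcongr; linarith
  have hXδ : 1 ≤ X ^ δ := one_le_rpow hX1' hδ.le
  set Y2 := B * X ^ δ with hY2
  have hdl : δ * ℓ ≤ 1 / 8 * ℓ := mul_le_mul_of_nonneg_right hδ8 (by linarith)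
  have hdl0 : 0 < δ * ℓ := by positivity
  have hB0 : 0 < B := by positivity
  have hBY : B ≤ Y2 := le_mul_of_one_le_right hB0.le hXδ
  set D := tkc f S A B (fun _ => blk A B) with hD
  have hid : ∀ t, dp D (blk A Y2) t = (Lp - ∑ p ∈ S, f p / p * tw t p) * BB f A B t := by
    intro t
    rw [hD, tk_id f S (fun p hp => (hSp p hp).1) A B Y2 hBY _ ?_ t, sub_mul, sum_mul]; rfl
    intro p hp m hm
    rw [mem_blk (by linarith)] at hm ⊢
    have hp1 : (1:ℝ) ≤ p := by exact_mod_cast (hSp p hp).1.one_lt.le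
    push_cast
    constructor
    · exact hm.1.trans_le (le_mul_of_one_le_left (by positivity) hp1)
    · rw [hY2, mul_comm]; exact mul_le_mul hm.2 (hSp p hp).2 (by positivity) hB0.le
  have hDs : ∑ n ∈ blk A Y2, n * ‖D n‖ ^ 2 ≤ 100 * (2 * ℓ * (2 * Λ) + 2 * δ * ℓ * (2 * Λ) ^ 2) := by
    have hlog1 : log (Y2 / A) = 1 + ℓ / 2 + δ * ℓ := by
      rw [hY2, hBe, hsq, hpow, ← exp_add, ← exp_sub, log_exp]; ring
    have hA0 : A ≠ 0 := by linarith
    refine (tk_coef hf S (fun p hp => (hSp p hp).1) hXδ (fun p hp => (hSp p hp).2) (X := A) (X1 := A * X ^ δ) (Y1 := B) ?_ (le_mul_of_one_le_right (by linarith) hXδ) ?_ le_rfl hBY ?_ (fun _ => blk A B) ?_).trans ?_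
    · rw [hpow, hsq, ← exp_nat_mul]; exact exp_le_exp.2 (by push_cast; linarith only [hdl])
    · rw [hpow, hsq, hBe, ← exp_add]; exact exp_le_exp.2 (by linarith only [hdl, hl1])
    · rw [hlog1]; linarith only [hdl0, hl1]
    · intro p hp m h1 h2
      rw [mem_blk (by linarith)]
      have hp1 : (1:ℝ) ≤ p := by exact_mod_cast (hSp p hp).1.one_lt.le
      push_cast at h1 h2
      constructor
      · have := (hSp p hp).2
        by_contra h
        push Not at h
        have : (p:ℝ) * m ≤ X ^ δ * A := mul_le_mul this h (by positivity) (by linarith)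
        linarith
      · have : (m:ℝ) ≤ p * m := le_mul_of_one_le_left (by positivity) hp1
        linarith
    · rw [hlog1, mul_div_cancel_left₀ _ hA0, hY2, mul_div_cancel_left₀ _ hB0.ne', hpow, log_exp]
      have hL0 : 0 ≤ Lp := Ls_nonneg _ _
      refine mul_le_mul_of_nonneg_left (add_le_add (mul_le_mul ?_ ?_ (by linarith) (by linarith)) ?_) (by norm_num)
      · linarith only [hdl, hl1]
      · linarith
      · rw [← hLp, show δ * ℓ + δ * ℓ = 2 * δ * ℓ by ring]
        refine mul_le_mul_of_nonneg_left (pow_le_pow_left₀ hL0 (by linarith) 2) (by positivity)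
  have hM := MD D (blk A Y2) (volume.restrict U) hA1 hLS fun n hn => ((mem_blk (by linarith)).1 hn).1
  haveI := fin_nu one_pos
  have hΛp : 0 < Λ := by linarith
  have hBA : log (B / A) = 1 + ℓ / 2 := by rw [hBe, hsq, ← exp_sub, log_exp]; ring
  have hE : MeasurableSet {s : ℝ | 2 * X ^ 2 < |s|} := (isOpen_lt continuous_const continuous_abs).measurableSet
  have hpt : ∀ t ∈ U, ∫ s, ‖BB f A B (t + s)‖ ^ 2 ∂nu 1 ≤ 64 / Λ ^ 2 * ∫ s, ‖dp D (blk A Y2) (t + s)‖ ^ 2 ∂nu 1 + 1 / X := by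
    intro t ht
    have ht' : |t| ≤ X ^ 2 := abs_le.2 (hUs ht)
    have i1 : Integrable (fun s => ‖BB f A B (t + s)‖ ^ 2) (nu 1) := by
      unfold BB; simp_rw [dp_shift]; exact int_dp _ _
    have i2 : Integrable (fun s => ‖dp D (blk A Y2) (t + s)‖ ^ 2) (nu 1) := by simp_rw [dp_shift]; exact int_dp _ _
    have i3 : Integrable ({s : ℝ | 2 * X ^ 2 < |s|}.indicator (fun _ => (2 * ℓ + 3) ^ 2)) (nu 1) := (integrable_const _).indicator hE
    refine (integral_mono i1 ((i2.const_mul (64 / Λ ^ 2)).add i3) fun s => ?_).trans ?_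
    · by_cases h : 2 * X ^ 2 < |s|
      · simp only [Pi.add_apply, Set.indicator_of_mem (show s ∈ {s : ℝ | 2 * X ^ 2 < |s|} from h)]
        have h1 := BB_le hf hA1 hAB (t + s)
        have h2 : ‖BB f A B (t + s)‖ ^ 2 ≤ (2 * ℓ + 3) ^ 2 := pow_le_pow_left₀ (norm_nonneg _) (by linarith) 2
        have : 0 ≤ 64 / Λ ^ 2 * ‖dp D (blk A Y2) (t + s)‖ ^ 2 := by positivity
        linarith
      · simp only [Pi.add_apply, Set.indicator_of_notMem (show s ∉ {s : ℝ | 2 * X ^ 2 < |s|} from h), add_zero]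
        rw [hid, norm_mul, mul_pow, ← mul_assoc]
        refine le_mul_of_one_le_left (by positivity) ?_
        have h1 := hX0 X hXX0 (t + s) ((abs_add_le _ _).trans (by linarith))
        set P := ∑ p ∈ S, f p / p * tw (t + s) p
        have h2 : Λ / 8 ≤ ‖(Lp:ℂ) - P‖ := by
          refine le_trans ?_ (Complex.re_le_norm _)
          rw [sub_re, ofReal_re]; linarith
        rw [div_mul_eq_mul_div, le_div_iff₀ (by positivity)]
        have h3 := pow_le_pow_left₀ (by positivity) h2 2
        linarith only [h3]
    · rw [integral_add' (i2.const_mul _) i3, integral_const_mul, integral_indicator_const _ hE]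
      gcongr
      have := nu_tail one_pos (show 0 < 2 * X ^ 2 by positivity)
      rw [smul_eq_mul]
      calc _ ≤ 16 * 1 ^ 2 / (2 * X ^ 2) * (2 * ℓ + 3) ^ 2 := by gcongr
        _ = (8 * (2 * ℓ + 3) ^ 2) / X ^ 2 := by field_simp; norm_num
        _ ≤ X / X ^ 2 := by gcongr
        _ = 1 / X := by field_simp
  have h5 : ∫ t in U, ∫ s, ‖BB f A B (t + s)‖ ^ 2 ∂nu 1 ≤ ∫ t in U, (64 / Λ ^ 2 * (∫ s, ‖dp D (blk A Y2) (t + s)‖ ^ 2 ∂nu 1) + 1 / X) :=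
    setIntegral_mono_on (fub_int _ _ _) (((fub_int _ _ _).const_mul _).add (integrable_const _)) hUm hpt
  rw [integral_add ((fub_int _ _ _).const_mul _) (integrable_const _), integral_const_mul, fub_eq, integral_const, smul_eq_mul, measureReal_restrict_apply_univ] at h5
  have e0 : ∫ t in U, ∫ s, ‖BB f A B (t + s)‖ ^ 2 ∂nu 1 = 2 * π * ∫ v, Gv (fun n => f n / n) (blk A B) (volume.restrict U) v := fub_eq _ _ _
  rw [e0] at h5
  set M := ∫ v, Gv (fun n => f n / n) (blk A B) (volume.restrict U) v
  set N := ∫ v, Gv D (blk A Y2) (volume.restrict U) v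
  have hpi := pi_gt_three
  have h6 : volume.real U * (1 / X) ≤ 1 := by rw [mul_one_div, div_le_one hXp]; exact hUv
  have h7 : 2 * π * M ≤ 2 * π * (64 / Λ ^ 2 * N + 1) := by nlinarith only [h5, h6, hpi]
  have h8 := le_of_mul_le_mul_left h7 (by positivity)
  have h9 : N ≤ C * (100 * (2 * ℓ * (2 * Λ) + 2 * δ * ℓ * (2 * Λ) ^ 2)) := hM.trans (by gcongr)
  refine h8.trans (add_le_add_left ?_ 1)
  calc 64 / Λ ^ 2 * N ≤ 64 / Λ ^ 2 * (C * (100 * (2 * ℓ * (2 * Λ) + 2 * δ * ℓ * (2 * Λ) ^ 2))) := by gcongr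
    _ = 64 * 100 * C * (4 * (1 / Λ) + 8 * δ) * ℓ := by field_simp; ring
    _ ≤ _ := by
      have : 0 ≤ 1 / Λ := by positivity
      have : 0 ≤ 64 * 100 * C * (4 * (1 / Λ)) * ℓ := by positivity
      nlinarith only [this]

end MR
namespace MR
open MeasureTheory

lemma qb {f : ℕ → ℂ} (hf : Mf f) {y0 : ℝ} {k v : ℕ} (hk : 1 ≤ k) (hy : 1 ≤ y0 + v / k) (t : ℝ) : ‖Qx f y0 k v t‖ ≤ 4 / (y0 + v / k) := by
  set y := y0 + v / k with hyd
  refine (norm_dp_le _ _ t).trans ((sum_le_sum fun n _ => fdn hf n).trans ?_)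
  have hy0 : 0 < y * exp y := by have := exp_pos y; nlinarith
  have h1 : ∑ p ∈ pw y0 k v, 1 / (p:ℝ) ≤ ∑ p ∈ pw y0 k v, log p / (y * exp y) := by
    refine sum_le_sum fun p hp => ?_
    obtain ⟨h1, h2, h3⟩ := pw_mem.1 hp
    have hp0 : (0:ℝ) < p := by exact_mod_cast h1.pos
    rw [div_le_div_iff₀ hp0 hy0]
    have := (lt_log_iff_exp_lt hp0).1 h2
    rw [one_mul]
    exact mul_le_mul h2.le this.le (exp_pos _).le (by linarith)
  have h2 : ∑ p ∈ pw y0 k v, log p ≤ Chebyshev.theta (exp (y + 1)) := by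
    unfold Chebyshev.theta
    refine sum_le_sum_of_subset_of_nonneg (fun p hp => ?_) fun p _ _ => Real.log_natCast_nonneg p
    obtain ⟨h1, h2, h3⟩ := pw_mem.1 hp
    have hp0 : (0:ℝ) < p := by exact_mod_cast h1.pos
    refine mem_filter.2 ⟨mem_Ioc.2 ⟨h1.pos, Nat.le_floor ?_⟩, h1⟩
    refine ((log_le_iff_le_exp hp0).1 h3).trans (exp_le_exp.2 ?_)
    rw [hyd, add_div]
    have : (1:ℝ) / k ≤ 1 := by rw [div_le_one (by exact_mod_cast hk)]; exact_mod_cast hk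
    linarith
  have h3 := Chebyshev.theta_le_log4_mul_x (exp_pos (y + 1)).le
  have h4 : log 4 * exp (y + 1) ≤ 4 * exp y := by
    rw [exp_add, show (4:ℝ) = 2 ^ 2 by norm_num, log_pow]
    have := log_two_lt_d9
    have h5 := exp_one_lt_d9
    have : log 2 * exp 1 ≤ 0.6931471808 * 2.7182818286 := mul_le_mul this.le h5.le (exp_pos _).le (by norm_num)
    push_cast; nlinarith [exp_pos y]
  refine h1.trans ?_
  rw [← Finset.sum_div, div_le_div_iff₀ hy0 (by linarith)]
  nlinarith

lemma Bx_win (f : ℕ → ℂ) {A B w : ℝ} (hA : 0 ≤ A) (h1 : A ≤ exp w) (h2 : exp (w + 1) ≤ B) (t : ℝ) : Bx f (exp w) t = win (fun n => f n / n * tw t n) (blk A B) 1 w := by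
  rw [win_tw (fun n => f n / n)]
  unfold Bx BB
  congr 1
  ext n
  rw [mem_filter, mem_blk hA, mem_blk (exp_pos _).le, ← exp_add, add_comm 1 w]
  constructor
  · rintro ⟨h3, h4⟩
    have hn : (0:ℝ) < n := (exp_pos _).trans h3
    exact ⟨⟨by linarith, by linarith⟩, (lt_log_iff_exp_lt hn).2 h3, (log_le_iff_le_exp hn).2 h4⟩
  · rintro ⟨⟨h3, _⟩, h4, h5⟩
    have hn : (0:ℝ) < n := by linarith
    exact ⟨(lt_log_iff_exp_lt hn).1 h4, (log_le_iff_le_exp hn).1 h5⟩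

lemma avg {φ : ℝ → ℝ} (hφ : Integrable φ) (h0 : ∀ x, 0 ≤ φ x) {K a : ℝ} (ha : 0 ≤ a) {k : ℕ} (hk : 1 ≤ k) (V : ℕ) (h : ∀ s, 0 ≤ s → s ≤ 1 / (k:ℝ) → K ≤ a * ∑ v ∈ range V, φ (s + v / k)) : K ≤ k * a * ∫ x, φ x := by
  have hk0 : (0:ℝ) < k := by exact_mod_cast hk
  have hi : ∀ v : ℕ, IntervalIntegrable (fun s => φ (s + v / k)) volume 0 (1 / k) := fun v => (hφ.comp_add_right (v / (k:ℝ))).intervalIntegrable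
  have h1 : ∫ s in (0:ℝ)..(1 / k), K ≤ ∫ s in (0:ℝ)..(1 / k), a * ∑ v ∈ range V, φ (s + v / k) := by
    refine intervalIntegral.integral_mono_on (by positivity) (by simp) ?_ fun s hs => h s hs.1 hs.2
    have := (IntervalIntegrable.sum (range V) fun v _ => hi v).const_mul a
    simpa using this
  rw [intervalIntegral.integral_const, intervalIntegral.integral_const_mul, intervalIntegral.integral_finsetSum fun v _ => hi v] at h1
  have h2 : ∀ v : ℕ, ∫ s in (0:ℝ)..(1 / k), φ (s + v / k) = ∫ s in ((v:ℝ) / k)..((v + 1 : ℕ) / k), φ s := by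
    intro v
    rw [intervalIntegral.integral_comp_add_right]; congr 1
    · ring
    · push_cast; ring
  simp_rw [h2] at h1
  rw [intervalIntegral.sum_integral_adjacent_intervals (a := fun v : ℕ => (v:ℝ) / k) fun v _ => hφ.intervalIntegrable, intervalIntegral.integral_of_le (by gcongr; positivity)] at h1
  have h3 : ∫ x in Set.Ioc (((0:ℕ):ℝ) / k) ((V:ℝ) / k), φ x ≤ ∫ x, φ x := setIntegral_le_integral hφ (Eventually.of_forall h0)
  rw [smul_eq_mul, sub_zero, one_div_mul_eq_div, div_le_iff₀ hk0] at h1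
  calc K ≤ _ := h1
    _ ≤ a * (∫ x, φ x) * k := by gcongr
    _ = _ := by ring

set_option maxHeartbeats 1000000 in
lemma G2 {f : ℕ → ℂ} (hf : Mf f) (C1 : ℝ) (hC10 : 0 < C1) (hC1 : ∀ x y, 2 ≤ x → x ≤ y → |∑ p ∈ prs x y, (p:ℝ)⁻¹ - log (log y / log x)| ≤ C1) {C : ℝ} (hC : 1 ≤ C) {η La : ℝ} (hη : 0 < η) (hη' : η ≤ 1 / 16) (hLa : 1 ≤ La) (hLη : La + C1 ≤ log (1 / (64 * η)))
    {k : ℕ} (hk : 1 ≤ k) {X : ℝ} (hX1 : 32 ≤ log X) (hX2 : 1 ≤ η * log X) {ρ : Measure ℝ} [IsFiniteMeasure ρ] (hLS : LS ρ C X) (hX : 1 ≤ X) :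
    ∫ t, ‖Bx f X t‖ ^ 2 ∂ρ ≤ k * (32 * (k * log X) / (η * log X) ^ 2) * (∫ v, Gv (fun n => f n / n) (blk (√X) (exp 1 * X)) ρ v) + 400 * C * (2 / La + 1 / k) := by
  rw [← sub_le_iff_le_add]
  set ℓ := log X with hℓ
  have hXp : 0 < X := by linarith
  have hXe : X = exp ℓ := (exp_log hXp).symm
  have hk0 : (0:ℝ) < k := by exact_mod_cast hk
  have hk1 : (1:ℝ) / k ≤ 1 := by rw [div_le_one hk0]; exact_mod_cast hk
  have hηl : η * ℓ ≤ 1 / 16 * ℓ := mul_le_mul_of_nonneg_right hη' (by linarith)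
  set V := ⌊k * ℓ / 16⌋₊ with hV
  have hV1 : (V:ℝ) ≤ k * ℓ / 16 := Nat.floor_le (by positivity)
  have hV2 : k * ℓ / 16 < V + 1 := Nat.lt_floor_add_one _
  have hV3 : (V:ℝ) / k ≤ ℓ / 16 := by rw [div_le_iff₀ hk0]; linarith
  have hV4 : ℓ / 16 - 1 ≤ V / k := by
    rw [le_div_iff₀ hk0]
    have : (1:ℝ) ≤ k := by exact_mod_cast hk
    linarith
  set G := Gv (fun n => f n / n) (blk (√X) (exp 1 * X)) ρ with hG
  have e1 : ∫ v, G v = ∫ u, G (ℓ - η * ℓ - u) := (integral_sub_left_eq_self _ _ _).symm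
  rw [e1]
  refine avg ((Gv_int _ _ ρ).comp_sub_left _) (fun _ => Gv_nonneg _ _ _ _) (by positivity) hk V fun s hs0 hs1 => ?_
  set y0 := η * ℓ + s with hy0
  set L := Ls 1 (prs (exp y0) (exp (y0 + V / k))) with hL
  have hVk : (0:ℝ) ≤ V / k := by positivity
  have hE := E0 hf ρ (by linarith) hXp hLS k V hk (y0 := y0) (by linarith) (by linarith) L hL
  have hLL : La ≤ L := by
    have h1 := (abs_le.1 (Ls_prs C1 hC1 (a := y0) (b := y0 + V / k) (by linarith [log_two_lt_d9]) (by linarith))).1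
    have h2 : log (1 / (64 * η)) ≤ log ((y0 + V / k) / y0) := by
      refine log_le_log (by positivity) ?_
      rw [div_le_div_iff₀ (by positivity) (by linarith)]
      have : 1 * y0 ≤ 2 * (η * ℓ) := by linarith
      refine this.trans ?_
      have h4 : ℓ / 32 ≤ y0 + V / k := by linarith
      have := mul_le_mul_of_nonneg_right h4 (show 0 ≤ 64 * η by positivity)
      linarith
    linarith
  have hL1 : 0 < L := by linarith
  have hsum : ∑ v ∈ range V, ∫ t, ‖Qx f y0 k v t‖ ^ 2 * ‖Bx f (X * exp (-(y0 + v / k))) t‖ ^ 2 ∂ρ ≤ 16 / (η * ℓ) ^ 2 * ∑ v ∈ range V, G (ℓ - η * ℓ - (s + v / k)) := by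
    rw [mul_sum]
    refine sum_le_sum fun v hv => ?_
    have hvV : (v:ℝ) / k ≤ V / k := by gcongr; exact (mem_range.1 hv).le
    have hv0 : (0:ℝ) ≤ v / k := by positivity
    have e2 : ∀ t, Bx f (X * exp (-(y0 + v / k))) t = win (fun n => f n / n * tw t n) (blk (√X) (exp 1 * X)) 1 (ℓ - η * ℓ - (s + v / k)) := by
      intro t
      rw [← Bx_win f (Real.sqrt_nonneg X) _ _ t]
      · nth_rewrite 1 [hXe]
        rw [← exp_add]; congr 2; rw [hy0]; ring
      · rw [sqrt_eq_rpow, rpow_def_of_pos hXp]; exact exp_le_exp.2 (by linarith)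
      · nth_rewrite 1 [hXe]
        rw [← exp_add]; exact exp_le_exp.2 (by linarith)
    rw [hG, Gv, ← integral_const_mul]
    simp_rw [← e2]
    refine integral_mono (int_dd _ _ _ _ 2 2) (((int_dp _ _)).const_mul _) fun t => ?_
    · refine mul_le_mul_of_nonneg_right ?_ (by positivity)
      have := qb hf hk (show 1 ≤ y0 + v / k by linarith) t
      have h4 : 4 / (y0 + v / k) ≤ 4 / (η * ℓ) := by gcongr; linarith
      calc _ ≤ (4 / (η * ℓ)) ^ 2 := by gcongr; linarith
        _ = _ := by rw [div_pow]; norm_num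
  have h6 : L ^ 2 * ∫ t, ‖Bx f X t‖ ^ 2 ∂ρ ≤ 32 * V / (η * ℓ) ^ 2 * ∑ v ∈ range V, G (ℓ - η * ℓ - (s + v / k)) + 400 * C * (L + 1 + L ^ 2 / k) := by
    refine hE.trans (add_le_add_left ?_ _)
    refine (mul_le_mul_of_nonneg_left hsum (by positivity)).trans_eq ?_
    ring
  set Sg := ∑ v ∈ range V, G (ℓ - η * ℓ - (s + v / k)) with hSg
  have hSg0 : 0 ≤ Sg := sum_nonneg fun _ _ => Gv_nonneg _ _ _ _
  set b := ∫ t, ‖Bx f X t‖ ^ 2 ∂ρ with hb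
  clear_value Sg b
  have h7 : b ≤ (32 * V / (η * ℓ) ^ 2 * Sg + 400 * C * (L + 1 + L ^ 2 / k)) / L ^ 2 := by
    rw [le_div_iff₀ (by positivity)]; linarith
  have h8 : 32 * V / (η * ℓ) ^ 2 * Sg / L ^ 2 ≤ 32 * (k * ℓ) / (η * ℓ) ^ 2 * Sg := by
    refine (div_le_self (by positivity) (one_le_pow₀ (hLa.trans hLL))).trans ?_
    have : (V:ℝ) ≤ k * ℓ := hV1.trans (div_le_self (by positivity) (by norm_num))
    gcongr
  have h9 : 400 * C * (L + 1 + L ^ 2 / k) / L ^ 2 ≤ 400 * C * (2 / La + 1 / k) := by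
    rw [mul_div_assoc]
    refine mul_le_mul_of_nonneg_left ?_ (by positivity)
    have e3 : (L + 1 + L ^ 2 / k) / L ^ 2 = (1 / L + 1 / L * (1 / L)) + 1 / k := by field_simp
    have h10 : 1 / L ≤ 1 / La := by gcongr
    have h11 : 1 / L * (1 / L) ≤ 1 / L := mul_le_of_le_one_right (by positivity) (by rw [div_le_one hL1]; linarith)
    rw [e3, show 2 / La = 1 / La + 1 / La by ring]
    linarith
  rw [add_div] at h7
  linarith

theorem MRmain {f : ℕ → ℂ} (hf : Mf f) (hcl : Cl f) {ε : ℝ} (hε : 0 < ε) : ∃ h ≥ (1:ℝ), ∃ X0 ≥ (1:ℝ), ∀ X ≥ X0, h ≤ X ∧ ∫ t, ‖Bx f X t‖ ^ 2 ∂nu (X / h) ≤ ε := by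
  obtain ⟨C, c, X0, hC, hc, hc1, hX01, hLS⟩ := LS_U
  obtain ⟨h, hh, X1, hX11, hE⟩ := partE hc hc1 hf (half_pos hε)
  obtain ⟨C1, hC10, hC1⟩ := mertens
  obtain ⟨C', L0, hC', hG⟩ := G1 hf hcl hC
  obtain ⟨k, hk⟩ := exists_nat_ge (3200 * C / ε + 1)
  have hCε : 0 < 3200 * C / ε := by positivity
  have hk0 : (0:ℝ) < k := by linarith
  have hk1 : 1 ≤ k := by exact_mod_cast hk0
  set La := 6400 * C / ε + 1 with hLa
  have hLa1 : 1 ≤ La := by rw [hLa]; have : 0 < 6400 * C / ε := by positivity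
                           linarith
  set η := exp (-(La + C1)) / 64 with hη
  have hη0 : 0 < η := by positivity
  have hη1 : η ≤ 1 / 16 := by
    have : exp (-(La + C1)) ≤ 1 := exp_le_one_iff.2 (by linarith)
    rw [hη]; linarith
  have hLη : La + C1 ≤ log (1 / (64 * η)) := by
    rw [hη, mul_div_cancel₀ _ (by norm_num), one_div, ← exp_neg, neg_neg, log_exp]
  set K := k * (32 * k / η ^ 2) with hK
  have hK0 : 0 < K := by positivity
  set Λ := max (max L0 1) (16 * (K * C') / ε) with hΛ
  have hΛ1 : 1 ≤ Λ := (le_max_right _ _).trans (le_max_left _ _)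
  set δ := min (1 / 8) (ε / (16 * (K * C'))) with hδ
  have hδ0 : 0 < δ := lt_min (by norm_num) (by positivity)
  have hlog : log (δ / (δ * exp (-Λ))) = Λ := by
    rw [← div_div, div_self hδ0.ne', one_div, ← exp_neg, neg_neg, log_exp]
  obtain ⟨X2, hX2⟩ := hG (δ * exp (-Λ)) δ (by positivity) (mul_le_of_le_one_right hδ0.le (exp_le_one_iff.2 (by linarith))) (min_le_left _ _) (by rw [hlog]; exact (le_max_left _ _).trans (le_max_left _ _))
  rw [hlog] at hX2
  have t1 := tendsto_log_atTop
  obtain ⟨X3, hX3⟩ := eventually_atTop.1 ((t1.eventually_ge_atTop 32).and (((t1.const_mul_atTop hη0).eventually_ge_atTop 1).and (t1.eventually_ge_atTop (16 * K / ε))))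
  refine ⟨h, hh, max (max X0 X1) (max X2 X3), hX01.trans ((le_max_left _ _).trans (le_max_left _ _)), fun X hX => ?_⟩
  simp only [ge_iff_le, max_le_iff] at hX
  obtain ⟨⟨h0, h1⟩, h2, h3⟩ := hX
  obtain ⟨hhX, U, hUm, hUs, hUv, hU⟩ := hE X h1
  refine ⟨hhX, hU.trans ?_⟩
  obtain ⟨h4, h5, h6⟩ := hX3 X h3
  have hXX : 1 ≤ X := by linarith
  haveI : IsFiniteMeasure (volume.restrict U) := ⟨by rw [Measure.restrict_apply_univ]; exact (measure_mono hUs).trans_lt (by simp)⟩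
  have hL := hLS X h0 U hUm hUs hUv
  have hb := G2 hf C1 hC10 hC1 hC hη0 hη1 hLa1 hLη hk1 h4 h5 (hL X (Real.sqrt_le_self_iff.2 (Or.inr hXX))) hXX
  have hM := hX2 X h2 U hUm hUs (hUv.trans (Real.rpow_le_self_of_one_le hXX hc1)) hL
  set ℓ := log X
  set M := ∫ v, Gv (fun n => f n / n) (blk (√X) (exp 1 * X)) (volume.restrict U) v
  have hl0 : 0 < ℓ := by linarith
  have e1 : k * (32 * (k * ℓ) / (η * ℓ) ^ 2) = K / ℓ := by rw [hK]; field_simp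
  rw [e1] at hb
  have h7 : K / ℓ * M ≤ K / ℓ * (C' * (1 / Λ + δ) * ℓ + 1) := by gcongr
  have e2 : K / ℓ * (C' * (1 / Λ + δ) * ℓ + 1) = K * C' * (1 / Λ) + K * C' * δ + K / ℓ := by field_simp
  have h8 : K * C' * (1 / Λ) ≤ ε / 16 := by
    have : 16 * (K * C') / ε ≤ Λ := le_max_right _ _
    rw [div_le_iff₀ hε] at this
    rw [mul_one_div, div_le_iff₀ (by linarith)]; linarith
  have h9 : K * C' * δ ≤ ε / 16 := by
    have : δ ≤ ε / (16 * (K * C')) := min_le_right _ _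
    rw [le_div_iff₀ (by positivity)] at this; linarith
  have h10 : K / ℓ ≤ ε / 16 := by
    rw [div_le_iff₀ hε] at h6
    rw [div_le_iff₀ hl0]; linarith
  have h11 : 400 * C * (2 / La + 1 / k) ≤ ε / 4 := by
    have a1 : 400 * C * (2 / La) ≤ ε / 8 := by
      rw [← mul_div_assoc, div_le_iff₀ (by linarith), hLa]
      have : ε / 8 * (6400 * C / ε + 1) = 800 * C + ε / 8 := by field_simp; ring
      linarith
    have a2 : 400 * C * (1 / k) ≤ ε / 8 := by
      rw [mul_one_div, div_le_iff₀ hk0]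
      have : ε / 8 * (3200 * C / ε + 1) ≤ ε / 8 * k := by gcongr
      have e : ε / 8 * (3200 * C / ε + 1) = 400 * C + ε / 8 := by field_simp; ring
      linarith
    linarith
  linarith

end MR
namespace MR
open MeasureTheory

lemma C1 {f : ℕ → ℂ} (hf : Mf f) {d X : ℝ} (hd : 0 < d) (hX : 1 ≤ X) {x H : ℕ} (hx : X ≤ x) (hxH : (x + H) * exp d ≤ exp 1 * X) :
    ‖∑ n ∈ Ioc x (x + H), f n / n - d⁻¹ * ∫ v in Set.Ico (log x) (log (x + H)), win (fun n => f n / n) (blk X (exp 1 * X)) d v‖ ≤ 2 * (d + 2 / x) := by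
  classical
  set S := blk X (exp 1 * X) with hS
  have hx1 : (1:ℝ) ≤ x := hX.trans hx
  have hx0 : (0:ℝ) < x := by linarith
  have hxH0 : (0:ℝ) < x + H := by positivity
  have hsub : Ioc x (x + H) ⊆ S := fun n hn => by
    rw [mem_Ioc] at hn
    rw [hS, mem_blk (by linarith)]
    have h1 : (x:ℝ) < n := by exact_mod_cast hn.1
    have h2 : (n:ℝ) ≤ x + H := by exact_mod_cast hn.2
    refine ⟨by linarith, h2.trans (le_trans ?_ hxH)⟩
    exact le_mul_of_one_le_right hxH0.le (one_le_exp hd.le)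
  set J := Set.Ico (log x) (log (x + H)) with hJ
  set w : ℕ → ℝ := fun n => d⁻¹ * volume.real (J ∩ Set.Ico (log n - d) (log n)) with hw
  have e1 : ∑ n ∈ Ioc x (x + H), f n / n = ∑ n ∈ S, f n / n * (if n ∈ Ioc x (x + H) then 1 else 0) := by
    simp_rw [mul_ite, mul_one, mul_zero]
    rw [← sum_filter, Finset.filter_mem_eq_inter, Finset.inter_eq_right.2 hsub]
  have e2 : ((d⁻¹ : ℝ) : ℂ) * ∫ v in J, win (fun n => f n / n) S d v = ∑ n ∈ S, f n / n * w n := by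
    unfold win
    rw [integral_finsetSum, mul_sum]
    · refine sum_congr rfl fun n _ => ?_
      rw [setIntegral_indicator measurableSet_Ico, setIntegral_const, real_smul, hw]; push_cast; ring
    · intro n _
      exact ((integrable_indicator_iff measurableSet_Ico).2 (integrableOn_const (by simp))).integrableOn
  rw [e1, e2, ← sum_sub_distrib]
  have hpt : ∀ n ∈ S, ‖f n / n * (if n ∈ Ioc x (x + H) then 1 else 0) - f n / n * w n‖ ≤ (if n ∈ blk x (x * exp d) then 1 / (n:ℝ) else 0) + (if n ∈ blk (x + H) ((x + H) * exp d) then 1 / (n:ℝ) else 0) := by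
    intro n hn
    have hn0 : (0:ℝ) < n := by have := ((mem_blk (by linarith)).1 hn).1; linarith
    rw [← mul_sub, norm_mul]
    have hw0 : 0 ≤ w n := by positivity
    have hw1 : w n ≤ 1 := by
      rw [hw, inv_mul_le_iff₀ hd]
      have := measureReal_mono (μ := volume) (Set.inter_subset_right (s := J) (t := Set.Ico (log n - d) (log n))) (by simp)
      simpa [hd.le] using this
    have hfn := fdn hf n
    have hwle : ∀ a : ℝ, |a| ≤ 1 → ‖f n / n‖ * ‖(a:ℂ)‖ ≤ 1 / n := fun a ha => by
      rw [norm_real, norm_eq_abs]; exact (mul_le_of_le_one_right (norm_nonneg _) ha).trans hfn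
    have hexp : ∀ y : ℝ, 0 < y → ((n:ℝ) ≤ y * exp d ↔ log n ≤ log y + d) := fun y hy => by
      rw [← log_le_log_iff hn0 (by positivity), log_mul hy.ne' (exp_pos d).ne', log_exp]
    have hI : n ∈ Ioc x (x + H) ↔ (x:ℝ) < n ∧ (n:ℝ) ≤ x + H := by rw [mem_Ioc]; norm_cast
    simp only [mem_blk hx0.le, mem_blk hxH0.le, hI, hexp _ hx0, hexp _ hxH0, ← Real.log_lt_log_iff hx0 hn0, ← Real.log_lt_log_iff hxH0 hn0, ← log_le_log_iff hn0 hxH0]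
    have hr : log x ≤ log (x + H) := log_le_log hx0 (by linarith [(Nat.cast_nonneg H : (0:ℝ) ≤ H)])
    set a := log n
    set b := log x
    set c := log (x + H)
    have hb1 : 0 ≤ 1 / (n:ℝ) := by positivity
    by_cases h1 : b < a ∧ a ≤ c
    · rw [if_pos h1]
      by_cases h2 : a ≤ b + d
      · rw [if_pos ⟨h1.1, h2⟩]
        have := hwle (1 - w n) (abs_le.2 ⟨by linarith, by linarith⟩)
        push_cast at this
        split_ifs <;> linarith
      · have : w n = 1 := by
          rw [hw]; simp only
          rw [Set.inter_eq_right.2 (Set.Ico_subset_Ico (by linarith) h1.2), Real.volume_real_Ico_of_le (by linarith), sub_sub_cancel, inv_mul_cancel₀ hd.ne']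
        rw [this]; simp; positivity
    · rw [if_neg h1]
      by_cases h2 : c < a ∧ a ≤ c + d
      · rw [if_pos h2]
        have := hwle (0 - w n) (abs_le.2 ⟨by linarith, by linarith⟩)
        push_cast at this
        split_ifs <;> linarith
      · have : w n = 0 := by
          rw [hw]; simp only
          rw [show J ∩ Set.Ico (a - d) a = ∅ from ?_]; · simp
          ext v
          simp only [hJ, Set.mem_inter_iff, Set.mem_Ico, Set.mem_empty_iff_false, iff_false]
          rintro ⟨⟨h3, h4⟩, h5, h6⟩
          by_cases h7 : b < a
          · have : c < a := by by_contra h; exact h1 ⟨h7, by linarith⟩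
            exact h2 ⟨this, by linarith⟩
          · linarith
        rw [this]; simp only [ofReal_zero, sub_zero, norm_zero, mul_zero]; positivity
  refine (norm_sum_le _ _).trans ((sum_le_sum hpt).trans ?_)
  rw [sum_add_distrib, ← sum_filter, ← sum_filter]
  have key : ∀ y : ℝ, (x:ℝ) ≤ y → ∑ n ∈ S with n ∈ blk y (y * exp d), 1 / (n:ℝ) ≤ d + 2 / x := by
    intro y hy
    have hy0 : 0 < y := by linarith
    have h1 := (abs_le.1 (harm (A := y) (B := y * exp d) (by linarith) (le_mul_of_one_le_right hy0.le (one_le_exp hd.le)))).2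
    rw [mul_div_cancel_left₀ _ hy0.ne', log_exp] at h1
    have h2 : 2 / y ≤ 2 / x := by gcongr
    refine (sum_le_sum_of_subset_of_nonneg (fun n hn => (mem_filter.1 hn).2) fun n _ _ => by positivity).trans (show ∑ n ∈ blk y (y * exp d), 1 / (n:ℝ) ≤ _ by linarith)
  have k1 := key x le_rfl
  have k2 := key (x + H) (by linarith [(Nat.cast_nonneg H : (0:ℝ) ≤ H)])
  linarith

lemma C2 {f : ℕ → ℂ} (hf : Mf f) {x H : ℕ} (hx : 1 ≤ x) : ‖∑ n ∈ Ioc x (x + H), f n‖ ≤ x * ‖∑ n ∈ Ioc x (x + H), f n / n‖ + H ^ 2 / x := by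
  have hx0 : (0:ℝ) < x := by exact_mod_cast hx
  have e : ∑ n ∈ Ioc x (x + H), f n = x * ∑ n ∈ Ioc x (x + H), f n / n + ∑ n ∈ Ioc x (x + H), f n * ((1 - x / n : ℝ) : ℂ) := by
    rw [mul_sum, ← sum_add_distrib]
    refine sum_congr rfl fun n hn => ?_
    push_cast; ring
  rw [e]
  refine (norm_add_le _ _).trans (add_le_add (by rw [norm_mul]; simp) ?_)
  refine (norm_sum_le _ _).trans ((sum_le_card_nsmul _ _ (H / x : ℝ) fun n hn => ?_).trans_eq ?_)
  · rw [mem_Ioc] at hn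
    have h1 : (x:ℝ) < n := by exact_mod_cast hn.1
    have h2 : (n:ℝ) ≤ x + H := by exact_mod_cast hn.2
    have hn0 : (0:ℝ) < n := by linarith
    have h3 : (x:ℝ) / n ≤ 1 := by rw [div_le_one hn0]; linarith
    rw [norm_mul, norm_real, norm_of_nonneg (by linarith)]
    refine (mul_le_of_le_one_left (by linarith) (hf.le n)).trans ?_
    rw [sub_le_iff_le_add, ← sub_le_iff_le_add', le_div_iff₀ hn0, sub_mul, one_mul, div_mul_eq_mul_div, sub_le_iff_le_add, ← sub_le_iff_le_add', le_div_iff₀ hx0]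
    have : (0:ℝ) ≤ H := Nat.cast_nonneg H
    nlinarith
  · simp; ring

end MR
namespace MR
open MeasureTheory

noncomputable def sh (f : ℕ → ℂ) (x H : ℕ) : ℂ := ∑ n ∈ Ioc x (x + H), f n
def NN (f : ℕ → ℂ) : Prop := ∀ ε > (0:ℝ), ∃ H0 : ℕ, ∀ H ≥ H0, ∃ M0 : ℕ, ∀ M ≥ M0, ∑ x ∈ range M, ‖sh f x H‖ ^ 2 ≤ ε * H ^ 2 * M

lemma int_cs {g : ℝ → ℝ} {ρ : Measure ℝ} [IsFiniteMeasure ρ] (h1 : Integrable g ρ) (h2 : Integrable (fun v => g v ^ 2) ρ) : (∫ v, g v ∂ρ) ^ 2 ≤ ρ.real Set.univ * ∫ v, g v ^ 2 ∂ρ := by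
  set m := ρ.real Set.univ
  have key : ∀ c : ℝ, 2 * c * (∫ v, g v ∂ρ) - c ^ 2 * m ≤ ∫ v, g v ^ 2 ∂ρ := by
    intro c
    have e : ∫ v, (2 * c * g v - c ^ 2) ∂ρ = 2 * c * (∫ v, g v ∂ρ) - c ^ 2 * m := by
      rw [integral_sub (h1.const_mul _) (integrable_const _), integral_const_mul, integral_const, smul_eq_mul, mul_comm m]
    rw [← e]
    exact integral_mono ((h1.const_mul _).sub (integrable_const _)) h2 fun v => by simp only; nlinarith [sq_nonneg (g v - c)]
  have hm : 0 ≤ m := measureReal_nonneg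
  rcases hm.eq_or_lt with h | h
  · have h0 : ρ = 0 := by
      rw [← Measure.measure_univ_eq_zero]
      exact ((measureReal_eq_zero_iff).1 h.symm)
    rw [← h]; simp [h0]
  · have := key ((∫ v, g v ∂ρ) / m)
    set I := ∫ v, g v ∂ρ
    have e : 2 * (I / m) * I - (I / m) ^ 2 * m = I ^ 2 / m := by field_simp; ring
    rw [e, div_le_iff₀ h] at this; linarith

lemma C3 {f : ℕ → ℂ} (hf : Mf f) {h X ε : ℝ} (hh : 1 ≤ h) (hX : 1 ≤ X) (hM : ∫ t, ‖Bx f X t‖ ^ 2 ∂nu (X / h) ≤ ε) {H : ℕ} (hH1 : 1 ≤ H) (hH : 4 * (4 * h + 5) ^ 2 ≤ ε * H ^ 2) (hXH : 10 * (H:ℝ) ^ 2 ≤ X) (hXh : 10 * h ≤ X) :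
    ∑ x ∈ blk X (2 * X), ‖sh f x H‖ ^ 2 ≤ 2 * ε * H ^ 2 * X := by
  have hX0 : 0 < X := by linarith
  set d := h / X with hd
  have hd0 : 0 < d := by positivity
  have hT : 1 / (X / h) = d := by rw [one_div_div]
  have hP := parseval (show 0 < X / h by positivity) (fun n => f n / n) (blk X (exp 1 * X))
  rw [hT] at hP
  set W := fun v => ‖win (fun n => f n / n) (blk X (exp 1 * X)) d v‖ with hW
  have hWi : Integrable (fun v => W v ^ 2) := win_int _ _ _
  have hWm : ∀ J : Set ℝ, Integrable W (volume.restrict J) := by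
    intro J
    refine Integrable.restrict ?_
    refine Integrable.norm (integrable_finsetSum _ fun n _ => (integrable_indicator_iff measurableSet_Ico).2 (integrableOn_const (by simp)))
  have hH0 : (1:ℝ) ≤ H := by exact_mod_cast hH1
  have hd1 : d ≤ 1 / 10 := by rw [hd, div_le_iff₀ hX0]; linarith
  have hHX : 10 * (H:ℝ) ≤ X := by nlinarith
  have hexp : exp d ≤ 6 / 5 := by
    have := Real.abs_exp_sub_one_le (show |d| ≤ 1 by rw [abs_of_pos hd0]; linarith)
    rw [abs_of_pos hd0] at this
    linarith [le_abs_self (exp d - 1)]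
  have he := Real.exp_one_gt_d9
  set J : ℕ → Set ℝ := fun x => Set.Ico (log x) (log (x + H)) with hJ
  have hpt : ∀ x ∈ blk X (2 * X), ‖sh f x H‖ ^ 2 ≤ 4 * X * H / d ^ 2 * (∫ v in J x, W v ^ 2) + 2 * (4 * h + 5) ^ 2 := by
    intro x hx
    obtain ⟨hx1, hx2⟩ := (mem_blk hX0.le).1 hx
    have hx0 : (0:ℝ) < x := by linarith
    have h1 := C1 hf hd0 hX (x := x) (H := H) hx1.le (by nlinarith [exp_pos d])
    have h2 := C2 hf (x := x) (H := H) (by exact_mod_cast hx0)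
    have h3 : ‖∫ v in J x, win (fun n => f n / n) (blk X (exp 1 * X)) d v‖ ≤ ∫ v in J x, W v := norm_integral_le_integral_norm _
    set I := ∫ v in J x, win (fun n => f n / n) (blk X (exp 1 * X)) d v
    have h4 : ‖∑ n ∈ Ioc x (x + H), f n / n‖ ≤ d⁻¹ * (∫ v in J x, W v) + 2 * (d + 2 / x) := by
      have := norm_sub_norm_le (∑ n ∈ Ioc x (x + H), f n / n) ((d:ℂ)⁻¹ * I)
      rw [norm_mul, norm_inv, norm_real, norm_of_nonneg hd0.le] at this
      have : d⁻¹ * ‖I‖ ≤ d⁻¹ * (∫ v in J x, W v) := by gcongr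
      push_cast at h1
      linarith
    have h5 : ‖sh f x H‖ ≤ x * d⁻¹ * (∫ v in J x, W v) + (4 * h + 5) := by
      refine h2.trans ?_
      have a1 : (x:ℝ) * ‖∑ n ∈ Ioc x (x + H), f n / n‖ ≤ x * (d⁻¹ * (∫ v in J x, W v) + 2 * (d + 2 / x)) := by gcongr
      have a2 : (x:ℝ) * (d⁻¹ * (∫ v in J x, W v) + 2 * (d + 2 / x)) = x * d⁻¹ * (∫ v in J x, W v) + 2 * (x * d) + 4 := by field_simp; ring
      have a3 : (x:ℝ) * d ≤ 2 * X * d := by gcongr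
      have a4 : 2 * X * d = 2 * h := by rw [hd]; field_simp
      have a5 : (H:ℝ) ^ 2 / x ≤ 1 := by rw [div_le_one hx0]; nlinarith
      linarith
    have hvol : (volume.restrict (J x)).real Set.univ ≤ H / x := by
      rw [measureReal_restrict_apply_univ, hJ]
      simp only
      rw [Real.volume_real_Ico_of_le (log_le_log hx0 (by linarith)), ← log_div (by positivity) hx0.ne', add_div, div_self hx0.ne']
      have := log_le_sub_one_of_pos (show (0:ℝ) < 1 + H / x by positivity)
      linarith
    have : IsFiniteMeasure (volume.restrict (J x)) := ⟨by rw [Measure.restrict_apply_univ]; simp [hJ]⟩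
    have h6 := int_cs (hWm (J x)) (hWi.restrict)
    set K := ∫ v in J x, W v
    set K2 := ∫ v in J x, W v ^ 2
    have hK2 : 0 ≤ K2 := integral_nonneg fun _ => by positivity
    have h7 : K ^ 2 ≤ H / x * K2 := h6.trans (by gcongr)
    calc ‖sh f x H‖ ^ 2 ≤ (x * d⁻¹ * K + (4 * h + 5)) ^ 2 := by gcongr
      _ ≤ 2 * (x * d⁻¹ * K) ^ 2 + 2 * (4 * h + 5) ^ 2 := by linarith only [sq_nonneg (x * d⁻¹ * K - (4 * h + 5))]
      _ = 2 * (x * d⁻¹) ^ 2 * K ^ 2 + 2 * (4 * h + 5) ^ 2 := by ring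
      _ ≤ 2 * (x * d⁻¹) ^ 2 * (H / x * K2) + 2 * (4 * h + 5) ^ 2 := by gcongr
      _ = x * (2 * H / d ^ 2 * K2) + 2 * (4 * h + 5) ^ 2 := by field_simp
      _ ≤ (2 * X) * (2 * H / d ^ 2 * K2) + 2 * (4 * h + 5) ^ 2 := by gcongr
      _ = _ := by ring
  refine (sum_le_sum hpt).trans ?_
  rw [sum_add_distrib, ← mul_sum, sum_const, nsmul_eq_mul]
  have hcard : ((blk X (2 * X)).card : ℝ) ≤ 2 * X := by
    unfold blk
    rw [Nat.card_Ioc]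
    have h1 : ((⌊2 * X⌋₊ - ⌊X⌋₊ : ℕ) : ℝ) ≤ ⌊2 * X⌋₊ := by exact_mod_cast Nat.sub_le _ _
    exact h1.trans (Nat.floor_le (by linarith))
  have hsum : ∑ x ∈ blk X (2 * X), ∫ v in J x, W v ^ 2 ≤ H * ∫ v, W v ^ 2 := by
    have hJm : ∀ x, MeasurableSet (J x) := fun x => measurableSet_Ico
    simp_rw [← integral_indicator (hJm _)]
    rw [← integral_finsetSum _ fun x _ => hWi.indicator (hJm x), ← integral_const_mul]
    refine integral_mono (integrable_finsetSum _ fun x _ => hWi.indicator (hJm x)) (hWi.const_mul _) fun v => ?_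
    simp only [Set.indicator]
    rw [← sum_filter, sum_const, nsmul_eq_mul]
    refine mul_le_mul_of_nonneg_right ?_ (by positivity)
    have : (blk X (2 * X)).filter (fun x => v ∈ J x) ⊆ Ioc (⌊exp v⌋₊ - H) ⌊exp v⌋₊ := by
      intro x hx
      obtain ⟨hx, h1, h2⟩ := mem_filter.1 hx
      have hx0 : (0:ℝ) < x := by linarith [((mem_blk hX0.le).1 hx).1]
      rw [log_le_iff_le_exp hx0] at h1
      rw [lt_log_iff_exp_lt (by positivity)] at h2
      have hx1 : 0 < x := by exact_mod_cast hx0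
      have h3 := Nat.le_floor h1
      have h4 : ⌊exp v⌋₊ < x + H := (Nat.floor_lt (exp_pos v).le).2 (by push_cast; exact h2)
      exact mem_Ioc.2 ⟨by omega, h3⟩
    have := card_le_card this
    rw [Nat.card_Ioc] at this
    exact_mod_cast this.trans (by omega)
  have hWε : (X / h) ^ 2 * ∫ v, W v ^ 2 ≤ ε / 6 := by
    have h1 : 2 * π * (X / h) ^ 2 * ∫ v, W v ^ 2 ≤ ε := hP ▸ hM
    have hpi := pi_gt_three
    have h0 : 0 ≤ (X / h) ^ 2 * ∫ v, W v ^ 2 := mul_nonneg (by positivity) (integral_nonneg fun _ => by positivity)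
    nlinarith only [h1, hpi, h0]
  have a1 : 4 * X * H / d ^ 2 * ∑ x ∈ blk X (2 * X), ∫ v in J x, W v ^ 2 ≤ 4 * X * H / d ^ 2 * (H * ∫ v, W v ^ 2) := by gcongr
  have a2 : 4 * X * H / d ^ 2 * (H * ∫ v, W v ^ 2) = 4 * X * H ^ 2 * ((X / h) ^ 2 * ∫ v, W v ^ 2) := by
    rw [hd]; field_simp
  have a3 : 4 * X * H ^ 2 * ((X / h) ^ 2 * ∫ v, W v ^ 2) ≤ 4 * X * H ^ 2 * (ε / 6) := by gcongr
  have a4 : (blk X (2 * X)).card * (2 * (4 * h + 5) ^ 2) ≤ 2 * X * (2 * (4 * h + 5) ^ 2) := by gcongr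
  have a5 : X * (4 * (4 * h + 5) ^ 2) ≤ X * (ε * H ^ 2) := by gcongr
  have a6 : 0 ≤ X * (ε * H ^ 2) := le_trans (by positivity) a5
  nlinarith only [a1, a2, a3, a4, a5, a6]

lemma sh_le {f : ℕ → ℂ} (hf : ∀ n, ‖f n‖ ≤ 1) (x H : ℕ) : ‖sh f x H‖ ≤ H :=
  (norm_sum_le _ _).trans ((sum_le_card_nsmul _ _ 1 fun n _ => hf n).trans (by simp))

theorem NN_of_Cl {f : ℕ → ℂ} (hf : Mf f) (hcl : Cl f) : NN f := by
  intro ε hε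
  obtain ⟨h, hh, X0, hX0, hM⟩ := MRmain hf hcl (show 0 < ε / 8 by positivity)
  obtain ⟨H0, hH0⟩ := exists_nat_ge (4 * (4 * h + 5) ^ 2 / (ε / 8) + 1)
  refine ⟨H0, fun H hH => ?_⟩
  have hq : 0 ≤ 4 * (4 * h + 5) ^ 2 / (ε / 8) := by positivity
  have hHH : (H0:ℝ) ≤ H := by exact_mod_cast hH
  have hH1 : (1:ℝ) ≤ H := by linarith
  have hHε : 4 * (4 * h + 5) ^ 2 ≤ ε / 8 * H ^ 2 := by
    have h1 : 4 * (4 * h + 5) ^ 2 / (ε / 8) ≤ H ^ 2 := by nlinarith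
    rw [div_le_iff₀ (by positivity)] at h1; linarith
  obtain ⟨K, hK⟩ := exists_nat_ge (2 * (X0 + 10 * (H:ℝ) ^ 2 + 10 * h))
  have main : ∀ M : ℕ, ∑ x ∈ range (M + 1), ‖sh f x H‖ ^ 2 ≤ ε / 4 * H ^ 2 * M + (K + 1) * H ^ 2 := by
    intro M
    induction M using Nat.strong_induction_on with
    | _ M ih =>
      by_cases hMK : M < K
      · refine (sum_le_card_nsmul _ _ ((H:ℝ) ^ 2) fun x _ => by gcongr; exact sh_le hf.le x H).trans ?_
        rw [card_range, nsmul_eq_mul]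
        have : ((M + 1 : ℕ) : ℝ) ≤ K + 1 := by exact_mod_cast by omega
        have : ((M + 1 : ℕ) : ℝ) * H ^ 2 ≤ (K + 1) * H ^ 2 := by gcongr
        have : 0 ≤ ε / 4 * H ^ 2 * M := by positivity
        linarith
      · have hMK' : (K:ℝ) ≤ M := by exact_mod_cast not_lt.1 hMK
        have hM2 : X0 + 10 * (H:ℝ) ^ 2 + 10 * h ≤ M / 2 := by linarith
        have hp : 0 ≤ 10 * (H:ℝ) ^ 2 := by positivity
        have hb := C3 hf hh (show (1:ℝ) ≤ (M:ℝ) / 2 by linarith) (hM _ (by linarith)).2 (by exact_mod_cast hH1) hHε (by linarith) (by linarith)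
        have hM0 : (0:ℝ) < M := by linarith
        have hlt : ⌊(M:ℝ) / 2⌋₊ < M := (Nat.floor_lt (by positivity)).2 (by linarith)
        have := ih _ hlt
        have hfl := Nat.floor_le (show (0:ℝ) ≤ (M:ℝ) / 2 by positivity)
        have e : ∑ x ∈ range (M + 1), ‖sh f x H‖ ^ 2 = ∑ x ∈ range (⌊(M:ℝ) / 2⌋₊ + 1), ‖sh f x H‖ ^ 2 + ∑ x ∈ blk (M / 2) (2 * (M / 2)), ‖sh f x H‖ ^ 2 := by
          unfold blk
          rw [mul_div_cancel₀ _ (by norm_num), Nat.floor_natCast, ← sum_union]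
          · congr 1; ext x; simp only [mem_range, mem_union, mem_Ioc]; omega
          · rw [disjoint_left]; intro x; simp only [mem_range, mem_Ioc]; omega
        rw [e]
        have : ε / 4 * H ^ 2 * (⌊(M:ℝ) / 2⌋₊ : ℝ) ≤ ε / 4 * H ^ 2 * (M / 2) := by gcongr
        linarith
  obtain ⟨M0, hM0⟩ := exists_nat_ge (2 * (K + 1) / ε)
  refine ⟨M0, fun M hMM => ?_⟩
  have h1 : ∑ x ∈ range M, ‖sh f x H‖ ^ 2 ≤ ∑ x ∈ range (M + 1), ‖sh f x H‖ ^ 2 :=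
    sum_le_sum_of_subset_of_nonneg (Finset.range_subset_range.2 (by omega)) fun _ _ _ => by positivity
  have h2 : 2 * (K + 1) / ε ≤ M := hM0.trans (by exact_mod_cast hMM)
  rw [div_le_iff₀ hε] at h2
  have h3 := mul_le_mul_of_nonneg_right h2 (show 0 ≤ (H:ℝ) ^ 2 by positivity)
  have h4 : 0 ≤ ε * H ^ 2 * M := by positivity
  linarith [main M]

end MR
namespace MR
open ArithmeticFunction

lemma moe_le (n : ℕ) : ‖(moebius n : ℂ)‖ ≤ 1 := by
  rw [Complex.norm_intCast]; exact_mod_cast abs_moebius_le_one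

lemma NN_chi (q : ℕ) [NeZero q] (χ : DirichletCharacter ℂ q) : NN (fun n => moebius n * χ n) := by
  refine NN_of_Cl ⟨fun n => ?_, fun p m hp hm => ?_⟩ ?_
  · rw [norm_mul]; exact mul_le_one₀ (moe_le n) (norm_nonneg _) (χ.norm_le_one _)
  · rw [isMultiplicative_moebius.map_mul_of_coprime ((Nat.Prime.coprime_iff_not_dvd hp).2 hm)]
    push_cast; rw [map_mul]; ring
  · obtain ⟨C0, h0, h⟩ := claim q χ
    refine ⟨C0, h0, fun a b ha hb => ?_⟩
    obtain ⟨X0, hX⟩ := h a b ha hb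
    refine ⟨X0, fun X h1 t ht => le_trans (le_of_eq ?_) (hX X h1 t ht)⟩
    rw [← Complex.neg_re, ← Finset.sum_neg_distrib]
    congr 1
    refine sum_congr rfl fun p hp => ?_
    beta_reduce
    rw [moebius_apply_prime (mem_filter.1 hp).2]
    push_cast; ring

lemma NN.add {f g : ℕ → ℂ} (hf : NN f) (hg : NN g) : NN (fun n => f n + g n) := by
  intro ε hε
  obtain ⟨A, hA⟩ := hf (ε / 4) (by positivity)
  obtain ⟨B, hB⟩ := hg (ε / 4) (by positivity)
  refine ⟨max A B, fun H hH => ?_⟩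
  obtain ⟨a, ha⟩ := hA H (le_of_max_le_left hH)
  obtain ⟨b, hb⟩ := hB H (le_of_max_le_right hH)
  refine ⟨max a b, fun M hM => ?_⟩
  have h1 := ha M (le_of_max_le_left hM)
  have h2 := hb M (le_of_max_le_right hM)
  have : ∑ x ∈ range M, ‖sh (fun n => f n + g n) x H‖ ^ 2 ≤ ∑ x ∈ range M, (2 * ‖sh f x H‖ ^ 2 + 2 * ‖sh g x H‖ ^ 2) := by
    refine sum_le_sum fun x _ => ?_
    have h3 : sh (fun n => f n + g n) x H = sh f x H + sh g x H := sum_add_distrib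
    rw [h3]
    nlinarith only [norm_add_le (sh f x H) (sh g x H), norm_nonneg (sh f x H + sh g x H), sq_nonneg (‖sh f x H‖ - ‖sh g x H‖)]
  rw [sum_add_distrib, ← mul_sum, ← mul_sum] at this
  linarith

lemma NN.smul {f : ℕ → ℂ} (hf : NN f) (c : ℂ) : NN (fun n => c * f n) := by
  intro ε hε
  obtain ⟨A, hA⟩ := hf (ε / (‖c‖ ^ 2 + 1)) (by positivity)
  refine ⟨A, fun H hH => ?_⟩
  obtain ⟨a, ha⟩ := hA H hH
  refine ⟨a, fun M hM => ?_⟩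
  have h1 := ha M hM
  have : ∀ x, ‖sh (fun n => c * f n) x H‖ ^ 2 = ‖c‖ ^ 2 * ‖sh f x H‖ ^ 2 := fun x => by
    unfold sh; rw [← mul_sum, norm_mul, mul_pow]
  simp_rw [this]
  rw [← mul_sum]
  have h2 : ‖c‖ ^ 2 * (ε / (‖c‖ ^ 2 + 1)) ≤ ε := by
    rw [mul_div_assoc', div_le_iff₀ (by positivity)]; nlinarith only [hε]
  calc _ ≤ ‖c‖ ^ 2 * (ε / (‖c‖ ^ 2 + 1) * H ^ 2 * M) := by gcongr
    _ = ‖c‖ ^ 2 * (ε / (‖c‖ ^ 2 + 1)) * H ^ 2 * M := by ring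
    _ ≤ _ := by gcongr

lemma NN.sum {ι : Type*} (s : Finset ι) (f : ι → ℕ → ℂ) (h : ∀ i ∈ s, NN (f i)) : NN (fun n => ∑ i ∈ s, f i n) := by
  classical
  induction s using Finset.induction_on with
  | empty => exact fun ε hε => ⟨0, fun H _ => ⟨0, fun M _ => by simp [sh]; positivity⟩⟩
  | insert i s hi ih =>
    simp_rw [Finset.sum_insert hi]
    exact (h i (by simp)).add (ih fun j hj => h j (by simp [hj]))

lemma sum_div (G : ℕ → ℝ) {d : ℕ} (hd : 0 < d) (M : ℕ) : ∑ x ∈ range (d * M), G (x / d) = d * ∑ y ∈ range M, G y := by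
  induction M with
  | zero => simp
  | succ M ih =>
    rw [Nat.mul_succ, Finset.sum_range_add, ih, sum_range_succ, mul_add]
    congr 1
    rw [sum_congr rfl fun x hx => by rw [Nat.mul_add_div hd, Nat.div_eq_of_lt (mem_range.1 hx), add_zero]]
    simp

lemma NN.dil {F : ℕ → ℂ} (hF : NN F) (h1 : ∀ n, ‖F n‖ ≤ 1) {d : ℕ} (hd : 0 < d) : NN (fun n => if d ∣ n then F (n / d) else 0) := by
  intro ε hε
  obtain ⟨A, hA⟩ := hF (ε / (4 * d)) (by positivity)
  obtain ⟨B, hB⟩ := exists_nat_ge (4 / ε)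
  refine ⟨max (d * A) (B + 1), fun H hH => ?_⟩
  have hH1 := le_of_max_le_left hH
  have hH2 := le_of_max_le_right hH
  obtain ⟨a, ha⟩ := hA (H / d) ((Nat.le_div_iff_mul_le hd).2 (by rwa [mul_comm]))
  refine ⟨a, fun M hM => ?_⟩
  have key : ∀ x, ‖sh (fun n => if d ∣ n then F (n / d) else 0) x H‖ ^ 2 ≤ 2 * ‖sh F (x / d) (H / d)‖ ^ 2 + 2 := by
    intro x
    have e1 : sh (fun n => if d ∣ n then F (n / d) else 0) x H = ∑ m ∈ Ioc (x / d) ((x + H) / d), F m := by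
      unfold sh
      rw [← sum_filter]
      refine sum_nbij' (· / d) (d * ·) ?_ ?_ ?_ ?_ ?_
      · intro n hn
        simp only [mem_filter, mem_Ioc] at hn ⊢
        obtain ⟨⟨h1, h2⟩, k, rfl⟩ := hn
        rw [Nat.mul_div_cancel_left _ hd]
        exact ⟨(Nat.div_lt_iff_lt_mul hd).2 (by rwa [mul_comm]), (Nat.le_div_iff_mul_le hd).2 (by rwa [mul_comm])⟩
      · intro m hm
        simp only [mem_filter, mem_Ioc] at hm ⊢
        have h1 := (Nat.div_lt_iff_lt_mul hd).1 hm.1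
        have h2 := (Nat.le_div_iff_mul_le hd).1 hm.2
        rw [mul_comm d m]
        exact ⟨⟨h1, h2⟩, Dvd.intro_left _ rfl⟩
      · intro n hn; exact Nat.mul_div_cancel' (mem_filter.1 hn).2
      · intro m _; exact Nat.mul_div_cancel_left _ hd
      · intro n hn; rfl
    have e2 : ‖∑ m ∈ Ioc (x / d) ((x + H) / d), F m‖ ≤ ‖sh F (x / d) (H / d)‖ + 1 := by
      unfold sh
      rw [Nat.add_div hd]
      split_ifs
      · rw [← Finset.insert_Ioc_right_eq_Ioc_add_one (Nat.le_add_right _ _), Finset.sum_insert (by simp), add_comm]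
        exact (norm_add_le _ _).trans (by gcongr; exact h1 _)
      · rw [add_zero]; linarith
    rw [e1]
    nlinarith only [e2, norm_nonneg (∑ m ∈ Ioc (x / d) ((x + H) / d), F m), sq_nonneg (‖sh F (x / d) (H / d)‖ - 1)]
  have h2 := ha M hM
  have h3 : ((H / d : ℕ) : ℝ) ≤ H := by exact_mod_cast Nat.div_le_self _ _
  have h4 : 4 ≤ ε * (H:ℝ) ^ 2 := by
    have : (B:ℝ) + 1 ≤ H := by exact_mod_cast hH2
    rw [div_le_iff₀ hε] at hB
    have hb : (0:ℝ) ≤ B := by positivity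
    have : (B:ℝ) ≤ H ^ 2 := by nlinarith only [this, hb]
    nlinarith only [this, hB, hε]
  have hd' : (0:ℝ) < d := by exact_mod_cast hd
  calc _ ≤ ∑ x ∈ range M, (2 * ‖sh F (x / d) (H / d)‖ ^ 2 + 2) := sum_le_sum fun x _ => key x
    _ = 2 * ∑ x ∈ range M, ‖sh F (x / d) (H / d)‖ ^ 2 + 2 * M := by
      rw [sum_add_distrib, ← mul_sum]; simp [mul_comm]
    _ ≤ 2 * ∑ x ∈ range (d * M), ‖sh F (x / d) (H / d)‖ ^ 2 + 2 * M := by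
      gcongr; exact Nat.le_mul_of_pos_left _ hd
    _ = 2 * (d * ∑ y ∈ range M, ‖sh F y (H / d)‖ ^ 2) + 2 * M := by
      rw [sum_div (fun y => ‖sh F y (H / d)‖ ^ 2) hd]
    _ ≤ 2 * (d * (ε / (4 * d) * (H:ℝ) ^ 2 * M)) + 2 * M := by
      gcongr; exact h2.trans (by gcongr)
    _ = ε / 2 * (H:ℝ) ^ 2 * M + 2 * M := by field_simp; ring
    _ ≤ ε / 2 * (H:ℝ) ^ 2 * M + (ε * (H:ℝ) ^ 2) / 2 * M := by gcongr; linarith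
    _ = _ := by ring

lemma moe_exp (q : ℕ) [NeZero q] (g : ZMod q → ℂ) (n : ℕ) :
    (moebius n : ℂ) * g n = ∑ d ∈ q.divisors, ∑ χ : DirichletCharacter ℂ q,
      (moebius d / q.totient * ∑ a : (ZMod q)ˣ, χ ((a : ZMod q)⁻¹) * g (d * a)) * (if d ∣ n then (moebius (n / d) : ℂ) * χ ((n / d : ℕ)) else 0) := by
  have hq : (q.totient : ℂ) ≠ 0 := by exact_mod_cast (Nat.totient_pos.2 (NeZero.pos q)).ne'
  have key : ∀ d ∈ q.divisors, ∑ χ : DirichletCharacter ℂ q,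
      (moebius d / q.totient * ∑ a : (ZMod q)ˣ, χ ((a : ZMod q)⁻¹) * g (d * a)) * (if d ∣ n then (moebius (n / d) : ℂ) * χ ((n / d : ℕ)) else 0)
      = if d ∣ n ∧ (n / d).Coprime q then (moebius n : ℂ) * g n else 0 := by
    intro d hd
    by_cases hdn : d ∣ n
    · obtain ⟨m, rfl⟩ := hdn
      have hd0 : 0 < d := Nat.pos_of_mem_divisors hd
      simp only [dvd_mul_right, if_true, true_and, Nat.mul_div_cancel_left _ hd0]
      have : ∑ χ : DirichletCharacter ℂ q, (moebius d / q.totient * ∑ a : (ZMod q)ˣ, χ ((a : ZMod q)⁻¹) * g (d * a)) * ((moebius m : ℂ) * χ (m : ZMod q))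
          = moebius d * moebius m / q.totient * ∑ a : (ZMod q)ˣ, g (d * a) * if (a : ZMod q) = m then (q.totient : ℂ) else 0 := by
        simp_rw [← fun a : (ZMod q)ˣ => DirichletCharacter.sum_char_inv_mul_char_eq ℂ a.isUnit (m : ZMod q), mul_sum, sum_mul]
        rw [sum_comm]
        exact sum_congr rfl fun a _ => sum_congr rfl fun χ _ => by ring
      rw [this]
      split_ifs with hc
      · rw [Finset.sum_eq_single (ZMod.unitOfCoprime m hc)]
        · have hdm : d.Coprime m := (hc.coprime_dvd_right (Nat.dvd_of_mem_divisors hd)).symm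
          rw [isMultiplicative_moebius.map_mul_of_coprime hdm]
          simp only [ZMod.coe_unitOfCoprime, if_true]
          push_cast; field_simp
        · intro b _ hb
          rw [if_neg, mul_zero]
          exact fun h => hb (Units.ext (by simpa using h))
        · simp
      · rw [Finset.sum_eq_zero, mul_zero]
        intro a _
        rw [if_neg, mul_zero]
        exact fun h => hc ((ZMod.isUnit_iff_coprime m q).1 (h ▸ a.isUnit))
    · simp [hdn]
  rw [sum_congr rfl key]
  by_cases h0 : moebius n = 0
  · simp [h0]
  have hsq := moebius_ne_zero_iff_squarefree.1 h0
  have hn0 : 0 < n := Nat.pos_of_ne_zero hsq.ne_zero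
  have hg0 := Nat.gcd_pos_of_pos_left q hn0
  rw [Finset.sum_eq_single (n.gcd q), if_pos]
  · refine ⟨Nat.gcd_dvd_left _ _, ?_⟩
    obtain ⟨m, hm⟩ := Nat.gcd_dvd_left n q
    have h1 : n / n.gcd q = m := Nat.div_eq_of_eq_mul_right hg0 hm
    rw [h1]
    have h2 : (n.gcd q).Coprime m := by
      rw [hm, Nat.squarefree_mul_iff] at hsq
      exact hsq.1
    refine Nat.eq_one_of_dvd_one (h2 ▸ Nat.dvd_gcd (Nat.dvd_gcd ?_ (Nat.gcd_dvd_right _ _)) (Nat.gcd_dvd_left _ _))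
    exact (Nat.gcd_dvd_left m q).trans ⟨_, by rw [mul_comm]; exact hm⟩
  · intro d hd hne
    refine if_neg ?_
    rintro ⟨⟨m, rfl⟩, h2⟩
    rw [Nat.mul_div_cancel_left _ (Nat.pos_of_mem_divisors hd)] at h2
    apply hne
    obtain ⟨k, hk⟩ := Nat.dvd_of_mem_divisors hd
    rw [hk, Nat.gcd_mul_left, (h2.coprime_dvd_right ⟨d, by rw [hk, mul_comm]⟩ : m.gcd k = 1), mul_one]
  · exact fun h => absurd (Nat.mem_divisors.2 ⟨Nat.gcd_dvd_right _ _, NeZero.ne q⟩) h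

lemma NN_rat {z : ℂ} {q : ℕ} (hq : q ≠ 0) (hz : z ^ q = 1) : NN (fun n => moebius n * z ^ n) := by
  haveI : NeZero q := ⟨hq⟩
  obtain ⟨g, hg⟩ : ∃ g : ZMod q → ℂ, ∀ n : ℕ, z ^ n = g n :=
    ⟨fun a => z ^ a.val, fun n => by simp only [ZMod.val_natCast]; exact pow_eq_pow_mod n hz⟩
  simp_rw [hg, moe_exp q g]
  refine NN.sum _ _ fun d hd => NN.sum _ _ fun χ _ => NN.smul ?_ _
  exact (NN_chi q χ).dil (fun n => by rw [norm_mul]; exact mul_le_one₀ (moe_le n) (norm_nonneg _) (χ.norm_le_one _)) (Nat.pos_of_mem_divisors hd)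
end MR
namespace MR
open ArithmeticFunction

noncomputable def oP (P : Finset ℕ) (n : ℕ) : ℝ := ∑ p ∈ P, if p ∣ n then 1 else 0
noncomputable def LP (P : Finset ℕ) : ℝ := ∑ p ∈ P, (p:ℝ)⁻¹

lemma cntd (N p : ℕ) : ∑ n ∈ Ioc 0 N, (if p ∣ n then (1:ℝ) else 0) = (N / p : ℕ) := by
  rw [← sum_filter, sum_const, Nat.Ioc_filter_dvd_card_eq_div]; simp

lemma TK {P : Finset ℕ} (hP : ∀ p ∈ P, p.Prime) (N : ℕ) :
    ∑ n ∈ Ioc 0 N, (LP P - oP P n) ^ 2 ≤ N * LP P + 2 * LP P * P.card := by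
  have hL : 0 ≤ LP P := sum_nonneg fun p _ => by positivity
  have h1 : N * LP P - P.card ≤ ∑ n ∈ Ioc 0 N, oP P n := by
    unfold oP LP
    rw [sum_comm, mul_sum, Finset.card_eq_sum_ones, Nat.cast_sum, ← sum_sub_distrib]
    refine sum_le_sum fun p hp => ?_
    rw [cntd, Nat.cast_one, sub_le_iff_le_add, ← div_eq_mul_inv]
    have := Nat.lt_floor_add_one ((N:ℝ) / p)
    rw [Nat.floor_div_eq_div] at this
    exact this.le
  have h2 : ∑ n ∈ Ioc 0 N, oP P n ^ 2 ≤ N * LP P ^ 2 + N * LP P := by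
    have e : ∀ n, oP P n ^ 2 = ∑ p ∈ P, ∑ q ∈ P, (if p ∣ n then (1:ℝ) else 0) * (if q ∣ n then 1 else 0) := fun n => by
      rw [sq, oP, sum_mul_sum]
    simp_rw [e]
    rw [sum_comm]
    have e2 : (N:ℝ) * LP P ^ 2 + N * LP P = ∑ p ∈ P, ∑ q ∈ P, ((N:ℝ) * ((p:ℝ)⁻¹ * (q:ℝ)⁻¹) + if p = q then (N:ℝ) * (p:ℝ)⁻¹ else 0) := by
      simp_rw [sum_add_distrib, ← mul_sum]
      rw [sq, LP, sum_mul_sum]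
      simp_rw [mul_sum]
      congr 1
      refine sum_congr rfl fun p hp => ?_
      rw [sum_ite_eq, if_pos hp]
    rw [e2]
    refine sum_le_sum fun p hp => ?_
    rw [sum_comm]
    refine sum_le_sum fun q hq => ?_
    have hb : ∀ d : ℕ, ((N / d : ℕ) : ℝ) ≤ N * (d:ℝ)⁻¹ := fun d => by rw [← div_eq_mul_inv]; exact Nat.cast_div_le
    split_ifs with h
    · subst h
      have : ∀ n, (if p ∣ n then (1:ℝ) else 0) * (if p ∣ n then 1 else 0) = if p ∣ n then 1 else 0 := fun n => by split_ifs <;> simp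
      simp_rw [this]
      rw [cntd]
      have := hb p
      have : 0 ≤ (N:ℝ) * ((p:ℝ)⁻¹ * (p:ℝ)⁻¹) := by positivity
      linarith
    · have : ∀ n, (if p ∣ n then (1:ℝ) else 0) * (if q ∣ n then 1 else 0) = if p * q ∣ n then 1 else 0 := fun n => by
        have hi : p * q ∣ n ↔ p ∣ n ∧ q ∣ n := ⟨fun h => ⟨dvd_of_mul_right_dvd h, dvd_of_mul_left_dvd h⟩,
          fun g => Nat.Coprime.mul_dvd_of_dvd_of_dvd ((Nat.coprime_primes (hP p hp) (hP q hq)).2 h) g.1 g.2⟩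
        simp only [hi]
        split_ifs <;> simp_all
      simp_rw [this]
      rw [cntd]
      have := hb (p * q)
      push_cast at this
      rw [← mul_inv]
      linarith
  have h3 : ∑ n ∈ Ioc 0 N, (LP P - oP P n) ^ 2 = N * LP P ^ 2 - 2 * LP P * ∑ n ∈ Ioc 0 N, oP P n + ∑ n ∈ Ioc 0 N, oP P n ^ 2 := by
    simp_rw [sub_sq]
    rw [sum_add_distrib, sum_sub_distrib, ← mul_sum]; simp
  rw [h3]
  nlinarith only [h1, h2, mul_le_mul_of_nonneg_left h1 hL]

lemma cs1 (N : ℕ) (b : ℕ → ℂ) : ‖∑ m ∈ Ioc 0 N, moebius m * b m‖ ^ 2 ≤ N * ∑ m ∈ Ioc 0 N, ‖b m‖ ^ 2 := by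
  have h1 : ‖∑ m ∈ Ioc 0 N, moebius m * b m‖ ≤ ∑ m ∈ Ioc 0 N, ‖b m‖ :=
    norm_sum_le_of_le _ fun m _ => by rw [norm_mul]; exact mul_le_of_le_one_left (norm_nonneg _) (moe_le m)
  have h2 := sq_sum_le_card_mul_sum_sq (s := Ioc 0 N) (f := fun m => ‖b m‖)
  rw [Nat.card_Ioc, Nat.sub_zero] at h2
  exact (pow_le_pow_left₀ (norm_nonneg _) h1 2).trans h2

noncomputable def ff (F : ℕ → ℂ) (N p m : ℕ) : ℂ := if m ≤ N / p then F (p * m) else 0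

lemma ff_sum (F : ℕ → ℂ) (N p : ℕ) (c : ℕ → ℂ) : ∑ m ∈ Ioc 0 N, c m * ff F N p m = ∑ m ∈ Ioc 0 (N / p), c m * F (p * m) := by
  unfold ff
  simp_rw [mul_ite, mul_zero]
  rw [← sum_filter]
  congr 1
  ext m; simp only [mem_filter, mem_Ioc]
  have := Nat.div_le_self N p
  omega

lemma katai {P : Finset ℕ} (hP : ∀ p ∈ P, p.Prime) {C : ℝ} (hC : ∑ p ∈ P, ((p:ℝ) ^ 2)⁻¹ ≤ C) {F : ℕ → ℂ} {B : ℝ} (hB : 0 ≤ B) (hF : ∀ n, ‖F n‖ ≤ B) {N : ℕ}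
    (hN : 2 * P.card ≤ N) {O : ℕ → ℕ → ℝ} (hO0 : ∀ p q, 0 ≤ O p q) (hO : ∀ p ∈ P, ∀ q ∈ P, p ≠ q → ∀ K ≤ N, ‖∑ m ∈ Ioc 0 K, F (p * m) * conj (F (q * m))‖ ≤ O p q)
    (hOs : ∑ p ∈ P, ∑ q ∈ P, O p q ≤ B ^ 2 * N * LP P) :
    ‖∑ n ∈ Ioc 0 N, moebius n * F n‖ * LP P ≤ B * N * (2 * sqrt (2 * LP P) + C) := by
  have hL : 0 ≤ LP P := sum_nonneg fun p _ => by positivity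
  set L := LP P with hLd
  set s := sqrt (2 * L)
  have hs : s ^ 2 = 2 * L := sq_sqrt (by positivity)
  have hs0 : 0 ≤ s := Real.sqrt_nonneg _
  have E1 : ‖∑ n ∈ Ioc 0 N, moebius n * (F n * (L - oP P n : ℝ))‖ ≤ B * N * s := by
    rw [← pow_le_pow_iff_left₀ (norm_nonneg _) (by positivity) two_ne_zero]
    refine (cs1 _ _).trans ?_
    have h1 : ∑ m ∈ Ioc 0 N, ‖F m * (L - oP P m : ℝ)‖ ^ 2 ≤ B ^ 2 * (N * L + 2 * L * P.card) := by
      refine le_trans ?_ (mul_le_mul_of_nonneg_left (TK hP N) (by positivity))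
      rw [mul_sum]
      refine sum_le_sum fun m _ => ?_
      rw [norm_mul, mul_pow, norm_real, norm_eq_abs, sq_abs]
      gcongr; exact hF m
    have h2 : (2:ℝ) * P.card ≤ N := by exact_mod_cast hN
    have h3 : B ^ 2 * (N * L + 2 * L * P.card) ≤ B ^ 2 * (2 * N * L) := by
      gcongr; nlinarith only [h2, hL]
    calc _ ≤ (N:ℝ) * (B ^ 2 * (2 * N * L)) := by gcongr; exact h1.trans h3
      _ = _ := by rw [mul_pow, hs]; ring
  have E2 : ‖∑ p ∈ P, ∑ m ∈ Ioc 0 (N / p), ((moebius (p * m) + moebius m : ℤ) : ℂ) * F (p * m)‖ ≤ B * N * C := by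
    calc _ ≤ ∑ p ∈ P, B * N * ((p:ℝ) ^ 2)⁻¹ := by
          refine norm_sum_le_of_le _ fun p hp => ?_
          calc _ ≤ ∑ m ∈ Ioc 0 (N / p), (if p ∣ m then (1:ℝ) else 0) * B := by
                refine norm_sum_le_of_le _ fun m _ => ?_
                rw [norm_mul]
                refine mul_le_mul ?_ (hF _) (norm_nonneg _) (by split_ifs <;> simp)
                split_ifs with h
                · have : moebius (p * m) = 0 := by
                    refine moebius_eq_zero_of_not_squarefree fun hs => ?_
                    have := hs p (Nat.mul_dvd_mul_left p h)
                    exact (hP p hp).not_isUnit this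
                  rw [this, zero_add]; exact moe_le m
                · rw [isMultiplicative_moebius.map_mul_of_coprime ((Nat.Prime.coprime_iff_not_dvd (hP p hp)).2 h), moebius_apply_prime (hP p hp)]
                  simp
            _ = (N / p / p : ℕ) * B := by rw [← sum_mul, cntd]
            _ ≤ _ := by
              rw [Nat.div_div_eq_div_mul, mul_comm, mul_assoc]
              refine mul_le_mul_of_nonneg_left (Nat.cast_div_le.trans ?_) hB
              push_cast; rw [div_eq_mul_inv, sq]
      _ = B * N * ∑ p ∈ P, ((p:ℝ) ^ 2)⁻¹ := by rw [mul_sum]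
      _ ≤ _ := by gcongr
  have E3 : ‖∑ m ∈ Ioc 0 N, moebius m * ∑ p ∈ P, ff F N p m‖ ≤ B * N * s := by
    rw [← pow_le_pow_iff_left₀ (norm_nonneg _) (by positivity) two_ne_zero]
    refine (cs1 _ _).trans ?_
    have h1 : ((∑ m ∈ Ioc 0 N, ‖∑ p ∈ P, ff F N p m‖ ^ 2 : ℝ) : ℂ) = ∑ p ∈ P, ∑ q ∈ P, ∑ m ∈ Ioc 0 N, ff F N p m * conj (ff F N q m) := by
      push_cast
      simp_rw [← mul_conj', map_sum, sum_mul_sum]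
      rw [sum_comm]
      exact sum_congr rfl fun p _ => sum_comm
    have h2 : ∑ m ∈ Ioc 0 N, ‖∑ p ∈ P, ff F N p m‖ ^ 2 ≤ B ^ 2 * (2 * N * L) := by
      have h0 : 0 ≤ ∑ m ∈ Ioc 0 N, ‖∑ p ∈ P, ff F N p m‖ ^ 2 := sum_nonneg fun _ _ => by positivity
      rw [← abs_of_nonneg h0, ← norm_eq_abs, ← norm_real, h1]
      calc _ ≤ ∑ p ∈ P, ∑ q ∈ P, ((if p = q then B ^ 2 * N * (p:ℝ)⁻¹ else 0) + O p q) := by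
            refine norm_sum_le_of_le _ fun p hp => norm_sum_le_of_le _ fun q hq => ?_
            have e : ∑ m ∈ Ioc 0 N, ff F N p m * conj (ff F N q m) = ∑ m ∈ Ioc 0 (min (N / p) (N / q)), F (p * m) * conj (F (q * m)) := by
              unfold ff
              simp_rw [apply_ite (starRingEnd ℂ), _root_.map_zero, ite_mul, zero_mul, mul_ite, mul_zero, ← ite_and]
              rw [← sum_filter]
              congr 1
              ext m; simp only [mem_filter, mem_Ioc, le_min_iff]
              have := Nat.div_le_self N p
              omega
            rw [e]
            split_ifs with h
            · subst h
              rw [min_self]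
              have : ‖∑ m ∈ Ioc 0 (N / p), F (p * m) * conj (F (p * m))‖ ≤ (N / p : ℕ) * B ^ 2 := by
                refine (norm_sum_le_of_le (f := fun m => F (p * m) * conj (F (p * m))) _ fun m _ => (?_ : _ ≤ B ^ 2)).trans (by simp)
                rw [norm_mul, RCLike.norm_conj, ← sq]
                exact pow_le_pow_left₀ (norm_nonneg _) (hF _) 2
              have h4 : ((N / p : ℕ) : ℝ) * B ^ 2 ≤ N / p * B ^ 2 := by gcongr; exact Nat.cast_div_le
              have := hO0 p p
              rw [div_eq_mul_inv] at h4
              linarith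
            · rw [zero_add]
              exact hO p hp q hq h _ ((min_le_left _ _).trans (Nat.div_le_self _ _))
        _ = B ^ 2 * N * L + ∑ p ∈ P, ∑ q ∈ P, O p q := by
          simp_rw [sum_add_distrib]
          congr 1
          rw [hLd, LP, mul_sum]
          exact sum_congr rfl fun p hp => by rw [sum_ite_eq, if_pos hp]
        _ ≤ _ := by linarith
    calc _ ≤ (N:ℝ) * (B ^ 2 * (2 * N * L)) := by gcongr
      _ = _ := by rw [mul_pow, hs]; ring
  have key : (∑ n ∈ Ioc 0 N, moebius n * F n) * (L : ℂ) = ∑ n ∈ Ioc 0 N, moebius n * (F n * (L - oP P n : ℝ))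
      + ∑ p ∈ P, ∑ m ∈ Ioc 0 (N / p), ((moebius (p * m) + moebius m : ℤ) : ℂ) * F (p * m) - ∑ m ∈ Ioc 0 N, moebius m * ∑ p ∈ P, ff F N p m := by
    have e1 : ∑ m ∈ Ioc 0 N, moebius m * ∑ p ∈ P, ff F N p m = ∑ p ∈ P, ∑ m ∈ Ioc 0 (N / p), (moebius m : ℂ) * F (p * m) := by
      simp_rw [mul_sum]
      rw [sum_comm]
      exact sum_congr rfl fun p _ => ff_sum F N p _
    have e2 : ∑ n ∈ Ioc 0 N, moebius n * F n * (oP P n : ℂ) = ∑ p ∈ P, ∑ m ∈ Ioc 0 (N / p), (moebius (p * m) : ℂ) * F (p * m) := by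
      unfold oP
      push_cast
      simp_rw [mul_sum]
      rw [sum_comm]
      refine sum_congr rfl fun p hp => ?_
      have hp0 := (hP p hp).pos
      simp only [apply_ite Complex.ofReal, ofReal_one, ofReal_zero, mul_ite, mul_one, mul_zero]
      rw [← sum_filter]
      refine sum_nbij' (· / p) (p * ·) ?_ ?_ ?_ ?_ ?_
      · intro n hn
        simp only [mem_filter, mem_Ioc] at hn ⊢
        exact ⟨Nat.div_pos (Nat.le_of_dvd hn.1.1 hn.2) hp0, Nat.div_le_div_right hn.1.2⟩
      · intro m hm
        simp only [mem_filter, mem_Ioc] at hm ⊢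
        have := (Nat.le_div_iff_mul_le hp0).1 hm.2
        exact ⟨⟨Nat.mul_pos hp0 hm.1, by rwa [mul_comm]⟩, Dvd.intro _ rfl⟩
      · intro n hn; exact Nat.mul_div_cancel' (mem_filter.1 hn).2
      · intro m _; exact Nat.mul_div_cancel_left _ hp0
      · intro n hn; rw [Nat.mul_div_cancel' (mem_filter.1 hn).2]
    rw [e1]
    push_cast
    simp_rw [add_mul, sum_add_distrib]
    rw [← e2, sum_mul]
    simp_rw [mul_sub, sum_sub_distrib, mul_assoc]
    ring
  have h1 : ‖∑ n ∈ Ioc 0 N, moebius n * F n‖ * L = ‖(∑ n ∈ Ioc 0 N, moebius n * F n) * (L : ℂ)‖ := by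
    rw [norm_mul, norm_real, norm_of_nonneg hL]
  rw [h1, key]
  have h2 := norm_sub_le (∑ n ∈ Ioc 0 N, moebius n * (F n * (L - oP P n : ℝ))
      + ∑ p ∈ P, ∑ m ∈ Ioc 0 (N / p), ((moebius (p * m) + moebius m : ℤ) : ℂ) * F (p * m)) (∑ m ∈ Ioc 0 N, moebius m * ∑ p ∈ P, ff F N p m)
  have h3 := norm_add_le (∑ n ∈ Ioc 0 N, moebius n * (F n * (L - oP P n : ℝ))) (∑ p ∈ P, ∑ m ∈ Ioc 0 (N / p), ((moebius (p * m) + moebius m : ℤ) : ℂ) * F (p * m))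
  linarith only [h2, h3, E1, E2, E3]

lemma abel {w : ℂ} (hw : ‖w‖ = 1) {G : ℕ → ℂ} {B D : ℝ} (hB : ∀ n, ‖G n‖ ≤ B) (hD : ∀ n, ‖G (n + 1) - G n‖ ≤ D) (K : ℕ) :
    ‖w - 1‖ * ‖∑ m ∈ Ioc 0 K, w ^ m * G m‖ ≤ 2 * B + K * D := by
  have h : (w - 1) * ∑ m ∈ Ioc 0 K, w ^ m * G m = w ^ (K + 1) * G K - w * G 0 - ∑ m ∈ range K, w ^ (m + 1) * (G (m + 1) - G m) := by
    induction K with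
    | zero => simp
    | succ K ih => rw [sum_Ioc_succ_top (Nat.zero_le _), mul_add, ih, sum_range_succ]; ring
  rw [← norm_mul, h]
  have h1 : ‖∑ m ∈ range K, w ^ (m + 1) * (G (m + 1) - G m)‖ ≤ K * D :=
    (norm_sum_le_of_le _ fun m _ => (by rw [norm_mul, norm_pow, hw, one_pow, one_mul]; exact hD m : _ ≤ D)).trans (by simp)
  have h2 : ‖w ^ (K + 1) * G K‖ ≤ B := by rw [norm_mul, norm_pow, hw, one_pow, one_mul]; exact hB K
  have h3 : ‖w * G 0‖ ≤ B := by rw [norm_mul, hw, one_mul]; exact hB 0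
  have h4 := norm_sub_le (w ^ (K + 1) * G K - w * G 0) (∑ m ∈ range K, w ^ (m + 1) * (G (m + 1) - G m))
  have h5 := norm_sub_le (w ^ (K + 1) * G K) (w * G 0)
  linarith
end MR
namespace MR
open ArithmeticFunction

def W (z : ℂ) : Prop := ∀ ε > (0:ℝ), ∃ H ≥ 1, ∃ M0 : ℕ, ∀ M ≥ M0, ∑ x ∈ range M, ‖sh (fun n => moebius n * z ^ n) x H‖ ^ 2 ≤ ε * H ^ 2 * M

noncomputable def gg (A : ℕ → ℂ) (M H n : ℕ) : ℂ := ∑ x ∈ range M, if x < n ∧ n ≤ x + H then A x else 0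

lemma gg_le {A : ℕ → ℂ} {H : ℕ} (hA : ∀ x, ‖A x‖ ≤ H) (M n : ℕ) : ‖gg A M H n‖ ≤ (H:ℝ) ^ 2 := by
  unfold gg
  rw [← sum_filter]
  refine (norm_sum_le_of_le _ fun x _ => hA x).trans ?_
  rw [sum_const, nsmul_eq_mul, sq]
  gcongr
  have : (range M).filter (fun x => x < n ∧ n ≤ x + H) ⊆ Ico (n - H) n := by
    intro x hx
    simp only [mem_filter, mem_Ico] at hx ⊢
    omega
  exact (card_le_card this).trans (by rw [Nat.card_Ico]; omega)

lemma gg_diff {A : ℕ → ℂ} {H : ℕ} (hA : ∀ x, ‖A x‖ ≤ H) (M n k : ℕ) : ‖gg A M H (n + k) - gg A M H n‖ ≤ 2 * H * k := by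
  induction k with
  | zero => simp
  | succ k ih =>
    have h1 : ‖gg A M H (n + k + 1) - gg A M H (n + k)‖ ≤ 2 * H := by
      set n := n + k
      unfold gg
      rw [← sum_sub_distrib]
      calc _ ≤ ∑ x ∈ range M, ((if x = n then (H:ℝ) else 0) + if x = n - H then (H:ℝ) else 0) := by
            refine norm_sum_le_of_le _ fun x _ => ?_
            have := hA x
            have h0 : (0:ℝ) ≤ H := by positivity
            split_ifs <;> first | omega | simp <;> linarith
        _ ≤ H + H := by
          rw [sum_add_distrib]
          gcongr <;> · rw [sum_ite_eq']; split_ifs <;> simp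
        _ = _ := by ring
    have := norm_add_le (gg A M H (n + k + 1) - gg A M H (n + k)) (gg A M H (n + k) - gg A M H n)
    rw [sub_add_sub_cancel] at this
    push_cast
    rw [← add_assoc]
    linarith

lemma gg_id (u : ℕ → ℂ) (M H : ℕ) : ((∑ x ∈ range M, ‖sh u x H‖ ^ 2 : ℝ) : ℂ) = ∑ n ∈ Ioc 0 (M + H), u n * conj (gg (fun x => sh u x H) M H n) := by
  unfold gg
  push_cast
  simp_rw [← mul_conj', map_sum, mul_sum]
  rw [sum_comm]
  refine sum_congr rfl fun x hx => ?_
  have hx := mem_range.1 hx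
  conv_lhs => rw [sh, sum_mul]
  simp_rw [apply_ite (starRingEnd ℂ), _root_.map_zero, mul_ite, mul_zero]
  rw [← sum_filter]
  congr 1
  ext n; simp only [mem_filter, mem_Ioc]; omega

lemma irr_ne {z : ℂ} (hz : ‖z‖ = 1) (hi : ∀ k : ℕ, k ≠ 0 → z ^ k ≠ 1) {p q : ℕ} (h : p ≠ q) : z ^ p * conj (z ^ q) ≠ 1 := by
  have hz0 : z ≠ 0 := by rintro rfl; simp at hz
  have aux : ∀ a b : ℕ, a < b → z ^ a ≠ z ^ b := by
    intro a b hab h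
    refine hi (b - a) (by omega) ?_
    have h2 : z ^ a * z ^ (b - a) = z ^ a * 1 := by rw [← pow_add, Nat.add_sub_cancel' hab.le, mul_one, h]
    exact mul_left_cancel₀ (pow_ne_zero _ hz0) h2
  intro h1
  have h2 : conj (z ^ q) * z ^ q = 1 := by rw [conj_mul', norm_pow, hz]; simp
  have h3 : z ^ p = z ^ q := by
    calc z ^ p = z ^ p * (conj (z ^ q) * z ^ q) := by rw [h2, mul_one]
      _ = _ := by rw [← mul_assoc, h1, one_mul]
  rcases lt_or_gt_of_ne h with h | h
  · exact aux _ _ h h3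
  · exact aux _ _ h h3.symm

lemma exP : ∃ C > (0:ℝ), ∀ T : ℝ, ∃ P : Finset ℕ, (∀ p ∈ P, p.Prime) ∧ ∑ p ∈ P, ((p:ℝ) ^ 2)⁻¹ ≤ C ∧ T ≤ LP P := by
  have hs : Summable (fun n : ℕ => ((n:ℝ) ^ 2)⁻¹) := Real.summable_nat_pow_inv.2 (by norm_num)
  refine ⟨∑' n : ℕ, ((n:ℝ) ^ 2)⁻¹ + 1, by positivity, fun T => ?_⟩
  have h1 := (not_summable_iff_tendsto_nat_atTop_of_nonneg (fun n => Set.indicator_nonneg (fun n _ => by positivity) n)).1 not_summable_one_div_on_primes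
  obtain ⟨n, hn⟩ := (h1.eventually_ge_atTop T).exists
  refine ⟨(range n).filter Nat.Prime, fun p hp => (mem_filter.1 hp).2, ?_, ?_⟩
  · exact (hs.sum_le_tsum _ fun _ _ => by positivity).trans (by linarith)
  · refine hn.trans (le_of_eq ?_)
    rw [LP, sum_filter]
    exact sum_congr rfl fun p _ => by simp [Set.indicator]

set_option maxHeartbeats 1000000 in
lemma W_irr {z : ℂ} (hz : ‖z‖ = 1) (hi : ∀ k : ℕ, k ≠ 0 → z ^ k ≠ 1) : W z := by
  intro ε hε
  obtain ⟨C, hC0, hCP⟩ := exP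
  obtain ⟨P, hP, hC, hT⟩ := hCP (128 / ε ^ 2 + 4 * C / ε)
  set L := LP P with hLd
  have t1 : 0 < 128 / ε ^ 2 := by positivity
  have t2 : 0 < 4 * C / ε := by positivity
  have hL : 0 < L := by linarith
  set w : ℕ → ℕ → ℂ := fun p q => z ^ p * conj (z ^ q) with hw
  have hw1 : ∀ p q, ‖w p q‖ = 1 := fun p q => by simp [hw, hz]
  set k : ℕ → ℕ → ℝ := fun p q => (1 + p + q) / ‖w p q - 1‖ with hk
  set κ := ∑ p ∈ P, ∑ q ∈ P, k p q with hκ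
  have hk0 : ∀ p q, 0 ≤ k p q := fun p q => by positivity
  have hκ0 : 0 ≤ κ := sum_nonneg fun p _ => sum_nonneg fun q _ => hk0 p q
  obtain ⟨H', hH'⟩ := exists_nat_ge (4 * κ / L)
  set H := H' + 1 with hH
  have hHL : 4 * κ ≤ H * L := by
    rw [div_le_iff₀ hL] at hH'; rw [hH]; push_cast; nlinarith only [hH', hL]
  have hH0 : (1:ℝ) ≤ H := by rw [hH]; push_cast; linarith [(Nat.cast_nonneg H' : (0:ℝ) ≤ H')]
  refine ⟨H, by omega, 2 * P.card + H, fun M hM => ?_⟩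
  set u : ℕ → ℂ := fun n => moebius n * z ^ n with hu
  have hu1 : ∀ n, ‖u n‖ ≤ 1 := fun n => by simp only [hu, norm_mul, norm_pow, hz, one_pow, mul_one]; exact moe_le n
  set g := gg (fun x => sh u x H) M H with hg
  have hgl : ∀ n, ‖g n‖ ≤ (H:ℝ) ^ 2 := gg_le (fun x => sh_le hu1 x H) M
  have hgd : ∀ n k, ‖g (n + k) - g n‖ ≤ 2 * H * k := gg_diff (fun x => sh_le hu1 x H) M
  set F : ℕ → ℂ := fun n => z ^ n * conj (g n) with hF
  have hFl : ∀ n, ‖F n‖ ≤ (H:ℝ) ^ 2 := fun n => by simp only [hF, norm_mul, norm_pow, hz, one_pow, one_mul, RCLike.norm_conj]; exact hgl n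
  set N := M + H with hN
  have hNr : (N:ℝ) = M + H := by rw [hN]; push_cast; ring
  have hMH : (H:ℝ) ≤ M := by exact_mod_cast (by omega : H ≤ M)
  clear_value g κ
  have hod : ∀ p ∈ P, ∀ q ∈ P, p ≠ q → ∀ K ≤ N, ‖∑ m ∈ Ioc 0 K, F (p * m) * conj (F (q * m))‖ ≤ (2 * (H:ℝ) ^ 4 + N * (2 * H ^ 3 * (p + q))) / ‖w p q - 1‖ := by
    intro p _ q _ hpq K hK
    have hne : 0 < ‖w p q - 1‖ := norm_pos_iff.2 (sub_ne_zero.2 (irr_ne hz hi hpq))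
    rw [le_div_iff₀ hne, mul_comm]
    have e : ∀ m, F (p * m) * conj (F (q * m)) = w p q ^ m * (conj (g (p * m)) * g (q * m)) := fun m => by
      simp only [hF, hw, pow_mul, map_mul, map_pow, Complex.conj_conj, mul_pow]; ring
    simp_rw [e]
    refine (abel (hw1 p q) (G := fun m => conj (g (p * m)) * g (q * m)) (B := (H:ℝ) ^ 4) (D := 2 * H ^ 3 * (p + q)) ?_ ?_ K).trans ?_
    · intro n
      rw [norm_mul, RCLike.norm_conj]
      calc _ ≤ (H:ℝ) ^ 2 * H ^ 2 := by gcongr <;> exact hgl _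
        _ = _ := by ring
    · intro n
      have e2 : conj (g (p * (n + 1))) * g (q * (n + 1)) - conj (g (p * n)) * g (q * n)
        = conj (g (p * n + p) - g (p * n)) * g (q * (n + 1)) + conj (g (p * n)) * (g (q * n + q) - g (q * n)) := by
        rw [map_sub, mul_add, mul_add, mul_one, mul_one]; ring
      rw [e2]
      refine (norm_add_le _ _).trans ?_
      rw [norm_mul, norm_mul, RCLike.norm_conj, RCLike.norm_conj]
      calc _ ≤ 2 * H * p * (H:ℝ) ^ 2 + (H:ℝ) ^ 2 * (2 * H * q) := by
            gcongr
            exacts [hgd _ _, hgl _, hgl _, hgd _ _]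
        _ = _ := by ring
    · gcongr
  have hN0 : (0:ℝ) ≤ N := by positivity
  have hos : ∑ p ∈ P, ∑ q ∈ P, (2 * (H:ℝ) ^ 4 + N * (2 * H ^ 3 * (p + q))) / ‖w p q - 1‖ ≤ ((H:ℝ) ^ 2) ^ 2 * N * L := by
    calc _ ≤ ∑ p ∈ P, ∑ q ∈ P, (2 * (H:ℝ) ^ 4 + 2 * N * H ^ 3) * k p q := by
          refine sum_le_sum fun p _ => sum_le_sum fun q _ => ?_
          rw [hk, mul_div_assoc']
          refine div_le_div_of_nonneg_right ?_ (norm_nonneg _)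
          have a1 : (0:ℝ) ≤ p := by positivity
          have a2 : (0:ℝ) ≤ q := by positivity
          have a3 : 0 ≤ 2 * (H:ℝ) ^ 4 * (p + q) := by positivity
          have a4 : 0 ≤ 2 * (N:ℝ) * H ^ 3 := by positivity
          nlinarith only [a1, a2, a3, a4]
      _ = (2 * (H:ℝ) ^ 4 + 2 * N * H ^ 3) * κ := by simp_rw [hκ, mul_sum]
      _ ≤ (4 * (N:ℝ) * H ^ 3) * κ := by
        gcongr
        have : (H:ℝ) * H ^ 3 ≤ N * H ^ 3 := by gcongr; omega
        nlinarith only [this]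
      _ = N * H ^ 3 * (4 * κ) := by ring
      _ ≤ N * H ^ 3 * (H * L) := by gcongr
      _ = _ := by ring
  have hmain := katai hP hC (by positivity) hFl (N := N) (by omega) (fun p q => by positivity) hod hos
  rw [← hLd] at hmain
  have hid : ∑ n ∈ Ioc 0 N, (moebius n : ℂ) * F n = ((∑ x ∈ range M, ‖sh u x H‖ ^ 2 : ℝ) : ℂ) := by
    rw [gg_id, ← hg]
    exact sum_congr rfl fun n _ => by simp only [hF, hu]; ring
  rw [hid, norm_real, norm_of_nonneg (sum_nonneg fun _ _ => by positivity)] at hmain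
  have hsq : sqrt (2 * L) ≤ ε * L / 8 := by
    refine Real.sqrt_le_iff.2 ⟨by positivity, ?_⟩
    have : 128 / ε ^ 2 ≤ L := by linarith
    rw [div_le_iff₀ (by positivity)] at this
    nlinarith only [this, hL]
  have hCL : C ≤ ε * L / 4 := by
    have : 4 * C / ε ≤ L := by linarith
    rw [div_le_iff₀ hε] at this
    linarith
  refine le_of_mul_le_mul_right (hmain.trans ?_) hL
  calc _ ≤ (H:ℝ) ^ 2 * (2 * M) * (2 * (ε * L / 8) + ε * L / 4) := by
        gcongr; rw [hNr]; linarith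
    _ = _ := by ring

lemma W_all {z : ℂ} (hz : ‖z‖ = 1) : W z := by
  by_cases h : ∀ k : ℕ, k ≠ 0 → z ^ k ≠ 1
  · exact W_irr hz h
  · push Not at h
    obtain ⟨q, hq, h⟩ := h
    intro ε hε
    obtain ⟨H0, h0⟩ := NN_rat hq h ε hε
    exact ⟨max H0 1, le_max_right _ _, h0 _ (le_max_left _ _)⟩
end MR
namespace MR
open ArithmeticFunction

lemma sh_eq (f : ℕ → ℂ) (x H : ℕ) : sh f x H = ∑ j ∈ range H, f (x + j + 1) := by
  induction H with
  | zero => simp [sh]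
  | succ H ih => rw [sum_range_succ, ← ih, sh, sh, ← add_assoc, sum_Ioc_succ_top (Nat.le_add_right _ _)]

lemma sh_shift {f : ℕ → ℂ} (hf : ∀ n, ‖f n‖ ≤ 1) (x H i : ℕ) : ‖sh f (x + i) H - sh f x H‖ ≤ 2 * i := by
  induction i with
  | zero => simp
  | succ i ih =>
    have e : sh f (x + (i + 1)) H - sh f x H = (sh f (x + i) H - sh f x H) + (f (x + i + H + 1) - f (x + i + 1)) := by
      have h1 := sum_range_succ (fun j => f (x + i + j + 1)) H
      have h2 := Finset.sum_range_succ' (fun j => f (x + i + j + 1)) H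
      rw [h1] at h2
      simp only [add_zero] at h2
      rw [sh_eq f (x + (i + 1)), sh_eq f (x + i), sum_congr rfl fun j _ => by rw [show x + (i + 1) + j + 1 = x + i + (j + 1) + 1 by ring]]
      linear_combination -h2
    rw [e]
    have := norm_add_le (sh f (x + i) H - sh f x H) (f (x + i + H + 1) - f (x + i + 1))
    have := norm_sub_le (f (x + i + H + 1)) (f (x + i + 1))
    have := hf (x + i + H + 1)
    have := hf (x + i + 1)
    push_cast; linarith

lemma sh_mono {f : ℕ → ℂ} (hf : ∀ n, ‖f n‖ ≤ 1) (x H H0 : ℕ) : ‖(H0 : ℂ) * sh f x H‖ ≤ ∑ j ∈ range H, ‖sh f (x + j) H0‖ + 2 * (H0:ℝ) ^ 2 := by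
  have e : ∑ j ∈ range H, sh f (x + j) H0 = ∑ i ∈ range H0, sh f (x + i) H := by
    simp_rw [sh_eq]
    rw [sum_comm]
    exact sum_congr rfl fun i _ => sum_congr rfl fun j _ => by rw [show x + j + i + 1 = x + i + j + 1 by ring]
  have h1 : ‖∑ i ∈ range H0, sh f (x + i) H - H0 * sh f x H‖ ≤ 2 * (H0:ℝ) ^ 2 := by
    have : ∑ i ∈ range H0, sh f (x + i) H - H0 * sh f x H = ∑ i ∈ range H0, (sh f (x + i) H - sh f x H) := by
      rw [sum_sub_distrib]; simp
    rw [this]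
    refine (norm_sum_le_of_le _ fun i hi => (sh_shift hf x H i).trans (?_ : _ ≤ 2 * (H0:ℝ))).trans ?_
    · have : (i:ℝ) ≤ H0 := by exact_mod_cast (mem_range.1 hi).le
      linarith
    · simp; apply le_of_eq; ring
  have h2 := norm_sum_le (range H) fun j => sh f (x + j) H0
  rw [e] at h2
  have h3 := norm_sub_le (∑ i ∈ range H0, sh f (x + i) H) (∑ i ∈ range H0, sh f (x + i) H - H0 * sh f x H)
  rw [sub_sub_cancel] at h3
  linarith

lemma mono_all {f : ℕ → ℂ} (hf : ∀ n, ‖f n‖ ≤ 1) {ε : ℝ} (hε : 0 < ε) {H0 H M : ℕ} (h0 : 1 ≤ H0) (hH : 8 * (H0:ℝ) ^ 2 ≤ ε * (H:ℝ) ^ 2)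
    (h : ∑ x ∈ range (M + H), ‖sh f x H0‖ ^ 2 ≤ ε * H0 ^ 2 * (M + H : ℕ)) : ∑ x ∈ range M, ‖sh f x H‖ ^ 2 ≤ 3 * ε * H ^ 2 * (M + H) := by
  have h0' : (0:ℝ) < (H0:ℝ) ^ 2 := by positivity
  have key : ∀ x, (H0:ℝ) ^ 2 * ‖sh f x H‖ ^ 2 ≤ 2 * H * ∑ j ∈ range H, ‖sh f (x + j) H0‖ ^ 2 + 8 * (H0:ℝ) ^ 4 := by
    intro x
    have h1 := sh_mono hf x H H0
    have h2 := sq_sum_le_card_mul_sum_sq (s := range H) (f := fun j => ‖sh f (x + j) H0‖)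
    rw [card_range] at h2
    rw [norm_mul, Complex.norm_natCast] at h1
    have h3 := pow_le_pow_left₀ (by positivity) h1 2
    rw [mul_pow] at h3
    nlinarith only [h3, h2, sq_nonneg (∑ j ∈ range H, ‖sh f (x + j) H0‖ - 2 * (H0:ℝ) ^ 2)]
  have hs : ∑ x ∈ range M, ∑ j ∈ range H, ‖sh f (x + j) H0‖ ^ 2 ≤ H * (ε * H0 ^ 2 * (M + H)) := by
    rw [sum_comm]
    calc _ ≤ ∑ j ∈ range H, ε * H0 ^ 2 * (M + H) := by
          refine sum_le_sum fun j hj => ?_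
          push_cast at h
          refine le_trans ?_ h
          have hj := mem_range.1 hj
          rw [sum_congr rfl fun x _ => by rw [add_comm x j]]
          have e := Finset.sum_range_add (fun y => ‖sh f y H0‖ ^ 2) j M
          have e1 : 0 ≤ ∑ y ∈ range j, ‖sh f y H0‖ ^ 2 := sum_nonneg fun _ _ => by positivity
          have e2 : ∑ y ∈ range (j + M), ‖sh f y H0‖ ^ 2 ≤ ∑ y ∈ range (M + H), ‖sh f y H0‖ ^ 2 :=
            sum_le_sum_of_subset_of_nonneg (Finset.range_subset_range.2 (by omega)) fun _ _ _ => by positivity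
          linarith
      _ = _ := by simp
  refine le_of_mul_le_mul_left ?_ h0'
  calc _ = ∑ x ∈ range M, (H0:ℝ) ^ 2 * ‖sh f x H‖ ^ 2 := by rw [mul_sum]
    _ ≤ ∑ x ∈ range M, (2 * H * ∑ j ∈ range H, ‖sh f (x + j) H0‖ ^ 2 + 8 * (H0:ℝ) ^ 4) := sum_le_sum fun x _ => key x
    _ = 2 * H * ∑ x ∈ range M, ∑ j ∈ range H, ‖sh f (x + j) H0‖ ^ 2 + M * (H0 ^ 2 * (8 * (H0:ℝ) ^ 2)) := by
      rw [sum_add_distrib, ← mul_sum, sum_const, card_range, nsmul_eq_mul]; ring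
    _ ≤ 2 * H * (H * (ε * H0 ^ 2 * (M + H))) + (M + H) * (H0 ^ 2 * (ε * (H:ℝ) ^ 2)) := by
      gcongr; linarith [(Nat.cast_nonneg H : (0:ℝ) ≤ H)]
    _ = _ := by ring

noncomputable def mz (z : ℂ) (n : ℕ) : ℂ := moebius n * z ^ n
noncomputable def Bz (z : ℂ) (x H : ℕ) : ℂ := ∑ j ∈ range H, (moebius (x + j + 1) : ℂ) * z ^ j

lemma sh_Bz {z : ℂ} (hz : ‖z‖ = 1) (x H : ℕ) : ‖sh (mz z) x H‖ = ‖Bz z x H‖ := by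
  have : sh (mz z) x H = z ^ (x + 1) * Bz z x H := by
    rw [sh_eq, Bz, mul_sum]
    exact sum_congr rfl fun j _ => by unfold mz; ring
  rw [this, norm_mul, norm_pow, hz, one_pow, one_mul]

lemma pow_lip {z w : ℂ} (hz : ‖z‖ = 1) (hw : ‖w‖ = 1) (j : ℕ) : ‖z ^ j - w ^ j‖ ≤ j * ‖z - w‖ := by
  induction j with
  | zero => simp
  | succ j ih =>
    rw [show z ^ (j + 1) - w ^ (j + 1) = z * (z ^ j - w ^ j) + (z - w) * w ^ j by ring]
    have := norm_add_le (z * (z ^ j - w ^ j)) ((z - w) * w ^ j)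
    rw [norm_mul, norm_mul, norm_pow, hz, hw, one_pow] at this
    push_cast; linarith

lemma Bz_lip {z w : ℂ} (hz : ‖z‖ = 1) (hw : ‖w‖ = 1) (x H : ℕ) : ‖Bz z x H - Bz w x H‖ ≤ (H:ℝ) ^ 2 * ‖z - w‖ := by
  unfold Bz
  rw [← sum_sub_distrib]
  refine (norm_sum_le_of_le _ fun j hj => (?_ : _ ≤ (H:ℝ) * ‖z - w‖)).trans (by simp; apply le_of_eq; ring)
  rw [← mul_sub, norm_mul]
  have : (j:ℝ) ≤ H := by exact_mod_cast (mem_range.1 hj).le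
  calc _ ≤ 1 * (j * ‖z - w‖) := by gcongr; exacts [moe_le _, pow_lip hz hw j]
    _ ≤ _ := by rw [one_mul]; gcongr

lemma mz_le {z : ℂ} (hz : ‖z‖ = 1) (n : ℕ) : ‖mz z n‖ ≤ 1 := by
  simp only [mz, norm_mul, norm_pow, hz, one_pow, mul_one]; exact moe_le n

theorem unif {ε : ℝ} (hε : 0 < ε) : ∃ T : ℕ, ∀ z ∈ Metric.sphere (0:ℂ) 1, ∀ H ≥ T, ∀ M ≥ T, ∑ x ∈ range M, ‖Bz z x H‖ ^ 2 ≤ ε * H ^ 2 * (M + H) := by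
  refine (isCompact_sphere (0:ℂ) 1).induction_on (p := fun s => ∃ T : ℕ, ∀ z ∈ s, ∀ H ≥ T, ∀ M ≥ T, ∑ x ∈ range M, ‖Bz z x H‖ ^ 2 ≤ ε * H ^ 2 * (M + H)) ⟨0, by simp⟩ ?_ ?_ ?_
  · rintro s t hst ⟨T, h⟩; exact ⟨T, fun z hz => h z (hst hz)⟩
  · rintro s t ⟨T, h⟩ ⟨T', h'⟩
    refine ⟨max T T', fun z hz H hH M hM => ?_⟩
    rcases hz with hz | hz
    · exact h z hz H (le_of_max_le_left hH) M (le_of_max_le_left hM)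
    · exact h' z hz H (le_of_max_le_right hH) M (le_of_max_le_right hM)
  · intro z hz
    have hz1 : ‖z‖ = 1 := by simpa using hz
    obtain ⟨H0, h0, M0, hM⟩ := W_all hz1 (ε / 12) (by positivity)
    have h0r : (0:ℝ) < H0 := by exact_mod_cast h0
    set r := sqrt (ε / 12) / H0 with hr
    have hr0 : 0 < r := by positivity
    obtain ⟨T, hT⟩ := exists_nat_ge (24 * (H0:ℝ) ^ 2 / ε)
    refine ⟨Metric.ball z r ∩ Metric.sphere 0 1, inter_mem (mem_nhdsWithin_of_mem_nhds (Metric.ball_mem_nhds z hr0)) self_mem_nhdsWithin, max M0 (T + 1), ?_⟩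
    rintro w ⟨hw, hw1⟩ H hH M hM'
    have hw1 : ‖w‖ = 1 := by simpa using hw1
    have hd : ‖w - z‖ ≤ r := by rw [← dist_eq_norm]; exact (Metric.mem_ball.1 hw).le
    simp_rw [← sh_Bz hw1]
    have h3 : (3:ℝ) * (ε / 3) = ε := by ring
    rw [← h3]
    refine mono_all (mz_le hw1) (by positivity) h0 ?_ ?_
    · have : (T:ℝ) + 1 ≤ H := by exact_mod_cast le_of_max_le_right hH
      rw [div_le_iff₀ hε] at hT
      have hT0 : (0:ℝ) ≤ T := by positivity
      have : (T:ℝ) ≤ H ^ 2 := by nlinarith only [this, hT0]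
      nlinarith only [this, hT, hε]
    · have hb : ∀ x, ‖sh (mz w) x H0‖ ^ 2 ≤ 2 * ‖sh (mz z) x H0‖ ^ 2 + 2 * (ε / 12 * (H0:ℝ) ^ 2) := by
        intro x
        rw [sh_Bz hw1, sh_Bz hz1]
        have h1 : ‖Bz w x H0 - Bz z x H0‖ ≤ sqrt (ε / 12) * H0 := by
          refine (Bz_lip hw1 hz1 x H0).trans ?_
          calc _ ≤ (H0:ℝ) ^ 2 * r := by gcongr
            _ = _ := by rw [hr]; field_simp
        have h2 := pow_le_pow_left₀ (norm_nonneg _) h1 2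
        rw [mul_pow, sq_sqrt (by positivity)] at h2
        have h4 := norm_add_le (Bz w x H0 - Bz z x H0) (Bz z x H0)
        rw [sub_add_cancel] at h4
        nlinarith only [h2, h4, norm_nonneg (Bz w x H0), sq_nonneg (‖Bz w x H0 - Bz z x H0‖ - ‖Bz z x H0‖)]
      have hM2 := hM (M + H) ((le_of_max_le_left hM').trans (Nat.le_add_right _ _))
      calc _ ≤ ∑ x ∈ range (M + H), (2 * ‖sh (mz z) x H0‖ ^ 2 + 2 * (ε / 12 * (H0:ℝ) ^ 2)) := sum_le_sum fun x _ => hb x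
        _ = 2 * ∑ x ∈ range (M + H), ‖sh (mz z) x H0‖ ^ 2 + (M + H : ℕ) * (2 * (ε / 12 * (H0:ℝ) ^ 2)) := by
          rw [sum_add_distrib, ← mul_sum]; simp
        _ ≤ 2 * (ε / 12 * H0 ^ 2 * (M + H : ℕ)) + (M + H : ℕ) * (2 * (ε / 12 * (H0:ℝ) ^ 2)) := by gcongr; exact hM2
        _ = _ := by ring
end MR
namespace MR
open ArithmeticFunction

lemma orth {R : ℕ} {ζ : ℂ} (hR : 0 < R) (h : IsPrimitiveRoot ζ R) (hz : ‖ζ‖ = 1) {a b : ℕ} (ha : a < R) (hb : b < R) :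
    ∑ r ∈ range R, (ζ ^ r) ^ a * conj ((ζ ^ r) ^ b) = if a = b then (R:ℂ) else 0 := by
  set w := ζ ^ a * conj (ζ ^ b) with hw
  have e : ∀ r, (ζ ^ r) ^ a * conj ((ζ ^ r) ^ b) = w ^ r := fun r => by
    rw [hw, mul_pow, ← map_pow, ← pow_mul, ← pow_mul, ← pow_mul, ← pow_mul, mul_comm r a, mul_comm r b]
  simp_rw [e]
  have h2 : conj (ζ ^ b) * ζ ^ b = 1 := by rw [conj_mul', norm_pow, hz]; simp
  split_ifs with hab
  · have : w = 1 := by rw [hw, hab, mul_comm]; exact h2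
    rw [this]; simp
  · have hw1 : w ≠ 1 := by
      intro h1
      apply hab
      refine h.pow_inj ha hb ?_
      calc ζ ^ a = ζ ^ a * (conj (ζ ^ b) * ζ ^ b) := by rw [h2, mul_one]
        _ = _ := by rw [← mul_assoc, ← hw, h1, one_mul]
    have hwR : w ^ R = 1 := by
      rw [hw, mul_pow, ← map_pow, ← pow_mul, ← pow_mul, mul_comm a, mul_comm b, pow_mul, pow_mul, h.pow_eq_one]; simp
    have := mul_geom_sum w R
    rw [hwR, sub_self] at this
    exact (mul_eq_zero.1 this).resolve_left (sub_ne_zero.2 hw1)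

lemma par {R : ℕ} {ζ : ℂ} (hR : 0 < R) (h : IsPrimitiveRoot ζ R) (hz : ‖ζ‖ = 1) (A B : Finset ℕ) (t : ℕ) (hA : ∀ a ∈ A, a + t < R) (hB : ∀ a ∈ B, a < R) (c d : ℕ → ℂ) :
    ∑ r ∈ range R, (ζ ^ r) ^ t * (∑ a ∈ A, c a * (ζ ^ r) ^ a) * conj (∑ b ∈ B, d b * (ζ ^ r) ^ b) = R * ∑ a ∈ A, if a + t ∈ B then c a * conj (d (a + t)) else 0 := by
  have e : ∀ r, (ζ ^ r) ^ t * (∑ a ∈ A, c a * (ζ ^ r) ^ a) * conj (∑ b ∈ B, d b * (ζ ^ r) ^ b)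
      = ∑ a ∈ A, ∑ b ∈ B, c a * conj (d b) * ((ζ ^ r) ^ (a + t) * conj ((ζ ^ r) ^ b)) := fun r => by
    rw [mul_sum, map_sum, sum_mul_sum]
    refine sum_congr rfl fun a _ => sum_congr rfl fun b _ => ?_
    rw [map_mul, pow_add]; ring
  simp_rw [e]
  rw [sum_comm, mul_sum]
  refine sum_congr rfl fun a ha => ?_
  rw [sum_comm]
  calc _ = ∑ b ∈ B, if a + t = b then c a * conj (d b) * R else 0 := by
        refine sum_congr rfl fun b hb => ?_
        rw [← mul_sum, orth hR h hz (hA a ha) (hB b hb), mul_ite, mul_zero]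
    _ = _ := by rw [sum_ite_eq]; split_ifs <;> ring

lemma ex_sign (c : ℂ) : ∃ s : ℂ, ‖s‖ ≤ 1 ∧ s * c = ‖c‖ := by
  by_cases h : c = 0
  · exact ⟨0, by simp, by simp [h]⟩
  · have : (‖c‖:ℂ) ≠ 0 := by exact_mod_cast norm_ne_zero_iff.2 h
    refine ⟨conj c / ‖c‖, ?_, ?_⟩
    · rw [norm_div, RCLike.norm_conj, norm_real, norm_norm]; exact div_self_le_one _
    · rw [div_mul_eq_mul_div, conj_mul']; field_simp

noncomputable def cc (M K h : ℕ) : ℂ := ∑ x ∈ range M, ∑ a ∈ range (K - h), (moebius (x + a + 1) : ℂ) * moebius (x + a + 1 + h)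

lemma cc_bd {M H : ℕ} (hH : 1 ≤ H) {Q : ℝ} (hQ0 : 0 ≤ Q) (hQ : ∀ z : ℂ, ‖z‖ = 1 → ∑ x ∈ range M, ‖Bz z x (2 * H)‖ ^ 2 ≤ Q) :
    (∑ h ∈ Icc 1 H, ‖cc M (2 * H) h‖) ^ 2 ≤ Q * (2 * H * M) * H := by
  set R := 4 * H with hR
  have hR0 : 0 < R := by omega
  set ζ := Complex.exp (2 * π * I / R)
  have hζ : IsPrimitiveRoot ζ R := Complex.isPrimitiveRoot_exp R hR0.ne'
  have hz : ‖ζ‖ = 1 := hζ.norm'_eq_one hR0.ne'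
  clear_value ζ
  have hzr : ∀ r, ‖ζ ^ r‖ = 1 := fun r => by rw [norm_pow, hz, one_pow]
  choose s hs1 hs using fun h => ex_sign (cc M (2 * H) h)
  set P : ℕ → ℝ := fun r => ∑ x ∈ range M, ‖Bz (ζ ^ r) x (2 * H)‖ ^ 2 with hP
  have hP0 : ∀ r, 0 ≤ P r := fun r => sum_nonneg fun _ _ => by positivity
  set T : ℕ → ℂ := fun r => ∑ h ∈ Icc 1 H, s h * (ζ ^ r) ^ h with hT
  have hRr : (0:ℝ) < R := by exact_mod_cast hR0
  have hc : ∀ h ≤ H, (R:ℂ) * cc M (2 * H) h = ∑ r ∈ range R, (ζ ^ r) ^ h * (P r : ℂ) := by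
    intro h hh
    have e : ∀ r, (ζ ^ r) ^ h * (P r : ℂ) = ∑ x ∈ range M, (ζ ^ r) ^ h * Bz (ζ ^ r) x (2 * H) * conj (Bz (ζ ^ r) x (2 * H)) := fun r => by
      rw [hP]; push_cast
      rw [mul_sum]
      exact sum_congr rfl fun x _ => by rw [← mul_conj', mul_assoc]
    simp_rw [e]
    rw [sum_comm, cc, mul_sum]
    refine sum_congr rfl fun x _ => ?_
    unfold Bz
    rw [par hR0 hζ hz (range (2 * H)) (range (2 * H)) h (fun a ha => by rw [mem_range] at ha; omega) (fun a ha => by rw [mem_range] at ha; omega) (fun j => (moebius (x + j + 1) : ℂ)) fun j => (moebius (x + j + 1) : ℂ)]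
    congr 1
    rw [← sum_filter]
    refine sum_congr (by ext a; simp only [mem_filter, mem_range]; omega) fun a _ => ?_
    rw [map_intCast, show x + (a + h) + 1 = x + a + 1 + h by ring]
  have h1 : (R:ℝ) * ∑ h ∈ Icc 1 H, ‖cc M (2 * H) h‖ ≤ ∑ r ∈ range R, P r * ‖T r‖ := by
    have : ((R * ∑ h ∈ Icc 1 H, ‖cc M (2 * H) h‖ : ℝ) : ℂ) = ∑ r ∈ range R, (P r : ℂ) * T r := by
      push_cast
      simp_rw [← hs, hT, mul_sum]
      rw [sum_comm]
      refine sum_congr rfl fun h hh => ?_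
      rw [mul_left_comm, hc h (mem_Icc.1 hh).2, mul_sum]
      exact sum_congr rfl fun r _ => by ring
    have h2 := congrArg norm this
    rw [norm_real, norm_of_nonneg (by positivity)] at h2
    rw [h2]
    exact norm_sum_le_of_le _ fun r _ => by rw [norm_mul, norm_real, norm_of_nonneg (hP0 r)]
  have h2 : ∑ r ∈ range R, ‖T r‖ ^ 2 ≤ R * H := by
    have := par hR0 hζ hz (Icc 1 H) (Icc 1 H) 0 (fun a ha => by rw [mem_Icc] at ha; omega) (fun a ha => by rw [mem_Icc] at ha; omega) s s
    have e : ((∑ r ∈ range R, ‖T r‖ ^ 2 : ℝ) : ℂ) = ((R * ∑ a ∈ Icc 1 H, ‖s a‖ ^ 2 : ℝ) : ℂ) := by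
      push_cast
      simp_rw [← mul_conj', hT]
      simp_rw [pow_zero, one_mul, add_zero] at this
      rw [this]
      congr 1
      exact sum_congr rfl fun a ha => if_pos ha
    rw [Complex.ofReal_inj.1 e]
    gcongr
    refine (sum_le_card_nsmul _ _ 1 fun a _ => pow_le_one₀ (norm_nonneg _) (hs1 a)).trans (by simp)
  have h3 : ∑ r ∈ range R, P r ≤ R * (2 * H * M) := by
    have e : ((∑ r ∈ range R, P r : ℝ) : ℂ) = R * cc M (2 * H) 0 := by
      rw [hc 0 (Nat.zero_le _)]; push_cast; simp
    have e2 := congrArg norm e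
    rw [norm_real, norm_of_nonneg (sum_nonneg fun r _ => hP0 r), norm_mul, Complex.norm_natCast] at e2
    rw [e2]
    gcongr
    have : ‖cc M (2 * H) 0‖ ≤ ∑ x ∈ range M, ∑ a ∈ range (2 * H - 0), (1:ℝ) :=
      norm_sum_le_of_le _ fun x _ => norm_sum_le_of_le _ fun a _ => by
        rw [norm_mul]; exact mul_le_one₀ (moe_le _) (norm_nonneg _) (moe_le _)
    refine this.trans (le_of_eq ?_)
    simp; ring
  have h4 : ∑ r ∈ range R, P r ^ 2 ≤ Q * (R * (2 * H * M)) := by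
    refine le_trans ?_ (mul_le_mul_of_nonneg_left h3 hQ0)
    rw [mul_sum]
    refine sum_le_sum fun r _ => ?_
    rw [sq]; exact mul_le_mul_of_nonneg_right (hQ _ (hzr r)) (hP0 r)
  have h5 := Finset.sum_mul_sq_le_sq_mul_sq (range R) P (fun r => ‖T r‖)
  have h6 := pow_le_pow_left₀ (by positivity) h1 2
  have h7 : (∑ r ∈ range R, P r ^ 2) * ∑ r ∈ range R, ‖T r‖ ^ 2 ≤ Q * (R * (2 * H * M)) * (R * H) := by
    gcongr
  rw [mul_pow] at h6
  refine le_of_mul_le_mul_left ?_ (by positivity : (0:ℝ) < (R:ℝ) ^ 2)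
  refine (h6.trans (h5.trans h7)).trans (le_of_eq ?_)
  ring

lemma cc_S {M K h : ℕ} (hh : h ≤ K) : (K - h : ℝ) * ‖sh (fun n => (moebius n : ℂ) * moebius (n + h)) 0 M‖ ≤ ‖cc M K h‖ + 2 * (K:ℝ) ^ 2 := by
  set f : ℕ → ℂ := fun n => (moebius n : ℂ) * moebius (n + h) with hf
  have hf1 : ∀ n, ‖f n‖ ≤ 1 := fun n => by
    rw [hf, norm_mul]; exact mul_le_one₀ (moe_le _) (norm_nonneg _) (moe_le _)
  have e : cc M K h = ∑ a ∈ range (K - h), sh f (0 + a) M := by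
    rw [cc, sum_comm]
    refine sum_congr rfl fun a _ => ?_
    rw [sh_eq]
    exact sum_congr rfl fun x _ => by rw [hf, show 0 + a + x + 1 = x + a + 1 by ring]
  have e2 : ((K - h : ℕ) : ℂ) * sh f 0 M = cc M K h - ∑ a ∈ range (K - h), (sh f (0 + a) M - sh f 0 M) := by
    rw [e, sum_sub_distrib]; simp
  have h1 : ‖∑ a ∈ range (K - h), (sh f (0 + a) M - sh f 0 M)‖ ≤ 2 * (K:ℝ) ^ 2 := by
    have hk : ((K - h : ℕ) : ℝ) ≤ K := by exact_mod_cast Nat.sub_le _ _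
    refine (norm_sum_le_of_le _ fun a ha => (sh_shift hf1 0 M a).trans (?_ : _ ≤ 2 * (K:ℝ))).trans ?_
    · have : (a:ℝ) ≤ K := by exact_mod_cast (mem_range.1 ha).le.trans (Nat.sub_le _ _)
      linarith
    · rw [sum_const, card_range, nsmul_eq_mul]
      have : (0:ℝ) ≤ K := by positivity
      nlinarith only [hk, this]
  have h2 := congrArg norm e2
  rw [norm_mul, Complex.norm_natCast, Nat.cast_sub hh] at h2
  rw [h2]
  exact (norm_sub_le _ _).trans (by linarith)

theorem fin_bd {ε : ℝ} (hε : 0 < ε) : ∃ T : ℕ, ∀ H ≥ T, ∀ M ≥ T, 1 ≤ H → 2 * H ≤ M →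
    (1 / ((H:ℝ) * M)) * ∑ h ∈ Icc 1 H, |∑ m ∈ Icc 1 M, ((moebius m * moebius (m + h) : ℤ) : ℝ)| ≤ 4 * ε + 8 * (H / M) := by
  obtain ⟨T, hT⟩ := unif (pow_pos hε 2)
  refine ⟨T, fun H hH M hM h1 h2 => ?_⟩
  have hH0 : (0:ℝ) < H := by exact_mod_cast h1
  have hM2 : 2 * (H:ℝ) ≤ M := by exact_mod_cast h2
  have hM0 : (0:ℝ) < M := by linarith
  have hc := cc_bd (M := M) h1 (Q := ε ^ 2 * (2 * H : ℕ) ^ 2 * (M + (2 * H : ℕ))) (by positivity) fun z hz => hT z (by simpa using hz) _ (by omega) M hM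
  have hc2 : ∑ h ∈ Icc 1 H, ‖cc M (2 * H) h‖ ≤ 4 * ε * H ^ 2 * M := by
    rw [← pow_le_pow_iff_left₀ (sum_nonneg fun _ _ => norm_nonneg _) (by positivity) two_ne_zero]
    refine hc.trans ?_
    push_cast
    calc _ ≤ ε ^ 2 * (2 * (H:ℝ)) ^ 2 * (M + M) * (2 * H * M) * H := by gcongr
      _ = _ := by ring
  have hS : ∀ h ∈ Icc 1 H, (H:ℝ) * |∑ m ∈ Icc 1 M, ((moebius m * moebius (m + h) : ℤ) : ℝ)| ≤ ‖cc M (2 * H) h‖ + 8 * (H:ℝ) ^ 2 := by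
    intro h hh
    have hh := (mem_Icc.1 hh).2
    have hhr : (h:ℝ) ≤ H := by exact_mod_cast hh
    have e : |∑ m ∈ Icc 1 M, ((moebius m * moebius (m + h) : ℤ) : ℝ)| = ‖sh (fun n => (moebius n : ℂ) * moebius (n + h)) 0 M‖ := by
      rw [← norm_eq_abs, ← norm_real, sh, zero_add, ← Finset.Icc_add_one_left_eq_Ioc]
      push_cast; rfl
    rw [e]
    have := cc_S (M := M) (K := 2 * H) (h := h) (by omega)
    push_cast at this
    have h3 : (H:ℝ) * ‖sh (fun n => (moebius n : ℂ) * moebius (n + h)) 0 M‖ ≤ (2 * H - h) * ‖sh (fun n => (moebius n : ℂ) * moebius (n + h)) 0 M‖ := by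
      gcongr; linarith
    linarith
  have hsum := sum_le_sum hS
  rw [← mul_sum, sum_add_distrib, sum_const, Nat.card_Icc, nsmul_eq_mul, Nat.add_sub_cancel] at hsum
  rw [one_div_mul_eq_div, div_le_iff₀ (by positivity)]
  refine le_of_mul_le_mul_left ((hsum.trans (by gcongr : _ ≤ 4 * ε * (H:ℝ) ^ 2 * M + H * (8 * (H:ℝ) ^ 2))).trans (le_of_eq ?_)) hH0
  field_simp
end MR
end
/-- The averaged two-point Chowla conjecture for the Möbius function: for every sequence
`(H_M)` of positive integers with `H_M → ∞` and `H_M/M → 0`,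
`lim_{M→∞} (1/(H_M·M)) Σ_{h=1}^{H_M} |Σ_{m=1}^{M} μ(m)μ(m+h)| = 0`. -/
theorem averaged_two_point_chowla_moebius (H : ℕ → ℕ) (hHpos : ∀ M, 1 ≤ H M)
    (hHinf : Tendsto H atTop atTop)
    (hHsmall : Tendsto (fun M : ℕ => (H M : ℝ) / M) atTop (nhds 0)) :
    Tendsto
      (fun M : ℕ => (1 / ((H M : ℝ) * M)) *
        ∑ h ∈ Finset.Icc 1 (H M),
          |∑ m ∈ Finset.Icc 1 M,
            ((ArithmeticFunction.moebius m * ArithmeticFunction.moebius (m + h) : ℤ) : ℝ)|)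
      atTop (nhds 0) := by
  rw [Metric.tendsto_atTop']
  intro ε hε
  obtain ⟨T, hT⟩ := MR.fin_bd (ε := ε / 16) (by positivity)
  have h1 := hHsmall.eventually_lt_const (show (0:ℝ) < min (1 / 2) (ε / 32) by positivity)
  have h2 := hHinf.eventually_ge_atTop T
  obtain ⟨M0, h⟩ := eventually_atTop.1 (h1.and (h2.and (eventually_ge_atTop (max T 1))))
  refine ⟨M0, fun M hM => ?_⟩
  obtain ⟨a, b, c⟩ := h M hM.le
  have hM0 : (0:ℝ) < M := by exact_mod_cast (le_of_max_le_right c)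
  obtain ⟨a1, a2⟩ := lt_min_iff.1 a
  have d : 2 * H M ≤ M := by
    rw [div_lt_iff₀ hM0] at a1
    exact_mod_cast (by linarith : 2 * (H M : ℝ) ≤ M)
  have := hT (H M) b M (le_of_max_le_left c) (hHpos M) d
  rw [Real.dist_0_eq_abs, abs_of_nonneg (mul_nonneg (by positivity) (Finset.sum_nonneg fun _ _ => abs_nonneg _))]
  linarith
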